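/- There is a constant c > 0 such that for every undirected graph G of orientable genus g > 0 and every MEDP instance on G: if x is a feasible fractional solution to the flow LP of value val(x), then at least c·val(x)/(g·log²(g+1)) demand pairs can be routed integrally with congestion 3. -/

import Mathlib

open Finset

/-- Count of occurrences of `e` in a list (classical, no decidability assumptions). -/
noncomputable def ecount {α : Type} (l : List α) (e : α) : ℕ :=
  letI := Classical.decEq α
  l.count e

/-- A fractional solution to the multicommodity-flow LP relaxation of MEDP on the
graph `G` (with unit edge capacities) for the demand pairs `(s d, t d)`, `d : Fin n`.
It consists of finitely many flow paths (walks), each joining the endpoints of its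
demand, with nonnegative values, total value at most `1` per demand, and total value
at most `1` per edge. -/
structure FracSol {V : Type} (G : SimpleGraph V) {n : ℕ} (s t : Fin n → V) where
  m : ℕ
  dem : Fin m → Fin n
  fpath : ∀ i : Fin m, G.Walk (s (dem i)) (t (dem i))
  xval : Fin m → ℝ
  nonneg : ∀ i, 0 ≤ xval i
  perDemand : ∀ d : Fin n,
    (∑ i : Fin m, if dem i = d then xval i else 0) ≤ 1
  capacity : ∀ e : Sym2 V,
    (∑ i : Fin m, (ecount (fpath i).edges e : ℝ) * xval i) ≤ 1

namespace FracSol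

variable {V : Type} {G : SimpleGraph V} {n : ℕ} {s t : Fin n → V}

/-- The value `val(x) = ∑_P x_P` of a fractional solution. -/
noncomputable def value (x : FracSol G s t) : ℝ := ∑ i, x.xval i

/-- The amount of flow `z_d` routed for demand `d`. -/
noncomputable def demVal (x : FracSol G s t) (d : Fin n) : ℝ :=
  ∑ i, if x.dem i = d then x.xval i else 0

/-- The marginal value `x(v)` of a vertex `v`: total flow of demands having `v` as an
endpoint. -/
noncomputable def vertexMarg (x : FracSol G s t) (v : V) : ℝ :=
  letI := Classical.decEq V
  ∑ d : Fin n, if s d = v ∨ t d = v then x.demVal d else 0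

end FracSol

/-- There is an integral routing, with congestion at most `c`, of at least `N` of the
demand pairs `(s d, t d)`: a subset `I` of at least `N` demands and for each a connecting
path, such that every edge lies on at most `c` of the paths (counted with multiplicity). -/
def HasIntegralRouting {V : Type} (G : SimpleGraph V) {n : ℕ}
    (s t : Fin n → V) (c : ℕ) (N : ℝ) : Prop :=
  ∃ (I : Finset (Fin n)) (Q : ∀ d ∈ I, G.Walk (s d) (t d)),
    N ≤ (I.card : ℝ) ∧
    ∀ e : Sym2 V, (∑ d ∈ I.attach, ecount (Q d.1 d.2).edges e) ≤ c

/-- The demand pairs form a matching on the terminals: all `2n` endpoints are distinct. -/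
def IsMatchingInstance {V : Type} {n : ℕ} (s t : Fin n → V) : Prop :=
  Function.Injective (fun p : Fin n × Bool => if p.2 then s p.1 else t p.1)

/-- The set of terminals of a demand family. -/
def terminalSet {V : Type} [DecidableEq V] {n : ℕ} (s t : Fin n → V) : Finset V :=
  Finset.univ.image s ∪ Finset.univ.image t

/-- The reversal permutation on darts of a graph. -/
def dartRev {V : Type} (G : SimpleGraph V) : Equiv.Perm G.Dart :=
  ⟨SimpleGraph.Dart.symm, SimpleGraph.Dart.symm,
    fun d => SimpleGraph.Dart.symm_symm d, fun d => SimpleGraph.Dart.symm_symm d⟩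

/-- The setoid on `α` whose classes are the orbits (cycles) of the permutation `f`. -/
def permOrbitSetoid {α : Type} (f : Equiv.Perm α) : Setoid α :=
  ⟨f.SameCycle, ⟨fun x => Equiv.Perm.SameCycle.refl f x,
    fun h => h.symm, fun h h' => h.trans h'⟩⟩

/-- The number of orbits (cycles, including fixed points) of a permutation. -/
noncomputable def numOrbits {α : Type} (f : Equiv.Perm α) : ℕ :=
  Nat.card (Quotient (permOrbitSetoid f))

/-- A rotation system (combinatorial embedding into an orientable surface) for the
graph `G`: a permutation of the darts which fixes the tail of each dart and whose
restriction to the darts out of any fixed vertex is a single cycle. -/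
structure RotationSystem {V : Type} (G : SimpleGraph V) where
  rot : Equiv.Perm G.Dart
  tail_fixed : ∀ d : G.Dart, (rot d).toProd.1 = d.toProd.1
  vertex_cycle : ∀ d d' : G.Dart, d.toProd.1 = d'.toProd.1 → rot.SameCycle d d'

/-- The number of faces of the embedding described by a rotation system: the number of
orbits of the face permutation (rotation composed with dart reversal). -/
noncomputable def RotationSystem.numFaces {V : Type} {G : SimpleGraph V}
    (rs : RotationSystem G) : ℕ :=
  numOrbits (rs.rot * dartRev G)

/-- `G` embeds in the orientable surface of genus `g`; combinatorially, `G` has a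
rotation system whose Euler characteristic `|V| - |E| + F` is at least
`2·(number of components) - 2g`. -/
def genusLE {V : Type} (G : SimpleGraph V) (g : ℕ) : Prop :=
  ∃ rs : RotationSystem G,
    (2 * Nat.card G.ConnectedComponent : ℤ) - 2 * (g : ℤ) ≤
      (Nat.card V : ℤ) - (G.edgeSet.ncard : ℤ) + (rs.numFaces : ℤ)

namespace MEDP

set_option linter.unusedSectionVars false

section Basics

variable {V : Type} [Fintype V] [DecidableEq V]

/-- `sep A e` is `1` if exactly one endpoint of `e` lies in `A`, and `0` otherwise. -/
def sep (A : Finset V) (e : Sym2 V) : ℕ :=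
  Sym2.lift ⟨fun a b => if (a ∈ A ↔ b ∈ A) then 0 else 1, fun a b => by
    simp only [iff_comm]⟩ e

@[simp] lemma sep_mk (A : Finset V) (a b : V) :
    sep A s(a, b) = if (a ∈ A ↔ b ∈ A) then 0 else 1 := rfl

lemma sep_le_one (A : Finset V) (e : Sym2 V) : sep A e ≤ 1 := by
  induction e with | _ a b => simp only [sep_mk]; split_ifs <;> omega

/-- The capacity `u(δ(A))` of a cut. -/
def cut (u : Sym2 V → ℕ) (A : Finset V) : ℕ := ∑ e, u e * sep A e

lemma sep_compl (A : Finset V) (e : Sym2 V) : sep Aᶜ e = sep A e := by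
  induction e with | _ a b => simp only [sep_mk, mem_compl, not_iff_not]

lemma cut_compl (u : Sym2 V → ℕ) (A : Finset V) : cut u Aᶜ = cut u A := by
  simp only [cut, sep_compl]

lemma sep_empty (e : Sym2 V) : sep ∅ e = 0 := by
  induction e with | _ a b => simp

lemma cut_empty (u : Sym2 V → ℕ) : cut u ∅ = 0 := by
  simp [cut, sep_empty]

lemma sep_submodular (A B : Finset V) (e : Sym2 V) :
    sep (A ∩ B) e + sep (A ∪ B) e ≤ sep A e + sep B e := by
  induction e with | _ a b =>
  simp only [sep_mk, mem_inter, mem_union]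
  by_cases h1 : a ∈ A <;> by_cases h2 : a ∈ B <;> by_cases h3 : b ∈ A <;>
    by_cases h4 : b ∈ B <;> simp [h1, h2, h3, h4]

lemma sep_posimodular (A B : Finset V) (e : Sym2 V) :
    sep (A \ B) e + sep (B \ A) e ≤ sep A e + sep B e := by
  induction e with | _ a b =>
  simp only [sep_mk, mem_sdiff]
  by_cases h1 : a ∈ A <;> by_cases h2 : a ∈ B <;> by_cases h3 : b ∈ A <;>
    by_cases h4 : b ∈ B <;> simp [h1, h2, h3, h4]

lemma cut_submodular (u : Sym2 V → ℕ) (A B : Finset V) :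
    cut u (A ∩ B) + cut u (A ∪ B) ≤ cut u A + cut u B := by
  simp only [cut, ← sum_add_distrib, ← mul_add]
  exact sum_le_sum fun e _ => Nat.mul_le_mul_left _ (sep_submodular A B e)

lemma cut_posimodular (u : Sym2 V → ℕ) (A B : Finset V) :
    cut u (A \ B) + cut u (B \ A) ≤ cut u A + cut u B := by
  simp only [cut, ← sum_add_distrib, ← mul_add]
  exact sum_le_sum fun e _ => Nat.mul_le_mul_left _ (sep_posimodular A B e)

lemma cut_union_le (u : Sym2 V → ℕ) (A B : Finset V) :
    cut u (A ∪ B) ≤ cut u A + cut u B := by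
  have := cut_submodular u A B
  omega

lemma cut_mono {u u' : Sym2 V → ℕ} (h : ∀ e, u e ≤ u' e) (A : Finset V) :
    cut u A ≤ cut u' A :=
  sum_le_sum fun e _ => Nat.mul_le_mul_right _ (h e)

lemma cut_add (u u' : Sym2 V → ℕ) (A : Finset V) :
    cut (fun e => u e + u' e) A = cut u A + cut u' A := by
  simp only [cut, add_mul, sum_add_distrib]

lemma cut_single (e₀ : Sym2 V) (A : Finset V) :
    cut (fun e => if e = e₀ then 1 else 0) A = sep A e₀ := by
  simp [cut]

/-- `f` carries a route from `a` to `b`: some walk uses each pair `e` at most `f e` times. -/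
def IsRoute (a b : V) (f : Sym2 V → ℕ) : Prop :=
  ∃ w : (⊤ : SimpleGraph V).Walk a b, ∀ e, w.edges.count e ≤ f e

lemma IsRoute.mono {a b : V} {f g : Sym2 V → ℕ} (h : IsRoute a b f) (hfg : ∀ e, f e ≤ g e) :
    IsRoute a b g := by
  obtain ⟨w, hw⟩ := h
  exact ⟨w, fun e => (hw e).trans (hfg e)⟩

lemma IsRoute.refl (a : V) (f : Sym2 V → ℕ) : IsRoute a a f :=
  ⟨.nil, fun e => by simp⟩

lemma IsRoute.trans {a b c : V} {f g : Sym2 V → ℕ} (h : IsRoute a b f) (h' : IsRoute b c g) :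
    IsRoute a c (fun e => f e + g e) := by
  obtain ⟨w, hw⟩ := h
  obtain ⟨w', hw'⟩ := h'
  refine ⟨w.append w', fun e => ?_⟩
  rw [SimpleGraph.Walk.edges_append, List.count_append]
  exact add_le_add (hw e) (hw' e)

lemma IsRoute.symm {a b : V} {f : Sym2 V → ℕ} (h : IsRoute a b f) : IsRoute b a f := by
  obtain ⟨w, hw⟩ := h
  exact ⟨w.reverse, fun e => by simpa [SimpleGraph.Walk.edges_reverse] using hw e⟩

lemma IsRoute.edge {a b : V} {f : Sym2 V → ℕ} (h : a ≠ b → 1 ≤ f s(a, b)) : IsRoute a b f := by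
  by_cases hab : a = b
  · subst hab; exact IsRoute.refl _ _
  · refine ⟨.cons (by simpa using hab) .nil, fun e => ?_⟩
    simp only [SimpleGraph.Walk.edges_cons, SimpleGraph.Walk.edges_nil]
    by_cases he : e = s(a, b)
    · subst he; simpa using h hab
    · rw [List.count_eq_zero_of_not_mem (by simpa using he)]; omega

lemma sum_count_cons (x : Sym2 V) (l : List (Sym2 V)) (F : Sym2 V → ℕ) :
    ∑ e, (x :: l).count e * F e = F x + ∑ e, l.count e * F e := by
  simp only [List.count_cons, add_mul, sum_add_distrib, beq_iff_eq]
  rw [add_comm]; congr 1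
  simp

lemma sep_le_walk {H : SimpleGraph V} {a b : V} (w : H.Walk a b) (A : Finset V) :
    sep A s(a, b) ≤ ∑ e, w.edges.count e * sep A e ∧
    (∑ e, w.edges.count e * sep A e) % 2 = sep A s(a, b) % 2 := by
  induction w with
  | nil => simp
  | cons h p ih =>
    rw [SimpleGraph.Walk.edges_cons, sum_count_cons]
    rename_i u v w
    have key : sep A s(u, w) ≤ sep A s(u, v) + sep A s(v, w) ∧
        (sep A s(u, v) + sep A s(v, w)) % 2 = sep A s(u, w) % 2 := by
      simp only [sep_mk]
      by_cases h1 : u ∈ A <;> by_cases h2 : v ∈ A <;> by_cases h3 : w ∈ A <;>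
        simp [h1, h2, h3]
    omega

lemma IsRoute.sep_le {a b : V} {f : Sym2 V → ℕ} (h : IsRoute a b f) (A : Finset V) :
    sep A s(a, b) ≤ cut f A := by
  obtain ⟨w, hw⟩ := h
  exact (sep_le_walk w A).1.trans (sum_le_sum fun e _ => Nat.mul_le_mul_right _ (hw e))

lemma IsRoute.exists_exact {a b : V} {f : Sym2 V → ℕ} (h : IsRoute a b f) :
    ∃ f' : Sym2 V → ℕ, (∀ e, f' e ≤ f e) ∧ IsRoute a b f' ∧
      ∀ A : Finset V, cut f' A % 2 = sep A s(a, b) % 2 := by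
  obtain ⟨w, hw⟩ := h
  exact ⟨fun e => w.edges.count e, hw, ⟨w, fun e => le_rfl⟩, fun A => (sep_le_walk w A).2⟩

end Basics

section Menger

variable {V : Type} [Fintype V] [DecidableEq V]

lemma cut_insert_add (u : Sym2 V → ℕ) (D : Finset V) (v : V) (hv : v ∉ D)
    (hN : ∀ w, w ≠ v → 1 ≤ u s(v, w) → w ∈ D) :
    cut u (insert v D) + #{w | w ≠ v ∧ 1 ≤ u s(v, w)} ≤ cut u D := by
  have h1 : #{w | w ≠ v ∧ 1 ≤ u s(v, w)} ≤ ∑ w ∈ univ.erase v, u s(v, w) := by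
    rw [card_eq_sum_ones]
    refine (sum_le_sum fun w hw => ?_).trans
      (sum_le_sum_of_subset (f := fun w => u s(v, w)) fun w hw => ?_)
    · exact (mem_filter.1 hw).2.2
    · simpa using (mem_filter.1 hw).2.1
  have h2 : ∑ w ∈ univ.erase v, u s(v, w) =
      ∑ e ∈ (univ.erase v).image (fun w => s(v, w)), u e := by
    rw [sum_image]
    intro a _ b _ h
    exact Sym2.congr_right.1 h
  have h3 : ∑ e ∈ (univ.erase v).image (fun w => s(v, w)), u e =
      ∑ e, if e ∈ (univ.erase v).image (fun w => s(v, w)) then u e else 0 := by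
    rw [sum_ite_mem, univ_inter]
  have h4 : cut u (insert v D) + (∑ e, if e ∈ (univ.erase v).image (fun w => s(v, w)) then u e
      else 0) ≤ cut u D := by
    rw [cut, cut, ← sum_add_distrib]
    refine sum_le_sum fun e _ => ?_
    induction e with | _ a b =>
    by_cases hu : u s(a, b) = 0
    · simp [hu]
    have hu' : 1 ≤ u s(a, b) := Nat.one_le_iff_ne_zero.2 hu
    by_cases ha : a = v
    · subst ha
      by_cases hb : b = a
      · subst hb; simp
      · have := hN b hb hu'
        simp only [sep_mk, mem_insert, hv, hb, this]; simp; split_ifs <;> omega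
    · by_cases hb : b = v
      · subst hb
        have := hN a ha (by rwa [Sym2.eq_swap])
        simp only [sep_mk, mem_insert, hv, ha, this]; simp; split_ifs <;> omega
      · simp [ha, hb, Ne.symm ha, Ne.symm hb]
  omega

variable {ι κ : Type} [DecidableEq ι] [DecidableEq κ]

/-- Surplus of a set `A` in the Menger-type linking problem. -/
def slack (I : Finset ι) (J : Finset κ) (a : ι → V) (P : κ → Finset V) (u : Sym2 V → ℕ)
    (A : Finset V) : ℤ :=
  (cut u A : ℤ) + #{j ∈ J | (P j ∩ A).Nonempty} - #{i ∈ I | a i ∈ A}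

lemma slack_submodular (I : Finset ι) (J : Finset κ) (a : ι → V) (P : κ → Finset V)
    (u : Sym2 V → ℕ) (A B : Finset V) :
    slack I J a P u (A ∩ B) + slack I J a P u (A ∪ B) ≤
      slack I J a P u A + slack I J a P u B := by
  have h1 := cut_submodular u A B
  have h2 : #{i ∈ I | a i ∈ A ∩ B} + #{i ∈ I | a i ∈ A ∪ B} =
      #{i ∈ I | a i ∈ A} + #{i ∈ I | a i ∈ B} := by
    simp only [card_filter, ← sum_add_distrib]
    refine sum_congr rfl fun i _ => ?_
    by_cases h1 : a i ∈ A <;> by_cases h2 : a i ∈ B <;> simp [h1, h2]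
  have h3 : #{j ∈ J | (P j ∩ (A ∩ B)).Nonempty} + #{j ∈ J | (P j ∩ (A ∪ B)).Nonempty} ≤
      #{j ∈ J | (P j ∩ A).Nonempty} + #{j ∈ J | (P j ∩ B).Nonempty} := by
    simp only [card_filter, ← sum_add_distrib]
    refine sum_le_sum fun j _ => ?_
    have e1 : (P j ∩ (A ∪ B)).Nonempty ↔ (P j ∩ A).Nonempty ∨ (P j ∩ B).Nonempty := by
      rw [inter_union_distrib_left, union_nonempty]
    have e2 : (P j ∩ (A ∩ B)).Nonempty → (P j ∩ A).Nonempty ∧ (P j ∩ B).Nonempty := fun h =>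
      ⟨h.mono (inter_subset_inter_left inter_subset_left),
        h.mono (inter_subset_inter_left inter_subset_right)⟩
    by_cases h1 : (P j ∩ A).Nonempty <;> by_cases h2 : (P j ∩ B).Nonempty
    · rw [if_pos h1, if_pos h2]; split_ifs <;> omega
    all_goals
      rw [if_neg (fun h => by have := e2 h; tauto)]
      simp [e1, h1, h2]
  unfold slack
  omega

lemma slack_biUnion {α : Type} [DecidableEq α] (I : Finset ι) (J : Finset κ) (a : ι → V)
    (P : κ → Finset V) (u : Sym2 V → ℕ) (h : ∀ A, 0 ≤ slack I J a P u A)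
    (F : Finset α) (B : α → Finset V) (c : ℤ) (hc : ∀ x ∈ F, slack I J a P u (B x) ≤ c) :
    slack I J a P u (F.biUnion B) ≤ #F * c := by
  induction F using Finset.induction_on with
  | empty => simp [slack, cut_empty]
  | insert x F hx ih =>
    rw [biUnion_insert, card_insert_of_notMem hx]
    have h1 := slack_submodular I J a P u (B x) (F.biUnion B)
    have h2 := h (B x ∩ F.biUnion B)
    have h3 := hc x (mem_insert_self _ _)
    have h4 := ih fun y hy => hc y (mem_insert_of_mem hy)
    push_cast
    linarith

/-- Menger-type linking: sources `a i` are joined edge-disjointly to distinct sink sets. -/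
theorem menger [Nonempty κ] (I : Finset ι) (J : Finset κ) (a : ι → V) (P : κ → Finset V)
    (u : Sym2 V → ℕ)
    (h : ∀ A : Finset V, #{i ∈ I | a i ∈ A} ≤ cut u A + #{j ∈ J | (P j ∩ A).Nonempty}) :
    ∃ (φ : ι → κ) (b : ι → V) (f : ι → Sym2 V → ℕ), Set.InjOn φ I ∧
      (∀ i ∈ I, φ i ∈ J ∧ b i ∈ P (φ i) ∧ IsRoute (a i) (b i) (f i)) ∧
      ∀ e, ∑ i ∈ I, f i e ≤ u e := by
  classical
  induction hN : (∑ e, u e) + #I using Nat.strong_induction_on generalizing I J a u with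
  | _ N ih =>
  subst hN
  rcases I.eq_empty_or_nonempty with rfl | ⟨i₀, hi₀⟩
  · exact ⟨fun _ => Classical.arbitrary κ, a, fun _ _ => 0, by simp, by simp, by simp⟩
  set v := a i₀ with hv
  have hnn : ∀ A, 0 ≤ slack I J a P u A := fun A => by have := h A; unfold slack; omega
  by_cases hab : ∃ j ∈ J, v ∈ P j ∧ ∀ A : Finset V, #{i ∈ I.erase i₀ | a i ∈ A} ≤
      cut u A + #{j' ∈ J.erase j | (P j' ∩ A).Nonempty}
  · obtain ⟨j, hj, hvj, hA⟩ := hab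
    obtain ⟨φ, b, f, h1, h2, h3⟩ := ih _ (by
      have := card_erase_lt_of_mem hi₀; omega) (I.erase i₀) (J.erase j) a u hA rfl
    refine ⟨Function.update φ i₀ j, Function.update b i₀ v,
      Function.update f i₀ (fun _ => 0), ?_, ?_, ?_⟩
    · intro x hx y hy hxy
      by_cases hx0 : x = i₀ <;> by_cases hy0 : y = i₀
      · rw [hx0, hy0]
      · exfalso
        subst hx0
        rw [Function.update_self, Function.update_of_ne hy0] at hxy
        have := (h2 y (mem_erase.2 ⟨hy0, hy⟩)).1
        rw [← hxy] at this
        simp at this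
      · exfalso
        subst hy0
        rw [Function.update_self, Function.update_of_ne hx0] at hxy
        have := (h2 x (mem_erase.2 ⟨hx0, hx⟩)).1
        rw [hxy] at this
        simp at this
      · rw [Function.update_of_ne hx0, Function.update_of_ne hy0] at hxy
        exact h1 (by simp [hx0]; exact hx) (by simp [hy0]; exact hy) hxy
    · intro i hi
      by_cases hi0 : i = i₀
      · subst hi0
        simp only [Function.update_self]
        exact ⟨hj, hvj, IsRoute.refl _ _⟩
      · simp only [Function.update_of_ne hi0]
        have := h2 i (mem_erase.2 ⟨hi0, hi⟩)
        exact ⟨mem_of_mem_erase this.1, this.2⟩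
    · intro e
      rw [← add_sum_erase _ _ hi₀]
      simp only [Function.update_self, zero_add]
      refine le_trans (le_of_eq (sum_congr rfl fun i hi => ?_)) (h3 e)
      rw [Function.update_of_ne (ne_of_mem_erase hi)]
  by_cases hmv : ∃ w, w ≠ v ∧ 1 ≤ u s(v, w) ∧ ∀ A : Finset V,
      #{i ∈ I | Function.update a i₀ w i ∈ A} ≤
      cut (fun e => u e - if e = s(v, w) then 1 else 0) A + #{j ∈ J | (P j ∩ A).Nonempty}
  · obtain ⟨w, hwv, huw, hA⟩ := hmv
    have hle : ∀ e, (if e = s(v, w) then 1 else 0) ≤ u e := fun e => by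
      split_ifs with he
      · rw [he]; exact huw
      · omega
    obtain ⟨φ, b, f, h1, h2, h3⟩ := ih _ (by
      have : ∑ e, (u e - if e = s(v, w) then 1 else 0) < ∑ e, u e :=
        sum_lt_sum (fun e _ => Nat.sub_le _ _) ⟨s(v, w), mem_univ _, by simp; omega⟩
      omega) I J (Function.update a i₀ w) _ hA rfl
    refine ⟨φ, b, Function.update f i₀ (fun e => (if e = s(v, w) then 1 else 0) + f i₀ e),
      h1, ?_, ?_⟩
    · intro i hi
      obtain ⟨h4, h5, h6⟩ := h2 i hi
      refine ⟨h4, h5, ?_⟩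
      by_cases hi0 : i = i₀
      · subst hi0
        simp only [Function.update_self] at h6 ⊢
        exact IsRoute.trans (IsRoute.edge fun _ => by simp [hv]) h6
      · rw [Function.update_of_ne hi0] at h6 ⊢
        exact h6
    · intro e
      have := h3 e
      rw [← add_sum_erase _ _ hi₀] at this ⊢
      have h7 : ∑ x ∈ I.erase i₀, Function.update f i₀
          (fun e => (if e = s(v, w) then 1 else 0) + f i₀ e) x e = ∑ x ∈ I.erase i₀, f x e :=
        sum_congr rfl fun i hi => by rw [Function.update_of_ne (ne_of_mem_erase hi)]
      rw [h7]
      simp only [Function.update_self]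
      have := hle e
      omega
  exfalso
  push Not at hab hmv
  have hB : ∀ j, ∃ B : Finset V, j ∈ J → v ∈ P j →
      v ∉ B ∧ slack I J a P u B ≤ 0 ∧ (P j ∩ B).Nonempty := by
    intro j
    by_cases hj : j ∈ J ∧ v ∈ P j
    · obtain ⟨hj, hvj⟩ := hj
      obtain ⟨B, hB⟩ := hab j hj hvj
      refine ⟨B, fun _ _ => ?_⟩
      have hcond := h B
      rw [filter_erase, filter_erase] at hB
      have hvB : v ∉ B := by
        intro hvB
        have m1 : i₀ ∈ ({i ∈ I | a i ∈ B} : Finset ι) := mem_filter.2 ⟨hi₀, hvB⟩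
        have m2 : j ∈ ({j ∈ J | (P j ∩ B).Nonempty} : Finset κ) :=
          mem_filter.2 ⟨hj, ⟨v, mem_inter.2 ⟨hvj, hvB⟩⟩⟩
        rw [card_erase_of_mem m1, card_erase_of_mem m2] at hB
        have := card_pos.2 ⟨_, m1⟩
        have := card_pos.2 ⟨_, m2⟩
        omega
      rw [erase_eq_of_notMem (by simp [hvB, ← hv] : i₀ ∉ _)] at hB
      by_cases hjB : (P j ∩ B).Nonempty
      · rw [card_erase_of_mem (mem_filter.2 ⟨hj, hjB⟩)] at hB
        refine ⟨hvB, ?_, hjB⟩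
        unfold slack
        omega
      · have m2 : j ∉ ({j ∈ J | (P j ∩ B).Nonempty} : Finset κ) :=
          fun hh => hjB (mem_filter.1 hh).2
        rw [erase_eq_of_notMem m2] at hB
        omega
    · exact ⟨∅, fun h1 h2 => absurd ⟨h1, h2⟩ hj⟩
  have hC : ∀ w, ∃ B : Finset V, w ≠ v → 1 ≤ u s(v, w) →
      v ∉ B ∧ slack I J a P u B ≤ 1 ∧ w ∈ B := by
    intro w
    by_cases hw : w ≠ v ∧ 1 ≤ u s(v, w)
    · obtain ⟨hwv, huw⟩ := hw
      obtain ⟨B, hB⟩ := hmv w hwv huw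
      refine ⟨B, fun _ _ => ?_⟩
      have hcond := h B
      have hcut : cut u B = cut (fun e => u e - if e = s(v, w) then 1 else 0) B +
          sep B s(v, w) := by
        rw [← cut_single, ← cut_add]
        congr 1; ext e
        split_ifs with he
        · subst he; omega
        · omega
      have hI1 : #{i ∈ I | a i ∈ B} = (if v ∈ B then 1 else 0) + #{i ∈ I.erase i₀ | a i ∈ B} := by
        simp only [card_filter]
        rw [← add_sum_erase _ _ hi₀]
      have hI2 : #{i ∈ I | Function.update a i₀ w i ∈ B} =
          (if w ∈ B then 1 else 0) + #{i ∈ I.erase i₀ | a i ∈ B} := by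
        simp only [card_filter]
        rw [← add_sum_erase _ _ hi₀]
        congr 1
        · simp
        · exact sum_congr rfl fun i hi => by rw [Function.update_of_ne (ne_of_mem_erase hi)]
      rw [sep_mk] at hcut
      by_cases h1 : v ∈ B <;> by_cases h2 : w ∈ B <;> simp [h1, h2] at hcut hI1 hI2 <;>
        simp [h1, h2] <;> (try unfold slack) <;> omega
    · exact ⟨∅, fun h1 h2 => absurd ⟨h1, h2⟩ hw⟩
  choose B hB using hB
  choose C hC using hC
  set D1 := ({j ∈ J | v ∈ P j} : Finset κ).biUnion B with hD1
  set D2 := ({w | w ≠ v ∧ 1 ≤ u s(v, w)} : Finset V).biUnion C with hD2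
  have s1 : slack I J a P u D1 ≤ 0 := by
    refine (slack_biUnion I J a P u hnn _ B 0 fun j hj => ?_).trans (by simp)
    rw [mem_filter] at hj
    exact (hB j hj.1 hj.2).2.1
  have s2 : slack I J a P u D2 ≤ #{w | w ≠ v ∧ 1 ≤ u s(v, w)} := by
    refine (slack_biUnion I J a P u hnn _ C 1 fun w hw => ?_).trans (by simp)
    rw [mem_filter] at hw
    exact (hC w hw.2.1 hw.2.2).2.1
  have s3 := slack_submodular I J a P u D1 D2
  have s4 := hnn (D1 ∩ D2)
  have hvD : v ∉ D1 ∪ D2 := by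
    simp only [hD1, hD2, mem_union, mem_biUnion, mem_filter, mem_univ, true_and, not_or,
      not_exists, not_and]
    exact ⟨fun j hj => (hB j hj.1 hj.2).1, fun w hw => (hC w hw.1 hw.2).1⟩
  have s5 := cut_insert_add u (D1 ∪ D2) v hvD fun w h1 h2 =>
    mem_union_right _ (mem_biUnion.2 ⟨w, by simp [h1, h2], (hC w h1 h2).2.2⟩)
  have s6 : #{j ∈ J | (P j ∩ insert v (D1 ∪ D2)).Nonempty} ≤
      #{j ∈ J | (P j ∩ (D1 ∪ D2)).Nonempty} := by
    refine card_le_card fun j hj => ?_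
    rw [mem_filter] at hj ⊢
    refine ⟨hj.1, ?_⟩
    obtain ⟨x, hx⟩ := hj.2
    rw [mem_inter, mem_insert] at hx
    obtain ⟨hxj, rfl | hx⟩ := hx
    · obtain ⟨y, hy⟩ := (hB j hj.1 hxj).2.2
      rw [mem_inter] at hy
      exact ⟨y, mem_inter.2 ⟨hy.1, mem_union_left _ (mem_biUnion.2
        ⟨j, mem_filter.2 ⟨hj.1, hxj⟩, hy.2⟩)⟩⟩
    · exact ⟨x, mem_inter.2 ⟨hxj, hx⟩⟩
  have s7 : #{i ∈ I | a i ∈ D1 ∪ D2} < #{i ∈ I | a i ∈ insert v (D1 ∪ D2)} := by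
    refine card_lt_card ⟨fun i hi => ?_, fun hh => ?_⟩
    · rw [mem_filter] at hi ⊢
      exact ⟨hi.1, mem_insert_of_mem hi.2⟩
    · exact hvD (mem_filter.1 (hh (mem_filter.2 ⟨hi₀, mem_insert_self _ _⟩))).2
  have s8 := hnn (insert v (D1 ∪ D2))
  unfold slack at s1 s2 s3 s4 s8
  omega

end Menger

section OkamuraSeymour

variable {V : Type} [Fintype V] [DecidableEq V]

/-- Total demand across `A`. -/
def dem {ι : Type} [Fintype ι] (p q : ι → V) (A : Finset V) : ℕ := ∑ i, sep A s(p i, q i)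

lemma dem_compl {ι : Type} [Fintype ι] (p q : ι → V) (A : Finset V) :
    dem p q Aᶜ = dem p q A := by
  simp only [dem, sep_compl]

/-- The trace of `A` on the sequence `r 0, …, r (N-1)` is the interval `[i, j)`. -/
def TraceEq (r : ℕ → V) (N : ℕ) (A : Finset V) (i j : ℕ) : Prop :=
  ∀ k < N, (r k ∈ A ↔ i ≤ k ∧ k < j)

lemma cut_sub_single (u : Sym2 V → ℕ) (e : Sym2 V) (he : 1 ≤ u e) (A : Finset V) :
    cut (fun e' => u e' - if e' = e then 1 else 0) A + sep A e = cut u A := by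
  rw [← cut_single, ← cut_add]
  congr 1; ext e'
  split_ifs with h
  · subst h; omega
  · omega

lemma os_split {ι : Type} [Fintype ι] [DecidableEq ι] (r : ℕ → V) (N : ℕ) (hN : 0 < N)
    (p q : ι → V) (hp : ∀ i, ∃ k < N, r k = p i) (hq : ∀ i, ∃ k < N, r k = q i)
    (u : Sym2 V → ℕ) (hu : 1 ≤ u s(r 0, r (N - 1)))
    (hc : ∀ A i j, TraceEq r N A i j → dem p q A ≤ cut u A ∧ dem p q A % 2 = cut u A % 2) :
    ∃ p' q' : Option ι → V, (∀ i, ∃ k < N, r k = p' i) ∧ (∀ i, ∃ k < N, r k = q' i) ∧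
      (∀ A i j, TraceEq r N A i j →
        dem p' q' A ≤ cut (fun e' => u e' - if e' = s(r 0, r (N - 1)) then 1 else 0) A ∧
        dem p' q' A % 2 =
          cut (fun e' => u e' - if e' = s(r 0, r (N - 1)) then 1 else 0) A % 2) ∧
      ∀ f' : Option ι → Sym2 V → ℕ, (∀ i, IsRoute (p' i) (q' i) (f' i)) →
        (∀ e, ∑ i, f' i e ≤ u e - if e = s(r 0, r (N - 1)) then 1 else 0) →
        ∃ f : ι → Sym2 V → ℕ, (∀ i, IsRoute (p i) (q i) (f i)) ∧ ∀ e, ∑ i, f i e ≤ u e := by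
  set x := r 0 with hx
  set y := r (N - 1) with hy
  by_cases hT : ∀ A i j, TraceEq r N A i j → sep A s(x, y) = 1 → dem p q A ≠ cut u A
  · refine ⟨fun o => o.elim x p, fun o => o.elim y q, ?_, ?_, ?_, ?_⟩
    · rintro (_ | i)
      · exact ⟨0, hN, rfl⟩
      · exact hp i
    · rintro (_ | i)
      · exact ⟨N - 1, by omega, rfl⟩
      · exact hq i
    · intro A i j hA
      have h1 := cut_sub_single u s(x, y) hu A
      have h2 : dem (fun o : Option ι => o.elim x p) (fun o => o.elim y q) A =
          sep A s(x, y) + dem p q A := by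
        unfold dem; rw [Fintype.sum_option]; rfl
      have h3 := hc A i j hA
      have h4 := hT A i j hA
      have h5 := sep_le_one A s(x, y)
      omega
    · intro f' h1 h2
      refine ⟨fun i => f' (some i), fun i => h1 (some i), fun e => ?_⟩
      have := h2 e
      rw [Fintype.sum_option] at this
      exact le_trans (Nat.le_add_left _ _) (this.trans (Nat.sub_le _ _))
  -- a tight set separating `x` and `y`; normalise to a suffix
  push Not at hT
  have hcompl : ∀ A i j, TraceEq r N A i j → x ∈ A →
      ∃ i' j', TraceEq r N Aᶜ i' j' := by
    intro A i j hA hxA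
    have h0 := (hA 0 hN).1 hxA
    refine ⟨j, N, fun k hk => ?_⟩
    rw [mem_compl, hA k hk]
    omega
  have hex : ∃ i, 0 < i ∧ i < N ∧ ∃ A, TraceEq r N A i N ∧ dem p q A = cut u A := by
    obtain ⟨A, i, j, hA, hs, ht⟩ := hT
    have h0 := hA 0 hN
    have h1 := hA (N - 1) (by omega)
    rw [← hx] at h0
    rw [← hy] at h1
    by_cases hxA : x ∈ A
    · by_cases hyA : y ∈ A
      · simp [hxA, hyA] at hs
      · have h2 := h0.1 hxA
        refine ⟨j, by omega, ?_, Aᶜ, fun k hk => ?_, ?_⟩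
        · by_contra hj
          exact hyA (h1.2 (by omega))
        · rw [mem_compl, hA k hk]
          omega
        · rw [dem_compl, cut_compl, ht]
    · by_cases hyA : y ∈ A
      · have h2 := h1.1 hyA
        refine ⟨i, ?_, by omega, A, fun k hk => ?_, ht⟩
        · by_contra hi
          exact hxA (h0.2 (by omega))
        · rw [hA k hk]
          omega
      · simp [hxA, hyA] at hs
  obtain ⟨i, ⟨hi0, hiN, A, hA, hAt⟩, hmax⟩ : ∃ i, (0 < i ∧ i < N ∧ ∃ A, TraceEq r N A i N ∧
      dem p q A = cut u A) ∧ ∀ i', (0 < i' ∧ i' < N ∧ ∃ A, TraceEq r N A i' N ∧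
      dem p q A = cut u A) → i' ≤ i := by
    classical
    obtain ⟨i₀, hi₀⟩ := hex
    refine ⟨Nat.findGreatest (fun i => 0 < i ∧ i < N ∧ ∃ A, TraceEq r N A i N ∧
      dem p q A = cut u A) N, ?_, ?_⟩
    · exact Nat.findGreatest_spec (P := fun i => 0 < i ∧ i < N ∧ ∃ A, TraceEq r N A i N ∧
        dem p q A = cut u A) hi₀.2.1.le hi₀
    · intro i' hi'
      exact Nat.le_findGreatest hi'.2.1.le hi'
  have hyA : y ∈ A := (hA (N - 1) (by omega)).2 (by omega)
  have hxA : x ∉ A := fun h => by have := (hA 0 hN).1 h; omega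
  -- a demand crossing `A` whose outer end comes first on the ring
  have hcross : ∃ τ, τ < N ∧ ∃ i₁ s t, (p i₁ = s ∧ q i₁ = t ∨ p i₁ = t ∧ q i₁ = s) ∧
      s ∈ A ∧ t ∉ A ∧ r τ = t := by
    have h1 : 0 < dem p q A := by
      rw [hAt]
      refine lt_of_lt_of_le (Nat.pos_of_ne_zero ?_)
        (single_le_sum (f := fun e => u e * sep A e) (fun _ _ => Nat.zero_le _)
          (mem_univ s(x, y)))
      have : sep A s(x, y) = 1 := by simp [hxA, hyA]
      simp only [this]
      omega
    obtain ⟨i₁, -, h2⟩ := exists_ne_zero_of_sum_ne_zero h1.ne'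
    by_cases hs : p i₁ ∈ A
    · by_cases ht : q i₁ ∈ A
      · simp [hs, ht] at h2
      · obtain ⟨k, hk, hk'⟩ := hq i₁
        exact ⟨k, hk, i₁, _, _, Or.inl ⟨rfl, rfl⟩, hs, ht, hk'⟩
    · by_cases ht : q i₁ ∈ A
      · obtain ⟨k, hk, hk'⟩ := hp i₁
        exact ⟨k, hk, i₁, _, _, Or.inr ⟨rfl, rfl⟩, ht, hs, hk'⟩
      · simp [hs, ht] at h2
  classical
  obtain ⟨hτN, i₁, s, t, hst, hsA, htA, hτt⟩ := Nat.find_spec hcross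
  have hτmin := fun τ' (h : τ' < Nat.find hcross) => Nat.find_min hcross h
  set τ := Nat.find hcross with hτ
  have hτi : τ < i := by
    by_contra h
    exact htA (hτt ▸ (hA τ hτN).2 (by omega))
  obtain ⟨σ, hσN, hσs⟩ : ∃ k < N, r k = s := by
    rcases hst with ⟨h, -⟩ | ⟨-, h⟩
    · exact h ▸ hp i₁
    · exact h ▸ hq i₁
  have hiσ : i ≤ σ := ((hA σ hσN).1 (hσs ▸ hsA)).1
  have hbad : ∀ Y j k, TraceEq r N Y j k → x ∉ Y → dem p q Y = cut u Y →
      (y ∈ Y → s ∈ Y ∧ t ∉ Y) ∧ (s ∈ Y → t ∉ Y) := by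
    intro Y j k hY hxY hYt
    have hj0 : ¬ (j ≤ 0 ∧ 0 < k) := fun h => hxY ((hY 0 hN).2 h)
    have key : ¬ (s ∈ Y ∧ t ∈ Y) := by
      rintro ⟨hsY, htY⟩
      have hjτ := (hY τ hτN).1 (hτt ▸ htY)
      have hkσ := (hY σ hσN).1 (hσs ▸ hsY)
      have d1 : dem p q A + dem p q Y ≤ dem p q (A \ Y) + dem p q (Y \ A) := by
        simp only [dem, ← sum_add_distrib]
        refine sum_le_sum fun i' _ => ?_
        have hno : ∀ s' t', (p i' = s' ∧ q i' = t' ∨ p i' = t' ∧ q i' = s') →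
            ¬ (s' ∈ A ∧ s' ∈ Y ∧ t' ∉ A ∧ t' ∉ Y) := by
          rintro s' t' hst' ⟨h1, h2, h3, h4⟩
          obtain ⟨κ, hκN, hκ⟩ : ∃ k < N, r k = t' := by
            rcases hst' with ⟨-, h⟩ | ⟨h, -⟩
            · exact h ▸ hq i'
            · exact h ▸ hp i'
          have h5 : ¬ (i ≤ κ ∧ κ < N) := fun h => h3 (hκ ▸ (hA κ hκN).2 h)
          have h6 : ¬ (j ≤ κ ∧ κ < k) := fun h => h4 (hκ ▸ (hY κ hκN).2 h)
          exact hτmin κ (by omega) ⟨hκN, i', s', t', hst', h1, h3, hκ⟩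
        have n1 := hno (p i') (q i') (Or.inl ⟨rfl, rfl⟩)
        have n2 := hno (q i') (p i') (Or.inr ⟨rfl, rfl⟩)
        simp only [sep_mk, mem_sdiff]
        by_cases h1 : p i' ∈ A <;> by_cases h2 : q i' ∈ A <;> by_cases h3 : p i' ∈ Y <;>
          by_cases h4 : q i' ∈ Y <;> simp [h1, h2, h3, h4] at n1 n2 ⊢
      have tr1 : TraceEq r N (A \ Y) k N := by
        intro l hl
        rw [mem_sdiff, hA l hl, hY l hl]
        omega
      have tr2 : TraceEq r N (Y \ A) j i := by
        intro l hl
        rw [mem_sdiff, hA l hl, hY l hl]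
        omega
      have c1 := hc _ _ _ tr1
      have c2 := hc _ _ _ tr2
      have c3 := cut_posimodular u A Y
      by_cases hyY : y ∈ Y
      · have : cut u (A \ Y) + cut u (Y \ A) < cut u A + cut u Y := by
          simp only [cut, ← sum_add_distrib, ← mul_add]
          refine sum_lt_sum (fun e _ => Nat.mul_le_mul_left _ (sep_posimodular A Y e))
            ⟨s(x, y), mem_univ _, ?_⟩
          have e1 : sep (A \ Y) s(x, y) = 0 := by simp [hxA, hyY]
          have e2 : sep (Y \ A) s(x, y) = 0 := by simp [hxY, hyA]
          have e3 : sep A s(x, y) = 1 := by simp [hxA, hyA]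
          have e4 : sep Y s(x, y) = 1 := by simp [hxY, hyY]
          rw [e1, e2, e3, e4]
          omega
        omega
      · have hkN : k < N := by
          by_contra h
          exact hyY ((hY (N - 1) (by omega)).2 (by omega))
        have := hmax k ⟨by omega, hkN, A \ Y, tr1, by omega⟩
        omega
    refine ⟨fun hyY => ?_, fun hs ht => key ⟨hs, ht⟩⟩
    have hjN := (hY (N - 1) (by omega)).1 hyY
    have hji := hmax j ⟨by omega, by omega, Y, fun l hl => by rw [hY l hl]; omega, hYt⟩
    have hsY : s ∈ Y := hσs ▸ (hY σ hσN).2 (by omega)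
    exact ⟨hsY, fun ht => key ⟨hsY, ht⟩⟩
  have hpar : ∀ Y : Finset V, (sep Y s(s, t) + sep Y s(s, y) + sep Y s(x, t) + sep Y s(x, y)) % 2
      = 0 := by
    intro Y
    simp only [sep_mk]
    by_cases h1 : s ∈ Y <;> by_cases h2 : t ∈ Y <;> by_cases h3 : x ∈ Y <;>
      by_cases h4 : y ∈ Y <;> simp [h1, h2, h3, h4]
  have hdem : ∀ Y : Finset V, dem (fun o : Option ι => o.elim x (Function.update p i₁ s))
      (fun o => o.elim t (Function.update q i₁ y)) Y + sep Y s(s, t) =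
      dem p q Y + sep Y s(s, y) + sep Y s(x, t) := by
    intro Y
    have e1 : dem p q Y = sep Y s(s, t) + ∑ i' ∈ univ.erase i₁, sep Y s(p i', q i') := by
      unfold dem
      rw [← add_sum_erase _ _ (mem_univ i₁)]
      congr 1
      rcases hst with ⟨h1, h2⟩ | ⟨h1, h2⟩
      · rw [h1, h2]
      · rw [h1, h2, Sym2.eq_swap]
    have e2 : ∑ i' ∈ univ.erase i₁, sep Y s(Function.update p i₁ s i', Function.update q i₁ y i')
        = ∑ i' ∈ univ.erase i₁, sep Y s(p i', q i') :=
      sum_congr rfl fun i' hi' => by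
        rw [Function.update_of_ne (ne_of_mem_erase hi'),
          Function.update_of_ne (ne_of_mem_erase hi')]
    rw [e1]
    unfold dem
    rw [Fintype.sum_option, ← add_sum_erase _ _ (mem_univ i₁)]
    simp only [Option.elim_none, Option.elim_some, Function.update_self]
    rw [e2]
    ring
  have hmain : ∀ Y j k, TraceEq r N Y j k → x ∉ Y →
      dem (fun o : Option ι => o.elim x (Function.update p i₁ s))
        (fun o => o.elim t (Function.update q i₁ y)) Y ≤
      cut (fun e' => u e' - if e' = s(x, y) then 1 else 0) Y ∧
      dem (fun o : Option ι => o.elim x (Function.update p i₁ s))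
        (fun o => o.elim t (Function.update q i₁ y)) Y % 2 =
      cut (fun e' => u e' - if e' = s(x, y) then 1 else 0) Y % 2 := by
    intro Y j k hY hxY
    have h1 := hdem Y
    have h2 := hpar Y
    have h3 := hc Y j k hY
    have h4 := cut_sub_single u s(x, y) hu Y
    have h5 := hbad Y j k hY hxY
    refine ⟨?_, by omega⟩
    by_cases ht : dem p q Y = cut u Y
    · have h6 := h5 ht
      simp only [sep_mk] at h1 h4
      by_cases a1 : s ∈ Y <;> by_cases a2 : t ∈ Y <;> by_cases a4 : y ∈ Y <;>
        simp [a1, a2, a4, hxY] at h1 h4 h6 <;> omega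
    · simp only [sep_mk] at h1 h4
      by_cases a1 : s ∈ Y <;> by_cases a2 : t ∈ Y <;> by_cases a4 : y ∈ Y <;>
        simp [a1, a2, a4, hxY] at h1 h4 <;> omega
  refine ⟨fun o => o.elim x (Function.update p i₁ s),
    fun o => o.elim t (Function.update q i₁ y), ?_, ?_, ?_, ?_⟩
  · rintro (_ | i')
    · exact ⟨0, hN, rfl⟩
    · by_cases h : i' = i₁
      · subst h; simpa using ⟨σ, hσN, hσs⟩
      · simpa [Function.update_of_ne h] using hp i'
  · rintro (_ | i')
    · exact ⟨τ, hτN, hτt⟩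
    · by_cases h : i' = i₁
      · subst h; simpa using ⟨N - 1, by omega, hy.symm⟩
      · simpa [Function.update_of_ne h] using hq i'
  · intro Y j k hY
    by_cases hxY : x ∈ Y
    · obtain ⟨j', k', h'⟩ := hcompl Y j k hY hxY
      rw [← dem_compl, ← cut_compl]
      exact hmain _ _ _ h' (by simpa using hxY)
    · exact hmain _ _ _ hY hxY
  · intro f' h1 h2
    have hr : IsRoute s t (fun e => f' (some i₁) e + ((if e = s(x, y) then 1 else 0) +
        f' none e)) := by
      have r1 := h1 (some i₁)
      have r2 := h1 none
      simp only [Option.elim_some, Option.elim_none, Function.update_self] at r1 r2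
      exact r1.trans ((IsRoute.edge fun _ => by simp [Sym2.eq_swap]).trans r2)
    refine ⟨Function.update (fun i' => f' (some i')) i₁
      (fun e => f' (some i₁) e + ((if e = s(x, y) then 1 else 0) + f' none e)), ?_, ?_⟩
    · intro i'
      by_cases h : i' = i₁
      · subst h
        rw [Function.update_self]
        rcases hst with ⟨h3, h4⟩ | ⟨h3, h4⟩
        · rw [h3, h4]; exact hr
        · rw [h3, h4]; exact hr.symm
      · rw [Function.update_of_ne h]
        simpa [Function.update_of_ne h] using h1 (some i')
    · intro e
      have h3 := h2 e
      rw [Fintype.sum_option, ← add_sum_erase _ _ (mem_univ i₁)] at h3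
      rw [← add_sum_erase _ _ (mem_univ i₁), Function.update_self]
      have h4 : ∑ i' ∈ univ.erase i₁, Function.update (fun i' => f' (some i')) i₁
          (fun e => f' (some i₁) e + ((if e = s(x, y) then 1 else 0) + f' none e)) i' e =
          ∑ i' ∈ univ.erase i₁, f' (some i') e :=
        sum_congr rfl fun i' hi' => by rw [Function.update_of_ne (ne_of_mem_erase hi')]
      rw [h4]
      have h5 : (if e = s(x, y) then 1 else 0) ≤ u e := by
        split_ifs with h
        · rw [h]; exact hu
        · omega
      omega

end OkamuraSeymour

section OkamuraSeymour2

variable {V : Type} [Fintype V] [DecidableEq V]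

lemma quad_sublist_getD {α : Type} (l : List α) (x : α) {i j k m : ℕ} (hij : i < j) (hjk : j < k)
    (hkm : k < m) (hm : m < l.length) :
    [l.getD i x, l.getD j x, l.getD k x, l.getD m x].Sublist l := by
  have hget : ∀ n, n < l.length → l[n]? = some (l.getD n x) := by
    intro n hn
    rw [List.getD_eq_getElem?_getD, List.getElem?_eq_getElem hn]; rfl
  have key : ∀ (l : List α) (a : α) (n : ℕ) (t : List α), l[n]? = some a →
      t.Sublist (l.drop (n + 1)) → (a :: t).Sublist l := by
    intro l a n t h1 h2
    obtain ⟨hn, h1⟩ := List.getElem?_eq_some_iff.1 h1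
    have := List.drop_eq_getElem_cons hn
    rw [h1] at this
    exact (List.Sublist.cons_cons a h2).trans (this ▸ List.drop_sublist n l)
  have key2 : ∀ (n n' : ℕ) (t : List α), n < n' → n' < l.length → 
      t.Sublist (l.drop (n' + 1)) → (l.getD n' x :: t).Sublist (l.drop (n + 1)) := by
    intro n n' t hn hn' ht
    refine key _ _ (n' - (n + 1)) _ ?_ ?_
    · rw [List.getElem?_drop, show n + 1 + (n' - (n + 1)) = n' by omega]
      exact hget _ hn'
    · rw [List.drop_drop, show n + 1 + (n' - (n + 1) + 1) = n' + 1 by omega]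
      exact ht
  exact key _ _ i _ (hget _ (by omega)) (key2 _ _ _ hij (by omega) (key2 _ _ _ hjk (by omega)
    (key2 _ _ _ hkm (by omega) (List.nil_sublist _))))

lemma exists_of_quad_sublist {α : Type} {l : List α} {a b c d : α} (x : α)
    (h : [a, b, c, d].Sublist l) : ∃ i j k m, i < j ∧ j < k ∧ k < m ∧ m < l.length ∧
      l.getD i x = a ∧ l.getD j x = b ∧ l.getD k x = c ∧ l.getD m x = d := by
  obtain ⟨f, hf⟩ := List.sublist_iff_exists_fin_orderEmbedding_get_eq.1 h
  have h01 : f 0 < f 1 := f.strictMono (show (0 : Fin 4) < 1 by decide)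
  have h12 : f 1 < f 2 := f.strictMono (show (1 : Fin 4) < 2 by decide)
  have h23 : f 2 < f 3 := f.strictMono (show (2 : Fin 4) < 3 by decide)
  have e : ∀ i, l.getD (f i) x = [a, b, c, d].get i := fun i => by
    rw [hf, List.getD_eq_getElem _ _ (f i).2]; rfl
  exact ⟨f 0, f 1, f 2, f 3, h01, h12, h23, (f 3).2, e 0, e 1, e 2, e 3⟩

/-- `A` meets the cyclic sequence `l` in an arc. -/
def CycArc (l : List V) (A : Finset V) : Prop :=
  ∀ a b c d, [a, b, c, d].Sublist l →
    ¬ (a ∈ A ∧ b ∉ A ∧ c ∈ A ∧ d ∉ A) ∧ ¬ (a ∉ A ∧ b ∈ A ∧ c ∉ A ∧ d ∈ A)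

lemma CycArc.compl {l : List V} {A : Finset V} (h : CycArc l A) : CycArc l Aᶜ := by
  intro a b c d hs
  have := h a b c d hs
  simp only [mem_compl, not_not]
  tauto

lemma CycArc.sublist {l l' : List V} {A : Finset V} (h : CycArc l' A) (hl : l.Sublist l') :
    CycArc l A := fun a b c d hs => h a b c d (hs.trans hl)

lemma CycArc.of_traceEq {l : List V} {A : Finset V} (x : V) {i j : ℕ}
    (h : TraceEq (fun k => l.getD k x) l.length A i j) : CycArc l A := by
  intro a b c d hs
  obtain ⟨i', j', k', m', h1, h2, h3, h4, rfl, rfl, rfl, rfl⟩ := exists_of_quad_sublist x hs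
  have e1 := h i' (by omega)
  have e2 := h j' (by omega)
  have e3 := h k' (by omega)
  have e4 := h m' (by omega)
  simp only at e1 e2 e3 e4
  rw [e1, e2, e3, e4]
  omega

lemma CycArc.traceEq {l : List V} {A : Finset V} (x : V) (h : CycArc l A)
    (h0 : l.getD 0 x ∉ A) : ∃ i j, TraceEq (fun k => l.getD k x) l.length A i j := by
  classical
  by_cases hA : ∃ i, i < l.length ∧ l.getD i x ∈ A
  · set i := Nat.find hA with hi
    have hi1 := Nat.find_spec hA
    have hi2 := fun k (hk : k < i) => Nat.find_min hA hk
    by_cases hB : ∃ j, i < j ∧ j < l.length ∧ l.getD j x ∉ A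
    · set j := Nat.find hB with hj
      have hj1 := Nat.find_spec hB
      have hj2 := fun k (hk : k < j) => Nat.find_min hB hk
      refine ⟨i, j, fun k hk => ⟨fun hkA => ?_, fun hk' => ?_⟩⟩
      · have c1 : i ≤ k := by
          by_contra hlt
          exact hi2 k (by omega) ⟨hk, hkA⟩
        refine ⟨c1, ?_⟩
        by_contra hjk
        have hkj : k ≠ j := fun e => hj1.2.2 (by rw [← hj, ← e]; exact hkA)
        have hi0 : i ≠ 0 := fun e => h0 (by have := hi1.2; rwa [← hi, e] at this)
        exact (h _ _ _ _ (quad_sublist_getD l x (show 0 < i by omega) hj1.1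
          (show j < k by omega) hk)).2 ⟨h0, hi1.2, hj1.2.2, hkA⟩
      · by_contra hkA
        have hki : k ≠ i := fun e => hkA (by rw [e]; exact hi1.2)
        exact hj2 k hk'.2 ⟨by omega, hk, hkA⟩
    · push Not at hB
      refine ⟨i, l.length, fun k hk => ⟨fun hkA => ⟨?_, hk⟩, fun hk' => ?_⟩⟩
      · by_contra hlt
        exact hi2 k (by omega) ⟨hk, hkA⟩
      · by_cases hki : k = i
        · rw [hki]; exact hi1.2
        · exact hB k (by omega) hk
  · push Not at hA
    exact ⟨0, 0, fun k hk => ⟨fun h => absurd h (hA k hk), fun h => by omega⟩⟩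

lemma CycArc.rotate {l₁ l₂ : List V} {A : Finset V} (h : CycArc (l₁ ++ l₂) A) :
    CycArc (l₂ ++ l₁) A := by
  intro a b c d hs
  obtain ⟨s, t, hst, hs2, hs1⟩ := List.sublist_append_iff.1 hs
  have h1 : (t ++ s).Sublist (l₁ ++ l₂) := hs1.append hs2
  rcases s with _ | ⟨s1, _ | ⟨s2, _ | ⟨s3, _ | ⟨s4, _ | ⟨s5, s6⟩⟩⟩⟩⟩ <;>
    simp at hst
  · subst hst
    exact h _ _ _ _ h1
  · obtain ⟨rfl, rfl⟩ := hst
    have := h _ _ _ _ h1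
    tauto
  · obtain ⟨rfl, rfl, rfl⟩ := hst
    have := h _ _ _ _ h1
    tauto
  · obtain ⟨rfl, rfl, rfl, rfl⟩ := hst
    have := h _ _ _ _ h1
    tauto
  · obtain ⟨rfl, rfl, rfl, rfl, rfl⟩ := hst
    have := h _ _ _ _ h1
    tauto

/-- No two vertices alternate along the sequence. -/
def Noncross {α : Type} (l : List α) : Prop := ∀ a b, [a, b, a, b].Sublist l → a = b

/-- Peeling order of a plane graph drawn inside the closed curve through `ring`. -/
inductive Peel : List V → Finset (Sym2 V) → Prop
  | base (ring : List V) (supp : Finset (Sym2 V)) (h : Noncross ring)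
      (hs : ∀ e ∈ supp, ∀ v ∈ ring, v ∉ e) : Peel ring supp
  | step (l₁ l₂ : List V) (a w : V) (supp : Finset (Sym2 V)) (haw : a ≠ w)
      (he : s(a, w) ∈ supp) (h : Peel (l₁ ++ w :: a :: l₂) (supp.erase s(a, w))) :
      Peel (l₁ ++ a :: l₂) supp

/-- The cut condition for arcs, with parity. -/
def CutCond {ι : Type} [Fintype ι] (ring : List V) (u : Sym2 V → ℕ) (p q : ι → V) : Prop :=
  ∀ A, CycArc ring A → dem p q A ≤ cut u A ∧ dem p q A % 2 = cut u A % 2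

lemma exists_arc_of_noncross {l : List V} (hl : Noncross l) {p q : V} (hp : p ∈ l) (hq : q ∈ l)
    (hpq : p ≠ q) : ∃ A : Finset V, CycArc l A ∧ sep A s(p, q) = 1 ∧ ∀ v ∈ A, v ∈ l := by
  classical
  have key : ∀ p q : V, p ∈ l → q ∈ l → p ≠ q →
      (∀ i j k, i < j → j < k → k < l.length → l.getD i p = p → l.getD k p = p →
        l.getD j p ≠ q) →
      ∃ A : Finset V, CycArc l A ∧ p ∈ A ∧ q ∉ A ∧ ∀ v ∈ A, v ∈ l := by
    intro p q hp hq hpq hno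
    set A : Finset V := l.toFinset.filter fun v => ∃ i j k, i ≤ j ∧ j ≤ k ∧ k < l.length ∧
      l.getD i p = p ∧ l.getD k p = p ∧ l.getD j p = v with hA
    have hnc : ∀ i j k m, i < j → j < k → k < m → m < l.length → l.getD i p = l.getD k p →
        l.getD j p = l.getD m p → l.getD i p = l.getD j p := by
      intro i j k m h1 h2 h3 h4 h5 h6
      have := quad_sublist_getD l p h1 h2 h3 h4
      rw [← h5, ← h6] at this
      exact hl _ _ this
    have hP : ∃ i, i < l.length ∧ l.getD i p = p := by
      obtain ⟨i, hi, h⟩ := List.getElem_of_mem hp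
      exact ⟨i, hi, by rw [List.getD_eq_getElem _ _ hi, h]⟩
    have hmemA : ∀ v, v ∈ A ↔ v ∈ l ∧ ∃ i j k, i ≤ j ∧ j ≤ k ∧ k < l.length ∧
      l.getD i p = p ∧ l.getD k p = p ∧ l.getD j p = v := fun v => by
        rw [hA, mem_filter, List.mem_toFinset]
    set g := Nat.findGreatest (fun i => i < l.length ∧ l.getD i p = p) l.length with hg
    obtain ⟨i₀, hi₀⟩ := hP
    have hg1 : g < l.length ∧ l.getD g p = p := Nat.findGreatest_spec
      (P := fun i => i < l.length ∧ l.getD i p = p) hi₀.1.le hi₀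
    have hg2 : ∀ i, i < l.length → l.getD i p = p → i ≤ g := fun i h1 h2 =>
      Nat.le_findGreatest h1.le ⟨h1, h2⟩
    have hP : ∃ i, i < l.length ∧ l.getD i p = p := ⟨i₀, hi₀⟩
    set f := Nat.find hP with hf
    have hf1 : f < l.length ∧ l.getD f p = p := Nat.find_spec hP
    have hf2 : ∀ i, i < l.length → l.getD i p = p → f ≤ i := fun i h1 h2 =>
      Nat.find_min' hP ⟨h1, h2⟩
    have hfg : f ≤ g := hf2 _ hg1.1 hg1.2
    have htr : TraceEq (fun k => l.getD k p) l.length A f (g + 1) := by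
      intro k hk
      simp only
      rw [hmemA]
      constructor
      · rintro ⟨-, i, j, m, h1, h2, h3, h4, h5, h6⟩
        have := hf2 i (by omega) h4
        have := hg2 m (by omega) h5
        by_cases hkp : l.getD k p = p
        · have := hf2 k hk hkp
          have := hg2 k hk hkp
          omega
        have hji : j ≠ i := fun e => hkp (by rw [← h6, e, h4])
        have hjm : j ≠ m := fun e => hkp (by rw [← h6, e, h5])
        by_contra hout
        rcases Nat.lt_or_ge k f with hkf | hkf
        · exact hkp (hnc k i j m (by omega) (by omega) (by omega) h3 h6.symm (h4.trans h5.symm)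
            |>.trans h4)
        · exact hkp ((hnc i j m k (by omega) (by omega) (by omega) hk (h4.trans h5.symm)
              h6).symm.trans
            h4 |> fun h => h6.symm.trans h)
      · intro h
        refine ⟨?_, f, k, g, h.1, by omega, hg1.1, hf1.2, hg1.2, rfl⟩
        rw [List.getD_eq_getElem _ _ hk]
        exact List.getElem_mem _
    refine ⟨A, CycArc.of_traceEq p htr, ?_, ?_, fun v hv => ((hmemA v).1 hv).1⟩
    · exact (hmemA p).2 ⟨hp, f, f, f, le_rfl, le_rfl, hf1.1, hf1.2, hf1.2, hf1.2⟩
    · rw [hmemA]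
      rintro ⟨-, i, j, m, h1, h2, h3, h4, h5, h6⟩
      have hji : j ≠ i := fun e => hpq (by rw [← h6, e, h4])
      have hjm : j ≠ m := fun e => hpq (by rw [← h6, e, h5])
      exact hno i j m (by omega) (by omega) h3 h4 h5 h6
  have swapD : ∀ k, k < l.length → l.getD k p = l.getD k q := fun k hk => by
    rw [List.getD_eq_getElem _ _ hk, List.getD_eq_getElem _ _ hk]
  by_cases hno : ∀ i j k, i < j → j < k → k < l.length → l.getD i p = p → l.getD k p = p →
        l.getD j p ≠ q
  · obtain ⟨A, h1, h2, h3, h4⟩ := key p q hp hq hpq hno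
    exact ⟨A, h1, by simp [h2, h3], h4⟩
  · push Not at hno
    obtain ⟨i, j, k, h1, h2, h3, h4, h5, h6⟩ := hno
    have hno' : ∀ i' j' k', i' < j' → j' < k' → k' < l.length → l.getD i' q = q →
        l.getD k' q = q → l.getD j' q ≠ p := by
      intro i' j' k' g1 g2 g3 g4 g5 g6
      rw [← swapD _ (by omega)] at g4 g5 g6
      have hq' : ∀ a b c d, a < b → b < c → c < d → d < l.length → l.getD a p = l.getD c p →
        l.getD b p = l.getD d p → l.getD a p = l.getD b p := by
        intro a b c d h1 h2 h3 h4 h5 h6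
        have := quad_sublist_getD l p h1 h2 h3 h4
        rw [← h5, ← h6] at this
        exact hl _ _ this
      rcases lt_trichotomy i' i with hi | hi | hi
      · -- q p q p
        exact hpq ((hq' i' i j k hi h1 h2 h3 (g4.trans h6.symm) (h4.trans h5.symm)).symm.trans g4
          |> fun h => h4.symm.trans h)
      · rw [hi, h4] at g4; exact hpq g4
      · -- p q p q
        have := hq' i i' j' k' hi g1 g2 g3 (h4.trans g6.symm) (g4.trans g5.symm)
        rw [h4, g4] at this
        exact hpq this
    obtain ⟨A, h1, h2, h3, h4⟩ := key q p hq hp hpq.symm hno'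
    exact ⟨A, h1, by simp [h2, h3], h4⟩

/-- Okamura–Seymour: for a peelable ring, the cut condition with parity suffices. -/
theorem okamura_seymour {ring : List V} {supp : Finset (Sym2 V)} (hP : Peel ring supp) :
    ∀ (u : Sym2 V → ℕ), (∀ e ∉ supp, u e = 0) → ∀ (ι : Type) [Fintype ι] (p q : ι → V),
      (∀ i, p i ∈ ring) → (∀ i, q i ∈ ring) → CutCond ring u p q →
      ∃ f : ι → Sym2 V → ℕ, (∀ i, IsRoute (p i) (q i) (f i)) ∧ ∀ e, ∑ i, f i e ≤ u e := by
  classical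
  induction hP with
  | base ring supp h hs =>
    intro u hu ι _ p q hp hq hc
    refine ⟨fun _ _ => 0, fun i => ?_, by simp⟩
    by_cases hpq : p i = q i
    · rw [hpq]; exact IsRoute.refl _ _
    · exfalso
      obtain ⟨A, h1, h2, h3⟩ := exists_arc_of_noncross h (hp i) (hq i) hpq
      have h4 : cut u A = 0 := by
        refine sum_eq_zero fun e _ => ?_
        by_cases he : e ∈ supp
        · have : sep A e = 0 := by
            have h5 := hs e he
            induction e with | _ a b =>
            have ha : a ∉ A := fun ha => h5 a (h3 a ha) (Sym2.mem_mk_left _ _)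
            have hb : b ∉ A := fun ha => h5 b (h3 b ha) (Sym2.mem_mk_right _ _)
            simp [ha, hb]
          rw [this, mul_zero]
        · rw [hu e he, zero_mul]
      have h5 := (hc A h1).1
      rw [h4] at h5
      have h6 : sep A s(p i, q i) ≤ dem p q A :=
        single_le_sum (f := fun i => sep A s(p i, q i)) (fun _ _ => Nat.zero_le _) (mem_univ i)
      omega
  | step l₁ l₂ a w supp haw he h ih =>
    intro u hu ι _ p q hp hq hc
    have hsub : (l₁ ++ a :: l₂).Sublist (l₁ ++ w :: a :: l₂) :=
      (List.Sublist.refl l₁).append (List.sublist_cons_self _ _)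
    replace hp := fun i => hsub.subset (hp i)
    replace hq := fun i => hsub.subset (hq i)
    replace hc : CutCond (l₁ ++ w :: a :: l₂) u p q := fun A hA => hc A (hA.sublist hsub)
    clear hsub
    induction hm : u s(a, w) generalizing u ι with
    | zero =>
      refine ih u (fun e' he' => ?_) ι p q hp hq hc
      by_cases h' : e' = s(a, w)
      · rw [h']; exact hm
      · exact hu e' fun hh => he' (mem_erase.2 ⟨h', hh⟩)
    | succ m ihm =>
      set L := a :: (l₂ ++ (l₁ ++ [w])) with hL
      have hL2 : L = (a :: l₂) ++ (l₁ ++ [w]) := by simp [hL]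
      have hL3 : l₁ ++ w :: a :: l₂ = (l₁ ++ [w]) ++ (a :: l₂) := by simp
      have hmem : ∀ v, v ∈ l₁ ++ w :: a :: l₂ ↔ v ∈ L := by
        intro v; simp [hL]; tauto
      have hlen : 0 < L.length := by simp [hL]
      set r : ℕ → V := fun k => L.getD k a with hr
      have hr0 : r 0 = a := by simp [hr, hL]
      have hr1 : r (L.length - 1) = w := by
        have h1 : L = (a :: (l₂ ++ l₁)) ++ [w] := by simp [hL]
        have h2 : ∀ (l : List V), (l ++ [w]).getD ((l ++ [w]).length - 1) a = w := by
          intro l; simp [List.getD_eq_getElem?_getD]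
        simp only [hr]
        rw [h1]
        exact h2 _
      have hex : ∀ v, v ∈ l₁ ++ w :: a :: l₂ → ∃ k < L.length, r k = v := by
        intro v hv
        obtain ⟨k, hk, h⟩ := List.getElem_of_mem ((hmem v).1 hv)
        exact ⟨k, hk, by simp only [hr]; rw [List.getD_eq_getElem _ _ hk, h]⟩
      have hex' : ∀ v, (∃ k < L.length, r k = v) → v ∈ l₁ ++ w :: a :: l₂ := by
        rintro v ⟨k, hk, rfl⟩
        rw [hmem]
        simp only [hr]
        rw [List.getD_eq_getElem _ _ hk]
        exact List.getElem_mem _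
      obtain ⟨p', q', h1, h2, h3, h4⟩ := os_split r L.length hlen p q
        (fun i => hex _ (hp i)) (fun i => hex _ (hq i)) u 
        (by rw [hr0, hr1]; omega) (fun A i j hA => hc A (by
          rw [hL3]
          apply CycArc.rotate
          rw [← hL2]
          exact CycArc.of_traceEq a hA))
      rw [hr0, hr1] at h3 h4
      obtain ⟨f', h5, h6⟩ := ihm (fun e' => u e' - if e' = s(a, w) then 1 else 0)
        (fun e' he' => by simp only [hu e' he', Nat.zero_sub]) (Option ι) p' q'
        (fun i => hex' _ (h1 i)) (fun i => hex' _ (h2 i))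
        (by
          intro A hA
          have hA' : CycArc L A := by
            rw [hL2]; apply CycArc.rotate; rw [← hL3]; exact hA
          by_cases h0 : a ∈ A
          · obtain ⟨i, j, hij⟩ := hA'.compl.traceEq a (by simpa [hL] using h0)
            rw [← dem_compl, ← cut_compl]
            exact h3 _ i j hij
          · obtain ⟨i, j, hij⟩ := hA'.traceEq a (by simpa [hL] using h0)
            exact h3 _ i j hij) (by simp [hm])
      exact h4 f' h5 h6

end OkamuraSeymour2

section Topology

variable {D : Type} [Fintype D] [DecidableEq D]

/-- Boundary of a corner function with respect to the rotation `σ`. -/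
def bd (σ : Equiv.Perm D) (c : D → ZMod 2) (d : D) : ZMod 2 := c d + c (σ.symm d)

/-- Corner functions whose boundary is an edge set supported on `K`. -/
def IsZc (σ θ : Equiv.Perm D) (K : Finset D) (c : D → ZMod 2) : Prop :=
  (∀ d, bd σ c (θ d) = bd σ c d) ∧ ∀ d ∉ K, bd σ c d = 0

/-- Corner functions that are constant along the faces of `K`. -/
def IsFc (σ θ : Equiv.Perm D) (K : Finset D) (c : D → ZMod 2) : Prop :=
  (∀ d ∉ K, bd σ c d = 0) ∧ ∀ d ∈ K, c (σ.symm d) = c (θ d)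

/-- Every cycle bounds: planarity of the embedding restricted to `K`. -/
def Planar (σ θ : Equiv.Perm D) (K : Finset D) : Prop :=
  ∀ c, IsZc σ θ K c → ∃ l, IsFc σ θ K l ∧ ∀ d, bd σ l d = bd σ c d

lemma IsZc.mono {σ θ : Equiv.Perm D} {K K' : Finset D} {c : D → ZMod 2} (h : IsZc σ θ K c)
    (hK : K ⊆ K') : IsZc σ θ K' c :=
  ⟨h.1, fun d hd => h.2 d fun hd' => hd (hK hd')⟩

lemma Planar.mono {σ θ : Equiv.Perm D} {K K' : Finset D} (h : Planar σ θ K')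
    (hK : K ⊆ K') : Planar σ θ K := by
  intro c hc
  obtain ⟨l, hl, hlc⟩ := h c (hc.mono hK)
  exact ⟨l, ⟨fun d hd => (hlc d).trans (hc.2 d hd), fun d hd => hl.2 d (hK hd)⟩, hlc⟩

/-- Slide the dart `σ x` along the edge of `x` so that it immediately precedes `θ x`. -/
def slide (σ θ : Equiv.Perm D) (x : D) : Equiv.Perm D :=
  σ * (Equiv.swap x (σ.symm (θ x)) * Equiv.swap x (σ x))

lemma slide_apply (σ θ : Equiv.Perm D) (x : D) (hdx : σ x ≠ x) (hpx : σ.symm (θ x) ≠ x)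
    (hpd : σ.symm (θ x) ≠ σ x) (e : D) :
    slide σ θ x e = if e = x then σ (σ x) else if e = σ x then θ x else
      if e = σ.symm (θ x) then σ x else σ e := by
  simp only [slide, Equiv.Perm.mul_apply]
  split_ifs with h1 h2 h3
  · subst h1
    rw [Equiv.swap_apply_left, Equiv.swap_apply_of_ne_of_ne hdx hpd.symm]
  · subst h2
    rw [Equiv.swap_apply_right, Equiv.swap_apply_left, Equiv.apply_symm_apply]
  · subst h3
    rw [Equiv.swap_apply_of_ne_of_ne hpx hpd, Equiv.swap_apply_right]
  · rw [Equiv.swap_apply_of_ne_of_ne h1 h2, Equiv.swap_apply_of_ne_of_ne h1 h3]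

lemma slide_symm_apply (σ θ : Equiv.Perm D) (x : D) (hdx : σ x ≠ x) (hpx : σ.symm (θ x) ≠ x)
    (hpd : σ.symm (θ x) ≠ σ x) (e : D) :
    (slide σ θ x).symm e = if e = σ x then σ.symm (θ x) else if e = θ x then σ x else
      if e = σ (σ x) then x else σ.symm e := by
  rw [Equiv.symm_apply_eq, slide_apply σ θ x hdx hpx hpd]
  have i1 : σ (σ x) ≠ σ x := fun h => hdx (σ.injective h)
  by_cases h1 : e = σ x
  · subst h1
    simp [hpx, hpd]
  by_cases h2 : e = θ x
  · subst h2
    simp [h1, hdx]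
  by_cases h3 : e = σ (σ x)
  · subst h3
    simp [h1, h2]
  · have j1 : σ.symm e ≠ x := fun h => h1 ((Equiv.symm_apply_eq σ).1 h)
    have j2 : σ.symm e ≠ σ x := fun h => h3 ((Equiv.symm_apply_eq σ).1 h)
    have j3 : σ.symm e ≠ σ.symm (θ x) := fun h => h2 (σ.symm.injective h)
    simp [h1, h2, h3, j1, j2, j3]

lemma Planar.slide {σ θ : Equiv.Perm D} {K : Finset D} (h : Planar σ θ K)
    (hθ : ∀ d, θ (θ d) = d) (hKθ : ∀ d ∈ K, θ d ∈ K) {x : D} (hx : x ∈ K) (hdx : σ x ≠ x)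
    (hpx : σ.symm (θ x) ≠ x) (hpd : σ.symm (θ x) ≠ σ x) (hθx : θ x ≠ x) (hθd : θ x ≠ σ x)
    (hθdd : θ x ≠ σ (σ x)) :
    Planar (slide σ θ x) θ K := by
  intro c' hc'
  set d := σ x with hd
  set p := σ.symm (θ x) with hp
  set σ' := MEDP.slide σ θ x with hσ'
  have hs : ∀ e, σ'.symm e = if e = d then p else if e = θ x then d else
      if e = σ d then x else σ.symm e := slide_symm_apply σ θ x hdx hpx hpd
  have hsd : σ.symm d = x := by simp [hd]
  have hsdd : σ.symm (σ d) = d := by simp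
  have hsx : ∀ e, σ.symm e = x ↔ e = d := fun e => by rw [Equiv.symm_apply_eq, hd]
  have hsdi : ∀ e, σ.symm e = d ↔ e = σ d := fun e => by rw [Equiv.symm_apply_eq]
  have hddd : σ d ≠ d := fun h => hdx (σ.injective h)
  have h2 : ∀ a : ZMod 2, a + a = 0 := by decide
  set c : D → ZMod 2 := fun e => if e = d then c' x else if e = x then c' x + c' d + c' p else c' e
    with hc
  have hbd : ∀ e, bd σ c e = bd σ' c' e + if e = x ∨ e = θ x then bd σ' c' d else 0 := by
    intro e
    simp only [bd, hs, hc, hsx, hsdi, if_true]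
    by_cases e1 : e = d
    · subst e1
      have : d ≠ θ x := hθd.symm
      simp [hdx, this, hddd.symm]
      grind
    by_cases e2 : e = θ x
    · subst e2
      simp [hθd, hθx, hθdd, ← hp]
      grind
    by_cases e3 : e = x
    · subst e3
      by_cases e4 : e = σ d
      · simp [e1, e2, ← e4]; grind
      · simp [e1, e2, e4]; grind
    · by_cases e4 : e = σ d
      · have h5 : σ d ≠ x := fun h => e3 (e4.trans h)
        simp [e4, hddd, hθdd.symm, h5]
      · simp [e1, e2, e3, e4]
  have hZ : IsZc σ θ K c := by
    constructor
    · intro e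
      have i1 : θ e = x ↔ e = θ x := ⟨fun h => by rw [← h, hθ], fun h => by rw [h, hθ]⟩
      have i2 : θ e = θ x ↔ e = x := θ.injective.eq_iff
      rw [hbd, hbd, hc'.1]
      simp only [i1, i2, or_comm]
    · intro e he
      rw [hbd, hc'.2 e he, if_neg, add_zero]
      rintro (h | h)
      · exact he (h ▸ hx)
      · exact he (h ▸ hKθ x hx)
  obtain ⟨l, hl, hlc⟩ := h c hZ
  have hlp : l p = l x := by
    have := hl.2 _ (hKθ x hx)
    rwa [hθ] at this
  have hbd' : ∀ e, bd σ' c' e = bd σ l e + if e = x ∨ e = θ x then l d + l x else 0 := by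
    intro e
    have h1 := hbd e
    have h2 := hbd d
    have h3 := hlc d
    rw [if_neg (by rintro (h | h); exacts [hdx h, hθd h.symm])] at h2
    rw [add_zero] at h2
    simp only [bd, hsd] at h3
    rw [hlc, h1, ← h2]
    simp only [bd, hsd]
    split_ifs <;> grind
  set l' : D → ZMod 2 := fun e => if e = x then l d else l e with hl'
  have hbl : ∀ e, bd σ' l' e = bd σ' c' e := by
    intro e
    rw [hbd']
    simp only [bd, hs, hl']
    by_cases e1 : e = d
    · subst e1
      have : d ≠ θ x := hθd.symm
      simp [hdx, this, hpx, hlp, hsd]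
    by_cases e2 : e = θ x
    · subst e2
      simp [hθd, hθx, hdx, ← hp, hlp]
      grind
    by_cases e3 : e = x
    · subst e3
      by_cases e4 : e = σ d
      · have : σ.symm e = d := (hsdi e).2 e4
        simp [e1, e2, ← e4, this]; grind
      · have : ¬ σ.symm e = e := fun h => e1 ((hsx e).1 h)
        simp [e1, e2, e4, this]; grind
    · by_cases e4 : e = σ d
      · have h5 : σ d ≠ x := fun h => e3 (e4.trans h)
        simp [e4, hddd, hθdd.symm, h5]
      · have : ¬ σ.symm e = x := fun h => e1 ((hsx e).1 h)
        simp [e1, e2, e3, e4, this]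
  refine ⟨l', ⟨fun e he => (hbl e).trans (hc'.2 e he), fun e he => ?_⟩, hbl⟩
  have hf := hl.2 e he
  have i1 : θ e = x ↔ e = θ x := ⟨fun h => by rw [← h, hθ], fun h => by rw [h, hθ]⟩
  simp only [hs, hl', i1]
  by_cases e1 : e = d
  · subst e1
    rw [hsd] at hf
    simp [hθd.symm, hpx, hlp, hf]
  by_cases e2 : e = θ x
  · subst e2
    simp [hθd, hdx]
  by_cases e4 : e = σ d
  · rw [e4, hsdd] at hf
    simp [e4, hddd, hθdd.symm, hf]
  · have : ¬ σ.symm e = x := fun h => e1 ((hsx e).1 h)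
    simp [e1, e2, e4, this, hf]

lemma exists_arc_chain (σ : Equiv.Perm D) (y : D) (n : ℕ) :
    ∃ c : D → ZMod 2, ∀ d, bd σ c d =
      (if d = y then 1 else 0) + (if d = (σ ^ n) y then 1 else 0) := by
  induction n with
  | zero =>
    refine ⟨fun _ => 0, fun d => ?_⟩
    simp only [bd, pow_zero, Equiv.Perm.one_apply]
    split_ifs <;> decide
  | succ n ih =>
    obtain ⟨c, hc⟩ := ih
    refine ⟨fun d => c d + if d = (σ ^ n) y then 1 else 0, fun d => ?_⟩
    have h1 := hc d
    simp only [bd] at h1 ⊢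
    have h2 : σ.symm d = (σ ^ n) y ↔ d = (σ ^ (n + 1)) y := by
      rw [Equiv.symm_apply_eq, pow_succ', Equiv.Perm.mul_apply]
    simp only [h2]
    grind

end Topology

section PeelExistence

variable {V D : Type} [DecidableEq V] [Fintype D] [DecidableEq D]

/-- Combinatorial embedding data: rotation, reversal and tail map of the darts of a simple
graph. -/
structure Emb (σ θ : Equiv.Perm D) (vt : D → V) : Prop where
  inv : ∀ d, θ (θ d) = d
  tail : ∀ d, vt (σ d) = vt d
  cyc : ∀ d d', vt d = vt d' → ∃ n : ℕ, (σ ^ n) d = d'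
  noloop : ∀ d, vt d ≠ vt (θ d)
  simple : ∀ d e, s(vt d, vt (θ d)) = s(vt e, vt (θ e)) → d = e ∨ d = θ e

/-- Intermediate state of the contraction of a disc: `L` lists the darts at the contracted
vertex in cyclic order. -/
structure DiscState (σ θ : Equiv.Perm D) (vt : D → V) (K : Finset D) (L : List D) : Prop where
  planar : Planar σ θ K
  chain : L.IsChain (fun u v => σ u = v)
  nodup : L.Nodup
  closed : ∀ u, σ u ∈ L ↔ u ∈ L
  tail : ∀ u, u ∉ L → vt (σ u) = vt u
  cyc : ∀ u u', u ∉ L → u' ∉ L → vt u = vt u' → ∃ n : ℕ, (σ ^ n) u = u'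

lemma DiscState.slide {σ θ : Equiv.Perm D} {vt : D → V} {K : Finset D} {L₁ L₂ : List D} {x : D}
    (hθ : ∀ d, θ (θ d) = d) (hKθ : ∀ d ∈ K, θ d ∈ K)
    (h : DiscState σ θ vt K (L₁ ++ θ x :: L₂)) (hx : x ∈ K) (hxL : x ∉ L₁ ++ θ x :: L₂)
    (hdx : σ x ≠ x) :
    DiscState (slide σ θ x) θ vt K (L₁ ++ σ x :: θ x :: L₂) := by
  set L := L₁ ++ θ x :: L₂ with hL
  have m1 : θ x ∈ L := by simp [hL]
  have m2 : σ x ∉ L := fun h' => hxL ((h.closed x).1 h')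
  have m3 : σ (σ x) ∉ L := fun h' => m2 ((h.closed _).1 h')
  have m4 : σ.symm (θ x) ∈ L := by rw [← h.closed]; simpa using m1
  have n1 : σ.symm (θ x) ≠ x := fun h' => hxL (h' ▸ m4)
  have n2 : σ.symm (θ x) ≠ σ x := fun h' => m2 (h' ▸ m4)
  have n3 : θ x ≠ x := fun h' => hxL (h' ▸ m1)
  have n4 : θ x ≠ σ x := fun h' => m2 (h' ▸ m1)
  have n5 : θ x ≠ σ (σ x) := fun h' => m3 (h' ▸ m1)
  have n6 : σ (σ x) ≠ σ x := fun h' => hdx (σ.injective h')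
  have hs := slide_apply σ θ x hdx n1 n2
  have hmem : ∀ u, u ∈ L₁ ++ σ x :: θ x :: L₂ ↔ u = σ x ∨ u ∈ L := by
    intro u; simp [hL]; tauto
  have hnd := h.nodup
  have hch := h.chain
  have hsL : ∀ u v, u ∈ L → v ≠ θ x → σ u = v → MEDP.slide σ θ x u = v := by
    intro u v hu hv huv
    rw [hs, if_neg (fun h' : u = x => hxL (h' ▸ hu)),
      if_neg (fun h' : u = σ x => m2 (h' ▸ hu)), if_neg, huv]
    rintro rfl
    exact hv (by simpa using huv.symm)
  refine ⟨h.planar.slide hθ hKθ hx hdx n1 n2 n3 n4 n5, ?_, ?_, ?_, ?_, ?_⟩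
  · rw [hL, List.isChain_append] at hch
    rw [List.isChain_append]
    refine ⟨?_, ?_, ?_⟩
    · refine hch.1.imp_of_mem_imp fun u v hu hv huv => hsL u v (by simp [hL, hu]) ?_ huv
      rintro rfl
      rw [hL, List.nodup_append] at hnd
      exact hnd.2.2 _ hv _ (by simp) rfl
    · rw [List.isChain_cons_cons]
      refine ⟨by rw [hs, if_neg hdx, if_pos rfl], ?_⟩
      refine hch.2.1.imp_of_mem_tail_imp fun u v hu hv huv =>
        hsL u v (by rw [hL]; exact List.mem_append_right _ hu) ?_ huv
      rintro rfl
      rw [hL, List.nodup_append, List.nodup_cons] at hnd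
      exact hnd.2.1.1 hv
    · intro u hu v hv
      have h1 := hch.2.2 u hu (θ x) (by simp)
      have h2 : σ x = v := by simpa using hv
      have h3 : u = σ.symm (θ x) := by rw [Equiv.eq_symm_apply]; exact h1
      rw [hs, ← h2, h3, if_neg n1, if_neg n2, if_pos rfl]
  · rw [hL] at hnd m2
    rw [List.nodup_middle] at *
    rw [List.nodup_cons]
    exact ⟨m2, by rw [List.nodup_middle]; exact hnd⟩
  · intro u
    rw [hmem, hmem, hs]
    split_ifs with h1 h2 h3
    · subst h1; simp [n6, m3, hdx.symm, hxL]
    · subst h2; simp [m1]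
    · subst h3; simp [m4]
    · rw [h.closed]
      constructor
      · rintro (h' | h')
        · exact absurd (σ.injective h') h1
        · exact Or.inr h'
      · rintro (h' | h')
        · exact absurd h' h2
        · exact Or.inr h'
  · intro u hu
    rw [hmem, not_or] at hu
    rw [hs, if_neg hu.1]
    split_ifs with h1 h2
    · subst h1
      rw [h.tail _ m2, h.tail _ hxL]
    · exact absurd m4 (h2 ▸ hu.2)
    · exact h.tail _ hu.2
  · have key : ∀ n : ℕ, ∀ u u', u ∉ L₁ ++ σ x :: θ x :: L₂ → u' ∉ L₁ ++ σ x :: θ x :: L₂ →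
        (σ ^ n) u = u' → ∃ n : ℕ, (MEDP.slide σ θ x ^ n) u = u' := by
      intro n
      induction n using Nat.strong_induction_on with
      | _ n ih =>
      intro u u' hu hu' hn
      have hu2 := hu
      rw [hmem, not_or] at hu
      have hu3 := hu'
      rw [hmem, not_or] at hu3
      match n, hn with
      | 0, hn => exact ⟨0, hn⟩
      | n + 1, hn =>
        rw [pow_succ, Equiv.Perm.mul_apply] at hn
        by_cases hux : u = x
        · subst hux
          match n, hn with
          | 0, hn => exact absurd hn.symm hu3.1
          | n + 1, hn =>
            rw [pow_succ, Equiv.Perm.mul_apply] at hn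
            obtain ⟨k, hk⟩ := ih n (by omega) (σ (σ u)) u'
              (by rw [hmem, not_or]; exact ⟨n6, m3⟩) hu' hn
            refine ⟨k + 1, ?_⟩
            rw [pow_succ, Equiv.Perm.mul_apply, hs, if_pos rfl, hk]
        · have hu4 : σ u ∉ L := fun h' => hu.2 ((h.closed _).1 h')
          obtain ⟨k, hk⟩ := ih n (by omega) (σ u) u'
              (by rw [hmem, not_or]; exact ⟨fun h' => hux (σ.injective h'), hu4⟩) hu' hn
          refine ⟨k + 1, ?_⟩
          rw [pow_succ, Equiv.Perm.mul_apply, hs, if_neg hux, if_neg hu.1,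
            if_neg (fun h' : u = _ => hu.2 (h' ▸ m4)), hk]
    intro u u' hu hu' huu
    have hu2 := hu
    have hu3 := hu'
    rw [hmem, not_or] at hu2 hu3
    obtain ⟨n, hn⟩ := h.cyc u u' hu2.2 hu3.2 huu
    exact key n u u' hu hu' hn

lemma bd_chain_sum {σ : Equiv.Perm D} (l : D → ZMod 2) (y : D) (M : List D)
    (h : (y :: M).IsChain (fun u v => σ u = v)) (z : D) (hz : (y :: M).getLast? = some z) :
    l z = l y + (M.map (bd σ l)).sum := by
  induction M generalizing y with
  | nil => simp at hz; simp [hz]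
  | cons v M ih =>
    rw [List.isChain_cons_cons] at h
    have := ih v h.2 (by simpa using hz)
    rw [this, List.map_cons, List.sum_cons]
    have h3 : σ.symm v = y := by rw [← h.1]; simp
    simp only [bd, h3]
    grind

lemma isChain_of_isInfix {α : Type} {R : α → α → Prop} {l m : List α} (h : l.IsChain R)
    (hm : m <:+: l) : m.IsChain R := by
  obtain ⟨a, b, rfl⟩ := hm
  exact h.left_of_append.right_of_append

lemma pow_of_chain {σ : Equiv.Perm D} (y : D) (M : List D)
    (h : (y :: M).IsChain (fun u v => σ u = v)) (z : D) (hz : (y :: M).getLast? = some z) :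
    ∃ n : ℕ, (σ ^ n) y = z := by
  induction M generalizing y with
  | nil => simp at hz; exact ⟨0, by simp [hz]⟩
  | cons v M ih =>
    rw [List.isChain_cons_cons] at h
    obtain ⟨n, hn⟩ := ih v h.2 (by simpa using hz)
    exact ⟨n + 1, by rw [pow_succ, Equiv.Perm.mul_apply, h.1, hn]⟩

lemma exists_append_of_cons_sublist {α : Type} {a : α} {l L : List α} (h : (a :: l).Sublist L) :
    ∃ A R, L = A ++ a :: R ∧ l.Sublist R := by
  obtain ⟨r₁, r₂, rfl, h1, h2⟩ := List.cons_sublist_iff.1 h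
  obtain ⟨s, t, rfl⟩ := List.append_of_mem h1
  exact ⟨s, t ++ r₂, by simp, h2.trans (List.sublist_append_right _ _)⟩

/-- Two pairs of darts at the contracted vertex cannot cross if they end at distinct vertices. -/
lemma DiscState.noncross {σ θ : Equiv.Perm D} {vt : D → V} {K : Finset D} {L : List D}
    (hθ : ∀ d, θ (θ d) = d) (hKθ : ∀ d ∈ K, θ d ∈ K) (h : DiscState σ θ vt K L)
    (hLθ : ∀ d ∈ K, d ∈ L → θ d ∉ L) {x₁ y₁ x₂ y₂ : D} (hsub : [x₁, y₁, x₂, y₂].Sublist L)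
    (hx₁ : x₁ ∈ K) (hx₂ : x₂ ∈ K) (hy₁ : y₁ ∈ K) (hy₂ : y₂ ∈ K)
    (ha : vt (θ x₁) = vt (θ x₂)) (hb : vt (θ y₁) = vt (θ y₂)) : vt (θ x₁) = vt (θ y₁) := by
  by_contra hab
  obtain ⟨A, R₁, hL, h1⟩ := exists_append_of_cons_sublist hsub
  obtain ⟨B, R₂, rfl, h2⟩ := exists_append_of_cons_sublist h1
  obtain ⟨C, R₃, rfl, h3⟩ := exists_append_of_cons_sublist h2
  obtain ⟨E, F, rfl, -⟩ := exists_append_of_cons_sublist h3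
  have i1 : (x₁ :: (B ++ y₁ :: C ++ [x₂])) <:+: L :=
    ⟨A, E ++ y₂ :: F, by rw [hL]; simp⟩
  have i2 : (y₁ :: (C ++ x₂ :: E ++ [y₂])) <:+: L :=
    ⟨A ++ x₁ :: B, F, by rw [hL]; simp⟩
  obtain ⟨n, hn⟩ := pow_of_chain _ _ (isChain_of_isInfix h.chain i1) x₂
    (List.getLast?_concat (l := x₁ :: (B ++ y₁ :: C)))
  have hmemL : ∀ d ∈ [x₁, y₁, x₂, y₂], d ∈ L := fun d hd => hsub.subset hd
  have hx₁L := hmemL x₁ (by simp)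
  have hx₂L := hmemL x₂ (by simp)
  have hy₁L := hmemL y₁ (by simp)
  have hy₂L := hmemL y₂ (by simp)
  obtain ⟨k, hk⟩ := h.cyc (θ x₁) (θ x₂) (hLθ _ hx₁ hx₁L) (hLθ _ hx₂ hx₂L) ha
  obtain ⟨c₁, hc₁⟩ := exists_arc_chain σ x₁ n
  obtain ⟨c₂, hc₂⟩ := exists_arc_chain σ (θ x₁) k
  rw [hn] at hc₁
  rw [hk] at hc₂
  have hbd : ∀ d, bd σ (fun e => c₁ e + c₂ e) d = ((if d = x₁ then 1 else 0) +
      (if d = x₂ then 1 else 0)) + ((if d = θ x₁ then 1 else 0) + if d = θ x₂ then 1 else 0) := by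
    intro d
    rw [← hc₁, ← hc₂]
    simp only [bd]
    ring
  have hθi : ∀ u v, θ u = v ↔ u = θ v :=
    fun u v => ⟨fun h => by rw [← h, hθ], fun h => by rw [h, hθ]⟩
  obtain ⟨l, hl, hlc⟩ := h.planar (fun e => c₁ e + c₂ e) (by
    constructor
    · intro d
      rw [hbd, hbd]
      simp only [hθi, hθ]
      ring
    · intro d hd
      have e1 : d ≠ x₁ := fun h' => hd (h' ▸ hx₁)
      have e2 : d ≠ x₂ := fun h' => hd (h' ▸ hx₂)
      have e3 : d ≠ θ x₁ := fun h' => hd (h' ▸ hKθ _ hx₁)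
      have e4 : d ≠ θ x₂ := fun h' => hd (h' ▸ hKθ _ hx₂)
      rw [hbd]
      simp [e1, e2, e3, e4])
  have hlb : ∀ d, bd σ l d = ((if d = x₁ then 1 else 0) +
      (if d = x₂ then 1 else 0)) + ((if d = θ x₁ then 1 else 0) + if d = θ x₂ then 1 else 0) :=
    fun d => (hlc d).trans (hbd d)
  have hnd := h.nodup
  have hnd' : [x₁, y₁, x₂, y₂].Nodup := hnd.sublist hsub
  have hz2 : ∀ a b : ZMod 2, a + b = 0 + 0 + (0 + 0) → a = b := by decide
  have hy : ∀ y ∈ L, y ∈ K → y ≠ x₁ → y ≠ x₂ → l y = l (θ y) := by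
    intro y hyL hyK e1 e2
    have h1 := hlb y
    have e3 : y ≠ θ x₁ := fun h' => hLθ _ hx₁ hx₁L (h' ▸ hyL)
    have e4 : y ≠ θ x₂ := fun h' => hLθ _ hx₂ hx₂L (h' ▸ hyL)
    rw [if_neg e1, if_neg e2, if_neg e3, if_neg e4] at h1
    have h2 := hl.2 y hyK
    simp only [bd] at h1
    rw [← h2]
    exact hz2 _ _ h1
  have hconst : ∀ j : ℕ, l ((σ ^ j) (θ y₁)) = l (θ y₁) ∧ (σ ^ j) (θ y₁) ∉ L ∧
      vt ((σ ^ j) (θ y₁)) = vt (θ y₁) := by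
    intro j
    induction j with
    | zero => exact ⟨rfl, hLθ _ hy₁ hy₁L, rfl⟩
    | succ j ih =>
      obtain ⟨j1, j2, j3⟩ := ih
      rw [pow_succ', Equiv.Perm.mul_apply]
      set u := (σ ^ j) (θ y₁) with hu
      have k2 : σ u ∉ L := fun h' => j2 ((h.closed _).1 h')
      have k3 : vt (σ u) = vt (θ y₁) := by rw [h.tail _ j2, j3]
      refine ⟨?_, k2, k3⟩
      have h1 := hlb (σ u)
      have e1 : σ u ≠ x₁ := fun h' => k2 (h' ▸ hx₁L)
      have e2 : σ u ≠ x₂ := fun h' => k2 (h' ▸ hx₂L)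
      have e3 : σ u ≠ θ x₁ := fun h' => hab (by rw [← h', k3])
      have e4 : σ u ≠ θ x₂ := fun h' => hab (by rw [ha, ← h', k3])
      rw [if_neg e1, if_neg e2, if_neg e3, if_neg e4] at h1
      simp only [bd, Equiv.symm_apply_apply] at h1
      rw [← j1]
      exact hz2 _ _ h1
  obtain ⟨j, hj⟩ := h.cyc (θ y₁) (θ y₂) (hLθ _ hy₁ hy₁L) (hLθ _ hy₂ hy₂L) hb
  have hjc := (hconst j).1
  rw [hj] at hjc
  simp only [List.nodup_cons, List.mem_cons, not_or] at hnd'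
  rw [← hy y₁ hy₁L hy₁ (Ne.symm hnd'.1.1) hnd'.2.1.1, ← hy y₂ hy₂L hy₂ (Ne.symm hnd'.1.2.2.1)
    (Ne.symm hnd'.2.2.1.1)] at hjc
  have hsum := bd_chain_sum l _ _ (isChain_of_isInfix h.chain i2) y₂
    (List.getLast?_concat (l := y₁ :: (C ++ x₂ :: E)))
  have hz : ∀ M : List D, (∀ d ∈ M, d ∈ L ∧ d ≠ x₁ ∧ d ≠ x₂) → (M.map (bd σ l)).sum = 0 := by
    intro M hM
    refine List.sum_eq_zero fun z hz => ?_
    obtain ⟨d, hd, rfl⟩ := List.mem_map.1 hz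
    obtain ⟨q1, q2, q3⟩ := hM d hd
    rw [hlb, if_neg q2, if_neg q3, if_neg (fun h' : d = θ x₁ => hLθ _ hx₁ hx₁L (h' ▸ q1)),
      if_neg (fun h' : d = θ x₂ => hLθ _ hx₂ hx₂L (h' ▸ q1))]
    decide
  have hx₂v : bd σ l x₂ = 1 := by
    rw [hlb, if_neg (Ne.symm hnd'.1.2.1), if_pos rfl, if_neg (fun h' : x₂ = θ x₁ => hLθ _ hx₁ hx₁L
        (h' ▸ hx₂L)),
      if_neg (fun h' : x₂ = θ x₂ => hLθ _ hx₂ hx₂L (h' ▸ hx₂L))]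
    decide
  have hne : ∀ d, d ∈ C ∨ d ∈ E → d ∈ L ∧ d ≠ x₁ ∧ d ≠ x₂ := by
    intro d hd
    refine ⟨by rw [hL]; rcases hd with hd | hd <;> simp [hd], ?_, ?_⟩ <;> rintro rfl <;>
      rw [hL] at hnd <;> simp [List.nodup_append] at hnd <;> grind
  rw [List.map_append, List.map_append, List.map_cons, List.sum_append, List.sum_append,
    List.sum_cons, hz C fun d hd => hne d (Or.inl hd), hz E fun d hd => hne d (Or.inr hd),
    hz [y₂] (by simpa using ⟨hy₂L, Ne.symm hnd'.1.2.2.1, Ne.symm hnd'.2.2.1.1⟩), hx₂v, hjc] at hsum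
  generalize l y₁ = u at hsum
  revert u; decide

end PeelExistence

section PeelExistence

variable {V D : Type} [Fintype V] [DecidableEq V] [Fintype D] [DecidableEq D]

/-- Outer endpoints of the live darts at the contracted vertex. -/
def ringOf (θ : Equiv.Perm D) (vt : D → V) (K : Finset D) (L : List D) : List V :=
  (L.filter (· ∈ K)).map (fun d => vt (θ d))

/-- Live edges away from the contracted vertex. -/
def innerEdges (θ : Equiv.Perm D) (vt : D → V) (K : Finset D) (L : List D) : Finset (Sym2 V) :=
  (K.filter fun d => d ∉ L ∧ θ d ∉ L).image fun d => s(vt d, vt (θ d))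

lemma exists_consecutive {σ : Equiv.Perm D} {P : D → Prop} {x : D} {n : ℕ} (hx : P x)
    (hn : ¬ P ((σ ^ n) x)) : ∃ k < n, P ((σ ^ k) x) ∧ ¬ P (σ ((σ ^ k) x)) := by
  induction n with
  | zero => exact absurd hx hn
  | succ n ih =>
    by_cases h : P ((σ ^ n) x)
    · exact ⟨n, by omega, h, by rwa [pow_succ', Equiv.Perm.mul_apply] at hn⟩
    · obtain ⟨k, hk, hk'⟩ := ih h
      exact ⟨k, by omega, hk'⟩

lemma DiscState.pow_notMem {σ θ : Equiv.Perm D} {vt : D → V} {K : Finset D} {L : List D}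
    (h : DiscState σ θ vt K L) {x : D} (hx : x ∉ L) (n : ℕ) :
    (σ ^ n) x ∉ L ∧ vt ((σ ^ n) x) = vt x := by
  induction n with
  | zero => exact ⟨hx, rfl⟩
  | succ n ih =>
    rw [pow_succ', Equiv.Perm.mul_apply]
    exact ⟨fun h' => ih.1 ((h.closed _).1 h'), by rw [h.tail _ ih.1, ih.2]⟩

lemma exists_sublist_of_map {α β : Type} {f : α → β} {l : List α} {m : List β}
    (h : m.Sublist (l.map f)) : ∃ l' : List α, l'.Sublist l ∧ l'.map f = m := by
  obtain ⟨l', h1, h2⟩ := List.sublist_map_iff.1 h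
  exact ⟨l', h1, h2.symm⟩

lemma DiscState.noncross_ring {σ θ : Equiv.Perm D} {vt : D → V} {K : Finset D} {L : List D}
    (hθ : ∀ d, θ (θ d) = d) (hKθ : ∀ d ∈ K, θ d ∈ K) (h : DiscState σ θ vt K L)
    (hLθ : ∀ d ∈ K, d ∈ L → θ d ∉ L) : Noncross (ringOf θ vt K L) := by
  intro a b hab
  obtain ⟨l', h1, h2⟩ := exists_sublist_of_map hab
  match l', h2 with
  | [_, _, _], h2 => simp at h2
  | _ :: _ :: _ :: _ :: _ :: _, h2 => simp at h2
  | [x₁, y₁, x₂, y₂], h2 =>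
    simp only [List.map_cons, List.map_nil, List.cons.injEq, and_true] at h2
    have hm : ∀ d ∈ [x₁, y₁, x₂, y₂], d ∈ K := fun d hd => by
      have := h1.subset hd
      simpa using (List.mem_filter.1 this).2
    rw [← h2.1, ← h2.2.1]
    exact h.noncross hθ hKθ hLθ (h1.trans List.filter_sublist) (hm _ (by simp)) (hm _ (by simp))
      (hm _ (by simp)) (hm _ (by simp)) (by rw [h2.1, h2.2.2.1]) (by rw [h2.2.1, h2.2.2.2])

lemma peel_of_discState {θ : Equiv.Perm D} {vt : D → V} {K : Finset D}
    (hθ : ∀ d, θ (θ d) = d) (hKθ : ∀ d ∈ K, θ d ∈ K) (hnl : ∀ d, vt d ≠ vt (θ d))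
    (hsim : ∀ d d', s(vt d, vt (θ d)) = s(vt d', vt (θ d')) → d = d' ∨ d = θ d') :
    ∀ (N : ℕ) (σ : Equiv.Perm D) (L : List D), Fintype.card D ≤ L.length + N →
    DiscState σ θ vt K L → (∀ d ∈ K, d ∈ L → θ d ∉ L) →
    Peel (ringOf θ vt K L) (innerEdges θ vt K L) := by
  have base : ∀ (σ : Equiv.Perm D) (L : List D), DiscState σ θ vt K L →
      (∀ d ∈ K, d ∈ L → θ d ∉ L) → (∀ x y, x ∈ K → x ∉ L → θ x ∈ L → y ∉ L → vt y = vt x →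
      y ∈ K ∧ θ y ∈ L) → Peel (ringOf θ vt K L) (innerEdges θ vt K L) := by
    intro σ L h hLθ hn
    refine Peel.base _ _ (h.noncross_ring hθ hKθ hLθ) ?_
    intro e he v hv hve
    obtain ⟨d, hd, rfl⟩ := mem_image.1 he
    obtain ⟨hdK, hd1, hd2⟩ := mem_filter.1 hd
    obtain ⟨d₀, hd₀, rfl⟩ := List.mem_map.1 hv
    obtain ⟨hd₀L, hd₀K⟩ := List.mem_filter.1 hd₀
    have hd₀K : d₀ ∈ K := by simpa using hd₀K
    have key := fun y => hn (θ d₀) y (hKθ _ hd₀K) (hLθ _ hd₀K hd₀L) (by rwa [hθ])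
    rcases Sym2.mem_iff.1 hve with h1 | h1
    · exact hd2 (key d hd1 h1.symm).2
    · exact hd1 (by have := (key (θ d) hd2 h1.symm).2; rwa [hθ] at this)
  intro N
  induction N with
  | zero =>
    intro σ L hN h hLθ
    have hall : ∀ x, x ∈ L := by
      have h1 : L.toFinset.card = Fintype.card D := le_antisymm (card_le_univ _)
        (by rw [List.toFinset_card_of_nodup h.nodup]; omega)
      intro x
      have := (Finset.card_eq_iff_eq_univ _).1 h1
      rw [← List.mem_toFinset, this]; exact mem_univ _
    exact base σ L h hLθ fun x y _ hx => absurd (hall x) hx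
  | succ N ih =>
    intro σ L hN h hLθ
    by_cases hn : ∀ x y, x ∈ K → x ∉ L → θ x ∈ L → y ∉ L → vt y = vt x → y ∈ K ∧ θ y ∈ L
    · exact base σ L h hLθ hn
    push Not at hn
    obtain ⟨x, y, hxK, hxL, hθx, hyL, hyx, hy⟩ := hn
    obtain ⟨n, hn⟩ := h.cyc x y hxL hyL hyx.symm
    obtain ⟨k, -, ⟨hk1, hk2⟩, hk3⟩ := exists_consecutive (σ := σ) (P := fun z => z ∈ K ∧ θ z ∈ L)
      (x := x) (n := n) ⟨hxK, hθx⟩ (by rw [hn]; exact fun h' => hy h'.1 h'.2)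
    have hk4 := (h.pow_notMem hxL k).1
    set z := (σ ^ k) x with hz
    clear_value z
    obtain ⟨L₁, L₂, rfl⟩ := List.append_of_mem hk2
    have hzz : σ z ≠ z := fun h' => hk3 (by rw [h']; exact ⟨hk1, hk2⟩)
    have hs := h.slide hθ hKθ hk1 hk4 hzz
    have hσz : σ z ∉ L₁ ++ θ z :: L₂ := fun h' => hk4 ((h.closed _).1 h')
    have hvz : vt (σ z) = vt z := h.tail _ hk4
    have hmem : ∀ u, u ∈ L₁ ++ σ z :: θ z :: L₂ ↔ u = σ z ∨ u ∈ L₁ ++ θ z :: L₂ := by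
      intro u; simp; tauto
    have hθi : ∀ u v, θ u = v ↔ u = θ v :=
      fun u v => ⟨fun h => by rw [← h, hθ], fun h => by rw [h, hθ]⟩
    have hθz : θ z ∈ K := hKθ _ hk1
    have hih := ih _ _ (by simp at hN ⊢; omega) hs
    by_cases hd : σ z ∈ K
    · have hθσ : θ (σ z) ∉ L₁ ++ θ z :: L₂ := fun h' => hk3 ⟨hd, h'⟩
      have hih := hih (by
        intro d hdK hdL
        rw [hmem] at hdL ⊢
        rw [not_or]
        rcases hdL with rfl | hdL
        · exact ⟨fun h' => hnl (σ z) (by rw [h']), hθσ⟩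
        · exact ⟨fun h' => hθσ (by rw [← h', hθ]; exact hdL), hLθ d hdK hdL⟩)
      have e1 : ringOf θ vt K (L₁ ++ θ z :: L₂) = ringOf θ vt K L₁ ++ vt z :: ringOf θ vt K L₂ := by
        simp [ringOf, hθz, hθ]
      have e2 : ringOf θ vt K (L₁ ++ σ z :: θ z :: L₂) =
          ringOf θ vt K L₁ ++ vt (θ (σ z)) :: vt z :: ringOf θ vt K L₂ := by
        simp [ringOf, hθz, hθ, hd]
      rw [e2] at hih
      rw [e1]
      refine Peel.step _ _ _ (vt (θ (σ z))) _ (by rw [← hvz]; exact hnl _) ?_ ?_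
      · exact mem_image.2 ⟨σ z, mem_filter.2 ⟨hd, hσz, hθσ⟩, by rw [hvz]⟩
      · convert hih using 1
        ext e
        simp only [innerEdges, mem_erase, mem_image, mem_filter, hmem, not_or]
        constructor
        · rintro ⟨h1, d, ⟨h2, h3, h4⟩, rfl⟩
          refine ⟨d, ⟨h2, ⟨?_, h3⟩, ?_, h4⟩, rfl⟩
          · rintro rfl; exact h1 (by rw [hvz])
          · intro h'
            apply h1
            rw [h', ← hvz, Sym2.eq_swap, ← h', hθ]
        · rintro ⟨d, ⟨h2, ⟨h3, h3'⟩, h4, h4'⟩, rfl⟩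
          refine ⟨fun h' => ?_, d, ⟨h2, h3', h4'⟩, rfl⟩
          rw [← hvz] at h'
          rcases hsim _ _ h' with h5 | h5
          · exact h3 h5
          · exact h4 (by rw [h5, hθ])
    · have hθd : θ (σ z) ∉ K := fun h' => hd (by have := hKθ _ h'; rwa [hθ] at this)
      have hih := hih (by
        intro d hdK hdL
        rw [hmem] at hdL ⊢
        rw [not_or]
        rcases hdL with rfl | hdL
        · exact absurd hdK hd
        · exact ⟨fun h' => hd (h' ▸ hKθ _ hdK), hLθ d hdK hdL⟩)
      convert hih using 1
      · simp [ringOf, hθz, hd]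
      · ext e
        simp only [innerEdges, mem_image, mem_filter, hmem, not_or]
        constructor
        · rintro ⟨d, ⟨h2, h3, h4⟩, rfl⟩
          exact ⟨d, ⟨h2, ⟨fun h' => hd (h' ▸ h2), h3⟩, fun h' => hd (h' ▸ hKθ _ h2), h4⟩, rfl⟩
        · rintro ⟨d, ⟨h2, ⟨h3, h3'⟩, h4, h4'⟩, rfl⟩
          exact ⟨d, ⟨h2, h3', h4'⟩, rfl⟩

end PeelExistence

section PeelExistence

variable {V D : Type} [Fintype V] [DecidableEq V] [Fintype D] [DecidableEq D]

lemma exists_orbit_list (σ : Equiv.Perm D) (x : D) :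
    ∃ L : List D, L.Nodup ∧ L.IsChain (fun u v => σ u = v) ∧ ∀ u, u ∈ L ↔ ∃ n : ℕ, (σ ^ n) x =
        u := by
  classical
  have hex : ∃ n : ℕ, 0 < n ∧ (σ ^ n) x = x :=
    ⟨orderOf σ, orderOf_pos σ, by rw [pow_orderOf_eq_one]; rfl⟩
  obtain ⟨hn0, hn⟩ := Nat.find_spec hex
  have hmin : ∀ m, 0 < m → m < Nat.find hex → (σ ^ m) x ≠ x :=
    fun m h0 hm h => Nat.find_min hex hm ⟨h0, h⟩
  set n := Nat.find hex
  clear_value n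
  refine ⟨(List.range n).map fun k => (σ ^ k) x, ?_, ?_, ?_⟩
  · have key : ∀ i j, i < j → j < n → (σ ^ i) x ≠ (σ ^ j) x := by
      intro i j hij hj h
      apply hmin (j - i) (by omega) (by omega)
      apply (σ ^ i).injective
      rw [← Equiv.Perm.mul_apply, ← pow_add, Nat.add_sub_cancel' hij.le, h]
    refine List.Nodup.map_on (fun i hi j hj h => ?_) List.nodup_range
    rw [List.mem_range] at hi hj
    rcases lt_trichotomy i j with h1 | h1 | h1
    · exact absurd h (key i j h1 hj)
    · exact h1
    · exact absurd h.symm (key j i h1 hi)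
  · rw [List.isChain_iff_getElem]
    intro i hi
    simp [pow_succ']
  · intro u
    rw [List.mem_map]
    constructor
    · rintro ⟨k, -, hk⟩
      exact ⟨k, hk⟩
    · rintro ⟨k, hk⟩
      refine ⟨k % n, List.mem_range.2 (Nat.mod_lt _ hn0), ?_⟩
      have h1 : ∀ q : ℕ, (σ ^ (n * q)) x = x := by
        intro q
        induction q with
        | zero => rfl
        | succ q ih => rw [Nat.mul_succ, pow_add, Equiv.Perm.mul_apply, hn, ih]
      rw [← hk]
      conv_rhs => rw [← Nat.mod_add_div k n, pow_add, Equiv.Perm.mul_apply, h1]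

/-- Contract the live edge of `x`, absorbing all other darts at its tail. -/
lemma DiscState.absorb {θ : Equiv.Perm D} {vt : D → V} {K : Finset D}
    (hθ : ∀ d, θ (θ d) = d) (hKθ : ∀ d ∈ K, θ d ∈ K) {x : D} (hx : x ∈ K) :
    ∀ (N : ℕ) (σ : Equiv.Perm D) (L : List D), Fintype.card D ≤ L.length + N →
    DiscState σ θ vt K L → x ∉ L → θ x ∈ L →
    ∃ (σ' : Equiv.Perm D) (L' : List D), DiscState σ' θ vt K L' ∧ (∀ d ∈ L, d ∈ L') ∧ x ∉ L' ∧
      (∀ d ∈ L', d ∈ L ∨ vt d = vt x) ∧ ∀ d, vt d = vt x → d ∈ L' ∨ d = x := by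
  intro N
  induction N with
  | zero =>
    intro σ L hN h hxL
    exfalso
    apply hxL
    have h1 : L.toFinset.card = Fintype.card D := le_antisymm (card_le_univ _)
        (by rw [List.toFinset_card_of_nodup h.nodup]; omega)
    have := (Finset.card_eq_iff_eq_univ _).1 h1
    rw [← List.mem_toFinset, this]; exact mem_univ _
  | succ N ih =>
    intro σ L hN h hxL hθx
    by_cases hxx : σ x = x
    · refine ⟨σ, L, h, fun d hd => hd, hxL, fun d hd => Or.inl hd, fun d hd => ?_⟩
      by_cases hdL : d ∈ L
      · exact Or.inl hdL
      · obtain ⟨n, hn⟩ := h.cyc x d hxL hdL hd.symm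
        have : ∀ n : ℕ, (σ ^ n) x = x := by
          intro n
          induction n with
          | zero => rfl
          | succ n ih => rw [pow_succ, Equiv.Perm.mul_apply, hxx, ih]
        exact Or.inr (by rw [← hn, this])
    · obtain ⟨L₁, L₂, rfl⟩ := List.append_of_mem hθx
      have hs := h.slide hθ hKθ hx hxL hxx
      have hmem : ∀ u, u ∈ L₁ ++ σ x :: θ x :: L₂ ↔ u = σ x ∨ u ∈ L₁ ++ θ x :: L₂ := by
        intro u; simp; tauto
      obtain ⟨σ', L', h1, h2, h3, h4, h5⟩ := ih _ _ (by simp at hN ⊢; omega) hs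
        (by rw [hmem, not_or]; exact ⟨Ne.symm hxx, hxL⟩) (by simp)
      refine ⟨σ', L', h1, fun d hd => h2 d ((hmem d).2 (Or.inr hd)), h3, fun d hd => ?_, h5⟩
      rcases h4 d hd with h6 | h6
      · rcases (hmem d).1 h6 with rfl | h7
        · exact Or.inr (h.tail _ hxL)
        · exact Or.inl h7
      · exact Or.inr h6

/-- Step relation: `v` is outside `S` and joined to `u` by a live edge. -/
def LiveStep (θ : Equiv.Perm D) (vt : D → V) (K : Finset D) (S : Finset V) (u v : V) : Prop :=
  v ∉ S ∧ ∃ d ∈ K, vt d = u ∧ vt (θ d) = v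

lemma exists_contracted {σ θ : Equiv.Perm D} {vt : D → V} {K : Finset D} {S : Finset V}
    (hE : Emb σ θ vt) (hKθ : ∀ d ∈ K, θ d ∈ K) (hK : Planar σ θ K) {x : D} (hxS : vt x ∉ S) :
    ∃ (σ' : Equiv.Perm D) (L : List D) (R : Finset V), DiscState σ' θ vt K L ∧ Disjoint R S ∧
      vt x ∈ R ∧ (∀ d ∈ L, vt d ∈ R) ∧ (∀ d, vt d ∈ R → d ∈ L ∨ vt (θ d) ∈ R) ∧
      ∀ u v, u ∈ R → LiveStep θ vt K S u v → v ∈ R := by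
  have key : ∀ (N : ℕ) (σ' : Equiv.Perm D) (L : List D) (R : Finset V),
      Fintype.card V ≤ R.card + N → DiscState σ' θ vt K L → Disjoint R S →
      vt x ∈ R → (∀ d ∈ L, vt d ∈ R) → (∀ d, vt d ∈ R → d ∈ L ∨ vt (θ d) ∈ R) →
      ∃ (σ' : Equiv.Perm D) (L : List D) (R : Finset V), DiscState σ' θ vt K L ∧ Disjoint R S ∧
      vt x ∈ R ∧ (∀ d ∈ L, vt d ∈ R) ∧ (∀ d, vt d ∈ R → d ∈ L ∨ vt (θ d) ∈ R) ∧
      ∀ u v, u ∈ R → LiveStep θ vt K S u v → v ∈ R := by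
    intro N
    induction N with
    | zero =>
      intro σ' L R hN h1 h2 h3 h4 h5
      have hR : R = univ := (Finset.card_eq_iff_eq_univ _).1 (le_antisymm (card_le_univ _) hN)
      exact ⟨σ', L, R, h1, h2, h3, h4, h5, fun u v _ _ => by rw [hR]; exact mem_univ _⟩
    | succ N ih =>
      intro σ' L R hN h1 h2 h3 h4 h5
      by_cases hc : ∀ u v, u ∈ R → LiveStep θ vt K S u v → v ∈ R
      · exact ⟨σ', L, R, h1, h2, h3, h4, h5, hc⟩
      push Not at hc
      obtain ⟨u, v, hu, ⟨hvS, d, hdK, rfl, rfl⟩, hv⟩ := hc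
      have hdL : d ∈ L := (h5 d hu).resolve_right hv
      obtain ⟨σ₁, L₁, k1, k2, k3, k4, k5⟩ := DiscState.absorb hE.inv hKθ (hKθ _ hdK) _ _ _
          le_add_self
        h1 (fun h' => hv (h4 _ h')) (by rwa [hE.inv])
      refine ih σ₁ L₁ (insert (vt (θ d)) R) (by rw [card_insert_of_notMem hv]; omega) k1 ?_ ?_ ?_ ?_
      · rw [disjoint_insert_left]; exact ⟨hvS, h2⟩
      · exact mem_insert_of_mem h3
      · intro e he
        rcases k4 e he with h6 | h6
        · exact mem_insert_of_mem (h4 e h6)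
        · rw [h6]; exact mem_insert_self _ _
      · intro e he
        rcases mem_insert.1 he with h6 | h6
        · rcases k5 e h6 with h7 | h7
          · exact Or.inl h7
          · right
            rw [h7, hE.inv]
            exact mem_insert_of_mem hu
        · rcases h5 e h6 with h7 | h7
          · exact Or.inl (k2 _ h7)
          · exact Or.inr (mem_insert_of_mem h7)
  obtain ⟨L, hL1, hL2, hL3⟩ := exists_orbit_list σ x
  have hL4 : ∀ u, u ∈ L ↔ vt u = vt x := by
    intro u
    rw [hL3]
    constructor
    · rintro ⟨n, rfl⟩
      induction n with
      | zero => rfl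
      | succ n ih => rw [pow_succ', Equiv.Perm.mul_apply, hE.tail, ih]
    · intro h
      exact hE.cyc x u h.symm
  refine key (Fintype.card V) σ L {vt x} (by omega) ⟨hK, hL2, hL1, ?_, ?_, ?_⟩ ?_ ?_ ?_ ?_
  · intro u; rw [hL4, hL4, hE.tail]
  · intro u _; exact hE.tail u
  · intro u u' _ _ h; exact hE.cyc u u' h
  · simpa using hxS
  · simp
  · intro d hd; simpa using (hL4 d).1 hd
  · intro d hd; exact Or.inl ((hL4 d).2 (by simpa using hd))

/-- A piece whose complement is connected in a plane graph can be peeled from its boundary. -/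
theorem exists_peel {σ θ : Equiv.Perm D} {vt : D → V} {K : Finset D} {S : Finset V}
    (hE : Emb σ θ vt) (hKθ : ∀ d ∈ K, θ d ∈ K) (hK : Planar σ θ K) {r : V} (hrS : r ∉ S)
    (hconn : ∀ d ∈ K, vt d ∉ S → vt (θ d) ∈ S → Relation.ReflTransGen (LiveStep θ vt K S) r (vt d))
    (hne : ∃ d ∈ K, vt d ∉ S ∧ vt (θ d) ∈ S) :
    ∃ ring : List V,
      Peel ring ((K.filter fun d => vt d ∈ S ∧ vt (θ d) ∈ S).image fun d => s(vt d, vt (θ d))) ∧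
      ring.length = #{d ∈ K | vt d ∉ S ∧ vt (θ d) ∈ S} ∧
      ∀ v, v ∈ ring ↔ v ∈ S ∧ ∃ d ∈ K, vt d = v ∧ vt (θ d) ∉ S := by
  have hx : ∃ x, vt x = r := by
    obtain ⟨d, hd, h1, h2⟩ := hne
    rcases (Relation.ReflTransGen.cases_head (hconn d hd h1 h2)) with h3 | ⟨c, ⟨-, d', -, h4, -⟩, -⟩
    · exact ⟨d, h3.symm⟩
    · exact ⟨d', h4⟩
  obtain ⟨x, rfl⟩ := hx
  obtain ⟨σ', L, R, h1, h2, h3, h4, h5, h6⟩ := exists_contracted hE hKθ hK hrS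
  have hR : ∀ v, Relation.ReflTransGen (LiveStep θ vt K S) (vt x) v → v ∈ R := by
    intro v hv
    induction hv with
    | refl => exact h3
    | tail _ h ih => exact h6 _ _ ih h
  have hRS : ∀ v ∈ R, v ∉ S := fun v hv => disjoint_left.1 h2 hv
  set K' := K.filter fun d => vt d ∈ S ∨ vt (θ d) ∈ S with hK'
  have hcross : ∀ d ∈ K, vt d ∉ S → vt (θ d) ∈ S → d ∈ L := by
    intro d hd h7 h8
    exact (h5 d (hR _ (hconn d hd h7 h8))).resolve_right fun h' => hRS _ h' h8
  have hSL : ∀ d, vt d ∈ S → d ∉ L := fun d hd h' => hRS _ (h4 d h') hd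
  have hL : ∀ d ∈ K', (d ∈ L ↔ vt d ∉ S ∧ vt (θ d) ∈ S) := by
    intro d hd
    obtain ⟨hdK, hdS⟩ := mem_filter.1 hd
    constructor
    · intro h
      have := hRS _ (h4 d h)
      exact ⟨this, hdS.resolve_left this⟩
    · rintro ⟨h7, h8⟩
      exact hcross d hdK h7 h8
  have hKθ' : ∀ d ∈ K', θ d ∈ K' := by
    intro d hd
    obtain ⟨hdK, hdS⟩ := mem_filter.1 hd
    exact mem_filter.2 ⟨hKθ _ hdK, by rw [hE.inv]; exact hdS.symm⟩
  have hst : DiscState σ' θ vt K' L :=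
    ⟨h1.planar.mono (filter_subset _ _), h1.chain, h1.nodup, h1.closed, h1.tail, h1.cyc⟩
  have hP := peel_of_discState hE.inv hKθ' hE.noloop hE.simple (Fintype.card D) σ' L
    (by omega) hst (fun d hd hdL => hSL _ ((hL d hd).1 hdL).2)
  have hfil : ∀ d, d ∈ L ∧ d ∈ K' ↔ d ∈ K ∧ vt d ∉ S ∧ vt (θ d) ∈ S := by
    intro d
    constructor
    · rintro ⟨h7, h8⟩
      exact ⟨(mem_filter.1 h8).1, (hL d h8).1 h7⟩
    · rintro ⟨h7, h8⟩
      have : d ∈ K' := mem_filter.2 ⟨h7, Or.inr h8.2⟩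
      exact ⟨(hL d this).2 h8, this⟩
  refine ⟨ringOf θ vt K' L, ?_, ?_, ?_⟩
  · convert hP using 1
    unfold innerEdges
    congr 1
    ext d
    simp only [mem_filter]
    constructor
    · rintro ⟨h7, h8, h9⟩
      exact ⟨mem_filter.2 ⟨h7, Or.inl h8⟩, hSL _ h8, hSL _ h9⟩
    · rintro ⟨h7, h8, h9⟩
      obtain ⟨i1, i2⟩ := mem_filter.1 h7
      refine ⟨i1, ?_⟩
      by_contra hcon
      rw [not_and_or] at hcon
      rcases hcon with h | h
      · exact h8 (hcross d i1 h (i2.resolve_left h))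
      · exact h9 (hcross (θ d) (hKθ _ i1) h (by rw [hE.inv]; exact i2.resolve_right h))
  · rw [ringOf, List.length_map, ← List.toFinset_card_of_nodup (h1.nodup.filter _)]
    congr 1
    ext d
    simp only [List.mem_toFinset, List.mem_filter, mem_filter, ← hfil, decide_eq_true_eq]
  · intro v
    simp only [ringOf, List.mem_map, List.mem_filter, decide_eq_true_eq, hfil]
    constructor
    · rintro ⟨d, ⟨h7, h8, h9⟩, rfl⟩
      exact ⟨h9, θ d, hKθ _ h7, rfl, by rwa [hE.inv]⟩
    · rintro ⟨h7, d, h8, rfl, h9⟩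
      exact ⟨θ d, ⟨hKθ _ h8, h9, by rwa [hE.inv]⟩, by rw [hE.inv]⟩

end PeelExistence

section Linking

variable {V ι : Type} [Fintype V] [DecidableEq V] [Fintype ι]

/-- Indicator of membership as a natural number. -/
def ind (v : V) (A : Finset V) : ℕ := if v ∈ A then 1 else 0

lemma ind_inter_union (v : V) (A B : Finset V) :
    ind v (A ∩ B) + ind v (A ∪ B) = ind v A + ind v B := by
  simp only [ind, mem_inter, mem_union]
  by_cases h1 : v ∈ A <;> by_cases h2 : v ∈ B <;> simp [h1, h2]

lemma ind_le_one (v : V) (A : Finset V) : ind v A ≤ 1 := by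
  unfold ind; split_ifs <;> omega

lemma ind_mono (v : V) {A B : Finset V} (h : A ⊆ B) : ind v A ≤ ind v B := by
  unfold ind
  split_ifs with h1 h2
  · omega
  · exact absurd (h h1) h2
  · omega
  · omega

/-- Number of endpoints of the demands `I` inside `A`. -/
def load (s t : ι → V) (I : Finset ι) (A : Finset V) : ℕ := ∑ d ∈ I, (ind (s d) A + ind (t d) A)

/-- Total weight of the endpoints inside `A`. -/
noncomputable def wload (s t : ι → V) (z : ι → ℝ) (A : Finset V) : ℝ :=
  ∑ d, z d * ((ind (s d) A : ℝ) + ind (t d) A)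

lemma load_inter_union (s t : ι → V) (I : Finset ι) (A B : Finset V) :
    load s t I (A ∩ B) + load s t I (A ∪ B) = load s t I A + load s t I B := by
  simp only [load, ← sum_add_distrib]
  refine sum_congr rfl fun d _ => ?_
  have := ind_inter_union (s d) A B
  have := ind_inter_union (t d) A B
  omega

lemma load_le (s t : ι → V) (I : Finset ι) (A : Finset V) : load s t I A ≤ 2 * #I := by
  unfold load
  calc ∑ d ∈ I, (ind (s d) A + ind (t d) A) ≤ ∑ d ∈ I, 2 := sum_le_sum fun d _ => by
        have := ind_le_one (s d) A
        have := ind_le_one (t d) A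
        omega
    _ = 2 * #I := by rw [sum_const, smul_eq_mul, mul_comm]

lemma load_empty (s t : ι → V) (I : Finset ι) : load s t I ∅ = 0 := by
  simp [load, ind]

lemma load_sum_le (s t : ι → V) (I : Finset ι) (F : Finset (Finset V))
    (hF : (F : Set (Finset V)).PairwiseDisjoint id) : ∑ W ∈ F, load s t I W ≤ 2 * #I := by
  have hv : ∀ v : V, ∑ W ∈ F, ind v W ≤ 1 := by
    intro v
    simp only [ind, ← card_filter]
    rw [card_le_one]
    intro W hW W' hW'
    rw [mem_filter] at hW hW'
    by_contra hne
    exact disjoint_left.1 (hF hW.1 hW'.1 hne) hW.2 hW'.2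
  unfold load
  rw [sum_comm]
  calc ∑ d ∈ I, ∑ W ∈ F, (ind (s d) W + ind (t d) W) ≤ ∑ d ∈ I, 2 := sum_le_sum fun d _ => by
        rw [sum_add_distrib]
        have := hv (s d)
        have := hv (t d)
        omega
    _ = 2 * #I := by rw [sum_const, smul_eq_mul, mul_comm]

/-- Edges between a fixed set and disjoint sets outside it. -/
lemma cut_petals (u : Sym2 V → ℕ) (U : Finset V) (F : Finset (Finset V))
    (hF : (F : Set (Finset V)).PairwiseDisjoint id) (hU : ∀ W ∈ F, Disjoint U W) :
    ∑ W ∈ F, (cut u U + cut u W) ≤ ∑ W ∈ F, cut u (U ∪ W) + 2 * cut u U := by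
  simp only [cut, ← sum_add_distrib, ← mul_add, mul_sum]
  rw [sum_comm, sum_comm (s := F), ← sum_add_distrib]
  refine sum_le_sum fun e _ => ?_
  rw [← mul_sum, ← mul_sum, mul_left_comm, ← mul_add]
  refine Nat.mul_le_mul_left _ ?_
  induction e with | _ a b =>
  have hone : ∀ v : V, ∑ W ∈ F, ind v W ≤ 1 := by
    intro v
    simp only [ind, ← card_filter]
    rw [card_le_one]
    intro W hW W' hW'
    rw [mem_filter] at hW hW'
    by_contra hne
    exact disjoint_left.1 (hF hW.1 hW'.1 hne) hW.2 hW'.2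
  by_cases ha : a ∈ U <;> by_cases hb : b ∈ U
  · have : ∑ W ∈ F, (sep U s(a, b) + sep W s(a, b)) = ∑ W ∈ F, sep (U ∪ W) s(a, b) :=
      sum_congr rfl fun W hW => by
        have h1 := disjoint_left.1 (hU W hW) ha
        have h2 := disjoint_left.1 (hU W hW) hb
        simp [ha, hb, h1, h2]
    omega
  · have : ∑ W ∈ F, (sep U s(a, b) + sep W s(a, b)) =
        ∑ W ∈ F, sep (U ∪ W) s(a, b) + 2 * ∑ W ∈ F, ind b W := by
      rw [mul_sum, ← sum_add_distrib]
      refine sum_congr rfl fun W hW => ?_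
      have h1 := disjoint_left.1 (hU W hW) ha
      by_cases h2 : b ∈ W <;> simp [ha, hb, h1, h2, ind]
    have h3 := hone b
    have h4 : sep U s(a, b) = 1 := by simp [ha, hb]
    omega
  · have : ∑ W ∈ F, (sep U s(a, b) + sep W s(a, b)) =
        ∑ W ∈ F, sep (U ∪ W) s(a, b) + 2 * ∑ W ∈ F, ind a W := by
      rw [mul_sum, ← sum_add_distrib]
      refine sum_congr rfl fun W hW => ?_
      have h1 := disjoint_left.1 (hU W hW) hb
      by_cases h2 : a ∈ W <;> simp [ha, hb, h1, h2, ind]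
    have h3 := hone a
    have h4 : sep U s(a, b) = 1 := by simp [ha, hb]
    omega
  · have : ∑ W ∈ F, (sep U s(a, b) + sep W s(a, b)) = ∑ W ∈ F, sep (U ∪ W) s(a, b) :=
      sum_congr rfl fun W hW => by simp [ha, hb]
    omega

/-- The linking condition: every set of the family has enough boundary for its endpoints. -/
def Linkable (u : Sym2 V → ℕ) (s t : ι → V) (L : Finset V → Prop) (I : Finset ι) : Prop :=
  ∀ A, L A → load s t I A ≤ cut u A

/-- Adding `d` preserves the linking condition. -/
def Addable (u : Sym2 V → ℕ) (s t : ι → V) (L : Finset V → Prop) (I : Finset ι) (d : ι) : Prop :=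
  ∀ A, L A → load s t I A + (ind (s d) A + ind (t d) A) ≤ cut u A

set_option maxHeartbeats 800000 in
open Classical in
/-- The demands that cannot be added have small total weight, apart from disjoint petals with
boundary at most one. -/
theorem nonaddable_weight (u : Sym2 V → ℕ) (s t : ι → V) (L : Finset V → Prop)
    (hdown : ∀ A B, A ⊆ B → L B → L A) (C : ℕ)
    (hunion : ∀ A B, L A → L B → cut u A + cut u B ≤ C → L (A ∪ B)) (h0 : L ∅)
    (I : Finset ι) (hC : 4 * #I + 2 ≤ C) (hI : Linkable u s t L I)
    (z : ι → ℝ) (hz : ∀ d, 0 ≤ z d) (ε : ℝ) (hε : 0 < ε)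
    (hL : ∀ A, L A → ε * wload s t z A ≤ cut u A) :
    ∃ F : Finset (Finset V), (F : Set (Finset V)).PairwiseDisjoint id ∧
      (∀ W ∈ F, cut u W ≤ 1 ∧ ∃ d, 0 < z d ∧ s d ∈ W ∧ t d ∈ W) ∧
      ε * ∑ d with ¬ Addable u s t L I d, z d ≤ 8 * #I + #F := by
  classical
  have hsub : ∀ A B, cut u (A ∩ B) + cut u (A ∪ B) ≤ cut u A + cut u B := cut_submodular u
  have hld := load_inter_union s t I
  have hle := load_le s t I
  -- union of the tight sets
  set TT : Finset (Finset V) := univ.filter fun A => L A ∧ cut u A = load s t I A with hTT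
  have hUall : ∀ T ⊆ TT, L (T.biUnion id) ∧ cut u (T.biUnion id) = load s t I (T.biUnion id) := by
    intro T
    induction T using Finset.induction_on with
    | empty => intro _; simp [h0, cut_empty, load_empty]
    | insert A T _ ih =>
      intro hT
      obtain ⟨i1, i2⟩ := ih fun B hB => hT (mem_insert_of_mem hB)
      obtain ⟨-, j1, j2⟩ := mem_filter.1 (hT (mem_insert_self _ _))
      rw [biUnion_insert, id]
      have k1 := hle A
      have k2 := hle (T.biUnion id)
      have k3 := hunion A _ j1 i1 (by omega)
      have k4 := hsub A (T.biUnion id)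
      have k5 := hld A (T.biUnion id)
      have k6 := hI _ k3
      have k7 := hI _ (hdown _ _ inter_subset_left j1 : L (A ∩ T.biUnion id))
      exact ⟨k3, by omega⟩
  set U := TT.biUnion id with hU
  have hUL : L U := (hUall TT subset_rfl).1
  have hUt : cut u U = load s t I U := (hUall TT subset_rfl).2
  have hUcut : cut u U ≤ 2 * #I := by rw [hUt]; exact hle U
  have htight : ∀ A, L A → cut u A = load s t I A → A ⊆ U := by
    intro A h1 h2
    exact subset_biUnion_of_mem id (mem_filter.2 ⟨mem_univ _, h1, h2⟩)
  clear_value U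
  -- maximal sets of slack one
  set S1 : Finset (Finset V) :=
    univ.filter fun A => L A ∧ U ⊆ A ∧ cut u A = load s t I A + 1 with hS1
  set M1 := S1.filter fun A => ∀ B ∈ S1, A ⊆ B → B = A with hM1
  have hmax : ∀ A ∈ S1, ∃ B ∈ M1, A ⊆ B := by
    intro A hA
    obtain ⟨B, hB, hB2⟩ := (S1.filter fun B => A ⊆ B).exists_max_image card
      ⟨A, mem_filter.2 ⟨hA, subset_rfl⟩⟩
    rw [mem_filter] at hB
    refine ⟨B, mem_filter.2 ⟨hB.1, fun B' hB' hBB' => ?_⟩, hB.2⟩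
    exact (eq_of_subset_of_card_le hBB' (hB2 B' (mem_filter.2 ⟨hB', hB.2.trans hBB'⟩))).symm
  have hpet : ∀ A ∈ M1, ∀ B ∈ M1, A ≠ B → A ∩ B ⊆ U := by
    intro A hA B hB hAB
    obtain ⟨hA1, hA2⟩ := mem_filter.1 hA
    obtain ⟨hB1, hB2⟩ := mem_filter.1 hB
    obtain ⟨-, a1, a2, a3⟩ := mem_filter.1 hA1
    obtain ⟨-, b1, b2, b3⟩ := mem_filter.1 hB1
    have k1 := hle A
    have k2 := hle B
    have k3 := hunion A B a1 b1 (by omega)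
    have k4 := hsub A B
    have k5 := hld A B
    have k6 := hI _ k3
    have k8 := (hdown _ _ inter_subset_left a1 : L (A ∩ B))
    have k7 := hI _ k8
    apply htight _ k8
    have k9 : cut u (A ∪ B) ≠ load s t I (A ∪ B) := by
      intro h
      have h1 := htight _ k3 h
      have h2 : A = U := subset_antisymm (subset_union_left.trans h1) a2
      rw [h2, hUt] at a3
      omega
    have k10 : cut u (A ∪ B) ≠ load s t I (A ∪ B) + 1 := by
      intro h
      have h1 : A ∪ B ∈ S1 := mem_filter.2 ⟨mem_univ _, k3, a2.trans subset_union_left, h⟩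
      exact hAB ((hA2 _ h1 subset_union_left).symm.trans (hB2 _ h1 subset_union_right))
    omega
  -- nonaddable demands
  have hnon : ∀ d, ¬ Addable u s t L I d → (s d ∈ U ∨ t d ∈ U) ∨
      ∃ A ∈ M1, s d ∈ A \ U ∧ t d ∈ A \ U := by
    intro d hd
    unfold Addable at hd
    push Not at hd
    obtain ⟨A, hA, hlt⟩ := hd
    by_cases hU' : s d ∈ U ∨ t d ∈ U
    · exact Or.inl hU'
    right
    rw [not_or] at hU'
    have k1 := hI A hA
    have k2 := ind_le_one (s d) A
    have k3 := ind_le_one (t d) A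
    have k0 : cut u A ≠ load s t I A := by
      intro h
      have h1 := htight A hA h
      have h2 : s d ∉ A := fun h' => hU'.1 (h1 h')
      have h3 : t d ∉ A := fun h' => hU'.2 (h1 h')
      simp [ind, h2, h3] at hlt
      omega
    have hs : s d ∈ A := by
      by_contra h
      have : ind (s d) A = 0 := by simp [ind, h]
      omega
    have ht : t d ∈ A := by
      by_contra h
      have : ind (t d) A = 0 := by simp [ind, h]
      omega
    have k4 := hle A
    have k5 := hunion A U hA hUL (by omega)
    have k6 := hsub A U
    have k7 := hld A U
    have k8 := hI _ k5
    have k9 := hI _ (hdown _ _ inter_subset_left hA : L (A ∩ U))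
    have k10 : cut u (A ∪ U) ≠ load s t I (A ∪ U) := fun h =>
      hU'.1 (htight _ k5 h (mem_union_left _ hs))
    have k11 : A ∪ U ∈ S1 := mem_filter.2 ⟨mem_univ _, k5, subset_union_right, by omega⟩
    obtain ⟨B, hB, hAB⟩ := hmax _ k11
    exact ⟨B, hB, mem_sdiff.2 ⟨hAB (mem_union_left _ hs), hU'.1⟩,
      mem_sdiff.2 ⟨hAB (mem_union_left _ ht), hU'.2⟩⟩
  -- petals
  set G : Finset (Finset V) := (M1.image fun A => A \ U) with hG
  set G' := G.filter fun W => ∃ d, 0 < z d ∧ s d ∈ W ∧ t d ∈ W with hG'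
  have hGd : (G : Set (Finset V)).PairwiseDisjoint id := by
    intro W hW W' hW' hne
    obtain ⟨A, hA, rfl⟩ := mem_image.1 (mem_coe.1 hW)
    obtain ⟨B, hB, rfl⟩ := mem_image.1 (mem_coe.1 hW')
    have hAB : A ≠ B := fun h => hne (by rw [h])
    rw [Function.onFun, id, id, disjoint_left]
    intro v hv hv'
    rw [mem_sdiff] at hv hv'
    exact hv.2 (hpet A hA B hB hAB (mem_inter.2 ⟨hv.1, hv'.1⟩))
  have hG'd : (G' : Set (Finset V)).PairwiseDisjoint id := hGd.subset (filter_subset _ _)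
  have hGU : ∀ W ∈ G, Disjoint U W ∧ L W ∧ cut u (U ∪ W) + load s t I W ≤ cut u U + 2 * load s t I
      W + 1 := by
    intro W hW
    obtain ⟨A, hA, rfl⟩ := mem_image.1 hW
    obtain ⟨hA1, -⟩ := mem_filter.1 hA
    obtain ⟨-, a1, a2, a3⟩ := mem_filter.1 hA1
    refine ⟨disjoint_sdiff, hdown _ _ sdiff_subset a1, ?_⟩
    have h1 := hld U (A \ U)
    rw [inter_sdiff_self, load_empty, union_sdiff_of_subset a2] at h1
    rw [union_sdiff_of_subset a2]
    omega
  set F := G'.filter fun W => cut u W ≤ 1 with hF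
  refine ⟨F, hG'd.subset (filter_subset _ _), ?_, ?_⟩
  · intro W hW
    obtain ⟨h1, h2⟩ := mem_filter.1 hW
    exact ⟨h2, (mem_filter.1 h1).2⟩
  -- total boundary of the petals
  have hcutsum : ∑ W ∈ G', cut u W ≤ 12 * #I + #F := by
    set B := G'.filter fun W => ¬ cut u W ≤ 1 with hB
    have e1 : ∑ W ∈ F, cut u W ≤ #F := by
      calc ∑ W ∈ F, cut u W ≤ ∑ W ∈ F, 1 := sum_le_sum fun W hW => (mem_filter.1 hW).2
        _ = #F := by simp
    have hBd : (B : Set (Finset V)).PairwiseDisjoint id := hG'd.subset (filter_subset _ _)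
    have hBG : ∀ W ∈ B, W ∈ G := fun W hW => (mem_filter.1 (mem_filter.1 hW).1).1
    have e2 := cut_petals u U B hBd fun W hW => (hGU W (hBG W hW)).1
    have e3 := load_sum_le s t I B hBd
    have e4 : ∑ W ∈ B, cut u (U ∪ W) ≤ ∑ W ∈ B, (cut u U + load s t I W + 1) :=
      sum_le_sum fun W hW => by have := (hGU W (hBG W hW)).2.2; omega
    have e5 : 2 * #B ≤ ∑ W ∈ B, cut u W := by
      calc 2 * #B = ∑ W ∈ B, 2 := by rw [sum_const, smul_eq_mul, mul_comm]
        _ ≤ _ := sum_le_sum fun W hW => by have := (mem_filter.1 hW).2; omega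
    simp only [sum_add_distrib, sum_const, smul_eq_mul, mul_one] at e2 e4
    have e6 := sum_filter_add_sum_filter_not G' (fun W => cut u W ≤ 1) (fun W => cut u W)
    rw [← hF, ← hB] at e6
    omega
  have hwpos : ∀ A d, 0 ≤ z d * ((ind (s d) A : ℝ) + ind (t d) A) := fun A d =>
    mul_nonneg (hz d) (by positivity)
  have hU2 : ε * ∑ d with s d ∈ U ∨ t d ∈ U, z d ≤ 2 * #I := by
    have h1 : ∑ d with s d ∈ U ∨ t d ∈ U, z d ≤ wload s t z U := by
      rw [sum_filter]
      refine sum_le_sum fun d _ => ?_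
      split_ifs with h
      · have : (1 : ℝ) ≤ (ind (s d) U : ℝ) + ind (t d) U := by
          rcases h with h | h <;> simp [ind, h]
          all_goals positivity
        nlinarith [hz d]
      · exact hwpos U d
    have h2 := hL U hUL
    have h3 : (cut u U : ℝ) ≤ 2 * #I := by exact_mod_cast hUcut
    nlinarith
  have hW2 : ∀ W ∈ G', ε * ∑ d with s d ∈ W ∧ t d ∈ W, z d ≤ cut u W / 2 := by
    intro W hW
    have h1 : 2 * ∑ d with s d ∈ W ∧ t d ∈ W, z d ≤ wload s t z W := by
      rw [sum_filter, mul_sum]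
      refine sum_le_sum fun d _ => ?_
      split_ifs with h
      · simp [ind, h.1, h.2]; linarith
      · simpa using hwpos W d
    have h2 := hL W (hGU W (mem_filter.1 hW).1).2.1
    nlinarith
  have hcover : ∑ d with ¬ Addable u s t L I d, z d ≤ ∑ d with s d ∈ U ∨ t d ∈ U, z d +
      ∑ W ∈ G', ∑ d with s d ∈ W ∧ t d ∈ W, z d := by
    simp only [sum_filter]
    rw [sum_comm, ← sum_add_distrib]
    refine sum_le_sum fun d _ => ?_
    have hn2 : 0 ≤ ∑ W ∈ G', if s d ∈ W ∧ t d ∈ W then z d else 0 :=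
      sum_nonneg fun W _ => by split_ifs; exacts [hz d, le_rfl]
    have hn1 : 0 ≤ if s d ∈ U ∨ t d ∈ U then z d else 0 := by split_ifs; exacts [hz d, le_rfl]
    by_cases h1 : Addable u s t L I d
    · rw [if_neg (not_not.2 h1)]; linarith
    rw [if_pos h1]
    by_cases h3 : s d ∈ U ∨ t d ∈ U
    · rw [if_pos h3]; linarith
    rw [if_neg h3]
    rcases hnon d h1 with h4 | ⟨A, hA, h4, h5⟩
    · exact absurd h4 h3
    rcases (hz d).eq_or_lt with h6 | h6
    · rw [← h6] at hn2 ⊢; linarith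
    have hmem : A \ U ∈ G' := mem_filter.2 ⟨mem_image_of_mem _ hA, d, h6, h4, h5⟩
    have := single_le_sum (f := fun W => if s d ∈ W ∧ t d ∈ W then z d else 0)
      (fun W _ => by split_ifs; exacts [hz d, le_rfl]) hmem
    simp only [h4, h5, and_self, if_true] at this
    linarith
  have hfin : ε * ∑ W ∈ G', ∑ d with s d ∈ W ∧ t d ∈ W, z d ≤ (12 * #I + #F) / 2 := by
    rw [mul_sum]
    calc _ ≤ ∑ W ∈ G', (cut u W : ℝ) / 2 := sum_le_sum hW2
      _ = ((∑ W ∈ G', cut u W : ℕ) : ℝ) / 2 := by push_cast; rw [sum_div]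
      _ ≤ _ := by
        have : ((∑ W ∈ G', cut u W : ℕ) : ℝ) ≤ ((12 * #I + #F : ℕ) : ℝ) := by exact_mod_cast hcutsum
        push_cast at this ⊢
        linarith
  have hp : (0 : ℝ) ≤ #F := by positivity
  nlinarith [mul_le_mul_of_nonneg_left hcover hε.le]

end Linking

section Tools

variable {V ι : Type} [Fintype V] [DecidableEq V]

lemma IsRoute.min_one {a b : V} {f : Sym2 V → ℕ} (h : IsRoute a b f) :
    IsRoute a b (fun e => min (f e) 1) := by
  obtain ⟨w, hw⟩ := h
  refine ⟨w.bypass, fun e => ?_⟩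
  have h1 : w.bypass.edges.count e ≤ 1 := List.nodup_iff_count_le_one.1
    w.bypass_isPath.isTrail.edges_nodup e
  by_cases he : e ∈ w.bypass.edges
  · have h2 := w.edges_bypass_subset_edges he
    have h3 := List.count_pos_iff.2 h2
    have := hw e
    exact le_min (by omega) h1
  · rw [List.count_eq_zero_of_not_mem he]; exact Nat.zero_le _

lemma IsRoute.inside {a b : V} {f : Sym2 V → ℕ} (h : IsRoute a b f) {W : Finset V} (ha : a ∈ W)
    (hf : ∀ e, 0 < f e → sep W e = 0) :
    IsRoute a b (fun e => if ∀ v ∈ e, v ∈ W then f e else 0) := by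
  obtain ⟨w, hw⟩ := h
  refine ⟨w, fun e => ?_⟩
  have key : ∀ (a b : V) (w : (⊤ : SimpleGraph V).Walk a b), a ∈ W →
      (∀ e ∈ w.edges, sep W e = 0) → ∀ e ∈ w.edges, ∀ v ∈ e, v ∈ W := by
    intro a b w
    induction w with
    | nil => intro _ _ e he; simp at he
    | @cons a c b hac p ih =>
      intro ha hs e he
      have hc : c ∈ W := by
        have := hs s(a, c) (by simp)
        by_contra hc
        simp [ha, hc] at this
      rw [SimpleGraph.Walk.edges_cons, List.mem_cons] at he
      rcases he with rfl | he
      · intro v hv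
        rcases Sym2.mem_iff.1 hv with rfl | rfl
        exacts [ha, hc]
      · exact ih hc (fun e he => hs e (by simp [he])) e he
  by_cases he : e ∈ w.edges
  · have := key a b w ha (fun e he => hf e ((List.count_pos_iff.2 he).trans_le (hw e))) e he
    dsimp only; rw [if_pos this]; exact hw e
  · rw [List.count_eq_zero_of_not_mem he]; exact Nat.zero_le _

/-- Demands living in disjoint sets with boundary at most one are routed inside these sets. -/
lemma route_petals [Fintype ι] [DecidableEq ι] (u : Sym2 V → ℕ) (s t : ι → V) (z : ι → ℝ)
    (hw : ∀ d, 0 < z d → ∃ w, IsRoute (s d) (t d) w ∧ ∀ e, w e ≤ u e)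
    (F : Finset (Finset V)) (hF : (F : Set (Finset V)).PairwiseDisjoint id)
    (hc : ∀ W ∈ F, cut u W ≤ 1 ∧ ∃ d, 0 < z d ∧ s d ∈ W ∧ t d ∈ W) :
    ∃ (I : Finset ι) (f : ι → Sym2 V → ℕ), #I = #F ∧
      (∀ d ∈ I, 0 < z d ∧ IsRoute (s d) (t d) (f d)) ∧ ∀ e, ∑ d ∈ I, f d e ≤ u e := by
  classical
  rcases F.eq_empty_or_nonempty with rfl | ⟨W0, hW0⟩
  · exact ⟨∅, fun _ _ => 0, by simp, by simp, by simp⟩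
  have : Nonempty ι := ⟨(hc W0 hW0).2.choose⟩
  have hc' : ∀ W, ∃ d, W ∈ F → 0 < z d ∧ s d ∈ W ∧ t d ∈ W := fun W => by
    by_cases h : W ∈ F
    · obtain ⟨d, hd⟩ := (hc W h).2
      exact ⟨d, fun _ => hd⟩
    · exact ⟨Classical.arbitrary ι, fun h' => absurd h' h⟩
  choose D hD using hc'
  have hinj : ∀ W ∈ F, ∀ W' ∈ F, D W = D W' → W = W' := by
    intro W hW W' hW' he
    by_contra hne
    exact disjoint_left.1 (hF hW hW' hne) (hD W hW).2.1 (he ▸ (hD W' hW').2.1)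
  have hr : ∀ d, ∃ f : Sym2 V → ℕ, ∀ W ∈ F, D W = d → IsRoute (s d) (t d) f ∧
      ∀ e, f e ≤ if ∀ v ∈ e, v ∈ W then u e else 0 := by
    intro d
    by_cases h : ∃ W ∈ F, D W = d
    · obtain ⟨W, hW, rfl⟩ := h
      obtain ⟨h1, h2, h3⟩ := hD W hW
      obtain ⟨w, hw1, hw2⟩ := hw _ h1
      obtain ⟨w', hw3, hw4, hw5⟩ := hw1.exists_exact
      have h4 : cut w' W = 0 := by
        have h5 : cut w' W ≤ cut u W := cut_mono (fun e => (hw3 e).trans (hw2 e)) W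
        have h6 := hw5 W
        have h7 := (hc W hW).1
        simp only [sep_mk, h2, h3] at h6
        simp at h6
        omega
      have h8 := hw4.inside h2 (fun e he => by
        unfold cut at h4
        have := (sum_eq_zero_iff.1 h4) e (mem_univ e)
        rcases Nat.mul_eq_zero.1 this with h | h <;> omega)
      refine ⟨fun e => if ∀ v ∈ e, v ∈ W then w' e else 0, fun W' hW' he => ?_⟩
      obtain rfl := hinj _ hW' _ hW he
      refine ⟨h8, fun e => ?_⟩
      dsimp only
      split_ifs
      · exact (hw3 e).trans (hw2 e)
      · exact le_rfl
    · push Not at h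
      exact ⟨fun _ => 0, fun W hW he => absurd he (h W hW)⟩
  choose f hf using hr
  have hDi : Set.InjOn D F := fun W hW W' hW' he => hinj W hW W' hW' he
  refine ⟨F.image D, f, card_image_of_injOn hDi, ?_, ?_⟩
  · intro d hd
    obtain ⟨W, hW, rfl⟩ := mem_image.1 hd
    exact ⟨(hD W hW).1, (hf _ W hW rfl).1⟩
  · intro e
    rw [sum_image hDi]
    calc ∑ W ∈ F, f (D W) e ≤ ∑ W ∈ F, if ∀ v ∈ e, v ∈ W then u e else 0 :=
          sum_le_sum fun W hW => (hf _ W hW rfl).2 e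
      _ = #{W ∈ F | ∀ v ∈ e, v ∈ W} * u e := by rw [← sum_filter, sum_const, smul_eq_mul]
      _ ≤ 1 * u e := by
        refine Nat.mul_le_mul_right _ ?_
        rw [card_le_one]
        intro W hW W' hW'
        rw [mem_filter] at hW hW'
        by_contra hne
        induction e with | _ a b =>
        exact disjoint_left.1 (hF hW.1 hW'.1 hne) (hW.2 a (by simp)) (hW'.2 a (by simp))
      _ = u e := one_mul _

lemma sum_powerset_superset [DecidableEq ι] (U e : Finset ι) (he : e ⊆ U) (p : ℝ) :
    ∑ S ∈ U.powerset with e ⊆ S, p ^ #S * (1 - p) ^ (#U - #S) = p ^ #e := by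
  have h1 : ∑ S ∈ (U \ e).powerset, p ^ #S * (1 - p) ^ (#(U \ e) - #S) = 1 := by
    rw [sum_pow_mul_eq_add_pow]; simp
  have h2 : p ^ #e = p ^ #e * ∑ S ∈ (U \ e).powerset, p ^ #S * (1 - p) ^ (#(U \ e) - #S) := by
    rw [h1, mul_one]
  rw [h2, mul_sum]
  symm
  refine sum_nbij' (fun S => S ∪ e) (fun S => S \ e) ?_ ?_ ?_ ?_ ?_
  · intro S hS
    rw [mem_powerset] at hS
    rw [mem_filter, mem_powerset]
    exact ⟨union_subset (hS.trans sdiff_subset) he, subset_union_right⟩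
  · intro S hS
    rw [mem_filter, mem_powerset] at hS
    rw [mem_powerset]
    exact sdiff_subset_sdiff hS.1 subset_rfl
  · intro S hS
    rw [mem_powerset] at hS
    have : Disjoint S e := disjoint_left.2 fun x hx hxe => (mem_sdiff.1 (hS hx)).2 hxe
    rw [union_sdiff_right, sdiff_eq_self_of_disjoint this]
  · intro S hS
    rw [mem_filter] at hS
    exact sdiff_union_of_subset hS.2
  · intro S hS
    rw [mem_powerset] at hS
    have hd : Disjoint S e := disjoint_left.2 fun x hx hxe => (mem_sdiff.1 (hS hx)).2 hxe
    rw [card_union_of_disjoint hd, card_sdiff_of_subset he, pow_add]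
    have : #U - (#S + #e) = #U - #e - #S := by omega
    rw [this]; ring

/-- Sparse hypergraphs have large independent sets. -/
theorem exists_independent [DecidableEq ι] {κ : Type} (U : Finset ι) (Q : Finset κ)
    (E : κ → Finset ι) (hE : ∀ x ∈ Q, E x ⊆ U) (hne : ∀ x ∈ Q, (E x).Nonempty) (p : ℝ)
    (hp0 : 0 ≤ p) (hp1 : p ≤ 1) :
    ∃ M ⊆ U, (∀ x ∈ Q, ¬ E x ⊆ M) ∧ p * #U - ∑ x ∈ Q, p ^ #(E x) ≤ #M := by
  classical
  set μ : Finset ι → ℝ := fun S => p ^ #S * (1 - p) ^ (#U - #S) with hμ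
  have hμ0 : ∀ S, 0 ≤ μ S := fun S => by
    have : 0 ≤ 1 - p := by linarith
    positivity
  have htot : ∑ S ∈ U.powerset, μ S = 1 := by
    rw [hμ, sum_pow_mul_eq_add_pow]; simp
  have hcard : ∑ S ∈ U.powerset, μ S * #S = p * #U := by
    have : ∀ S ∈ U.powerset, μ S * #S = ∑ i ∈ U, if {i} ⊆ S then μ S else 0 := by
      intro S hS
      rw [← sum_filter, sum_const, nsmul_eq_mul, mul_comm]
      congr 3
      ext i
      simp only [mem_filter, singleton_subset_iff]
      exact ⟨fun h => ⟨mem_powerset.1 hS h, h⟩, fun h => h.2⟩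
    rw [sum_congr rfl this, sum_comm]
    have : ∀ i ∈ U, (∑ S ∈ U.powerset, if {i} ⊆ S then μ S else 0) = p := by
      intro i hi
      rw [← sum_filter, sum_powerset_superset U {i} (singleton_subset_iff.2 hi)]
      simp
    rw [sum_congr rfl this, sum_const, nsmul_eq_mul, mul_comm]
  have hedge : ∑ S ∈ U.powerset, μ S * #{x ∈ Q | E x ⊆ S} = ∑ x ∈ Q, p ^ #(E x) := by
    have : ∀ S ∈ U.powerset, μ S * #{x ∈ Q | E x ⊆ S} = ∑ x ∈ Q, if E x ⊆ S then μ S else 0 := by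
      intro S _
      rw [← sum_filter, sum_const, nsmul_eq_mul, mul_comm]
    rw [sum_congr rfl this, sum_comm]
    refine sum_congr rfl fun x hx => ?_
    rw [← sum_filter, sum_powerset_superset U _ (hE x hx)]
  obtain ⟨S, hS, hle⟩ : ∃ S ∈ U.powerset,
      p * #U - ∑ x ∈ Q, p ^ #(E x) ≤ (#S : ℝ) - #{x ∈ Q | E x ⊆ S} := by
    by_contra hcon
    push Not at hcon
    have h1 : ∑ S ∈ U.powerset, μ S * ((#S : ℝ) - #{x ∈ Q | E x ⊆ S}) =
        ∑ S ∈ U.powerset, μ S * (p * #U - ∑ x ∈ Q, p ^ #(E x)) := by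
      rw [← sum_mul, htot, one_mul]
      simp only [mul_sub, sum_sub_distrib]
      rw [hcard, hedge]
    have hpos : ∃ S ∈ U.powerset, 0 < μ S := by
      by_contra h
      push Not at h
      have := sum_nonpos h
      linarith
    obtain ⟨S0, hS0, hS0p⟩ := hpos
    have h2 : ∑ S ∈ U.powerset, μ S * ((#S : ℝ) - #{x ∈ Q | E x ⊆ S}) <
        ∑ S ∈ U.powerset, μ S * (p * #U - ∑ x ∈ Q, p ^ #(E x)) :=
      sum_lt_sum (fun S hS => mul_le_mul_of_nonneg_left (hcon S hS).le (hμ0 S))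
        ⟨S0, hS0, mul_lt_mul_of_pos_left (hcon S0 hS0) hS0p⟩
    linarith
  rw [mem_powerset] at hS
  rcases Q.eq_empty_or_nonempty with rfl | ⟨x0, hx0⟩
  · exact ⟨S, hS, by simp, by simpa using hle⟩
  have hpick : ∀ x, ∃ i, x ∈ Q → i ∈ E x := by
    intro x
    by_cases hx : x ∈ Q
    · obtain ⟨i, hi⟩ := hne x hx
      exact ⟨i, fun _ => hi⟩
    · exact ⟨(hne x0 hx0).choose, fun h => absurd h hx⟩
  choose r hr using hpick
  refine ⟨S \ ({x ∈ Q | E x ⊆ S}.image r), sdiff_subset.trans hS, ?_, ?_⟩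
  · intro x hx hsub
    have h2 := mem_sdiff.1 (hsub (hr x hx))
    exact h2.2 (mem_image_of_mem _ (mem_filter.2 ⟨hx, hsub.trans sdiff_subset⟩))
  · have h1 := le_card_sdiff ({x ∈ Q | E x ⊆ S}.image r) S
    have h2 : #({x ∈ Q | E x ⊆ S}.image r) ≤ #{x ∈ Q | E x ⊆ S} := card_image_le
    have h3 : (#S : ℝ) ≤ #(S \ ({x ∈ Q | E x ⊆ S}.image r)) + #{x ∈ Q | E x ⊆ S} := by
      exact_mod_cast (by omega : #S ≤ #(S \ ({x ∈ Q | E x ⊆ S}.image r)) + #{x ∈ Q | E x ⊆ S})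
    linarith

open Classical in
/-- Greedy choice keeping exponential potentials small. -/
theorem greedy_balanced [Fintype ι] {κ : Type} (Q : Finset κ) (sd : ι → κ → Prop) (z : ι → ℝ)
    (hz : ∀ d, 0 ≤ z d) (cap : κ → ℝ) (hcap : ∀ q ∈ Q, ∑ d with sd d q, z d ≤ cap q)
    (P : Finset ι → Prop) (h0 : P ∅) (Y : ℝ) (hY : 0 < Y) (M0 : ℕ)
    (hav : ∀ I, P I → #I < M0 → Y ≤ ∑ d with d ∉ I ∧ P (insert d I), z d) :
    ∀ t ≤ M0, ∀ w : κ → ℝ, (∀ q, 0 ≤ w q) → ∃ I, P I ∧ #I = t ∧ (∀ d ∈ I, 0 < z d) ∧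
      ∑ q ∈ Q, w q * 4 ^ #{d ∈ I | sd d q} ≤ ∑ q ∈ Q, w q * (1 + 3 * cap q / Y) ^ t := by
  intro t
  induction t with
  | zero => intro _ w _; exact ⟨∅, h0, by simp, by simp, by simp⟩
  | succ t ih =>
    intro ht w hw
    have hcap0 : ∀ q ∈ Q, 0 ≤ cap q := fun q hq =>
      (sum_nonneg fun d _ => hz d).trans (hcap q hq)
    set β : κ → ℝ := fun q => if q ∈ Q then 1 + 3 * cap q / Y else 1 with hβ
    have hβ0 : ∀ q, 0 ≤ β q := by
      intro q
      simp only [hβ]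
      split_ifs with h
      · have := hcap0 q h; positivity
      · norm_num
    obtain ⟨I, hI, hIc, hIz, hIw⟩ := ih (by omega) (fun q => w q * β q)
      (fun q => mul_nonneg (hw q) (hβ0 q))
    set Av : Finset ι := univ.filter fun d => d ∉ I ∧ P (insert d I) with hAv
    have hmass := hav I hI (by omega)
    rw [← hAv] at hmass
    have hZ : 0 < ∑ d ∈ Av, z d := by linarith
    have hcount : ∀ d ∈ Av, ∀ q, (4 : ℝ) ^ #{x ∈ insert d I | sd x q} =
        4 ^ #{x ∈ I | sd x q} * (1 + 3 * if sd d q then 1 else 0) := by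
      intro d hd q
      have hdI := (mem_filter.1 hd).2.1
      rw [filter_insert]
      split_ifs with h
      · rw [card_insert_of_notMem (fun h' => hdI (mem_filter.1 h').1), pow_succ]; ring
      · ring
    have hex : ∃ d ∈ Av, 0 < z d ∧ ∑ q ∈ Q, w q * 4 ^ #{x ∈ insert d I | sd x q} ≤
        ∑ q ∈ Q, w q * β q * 4 ^ #{x ∈ I | sd x q} := by
      by_contra hcon
      push Not at hcon
      have h1 : ∑ d ∈ Av, z d * (∑ q ∈ Q, w q * β q * 4 ^ #{x ∈ I | sd x q}) <
          ∑ d ∈ Av, z d * ∑ q ∈ Q, w q * 4 ^ #{x ∈ insert d I | sd x q} := by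
        obtain ⟨d0, hd0, hd0z⟩ := exists_lt_of_sum_lt (s := Av) (f := fun _ => (0 : ℝ)) (g := z)
          (by simpa using hZ)
        refine sum_lt_sum (fun d hd => ?_) ⟨d0, hd0, mul_lt_mul_of_pos_left (hcon d0 hd0 hd0z) hd0z⟩
        rcases (hz d).eq_or_lt with h | h
        · rw [← h]; simp
        · exact mul_le_mul_of_nonneg_left (hcon d hd h).le h.le
      have h2 : ∑ d ∈ Av, z d * ∑ q ∈ Q, w q * 4 ^ #{x ∈ insert d I | sd x q} =
          ∑ q ∈ Q, w q * 4 ^ #{x ∈ I | sd x q} *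
            (∑ d ∈ Av, z d + 3 * ∑ d ∈ Av, if sd d q then z d else 0) := by
        simp only [mul_sum]
        rw [sum_comm]
        refine sum_congr rfl fun q _ => ?_
        rw [← sum_add_distrib, mul_sum]
        refine sum_congr rfl fun d hd => ?_
        rw [hcount d hd q]
        split_ifs <;> ring
      have h3 : ∑ q ∈ Q, w q * 4 ^ #{x ∈ I | sd x q} *
            (∑ d ∈ Av, z d + 3 * ∑ d ∈ Av, if sd d q then z d else 0) ≤
          ∑ q ∈ Q, (∑ d ∈ Av, z d) * (w q * β q * 4 ^ #{x ∈ I | sd x q}) := by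
        refine sum_le_sum fun q hq => ?_
        have h4 : ∑ d ∈ Av, (if sd d q then z d else 0) ≤ cap q := by
          refine le_trans ?_ (hcap q hq)
          calc ∑ d ∈ Av, (if sd d q then z d else 0) ≤ ∑ d, if sd d q then z d else 0 :=
                sum_le_sum_of_subset_of_nonneg (subset_univ _) fun d _ _ => by
                  by_cases h : sd d q
                  · rw [if_pos h]; exact hz d
                  · rw [if_neg h]
            _ = _ := (sum_filter _ _).symm
        have h5 : ∑ d ∈ Av, z d + 3 * ∑ d ∈ Av, (if sd d q then z d else 0) ≤
            (∑ d ∈ Av, z d) * β q := by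
          simp only [hβ, hq, if_true]
          have h6 : 3 * cap q ≤ (∑ d ∈ Av, z d) * (3 * cap q / Y) := by
            rw [mul_div_assoc', le_div_iff₀ hY]
            have := hcap0 q hq
            nlinarith
          linarith
        have h7 : 0 ≤ w q * 4 ^ #{x ∈ I | sd x q} := mul_nonneg (hw q) (by positivity)
        calc _ ≤ w q * 4 ^ #{x ∈ I | sd x q} * ((∑ d ∈ Av, z d) * β q) :=
              mul_le_mul_of_nonneg_left h5 h7
          _ = _ := by ring
      rw [← sum_mul, ] at h1
      rw [← mul_sum] at h3
      linarith
    obtain ⟨d, hd, hdz, hdle⟩ := hex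
    obtain ⟨-, hdI, hdP⟩ := mem_filter.1 hd
    refine ⟨insert d I, hdP, by rw [card_insert_of_notMem hdI, hIc], ?_, ?_⟩
    · intro x hx
      rcases mem_insert.1 hx with rfl | hx
      exacts [hdz, hIz x hx]
    · refine hdle.trans (hIw.trans (le_of_eq ?_))
      refine sum_congr rfl fun q hq => ?_
      simp only [hβ, hq, if_true]
      rw [pow_succ]; ring

end Tools

section Canon

variable {V ι : Type} [Fintype V] [DecidableEq V]

/-- `Cn` is a family of sets of small boundary dominating all arcs of boundary `k` which contain
a given position and end before another one. -/
def IsCanon (r : ℕ → V) (N : ℕ) (u : Sym2 V → ℕ) (Cn : ℕ → ℕ → Finset V) : Prop :=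
  (∀ B k, cut u (Cn B k) ≤ 2 * k) ∧ ∀ k l e, e < N →
    (∃ A i j, TraceEq r N A i j ∧ i ≤ l ∧ l < j ∧ j ≤ e ∧ cut u A ≤ k) →
    ∃ B ≤ N, (∀ x, e ≤ x → x < N → r x ∉ Cn B k) ∧
      ∀ A i j, TraceEq r N A i j → i ≤ l → l < j → j ≤ e → cut u A ≤ k →
        ∀ x < N, r x ∈ A → r x ∈ Cn B k

lemma exists_canon (r : ℕ → V) (N : ℕ) (u : Sym2 V → ℕ) : ∃ Cn, IsCanon r N u Cn := by
  classical
  have hex : ∀ B k, ∃ D : Finset V, cut u D ≤ 2 * k ∧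
      ∀ A i, TraceEq r N A i B → i < B → cut u A ≤ 2 * k → 
        ∃ a ≤ i, TraceEq r N D a B := by
    intro B k
    by_cases h : ∃ i, ∃ A, TraceEq r N A i B ∧ i < B ∧ cut u A ≤ 2 * k
    · obtain ⟨D, h1, h2, h3⟩ := Nat.find_spec h
      exact ⟨D, h3, fun A i hA hi hc => ⟨_, Nat.find_min' h ⟨A, hA, hi, hc⟩, h1⟩⟩
    · push Not at h
      refine ⟨∅, by rw [cut_empty]; omega, fun A i hA hi hc => ?_⟩
      have := h i A hA hi
      omega
  choose Cn h1 h2 using hex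
  refine ⟨Cn, h1, fun k l e he hA => ?_⟩
  have hb : ∃ B, (∃ A i, TraceEq r N A i B ∧ i ≤ l ∧ l < B ∧ B ≤ e ∧ cut u A ≤ k) ∧
      ∀ B', (∃ A i, TraceEq r N A i B' ∧ i ≤ l ∧ l < B' ∧ B' ≤ e ∧ cut u A ≤ k) → B' ≤ B := by
    obtain ⟨A, i, j, h⟩ := hA
    set Fs := (range (e + 1)).filter fun B => ∃ A i, TraceEq r N A i B ∧ i ≤ l ∧ l < B ∧ B ≤ e ∧
        cut u A ≤ k with hFs
    have hne : Fs.Nonempty := ⟨j, mem_filter.2 ⟨by rw [mem_range]; omega, A, i, h⟩⟩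
    refine ⟨Fs.max' hne, ?_, ?_⟩
    · exact (mem_filter.1 (Fs.max'_mem hne)).2
    · intro B' hB'
      refine Fs.le_max' _ (mem_filter.2 ⟨?_, hB'⟩)
      obtain ⟨_, _, _, _, _, _, _⟩ := hB'
      rw [mem_range]; omega
  obtain ⟨B, ⟨A1, i1, g1, g2, g3, g4, g5⟩, hmax⟩ := hb
  refine ⟨B, by omega, ?_, ?_⟩
  · intro x hx hxN hmem
    obtain ⟨a, _, ha⟩ := h2 B k A1 i1 g1 (by omega) (by omega)
    have := (ha x hxN).1 hmem
    omega
  · intro A i j hA hi hj hje hk x hx hxA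
    have hjB := hmax j ⟨A, i, hA, hi, hj, hje, hk⟩
    have htr : TraceEq r N (A ∪ A1) (min i i1) B := by
      intro y hy
      rw [mem_union, hA y hy, g1 y hy]
      omega
    have hc := cut_union_le u A A1
    obtain ⟨a, ha, hD⟩ := h2 B k _ _ htr (by omega) (by omega)
    rw [hD x hx]
    have := (hA x hx).1 hxA
    omega

lemma TraceEq.mirror {r : ℕ → V} {N : ℕ} {A : Finset V} {i j : ℕ} (h : TraceEq r N A i j) :
    TraceEq (fun x => r (N - 1 - x)) N A (N - j) (N - i) := by
  intro x hx
  have := h (N - 1 - x) (by omega)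
  simp only [this]
  omega

/-- Few others: a sparse subfamily. -/
lemma exists_thin [DecidableEq ι] (I : Finset ι) (K : ℕ) (S : Bool → ι → ℕ → Finset ι)
    (hS : ∀ b, ∀ d ∈ I, ∀ k, S b d k ⊆ I ∧ d ∉ S b d k ∧ #(S b d k) ≤ 18 * k) :
    ∃ M ⊆ I, (#I : ℝ) ≤ 2 ^ 62 * #M ∧
      ∀ b, ∀ d ∈ M, ∀ k, 1 ≤ k → k ≤ K → #(S b d k ∩ M) < max 1 (k / 2) := by
  classical
  set X : Finset (Bool × ι × ℕ) := (univ : Finset Bool) ×ˢ (I ×ˢ Icc 1 K) with hX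
  set Q : Finset (Σ _ : Bool × ι × ℕ, Finset ι) :=
    X.sigma fun x => powersetCard (max 1 (x.2.2 / 2)) (S x.1 x.2.1 x.2.2) with hQ
  have hQm : ∀ x ∈ Q, x.1.2.1 ∈ I ∧ x.2 ⊆ S x.1.1 x.1.2.1 x.1.2.2 ∧
      #x.2 = max 1 (x.1.2.2 / 2) := by
    intro x hx
    rw [hQ, mem_sigma, hX, mem_product, mem_product, mem_powersetCard] at hx
    exact ⟨hx.1.2.1, hx.2⟩
  obtain ⟨M, hMI, hM1, hM2⟩ := exists_independent I Q (fun x => insert x.1.2.1 x.2)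
    (fun x hx => by
      obtain ⟨h1, h2, h3⟩ := hQm x hx
      exact insert_subset h1 (h2.trans (hS _ _ h1 _).1))
    (fun x _ => insert_nonempty _ _) ((1 / 2) ^ 61) (by positivity) (by norm_num)
  refine ⟨M, hMI, ?_, ?_⟩
  · have hsum : ∑ x ∈ Q, ((1 / 2 : ℝ) ^ 61) ^ #(insert x.1.2.1 x.2) ≤ (1 / 2) ^ 62 * #I := by
      rw [hQ, sum_sigma]
      have hterm : ∀ x ∈ X, ∑ J ∈ powersetCard (max 1 (x.2.2 / 2)) (S x.1 x.2.1 x.2.2),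
          ((1 / 2 : ℝ) ^ 61) ^ #(insert x.2.1 J) ≤ (1 / 2) ^ 61 * (1 / 2) ^ (x.2.2 + 2) := by
        rintro ⟨b, d, k⟩ hx
        rw [hX, mem_product, mem_product, mem_Icc] at hx
        obtain ⟨-, hd, hk1, hkK⟩ := hx
        dsimp only at hd hk1 hkK ⊢
        obtain ⟨h1, h2, h3⟩ := hS b d hd k
        have hc : ∀ J ∈ powersetCard (max 1 (k / 2)) (S b d k),
            ((1 / 2 : ℝ) ^ 61) ^ #(insert d J) =
              (1 / 2) ^ 61 * (1 / 2) ^ (61 * max 1 (k / 2)) := by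
          intro J hJ
          rw [mem_powersetCard] at hJ
          rw [card_insert_of_notMem (fun h => h2 (hJ.1 h)), hJ.2, pow_succ, ← pow_mul, mul_comm]
        rw [sum_congr rfl hc, sum_const, nsmul_eq_mul, card_powersetCard]
        have h4 : ((#(S b d k)).choose (max 1 (k / 2)) : ℝ) ≤ 2 ^ (18 * k) := by
          have h5 := Nat.choose_le_two_pow (#(S b d k)) (max 1 (k / 2))
          have h6 : 2 ^ #(S b d k) ≤ 2 ^ (18 * k) := Nat.pow_le_pow_right (by norm_num) h3
          exact_mod_cast h5.trans h6
        have h7 : (1 / 2 : ℝ) ^ (61 * max 1 (k / 2)) ≤ (1 / 2) ^ (18 * k + (k + 2)) :=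
          pow_le_pow_of_le_one (by norm_num) (by norm_num) (by omega)
        calc _ ≤ (2 : ℝ) ^ (18 * k) * ((1 / 2) ^ 61 * (1 / 2) ^ (18 * k + (k + 2))) := by gcongr
          _ = (2 * (1 / 2)) ^ (18 * k) * ((1 / 2) ^ 61 * (1 / 2) ^ (k + 2)) := by
            rw [mul_pow, pow_add]; ring
          _ = _ := by norm_num
      refine (sum_le_sum hterm).trans ?_
      rw [hX, sum_product, Fintype.sum_bool, sum_product]
      dsimp only
      rw [sum_const, nsmul_eq_mul, ← mul_sum]
      have hgeo : ∀ K : ℕ, ∑ k ∈ Icc 1 K, (1 / 2 : ℝ) ^ (k + 2) ≤ 1 / 4 - (1 / 2) ^ (K + 2) := by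
        intro K
        induction K with
        | zero => norm_num
        | succ K ih =>
          rw [sum_Icc_succ_top (by omega)]
          have : (1 / 2 : ℝ) ^ (K + 2) = 2 * (1 / 2) ^ (K + 1 + 2) := by
            rw [pow_succ _ (K + 2)]; ring
          linarith
      have h8 := hgeo K
      have h9 : (0 : ℝ) ≤ (1 / 2) ^ (K + 2) := by positivity
      have h10 : (1 / 2 : ℝ) ^ 61 * ∑ k ∈ Icc 1 K, (1 / 2 : ℝ) ^ (k + 2) ≤
          (1 / 2) ^ 61 * (1 / 4) := by
        gcongr; linarith
      have h11 : (0 : ℝ) ≤ #I := by positivity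
      calc _ ≤ (#I : ℝ) * ((1 / 2) ^ 61 * (1 / 4)) + #I * ((1 / 2) ^ 61 * (1 / 4)) := by gcongr
        _ = (1 / 2) ^ 62 * #I := by rw [show (62 : ℕ) = 61 + 1 from rfl, pow_succ]; ring
    have h12 : (1 / 2 : ℝ) ^ 62 * #I ≤ #M := by
      have : (1 / 2 : ℝ) ^ 61 = 2 * (1 / 2) ^ 62 := by norm_num
      rw [this] at hM2
      rw [this] at hsum
      linarith
    calc (#I : ℝ) = 2 ^ 62 * ((1 / 2) ^ 62 * #I) := by rw [← mul_assoc, ← mul_pow]; norm_num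
      _ ≤ _ := by gcongr
  · intro b d hd k hk1 hkK
    by_contra hcon
    push Not at hcon
    obtain ⟨J, hJ, hJc⟩ := exists_subset_card_eq hcon
    refine hM1 ⟨(b, d, k), J⟩ ?_ ?_
    · rw [hQ, mem_sigma, hX, mem_product, mem_product, mem_powersetCard, mem_Icc]
      exact ⟨⟨mem_univ _, hMI hd, hk1, hkK⟩, hJ.trans inter_subset_left, hJc⟩
    · exact insert_subset hd (hJ.trans inter_subset_right)

open Classical in
/-- Nets crossing canonical sets only a few times contain a large subfamily obeying the cut
condition on all arcs. -/
theorem exists_thin_nets (r : ℕ → V) (N : ℕ) (u : Sym2 V → ℕ) (Cn Cn' : ℕ → ℕ → Finset V)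
    (hC : IsCanon r N u Cn) (hC' : IsCanon (fun x => r (N - 1 - x)) N u Cn') (I : Finset ι)
    (lo hi : ι → ℕ) (hlo : ∀ d ∈ I, lo d ≤ hi d) (hhi : ∀ d ∈ I, hi d < N) (K : ℕ)
    (hfew : ∀ B ≤ N, ∀ k, 1 ≤ k → k ≤ K →
      (∃ d ∈ I, sep (Cn B k) s(r (lo d), r (hi d)) = 1) →
        #{d ∈ I | sep (Cn B k) s(r (lo d), r (hi d)) = 1} ≤ 18 * k)
    (hfew' : ∀ B ≤ N, ∀ k, 1 ≤ k → k ≤ K →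
      (∃ d ∈ I, sep (Cn' B k) s(r (lo d), r (hi d)) = 1) →
        #{d ∈ I | sep (Cn' B k) s(r (lo d), r (hi d)) = 1} ≤ 18 * k) :
    ∃ M ⊆ I, (#I : ℝ) ≤ 2 ^ 62 * #M ∧ ∀ A i j, TraceEq r N A i j → 1 ≤ cut u A → cut u A ≤ K →
      #{d ∈ M | sep A s(r (lo d), r (hi d)) = 1} ≤ 2 * max 1 (cut u A / 2) := by
  -- one direction
  have hdir : ∀ (r : ℕ → V) (Cn : ℕ → ℕ → Finset V), IsCanon r N u Cn → ∀ lo hi : ι → ℕ,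
      (∀ d ∈ I, hi d < N) →
      (∀ B ≤ N, ∀ k, 1 ≤ k → k ≤ K →
        (∃ d ∈ I, sep (Cn B k) s(r (lo d), r (hi d)) = 1) →
        #{d ∈ I | sep (Cn B k) s(r (lo d), r (hi d)) = 1} ≤ 18 * k) →
      ∃ S : ι → ℕ → Finset ι,
        (∀ d ∈ I, ∀ k, S d k ⊆ I ∧ d ∉ S d k ∧ #(S d k) ≤ 18 * k) ∧
        ∀ M ⊆ I, (∀ d ∈ M, ∀ k, 1 ≤ k → k ≤ K → #(S d k ∩ M) < max 1 (k / 2)) →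
          ∀ A i j, TraceEq r N A i j → 1 ≤ cut u A → cut u A ≤ K →
            #{d ∈ M | i ≤ lo d ∧ lo d < j ∧ j ≤ hi d} ≤ max 1 (cut u A / 2) := by
    intro r Cn hC lo hi hhi hfew
    have hch : ∀ d k, ∃ S : Finset ι, (d ∈ I → S ⊆ I ∧ d ∉ S ∧ #S ≤ 18 * k) ∧
        (d ∈ I → 1 ≤ k → k ≤ K → ∀ A i j, TraceEq r N A i j → i ≤ lo d → lo d < j → j ≤ hi d →
          cut u A ≤ k → ∀ d' ∈ I, d' ≠ d → i ≤ lo d' → lo d' < j → hi d ≤ hi d' → d' ∈ S) := by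
      intro d k
      by_cases hd : d ∈ I
      swap
      · exact ⟨∅, fun h => absurd h hd, fun h => absurd h hd⟩
      by_cases h : (1 ≤ k ∧ k ≤ K) ∧ ∃ A i j, TraceEq r N A i j ∧ i ≤ lo d ∧ lo d < j ∧ j ≤ hi d ∧
          cut u A ≤ k
      · obtain ⟨⟨hk1, hkK⟩, hA⟩ := h
        obtain ⟨B, hB, h1, h2⟩ := hC.2 k (lo d) (hi d) (hhi d hd) hA
        refine ⟨{d' ∈ I | sep (Cn B k) s(r (lo d'), r (hi d')) = 1}.erase d, fun _ => ⟨?_, ?_, ?_⟩,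
          ?_⟩
        · exact (erase_subset _ _).trans (filter_subset _ _)
        · exact notMem_erase _ _
        · refine (card_le_card (erase_subset _ _)).trans (hfew B hB k hk1 hkK ⟨d, hd, ?_⟩)
          obtain ⟨A, i, j, g1, g2, g3, g4, g5⟩ := hA
          have hlt : lo d < N := lt_of_lt_of_le g3 (g4.trans (hhi d hd).le)
          have h3 := h2 A i j g1 g2 g3 g4 g5 (lo d) hlt ((g1 _ hlt).2 ⟨g2, g3⟩)
          have h4 := h1 (hi d) le_rfl (hhi d hd)
          simp [h3, h4]
        · intro _ _ _ A i j g1 g2 g3 g4 g5 d' hd' hne k1 k2 k3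
          rw [mem_erase, mem_filter]
          have hlt : lo d' < N := lt_of_lt_of_le k2 (g4.trans (hhi d hd).le)
          have h3 := h2 A i j g1 g2 g3 g4 g5 (lo d') hlt ((g1 _ hlt).2 ⟨k1, k2⟩)
          have h4 := h1 (hi d') k3 (hhi d' hd')
          exact ⟨hne, hd', by simp [h3, h4]⟩
      · refine ⟨∅, fun _ => by simp, fun _ h1 h2 A i j g1 g2 g3 g4 g5 => ?_⟩
        exact absurd ⟨⟨h1, h2⟩, A, i, j, g1, g2, g3, g4, g5⟩ h
    choose S hS1 hS2 using hch
    refine ⟨S, fun d hd k => hS1 d k hd, fun M hM hMS A i j hA hc1 hcK => ?_⟩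
    rcases ({d ∈ M | i ≤ lo d ∧ lo d < j ∧ j ≤ hi d} : Finset ι).eq_empty_or_nonempty with h | h
    · rw [h]; simp
    obtain ⟨d, hd, hmin⟩ := exists_min_image _ hi h
    obtain ⟨hdM, g2, g3, g4⟩ := mem_filter.1 hd
    have hsub : ({d ∈ M | i ≤ lo d ∧ lo d < j ∧ j ≤ hi d} : Finset ι).erase d ⊆
        S d (cut u A) ∩ M := by
      intro d' hd'
      obtain ⟨hne, hd'⟩ := mem_erase.1 hd'
      obtain ⟨hd'M, k1, k2, k3⟩ := mem_filter.1 hd'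
      exact mem_inter.2 ⟨hS2 d (cut u A) (hM hdM) hc1 hcK A i j hA g2 g3 g4 le_rfl d' (hM hd'M) hne
        k1 k2 (hmin d' hd'), hd'M⟩
    have h1 := card_le_card hsub
    rw [card_erase_of_mem hd] at h1
    have h2 := hMS d hdM _ hc1 hcK
    omega
  obtain ⟨S1, hS1, hS1'⟩ := hdir r Cn hC lo hi hhi hfew
  have hsep : ∀ d ∈ I, ∀ A : Finset V,
      sep A s(r (N - 1 - (N - 1 - hi d)), r (N - 1 - (N - 1 - lo d))) =
        sep A s(r (lo d), r (hi d)) := by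
    intro d hd A
    have h1 := hlo d hd
    have h2 := hhi d hd
    rw [show N - 1 - (N - 1 - hi d) = hi d by omega, show N - 1 - (N - 1 - lo d) = lo d by omega,
      Sym2.eq_swap]
  obtain ⟨S2, hS2, hS2'⟩ := hdir (fun x => r (N - 1 - x)) Cn' hC' (fun d => N - 1 - hi d)
    (fun d => N - 1 - lo d) (fun d hd => by have := hhi d hd; have := hlo d hd; omega) (by
      intro B hB k hk1 hkK
      have : ∀ d ∈ I, (sep (Cn' B k) s(r (N - 1 - (N - 1 - hi d)), r (N - 1 - (N - 1 - lo d))) = 1 ↔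
          sep (Cn' B k) s(r (lo d), r (hi d)) = 1) := fun d hd => by rw [hsep d hd]
      rintro ⟨d, hd, h⟩
      rw [filter_congr this]
      exact hfew' B hB k hk1 hkK ⟨d, hd, (this d hd).1 h⟩)
  obtain ⟨M, hM, hMc, hMS⟩ := exists_thin I K (fun b => bif b then S1 else S2) (by
    intro b; cases b
    · exact hS2
    · exact hS1)
  refine ⟨M, hM, hMc, fun A i j hA h1 hK => ?_⟩
  have e1 := hS1' M hM (hMS true) A i j hA h1 hK
  have e2 := hS2' M hM (hMS false) A _ _ hA.mirror h1 hK
  have hsub : ({d ∈ M | sep A s(r (lo d), r (hi d)) = 1} : Finset ι) ⊆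
      {d ∈ M | i ≤ lo d ∧ lo d < j ∧ j ≤ hi d} ∪
        {d ∈ M | N - j ≤ N - 1 - hi d ∧ N - 1 - hi d < N - i ∧ N - i ≤ N - 1 - lo d} := by
    intro d hd
    obtain ⟨hdM, hd⟩ := mem_filter.1 hd
    have h3 := hlo d (hM hdM)
    have h4 := hhi d (hM hdM)
    rw [mem_union, mem_filter, mem_filter]
    have h5 := hA (lo d) (by omega)
    have h6 := hA (hi d) h4
    by_cases h7 : r (lo d) ∈ A <;> by_cases h8 : r (hi d) ∈ A
    · simp [h7, h8] at hd
    · have := h5.1 h7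
      have h9 : ¬(i ≤ hi d ∧ hi d < j) := fun h => h8 (h6.2 h)
      left; refine ⟨hdM, ?_, ?_, ?_⟩ <;> omega
    · have := h6.1 h8
      have h9 : ¬(i ≤ lo d ∧ lo d < j) := fun h => h7 (h5.2 h)
      right; refine ⟨hdM, ?_, ?_, ?_⟩ <;> omega
    · simp [h7, h8] at hd
  have := (card_le_card hsub).trans (card_union_le _ _)
  omega

end Canon

section JointLink

variable {V ι : Type} [Fintype V] [DecidableEq V] [Fintype ι] [DecidableEq ι]

lemma load_insert (s t : ι → V) (I : Finset ι) (d : ι) (hd : d ∉ I) (A : Finset V) :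
    load s t (insert d I) A = load s t I A + (ind (s d) A + ind (t d) A) := by
  rw [load, sum_insert hd, add_comm]; rfl

open Classical in
/-- Either many demands can be routed locally or linkable families can be extended. -/
lemma extendable_or_local (u : Sym2 V → ℕ) (s t : ι → V) (L : Finset V → Prop)
    (hdown : ∀ A B, A ⊆ B → L B → L A) (C : ℕ)
    (hunion : ∀ A B, L A → L B → cut u A + cut u B ≤ C → L (A ∪ B)) (h0 : L ∅)
    (z : ι → ℝ) (hz : ∀ d, 0 ≤ z d) (hz1 : ∀ d, z d ≤ 1)
    (ε : ℝ) (hε : 0 < ε) (hε1 : ε ≤ 1)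
    (hL : ∀ A, L A → ε * wload s t z A ≤ cut u A)
    (hw : ∀ d, 0 < z d → ∃ w, IsRoute (s d) (t d) w ∧ ∀ e, w e ≤ u e)
    (M0 : ℕ) (hM0 : (M0 : ℝ) ≤ ε * (∑ d, z d) / 64) (hC : 4 * M0 + 2 ≤ C) :
    (∃ (I : Finset ι) (f : ι → Sym2 V → ℕ), ε * (∑ d, z d) / 4 ≤ #I ∧
      (∀ d ∈ I, 0 < z d ∧ IsRoute (s d) (t d) (f d)) ∧ ∀ e, ∑ d ∈ I, f d e ≤ u e) ∨
    ∀ I, Linkable u s t L I → #I < M0 →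
      (∑ d, z d) / 2 ≤ ∑ d with d ∉ I ∧ Linkable u s t L (insert d I), z d := by
  by_contra hcon
  rw [not_or] at hcon
  obtain ⟨h1, h2⟩ := hcon
  push Not at h2
  obtain ⟨I, hI, hIM, hlt⟩ := h2
  obtain ⟨F, hF, hFc, hFs⟩ := nonaddable_weight u s t L hdown C hunion h0 I (by omega) hI z hz ε hε
      hL
  obtain ⟨J, f, hJ, hJr, hJu⟩ := route_petals u s t z hw F hF hFc
  refine h1 ⟨J, f, ?_, hJr, hJu⟩
  set X := ∑ d, z d with hX
  have hX0 : 0 ≤ X := sum_nonneg fun d _ => hz d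
  have hsplit : X ≤ (∑ d with d ∉ I ∧ Linkable u s t L (insert d I), z d) +
      (∑ d ∈ I, z d + ∑ d with ¬ Addable u s t L I d, z d) := by
    have h3 : ∑ d ∈ I, z d = ∑ d, if d ∈ I then z d else 0 := by
      rw [← sum_filter]; congr 1; ext; simp
    rw [hX, sum_filter, sum_filter, h3, ← sum_add_distrib, ← sum_add_distrib]
    refine sum_le_sum fun d _ => ?_
    have hzd := hz d
    by_cases h4 : d ∈ I
    · by_cases h5 : Addable u s t L I d <;> simp [h4, h5, hzd]
    · by_cases h5 : Addable u s t L I d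
      · have h6 : Linkable u s t L (insert d I) := fun A hA => by
          rw [load_insert _ _ _ _ h4]; exact h5 A hA
        simp [h4, h5, h6]
      · by_cases h6 : Linkable u s t L (insert d I) <;> simp [h4, h5, h6, hzd]
  have hIz : ∑ d ∈ I, z d ≤ #I := by
    calc ∑ d ∈ I, z d ≤ ∑ d ∈ I, 1 := sum_le_sum fun d _ => hz1 d
      _ = #I := by simp
  have hIM' : (#I : ℝ) ≤ M0 := by exact_mod_cast hIM.le
  rw [hJ]
  set Nz := ∑ d with ¬ Addable u s t L I d, z d
  have hεX : ε * X ≤ X := by nlinarith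
  have h7 : X / 2 - X / 64 ≤ Nz := by linarith
  have h8 : ε * (X / 2 - X / 64) ≤ ε * Nz := by gcongr
  linarith

/-- Links from the endpoints of the demands to distinct targets. -/
lemma exists_links {κ : Type} [Nonempty κ] (u : Sym2 V → ℕ) (s t : ι → V) (I : Finset ι)
    (J : Finset κ) (P : κ → Finset V)
    (h : ∀ A, load s t I A ≤ cut u A + #{j ∈ J | (P j ∩ A).Nonempty}) :
    ∃ (φ ψ : ι → κ) (p q : ι → V) (g h : ι → Sym2 V → ℕ),
      (∀ d ∈ I, ∀ d' ∈ I, φ d = φ d' → d = d') ∧ (∀ d ∈ I, ∀ d' ∈ I, ψ d = ψ d' → d = d') ∧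
      (∀ d ∈ I, ∀ d' ∈ I, φ d ≠ ψ d') ∧
      (∀ d ∈ I, φ d ∈ J ∧ p d ∈ P (φ d) ∧ IsRoute (s d) (p d) (g d)) ∧
      (∀ d ∈ I, ψ d ∈ J ∧ q d ∈ P (ψ d) ∧ IsRoute (t d) (q d) (h d)) ∧
      ∀ e, ∑ d ∈ I, (g d e + h d e) ≤ u e := by
  classical
  obtain ⟨φ, b, f, h1, h2, h3⟩ := menger (I ×ˢ (univ : Finset Bool)) J
    (fun x => bif x.2 then s x.1 else t x.1) P u (by
      intro A
      refine le_trans (le_of_eq ?_) (h A)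
      rw [card_filter, sum_product, load]
      refine sum_congr rfl fun d _ => ?_
      rw [Fintype.sum_bool]; rfl)
  have hm : ∀ d ∈ I, ∀ b : Bool, (d, b) ∈ (↑(I ×ˢ (univ : Finset Bool)) : Set (ι × Bool)) :=
    fun d hd b => by simp [hd]
  have hm' : ∀ d ∈ I, ∀ b : Bool, (d, b) ∈ I ×ˢ (univ : Finset Bool) := fun d hd b => by simp [hd]
  refine ⟨fun d => φ (d, true), fun d => φ (d, false), fun d => b (d, true), fun d => b (d, false),
    fun d => f (d, true), fun d => f (d, false), ?_, ?_, ?_, ?_, ?_, ?_⟩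
  · intro d hd d' hd' he
    exact congrArg Prod.fst (h1 (hm d hd _) (hm d' hd' _) he)
  · intro d hd d' hd' he
    exact congrArg Prod.fst (h1 (hm d hd _) (hm d' hd' _) he)
  · intro d hd d' hd' he
    exact Bool.noConfusion (congrArg Prod.snd (h1 (hm d hd true) (hm d' hd' false) he))
  · exact fun d hd => h2 _ (hm' d hd _)
  · exact fun d hd => h2 _ (hm' d hd _)
  · intro e
    have := h3 e
    rw [sum_product] at this
    simpa using this

/-- Nets on the ring of a peelable graph obeying a relaxed cut condition are routable with
congestion two. -/
lemma route_nets (R : List V) (supp : Finset (Sym2 V)) (hP : Peel R supp) (u : Sym2 V → ℕ)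
    (hu : u = fun e => if e ∈ supp then 1 else 0) (M : Finset ι) (p q : ι → V)
        (hp : ∀ d ∈ M, p d ∈ R)
    (hq : ∀ d ∈ M, q d ∈ R) (w : ι → Sym2 V → ℕ) (hw : ∀ d ∈ M, IsRoute (p d) (q d) (w d))
    (hws : ∀ d ∈ M, ∀ e ∉ supp, w d e = 0) (x : V)
    (hcut : ∀ A i j, TraceEq (fun k => R.getD k x) R.length A i j → 1 ≤ cut u A →
      #{d ∈ M | sep A s(p d, q d) = 1} ≤ 2 * max 1 (cut u A / 2)) :
    ∃ f : ι → Sym2 V → ℕ, (∀ d ∈ M, IsRoute (p d) (q d) (f d)) ∧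
      ∀ e, ∑ d ∈ M, f d e ≤ 2 * u e := by
  classical
  have hex : ∀ d : M, ∃ W : Sym2 V → ℕ, (∀ e, W e ≤ w d e) ∧ IsRoute (p d) (q d) W ∧
      ∀ A : Finset V, cut W A % 2 = sep A s(p d, q d) % 2 := fun d => (hw d d.2).exists_exact
  choose W hW1 hW2 hW3 using hex
  have hW0 : ∀ d, ∀ e ∉ supp, W d e = 0 := fun d e he => by
    have := hW1 d e; rw [hws d d.2 e he] at this; omega
  set F : Sym2 V → ℕ := fun e => (∑ d, W d e) % 2 with hF
  set u2 : Sym2 V → ℕ := fun e => if e ∈ supp then 2 - F e else 0 with hu2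
  have hF1 : ∀ e, F e ≤ 1 := fun e => by
    have := Nat.mod_lt (∑ d, W d e) (show 0 < 2 by norm_num)
    simp only [hF]; omega
  have hF0 : ∀ e ∉ supp, F e = 0 := fun e he => by
    simp only [hF, hW0 _ e he, sum_const_zero, Nat.zero_mod]
  have hu2u : ∀ e, u e ≤ u2 e := fun e => by
    have := hF1 e
    simp only [hu, hu2]
    by_cases he : e ∈ supp
    · rw [if_pos he, if_pos he]; omega
    · rw [if_neg he]; omega
  have hu2u' : ∀ e, u2 e ≤ 2 * u e := fun e => by
    simp only [hu, hu2]
    by_cases he : e ∈ supp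
    · rw [if_pos he, if_pos he]; omega
    · rw [if_neg he]; omega
  set p' : M → V := fun d => p d with hp'
  set q' : M → V := fun d => q d with hq'
  have hdem : ∀ A, dem p' q' A = #{d ∈ M | sep A s(p d, q d) = 1} := by
    intro A
    rw [dem, card_filter, ← sum_coe_sort M]
    refine sum_congr rfl fun d _ => ?_
    have := sep_le_one A s(p d, q d)
    by_cases h : sep A s(p d, q d) = 1
    · rw [if_pos h]; exact h
    · rw [if_neg h]; simp only [hp', hq']; omega
  have hpar : ∀ A, dem p' q' A % 2 = cut u2 A % 2 := by
    intro A
    have h1 : cut u2 A + cut F A = 2 * cut u A := by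
      simp only [cut, ← sum_add_distrib, mul_sum]
      refine sum_congr rfl fun e _ => ?_
      simp only [hu, hu2]
      by_cases he : e ∈ supp
      · rw [if_pos he, if_pos he, ← add_mul, Nat.sub_add_cancel ((hF1 e).trans (by norm_num))]; ring
      · rw [if_neg he, if_neg he, hF0 e he]; ring
    have h2 : cut F A % 2 = (∑ d, cut (W d) A) % 2 := by
      have : ∑ d, cut (W d) A = ∑ e, (∑ d, W d e) * sep A e := by
        simp only [cut, sum_mul]; exact sum_comm
      rw [this, cut, sum_nat_mod, sum_nat_mod (f := fun e => (∑ d, W d e) * sep A e)]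
      congr 1
      refine sum_congr rfl fun e _ => ?_
      simp only [hF]; rw [Nat.mod_mul_mod]
    have h3 : (∑ d, cut (W d) A) % 2 = dem p' q' A % 2 := by
      rw [dem, sum_nat_mod, sum_nat_mod (f := fun d => sep A s(p' d, q' d))]
      congr 1
      exact sum_congr rfl fun d _ => hW3 d A
    omega
  have hzero : ∀ A, cut u A = 0 → dem p' q' A = 0 := by
    intro A hA
    rw [dem, sum_eq_zero_iff]
    intro d _
    have h1 := (hW2 d).sep_le A
    have h2 : cut (W d) A = 0 := by
      rw [cut, sum_eq_zero_iff] at hA ⊢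
      intro e he
      have h3 := hA e he
      simp only [hu] at h3
      by_cases hs : e ∈ supp
      · rw [if_pos hs, one_mul] at h3; rw [h3, mul_zero]
      · rw [hW0 d e hs, zero_mul]
    simp only [hp', hq']; omega
  have hmain : ∀ A, R.getD 0 x ∉ A → CycArc R A → dem p' q' A ≤ cut u2 A := by
    intro A h0 hA
    obtain ⟨i, j, hij⟩ := hA.traceEq x h0
    have h1 := cut_mono hu2u A
    have h4 := hpar A
    by_cases hc : cut u A = 0
    · rw [hzero A hc]; omega
    · have h3 := hcut A i j hij (by omega)
      rw [← hdem] at h3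
      omega
  obtain ⟨f, hf, hfu⟩ := okamura_seymour hP u2 (fun e he => by simp only [hu2]; rw [if_neg he]) M
      p' q'
    (fun d => hp d d.2) (fun d => hq d d.2) (fun A hA => ⟨by
      by_cases h0 : R.getD 0 x ∈ A
      · rw [← dem_compl, ← cut_compl]
        exact hmain Aᶜ (by simpa using h0) hA.compl
      · exact hmain A h0 hA, hpar A⟩)
  refine ⟨fun d => if h : d ∈ M then f ⟨d, h⟩ else 0, fun d hd => ?_, fun e => ?_⟩
  · dsimp only; rw [dif_pos hd]; exact hf ⟨d, hd⟩
  · refine le_trans (le_of_eq ?_) ((hfu e).trans (hu2u' e))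
    rw [← sum_coe_sort M]
    refine sum_congr rfl fun d _ => ?_
    dsimp only; rw [dif_pos d.2]

end JointLink

section RingRouting

variable {V ι : Type} [Fintype V] [DecidableEq V] [Fintype ι]

lemma wload_univ (s t : ι → V) (z : ι → ℝ) : wload s t z univ = 2 * ∑ d, z d := by
  simp only [wload, ind, mem_univ, if_true, mul_sum]
  exact sum_congr rfl fun d _ => by push_cast; ring

lemma cut_univ (u : Sym2 V → ℕ) : cut u univ = 0 := by
  rw [← compl_empty, cut_compl, cut_empty]

open Classical in
/-- A balanced linkable family: the canonical sets crossed too often are crossed rarely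
in total. -/
lemma exists_balanced (N : ℕ) (K : ℕ) (D : Bool → ℕ → ℕ → Finset V) (u : Sym2 V → ℕ)
    (hD : ∀ b B k, cut u (D b B k) ≤ 2 * k) (s t : ι → V) (z : ι → ℝ) (hz : ∀ d, 0 ≤ z d)
    (hcut : ∀ A, ∑ d, z d * sep A s(s d, t d) ≤ cut u A) (L : Finset V → Prop)
    (hX : 1024 ≤ ∑ d, z d) (hN : (N : ℝ) ≤ 2 * ∑ d, z d) (M0 : ℕ)
        (hM0 : (M0 : ℝ) ≤ (∑ d, z d) / 128)
    (hav : ∀ I, Linkable u s t L I → #I < M0 →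
      (∑ d, z d) / 2 ≤ ∑ d with d ∉ I ∧ Linkable u s t L (insert d I), z d) :
    ∃ I, Linkable u s t L I ∧ #I = M0 ∧ (∀ d ∈ I, 0 < z d) ∧
      ((∑ x ∈ ((univ : Finset Bool) ×ˢ (range (N + 1) ×ˢ Icc 1 K)) with
        16 * x.2.2 ≤ #{d ∈ I | sep (D x.1 x.2.1 x.2.2) s(s d, t d) = 1},
        (#{d ∈ I | sep (D x.1 x.2.1 x.2.2) s(s d, t d) = 1} + 2 * x.2.2) : ℕ) : ℝ) ≤
          6 * (∑ d, z d) / 4096 := by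
  set X := ∑ d, z d with hXd
  set Q := ((univ : Finset Bool) ×ˢ (range (N + 1) ×ˢ Icc 1 K)) with hQ
  obtain ⟨I, hI, hIM, hIz, hIw⟩ := greedy_balanced Q
    (fun d x => sep (D x.1 x.2.1 x.2.2) s(s d, t d) = 1) z hz (fun x => 2 * (x.2.2 : ℝ)) (by
      intro x _
      refine le_trans ?_ ((hcut (D x.1 x.2.1 x.2.2)).trans ?_)
      · rw [sum_filter]
        refine sum_le_sum fun d _ => ?_
        by_cases h : sep (D x.1 x.2.1 x.2.2) s(s d, t d) = 1
        · rw [if_pos h, h]; simp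
        · rw [if_neg h]; exact mul_nonneg (hz d) (by positivity)
      · exact_mod_cast hD x.1 x.2.1 x.2.2) (Linkable u s t L)
    (fun A _ => by rw [show load s t ∅ A = 0 from rfl]; exact Nat.zero_le _) (X / 2) (by linarith)
        M0 hav
    M0 le_rfl (fun x => (1 / 4 : ℝ) ^ (8 * x.2.2)) (fun x => by positivity)
  refine ⟨I, hI, hIM, hIz, ?_⟩
  have hright : ∑ q ∈ Q, (1 / 4 : ℝ) ^ (8 * q.2.2) * (1 + 3 * (2 * (q.2.2 : ℝ)) / (X / 2)) ^ M0 ≤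
      6 * X / 4096 := by
    have h1 : ∀ q ∈ Q, (1 / 4 : ℝ) ^ (8 * q.2.2) * (1 + 3 * (2 * (q.2.2 : ℝ)) / (X / 2)) ^ M0 ≤
        (1 / 4) ^ (7 * q.2.2) := by
      intro q _
      set k := q.2.2
      have h2 : (1 + 3 * (2 * (k : ℝ)) / (X / 2)) ^ M0 ≤ 2 ^ k := by
        have h3 : (1 + 3 * (2 * (k : ℝ)) / (X / 2)) ≤ Real.exp (12 * k / X) := by
          have := Real.add_one_le_exp (12 * k / X)
          have e : 3 * (2 * (k : ℝ)) / (X / 2) = 12 * k / X := by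
            have : X ≠ 0 := by linarith
            field_simp; ring
          rw [e]; linarith
        have h4 : (0 : ℝ) ≤ 1 + 3 * (2 * (k : ℝ)) / (X / 2) := by
          have : 0 ≤ X := by linarith
          positivity
        have h5 : Real.exp (1 / 2) ≤ 2 := by
          have := Real.exp_one_lt_d9
          have h6 : Real.exp (1 / 2) * Real.exp (1 / 2) = Real.exp 1 := by
            rw [← Real.exp_add]; norm_num
          nlinarith [Real.exp_pos (1 / 2)]
        calc (1 + 3 * (2 * (k : ℝ)) / (X / 2)) ^ M0 ≤ Real.exp (12 * k / X) ^ M0 := by gcongr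
          _ = Real.exp (M0 * (12 * k / X)) := by rw [← Real.exp_nat_mul]
          _ ≤ Real.exp (k * (1 / 2)) := by
            rw [Real.exp_le_exp]
            calc (M0 : ℝ) * (12 * k / X) ≤ X / 128 * (12 * k / X) := by
                  have : 0 ≤ X := by linarith
                  gcongr
              _ = 12 * k / 128 := by
                have : X ≠ 0 := by linarith
                field_simp
              _ ≤ k * (1 / 2) := by
                have : (0 : ℝ) ≤ k := by positivity
                linarith
          _ = Real.exp (1 / 2) ^ k := by rw [← Real.exp_nat_mul]
          _ ≤ 2 ^ k := by gcongr
      calc (1 / 4 : ℝ) ^ (8 * k) * _ ≤ (1 / 4) ^ (8 * k) * 2 ^ k := by gcongr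
        _ = (1 / 4) ^ (7 * k) * ((1 / 4) * 2) ^ k := by
          rw [mul_pow, show 8 * k = 7 * k + k by ring, pow_add]; ring
        _ ≤ (1 / 4) ^ (7 * k) * 1 := by
          gcongr; exact pow_le_one₀ (by norm_num) (by norm_num)
        _ = _ := mul_one _
    refine (sum_le_sum h1).trans ?_
    rw [hQ, sum_product, Fintype.sum_bool, sum_product]
    dsimp only
    rw [sum_const, nsmul_eq_mul, card_range]
    have hgeo : ∀ K : ℕ, ∑ k ∈ Icc 1 K, (1 / 4 : ℝ) ^ (7 * k) ≤
        (1 / 4) ^ 6 - (1 / 4) ^ (7 * K + 6) := by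
      intro K
      induction K with
      | zero => norm_num
      | succ K ih =>
        rw [sum_Icc_succ_top (by omega)]
        have e1 : (1 / 4 : ℝ) ^ (7 * K + 6) = (1 / 4) ^ 6 * (1 / 4) ^ (7 * K) := by
          rw [pow_add]; ring
        have e2 : (1 / 4 : ℝ) ^ (7 * (K + 1) + 6) = (1 / 4) ^ 13 * (1 / 4) ^ (7 * K) := by
          rw [show 7 * (K + 1) + 6 = 13 + 7 * K by ring, pow_add]
        have e3 : (1 / 4 : ℝ) ^ (7 * (K + 1)) = (1 / 4) ^ 7 * (1 / 4) ^ (7 * K) := by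
          rw [show 7 * (K + 1) = 7 + 7 * K by ring, pow_add]
        have e4 : (0 : ℝ) ≤ (1 / 4) ^ (7 * K) := by positivity
        rw [e1] at ih
        rw [e2, e3]
        linarith
    have h6 := hgeo K
    have h7 : (0 : ℝ) ≤ (1 / 4) ^ (7 * K + 6) := by positivity
    have h8 : ∑ k ∈ Icc 1 K, (1 / 4 : ℝ) ^ (7 * k) ≤ 1 / 4096 := by
      have : (1 / 4 : ℝ) ^ 6 = 1 / 4096 := by norm_num
      linarith
    have h9 : ((N + 1 : ℕ) : ℝ) ≤ 3 * X := by push_cast; linarith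
    have h10 : ((N + 1 : ℕ) : ℝ) * ∑ k ∈ Icc 1 K, (1 / 4 : ℝ) ^ (7 * k) ≤ 3 * X * (1 / 4096) := by
      refine mul_le_mul h9 h8 ?_ ?_
      · exact sum_nonneg fun _ _ => by positivity
      · linarith
    linarith
  have hIw' : ∑ q ∈ Q, (1 / 4 : ℝ) ^ (8 * q.2.2) *
      4 ^ #{d ∈ I | sep (D q.1 q.2.1 q.2.2) s(s d, t d) = 1} ≤ 6 * X / 4096 := by
    refine le_trans (le_of_eq ?_) (hIw.trans hright)
    refine sum_congr rfl fun q _ => ?_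
    congr!
  refine le_trans ?_ hIw'
  push_cast
  rw [sum_filter]
  refine sum_le_sum fun q _ => ?_
  have hpos : (0 : ℝ) ≤ (1 / 4 : ℝ) ^ (8 * q.2.2) *
      4 ^ #{d ∈ I | sep (D q.1 q.2.1 q.2.2) s(s d, t d) = 1} := by positivity
  set m := #{d ∈ I | sep (D q.1 q.2.1 q.2.2) s(s d, t d) = 1}
  set k := q.2.2
  by_cases h : 16 * k ≤ m
  · rw [if_pos h]
    have h1 : (1 / 4 : ℝ) ^ (8 * k) * 4 ^ m = 4 ^ (m - 8 * k) := by
      conv_lhs => rw [show m = (m - 8 * k) + 8 * k by omega]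
      rw [pow_add, mul_comm, mul_assoc, ← mul_pow]; norm_num
    rw [h1]
    have h2 : m + 2 * k ≤ 4 ^ (m - 8 * k) := by
      have h3 : 2 ^ m ≤ 4 ^ (m - 8 * k) := by
        rw [show 4 = 2 ^ 2 by norm_num, ← pow_mul]
        exact Nat.pow_le_pow_right (by norm_num) (by omega)
      by_cases hk : k = 0
      · have := Nat.lt_two_pow_self (n := m)
        omega
      · obtain ⟨m', hm'⟩ : ∃ m', m = m' + 1 := ⟨m - 1, by omega⟩
        have := Nat.lt_two_pow_self (n := m')
        have e : 2 ^ m = 2 * 2 ^ m' := by rw [hm', pow_succ]; ring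
        omega
    exact_mod_cast h2
  · rw [if_neg h]; exact hpos

end RingRouting

section RingRouting

variable {V ι : Type} [Fintype V] [DecidableEq V] [Fintype ι]

lemma exists_positions (R : List V) (x : V) {p q : V} (hp : p ∈ R) (hq : q ∈ R) :
    ∃ i j, i ≤ j ∧ j < R.length ∧
      ∀ A : Finset V, sep A s(R.getD i x, R.getD j x) = sep A s(p, q) := by
  have hg : ∀ v ∈ R, ∃ i < R.length, R.getD i x = v := by
    intro v hv
    obtain ⟨i, hi, h⟩ := List.mem_iff_getElem.1 hv
    refine ⟨i, hi, ?_⟩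
    rw [List.getD_eq_getElem?_getD, List.getElem?_eq_getElem hi]
    exact h
  obtain ⟨i, hi, hi'⟩ := hg p hp
  obtain ⟨j, hj, hj'⟩ := hg q hq
  rcases le_total i j with h | h
  · exact ⟨i, j, h, hj, fun A => by rw [hi', hj']⟩
  · exact ⟨j, i, h, hi, fun A => by rw [hi', hj', Sym2.eq_swap]⟩

set_option maxHeartbeats 800000 in
/-- Routing through the ring of a peelable graph. -/
theorem ring_routing (R : List V) (supp : Finset (Sym2 V)) (hP : Peel R supp) (u : Sym2 V → ℕ)
    (hu : u = fun e => if e ∈ supp then 1 else 0) (s t : ι → V) (z : ι → ℝ) (hz : ∀ d, 0 ≤ z d)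
    (hz1 : ∀ d, z d ≤ 1) (hN : (R.length : ℝ) ≤ 2 * ∑ d, z d)
    (hw : ∀ d, 0 < z d → ∃ w, IsRoute (s d) (t d) w ∧ ∀ e ∉ supp, w e = 0)
    (hcut : ∀ A, ∑ d, z d * sep A s(s d, t d) ≤ cut u A)
    (hnv : ∀ A, (∀ v ∈ R, v ∉ A) → 1 / 2 * wload s t z A ≤ cut u A) :
    ∃ (I : Finset ι) (f : ι → Sym2 V → ℕ), (∀ d ∈ I, 0 < z d ∧ IsRoute (s d) (t d) (f d)) ∧
      (∀ e, ∑ d ∈ I, f d e ≤ 3 * u e) ∧ ∑ d, z d ≤ 2 ^ 72 * #I := by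
  classical
  set X := ∑ d, z d with hX
  have hX0 : 0 ≤ X := sum_nonneg fun d _ => hz d
  rcases hX0.eq_or_lt with hX0' | hXpos
  · exact ⟨∅, 0, by simp, by simp, by simp [← hX0']⟩
  have hR : R ≠ [] := by
    rintro rfl
    have := hnv univ (by simp)
    rw [wload_univ, cut_univ] at this
    push_cast at this
    linarith
  have hw1 : ∀ d, 0 < z d → ∃ w, IsRoute (s d) (t d) w ∧ ∀ e, w e ≤ u e := by
    intro d hd
    obtain ⟨w, h1, h2⟩ := hw d hd
    refine ⟨_, h1.min_one, fun e => ?_⟩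
    simp only [hu]
    by_cases he : e ∈ supp
    · rw [if_pos he]; omega
    · rw [if_neg he, h2 e he]; omega
  by_cases hXs : X < 1024
  · obtain ⟨d, -, hd⟩ : ∃ d ∈ univ, 0 < z d := by
      by_contra hcon
      push Not at hcon
      have : X ≤ 0 := sum_nonpos hcon
      linarith
    obtain ⟨w, h1, h2⟩ := hw1 d hd
    refine ⟨{d}, fun _ => w, by simpa using ⟨hd, h1⟩, fun e => ?_, ?_⟩
    · have := h2 e
      simp only [sum_singleton]; omega
    · rw [card_singleton]; norm_num; linarith
  push Not at hXs
  set M0 := ⌊X / 128⌋₊ with hM0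
  have hM0le : (M0 : ℝ) ≤ X / 128 := Nat.floor_le (by linarith)
  have hM0ge : X / 128 - 1 < M0 := by linarith [Nat.lt_floor_add_one (X / 128)]
  rcases extendable_or_local u s t (fun A => ∀ v ∈ R, v ∉ A) (fun A B hAB hB v hv h => hB v hv
      (hAB h))
    (4 * M0 + 2) (fun A B hA hB _ v hv h => by
      rcases mem_union.1 h with h | h
      · exact hA v hv h
      · exact hB v hv h) (by simp) z hz hz1 (1 / 2) (by norm_num) (by norm_num) hnv hw1 M0
    (by linarith) le_rfl with ⟨I, f, h1, h2, h3⟩ | hav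
  · refine ⟨I, f, h2, fun e => (h3 e).trans (by omega), ?_⟩
    have : (0 : ℝ) ≤ #I := by positivity
    norm_num
    linarith
  obtain ⟨r0, R', hRe⟩ := List.exists_cons_of_ne_nil hR
  set r : ℕ → V := fun k => R.getD k r0 with hr
  obtain ⟨Cn, hCn⟩ := exists_canon r R.length u
  obtain ⟨Cn', hCn'⟩ := exists_canon (fun x => r (R.length - 1 - x)) R.length u
  set K := ∑ e, u e with hK
  set D : Bool → ℕ → ℕ → Finset V := fun b => bif b then Cn else Cn' with hDdef
  have hD : ∀ b B k, cut u (D b B k) ≤ 2 * k := by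
    intro b B k
    cases b
    · exact hCn'.1 B k
    · exact hCn.1 B k
  obtain ⟨I, hI, hIM, hIz, hIov⟩ := exists_balanced R.length K D u hD s t z hz hcut
    (fun A => ∀ v ∈ R, v ∉ A) hXs hN M0 hM0le hav
  have hM0pos : 0 < M0 := by
    have : (0 : ℝ) < M0 := by linarith
    exact_mod_cast this
  have hIne : I.Nonempty := card_pos.1 (by omega)
  have : Nonempty (ι × Bool) := ⟨(hIne.choose, true)⟩
  obtain ⟨φ, ψ, p, q, g, h, -, -, -, hp, hq, hgh⟩ := exists_links (κ := ι × Bool) u s t I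
    (I ×ˢ univ) (fun _ => R.toFinset) (by
      intro A
      by_cases hA : ∀ v ∈ R, v ∉ A
      · exact (hI A hA).trans (Nat.le_add_right _ _)
      · push Not at hA
        obtain ⟨v, hv, hvA⟩ := hA
        have : (R.toFinset ∩ A).Nonempty := ⟨v, by simp [hv, hvA]⟩
        simp only [this, filter_true, card_product]
        have := load_le s t I A
        simp
        omega)
  have hpR : ∀ d ∈ I, p d ∈ R := fun d hd => List.mem_toFinset.1 (hp d hd).2.1
  have hqR : ∀ d ∈ I, q d ∈ R := fun d hd => List.mem_toFinset.1 (hq d hd).2.1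
  -- crossings of the linked nets
  have hcross : ∀ A : Finset V, #{d ∈ I | sep A s(p d, q d) = 1} ≤
      #{d ∈ I | sep A s(s d, t d) = 1} + cut u A := by
    intro A
    have h1 : ∀ d ∈ I, (if sep A s(p d, q d) = 1 then 1 else 0) ≤
        (if sep A s(s d, t d) = 1 then 1 else 0) + (cut (g d) A + cut (h d) A) := by
      intro d hd
      have e1 := (hp d hd).2.2.sep_le A
      have e2 := (hq d hd).2.2.sep_le A
      simp only [sep_mk] at e1 e2 ⊢
      by_cases a1 : s d ∈ A <;> by_cases a2 : t d ∈ A <;> by_cases a3 : p d ∈ A <;>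
        by_cases a4 : q d ∈ A <;> simp [a1, a2, a3, a4] at e1 e2 ⊢ <;> omega
    have h2 : ∑ d ∈ I, (cut (g d) A + cut (h d) A) ≤ cut u A := by
      have : ∑ d ∈ I, (cut (g d) A + cut (h d) A) = cut (fun e => ∑ d ∈ I, (g d e + h d e)) A := by
        simp only [cut, sum_mul, add_mul]
        rw [sum_comm]
        simp only [sum_add_distrib]
      rw [this]
      exact cut_mono hgh A
    rw [card_filter, card_filter]
    have h3 := sum_le_sum h1
    rw [sum_add_distrib] at h3
    omega
  set Q := ((univ : Finset Bool) ×ˢ (range (R.length + 1) ×ˢ Icc 1 K)) with hQ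
  set ov : Bool × ℕ × ℕ → Prop := fun x =>
    16 * x.2.2 ≤ #{d ∈ I | sep (D x.1 x.2.1 x.2.2) s(s d, t d) = 1} with hov
  set bad : Finset ι := (Q.filter ov).biUnion fun x =>
    {d ∈ I | sep (D x.1 x.2.1 x.2.2) s(p d, q d) = 1} with hbad
  have hbadc : (#bad : ℝ) ≤ 6 * X / 4096 := by
    refine le_trans ?_ hIov
    have : #bad ≤ ∑ x ∈ Q.filter ov,
        (#{d ∈ I | sep (D x.1 x.2.1 x.2.2) s(s d, t d) = 1} + 2 * x.2.2) := by
      refine card_biUnion_le.trans (sum_le_sum fun x _ => ?_)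
      exact (hcross _).trans (Nat.add_le_add_left (hD _ _ _) _)
    exact_mod_cast this
  have hpos : ∀ d, ∃ i j, d ∈ I → i ≤ j ∧ j < R.length ∧
      ∀ A : Finset V, sep A s(r i, r j) = sep A s(p d, q d) := by
    intro d
    by_cases hd : d ∈ I
    · obtain ⟨i, j, h⟩ := exists_positions R r0 (hpR d hd) (hqR d hd)
      exact ⟨i, j, fun _ => h⟩
    · exact ⟨0, 0, fun h => absurd h hd⟩
  choose lo hi hlohi using hpos
  have hfew : ∀ b, ∀ B ≤ R.length, ∀ k, 1 ≤ k → k ≤ K →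
      (∃ d ∈ I \ bad, sep (D b B k) s(r (lo d), r (hi d)) = 1) →
        #{d ∈ I \ bad | sep (D b B k) s(r (lo d), r (hi d)) = 1} ≤ 18 * k := by
    rintro b B hB k hk1 hkK ⟨d, hd, hdD⟩
    obtain ⟨hdI, hdb⟩ := mem_sdiff.1 hd
    rw [(hlohi d hdI).2.2] at hdD
    have hnov : ¬ ov (b, B, k) := by
      intro ho
      apply hdb
      rw [hbad, mem_biUnion]
      refine ⟨(b, B, k), mem_filter.2 ⟨?_, ho⟩, mem_filter.2 ⟨hdI, hdD⟩⟩
      rw [hQ, mem_product, mem_product, mem_range, mem_Icc]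
      exact ⟨mem_univ _, Nat.lt_succ_of_le hB, hk1, hkK⟩
    simp only [hov, not_le] at hnov
    have h1 := hcross (D b B k)
    have h2 := hD b B k
    have h3 : #{d ∈ I \ bad | sep (D b B k) s(r (lo d), r (hi d)) = 1} ≤
        #{d ∈ I | sep (D b B k) s(p d, q d) = 1} := by
      refine card_le_card fun d' hd' => ?_
      obtain ⟨h4, h5⟩ := mem_filter.1 hd'
      have h6 := (mem_sdiff.1 h4).1
      rw [(hlohi d' h6).2.2] at h5
      exact mem_filter.2 ⟨h6, h5⟩
    omega
  obtain ⟨M, hMI, hMc, hMcut⟩ := exists_thin_nets r R.length u Cn Cn' hCn hCn' (I \ bad) lo hi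
    (fun d hd => (hlohi d (mem_sdiff.1 hd).1).1) (fun d hd => (hlohi d (mem_sdiff.1 hd).1).2.1) K
    (hfew true) (hfew false)
  have hMI' : M ⊆ I := hMI.trans sdiff_subset
  have hchw : ∀ d, ∃ w, d ∈ I → IsRoute (s d) (t d) w ∧ ∀ e ∉ supp, w e = 0 := by
    intro d
    by_cases hd : d ∈ I
    · obtain ⟨w, h⟩ := hw d (hIz d hd)
      exact ⟨w, fun _ => h⟩
    · exact ⟨0, fun h => absurd h hd⟩
  choose w hwr using hchw
  obtain ⟨f, hf, hfu⟩ := route_nets R supp hP u hu M p q (fun d hd => hpR d (hMI' hd))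
    (fun d hd => hqR d (hMI' hd)) (fun d e => g d e + w d e + h d e)
    (fun d hd => ((hp d (hMI' hd)).2.2.symm.trans (hwr d (hMI' hd)).1).trans (hq d (hMI' hd)).2.2)
    (by
      intro d hd e he
      have h1 := hgh e
      simp only [hu, if_neg he] at h1
      have h2 := single_le_sum (f := fun d => g d e + h d e) (fun _ _ => Nat.zero_le _) (hMI' hd)
      rw [(hwr d (hMI' hd)).2 e he]
      omega) r0 (by
      intro A i j hA h1
      have h2 : cut u A ≤ K := by
        refine sum_le_sum fun e _ => ?_
        have := sep_le_one A e
        calc u e * sep A e ≤ u e * 1 := Nat.mul_le_mul_left _ this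
          _ = u e := mul_one _
      refine le_trans (card_le_card fun d hd => ?_) (hMcut A i j hA h1 h2)
      obtain ⟨h3, h4⟩ := mem_filter.1 hd
      rw [← (hlohi d (hMI' h3)).2.2] at h4
      exact mem_filter.2 ⟨h3, h4⟩)
  refine ⟨M, fun d e => g d e + f d e + h d e, fun d hd => ⟨hIz d (hMI' hd), ?_⟩, fun e => ?_, ?_⟩
  · exact ((hp d (hMI' hd)).2.2.trans (hf d hd)).trans (hq d (hMI' hd)).2.2.symm
  · have h1 := hfu e
    have h2 := hgh e
    have h3 : ∑ d ∈ M, (g d e + h d e) ≤ ∑ d ∈ I, (g d e + h d e) := sum_le_sum_of_subset hMI'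
    simp only [sum_add_distrib] at h2 h3 ⊢
    omega
  · have h1 : #I ≤ #(I \ bad) + #bad := by
      have := le_card_sdiff bad I
      omega
    have h2 : (#I : ℝ) ≤ #(I \ bad) + #bad := by exact_mod_cast h1
    rw [hIM] at h2
    have h3 : 0 ≤ (#M : ℝ) := by positivity
    have h4 : X ≤ 1024 * #(I \ bad) := by linarith
    have h5 : (1024 : ℝ) * 2 ^ 62 = 2 ^ 72 := by norm_num
    rw [← h5]
    linarith

end RingRouting

section Flow

variable {V ι μ : Type} [Fintype V] [DecidableEq V] [Fintype ι] [DecidableEq ι] [Fintype μ]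

/-- Indicator capacities of an edge set. -/
def ue (E : Finset (Sym2 V)) : Sym2 V → ℕ := fun e => if e ∈ E then 1 else 0

lemma ue_mono {E E' : Finset (Sym2 V)} (h : E ⊆ E') (e : Sym2 V) : ue E e ≤ ue E' e := by
  unfold ue
  by_cases he : e ∈ E
  · rw [if_pos he, if_pos (h he)]
  · rw [if_neg he]; omega

lemma ue_add_le {E E₁ E₂ : Finset (Sym2 V)} (h₁ : E₁ ⊆ E) (h₂ : E₂ ⊆ E) (h : Disjoint E₁ E₂)
    (e : Sym2 V) : ue E₁ e + ue E₂ e ≤ ue E e := by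
  unfold ue
  by_cases h3 : e ∈ E₁
  · rw [if_pos h3, if_neg (disjoint_left.1 h h3), if_pos (h₁ h3)]
  · rw [if_neg h3, zero_add]; exact ue_mono h₂ e

lemma cut_ue_eq (E : Finset (Sym2 V)) (A : Finset V) :
    cut (ue E) A = #{e ∈ E | sep A e = 1} := by
  rw [card_filter, cut, ← sum_subset (subset_univ E)]
  · refine sum_congr rfl fun e he => ?_
    have := sep_le_one A e
    rw [ue, if_pos he]
    by_cases h : sep A e = 1
    · rw [if_pos h, h]
    · rw [if_neg h]; omega
  · intro e _ he
    rw [ue, if_neg he, zero_mul]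

lemma cut_ue_le {E E' : Finset (Sym2 V)} {A A' : Finset V}
    (h : ∀ e ∈ E, sep A e = 1 → e ∈ E' ∧ sep A' e = 1) : cut (ue E) A ≤ cut (ue E') A' := by
  rw [cut_ue_eq, cut_ue_eq]
  refine card_le_card fun e he => ?_
  obtain ⟨h1, h2⟩ := mem_filter.1 he
  exact mem_filter.2 (h e h1 h2)

variable {s t : ι → V} (dm : μ → ι) (wk : ∀ i, (⊤ : SimpleGraph V).Walk (s (dm i)) (t (dm i)))

/-- Feasible fractional flow inside the edge set `E`. -/
structure IsFlow (E : Finset (Sym2 V)) (y : μ → ℝ) : Prop where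
  nonneg : ∀ i, 0 ≤ y i
  inside : ∀ i, y i ≠ 0 → ∀ e ∈ (wk i).edges, e ∈ E
  cap : ∀ e, ∑ i, y i * ((wk i).edges.count e : ℝ) ≤ 1
  dem : ∀ d, ∑ i with dm i = d, y i ≤ 1

/-- Total flow of each demand. -/
noncomputable def zof (y : μ → ℝ) (d : ι) : ℝ := ∑ i with dm i = d, y i

variable {dm wk}

lemma sum_zof_mul (y : μ → ℝ) (g : ι → ℝ) : ∑ d, zof dm y d * g d = ∑ i, y i * g (dm i) := by
  have : ∀ d, zof dm y d * g d = ∑ i with dm i = d, y i * g (dm i) := by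
    intro d
    rw [zof, sum_mul]
    exact sum_congr rfl fun i hi => by rw [(mem_filter.1 hi).2]
  simp only [this]
  exact sum_fiberwise_of_maps_to (fun _ _ => mem_univ _) _

lemma sum_zof (y : μ → ℝ) : ∑ d, zof dm y d = ∑ i, y i := by
  simpa using sum_zof_mul (dm := dm) y (fun _ => 1)

lemma wload_zof (y : μ → ℝ) (A : Finset V) : wload s t (zof dm y) A =
    ∑ i, y i * ((ind (s (dm i)) A : ℝ) + ind (t (dm i)) A) :=
  sum_zof_mul y fun d => (ind (s d) A : ℝ) + ind (t d) A

namespace IsFlow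

variable {E : Finset (Sym2 V)} {y : μ → ℝ}

lemma zof_nonneg (h : IsFlow dm wk E y) (d : ι) : 0 ≤ zof dm y d := sum_nonneg fun i _ => h.nonneg i

lemma exists_of_zof_pos (h : 0 < zof dm y d) : ∃ i, y i ≠ 0 ∧ dm i = d := by
  by_contra hcon
  push Not at hcon
  have : zof dm y d = 0 := sum_eq_zero fun i hi => by
    by_contra h2
    exact hcon i h2 (mem_filter.1 hi).2
  linarith

lemma cross_le (h : IsFlow dm wk E y) (A : Finset V) :
    ∑ i, y i * ((∑ e, (wk i).edges.count e * sep A e : ℕ) : ℝ) ≤ cut (ue E) A := by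
  have h1 : ∑ i, y i * ((∑ e, (wk i).edges.count e * sep A e : ℕ) : ℝ) =
      ∑ e, (∑ i, y i * ((wk i).edges.count e : ℝ)) * sep A e := by
    simp only [Nat.cast_sum, Nat.cast_mul, mul_sum, sum_mul]
    rw [sum_comm]
    exact sum_congr rfl fun _ _ => sum_congr rfl fun _ _ => by ring
  rw [h1, cut]
  push_cast
  refine sum_le_sum fun e _ => mul_le_mul_of_nonneg_right ?_ (by positivity)
  by_cases he : e ∈ E
  · rw [ue, if_pos he]; exact_mod_cast h.cap e
  · rw [ue, if_neg he]
    refine le_of_eq ?_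
    rw [Nat.cast_zero]
    refine sum_eq_zero fun i _ => ?_
    by_cases hy : y i = 0
    · rw [hy, zero_mul]
    · rw [List.count_eq_zero_of_not_mem (fun h2 => he (h.inside i hy e h2))]; simp

lemma demand_cut (h : IsFlow dm wk E y) (A : Finset V) :
    ∑ d, zof dm y d * sep A s(s d, t d) ≤ cut (ue E) A := by
  rw [sum_zof_mul y fun d => (sep A s(s d, t d) : ℝ)]
  refine le_trans (sum_le_sum fun i _ => ?_) (h.cross_le A)
  exact mul_le_mul_of_nonneg_left (by exact_mod_cast (sep_le_walk (wk i) A).1) (h.nonneg i)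

lemma route (h : IsFlow dm wk E y) {d : ι} (hd : 0 < zof dm y d) :
    ∃ w, IsRoute (s d) (t d) w ∧ ∀ e ∉ E, w e = 0 := by
  obtain ⟨i, hi, rfl⟩ := exists_of_zof_pos hd
  exact ⟨fun e => (wk i).edges.count e, ⟨wk i, fun e => le_rfl⟩, fun e he =>
    List.count_eq_zero_of_not_mem (fun h2 => he (h.inside i hi e h2))⟩

lemma route_le (h : IsFlow dm wk E y) {d : ι} (hd : 0 < zof dm y d) :
    ∃ w, IsRoute (s d) (t d) w ∧ ∀ e, w e ≤ ue E e := by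
  obtain ⟨w, h1, h2⟩ := h.route hd
  refine ⟨_, h1.min_one, fun e => ?_⟩
  unfold ue
  by_cases he : e ∈ E
  · rw [if_pos he]; omega
  · rw [if_neg he, h2 e he]; omega

lemma filter (h : IsFlow dm wk E y) (P : μ → Prop) [DecidablePred P] {E' : Finset (Sym2 V)}
    (hE : ∀ i, y i ≠ 0 → P i → ∀ e ∈ (wk i).edges, e ∈ E') :
    IsFlow dm wk E' (fun i => if P i then y i else 0) := by
  have hle : ∀ i, (if P i then y i else 0) ≤ y i := fun i => by
    by_cases hp : P i
    · rw [if_pos hp]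
    · rw [if_neg hp]; exact h.nonneg i
  refine ⟨fun i => ?_, fun i hi => ?_, fun e => ?_, fun d => ?_⟩
  · by_cases hp : P i
    · rw [if_pos hp]; exact h.nonneg i
    · rw [if_neg hp]
  · by_cases hp : P i
    · rw [if_pos hp] at hi; exact hE i hi hp
    · rw [if_neg hp] at hi; exact absurd rfl hi
  · exact (sum_le_sum fun i _ => mul_le_mul_of_nonneg_right (hle i) (by positivity)).trans (h.cap e)
  · exact (sum_le_sum fun i _ => hle i).trans (h.dem d)

lemma zof_filter_le (h : IsFlow dm wk E y) (P : μ → Prop) [DecidablePred P] (d : ι) :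
    zof dm (fun i => if P i then y i else 0) d ≤ zof dm y d := by
  refine sum_le_sum fun i _ => ?_
  by_cases hp : P i
  · rw [if_pos hp]
  · rw [if_neg hp]; exact h.nonneg i

end IsFlow

variable (s t)

/-- The demands in `I` can be routed with congestion three inside `E`. -/
def Route3 (E : Finset (Sym2 V)) (I : Finset ι) : Prop :=
  ∃ f : ι → Sym2 V → ℕ, (∀ d ∈ I, IsRoute (s d) (t d) (f d)) ∧ ∀ e, ∑ d ∈ I, f d e ≤ 3 * ue E e

variable {s t}

lemma Route3.mono {E E' : Finset (Sym2 V)} {I : Finset ι} (h : Route3 s t E I) (hE : E ⊆ E') :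
    Route3 s t E' I := by
  obtain ⟨f, h1, h2⟩ := h
  exact ⟨f, h1, fun e => (h2 e).trans (Nat.mul_le_mul_left _ (ue_mono hE e))⟩

lemma Route3.union {E E₁ E₂ : Finset (Sym2 V)} {I₁ I₂ : Finset ι} (h₁ : Route3 s t E₁ I₁)
    (h₂ : Route3 s t E₂ I₂) (hE₁ : E₁ ⊆ E) (hE₂ : E₂ ⊆ E) (hE : Disjoint E₁ E₂)
    (hI : Disjoint I₁ I₂) : Route3 s t E (I₁ ∪ I₂) := by
  obtain ⟨f₁, h1, h2⟩ := h₁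
  obtain ⟨f₂, h3, h4⟩ := h₂
  refine ⟨fun d => if d ∈ I₁ then f₁ d else f₂ d, fun d hd => ?_, fun e => ?_⟩
  · by_cases hd1 : d ∈ I₁
    · dsimp only; rw [if_pos hd1]; exact h1 d hd1
    · dsimp only; rw [if_neg hd1]; exact h3 d ((mem_union.1 hd).resolve_left hd1)
  · rw [sum_union hI]
    have e1 : ∑ d ∈ I₁, (if d ∈ I₁ then f₁ d else f₂ d) e = ∑ d ∈ I₁, f₁ d e :=
      sum_congr rfl fun d hd => by rw [if_pos hd]
    have e2 : ∑ d ∈ I₂, (if d ∈ I₁ then f₁ d else f₂ d) e = ∑ d ∈ I₂, f₂ d e :=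
      sum_congr rfl fun d hd => by rw [if_neg (disjoint_right.1 hI hd)]
    have := ue_add_le hE₁ hE₂ hE e
    have := h2 e
    have := h4 e
    dsimp only
    rw [e1, e2]
    omega

lemma Route3.of_le_one {E : Finset (Sym2 V)} {I : Finset ι} {f : ι → Sym2 V → ℕ}
    (h : ∀ d ∈ I, IsRoute (s d) (t d) (f d)) (hf : ∀ e, ∑ d ∈ I, f d e ≤ ue E e) :
    Route3 s t E I := ⟨f, h, fun e => (hf e).trans (by omega)⟩

/-- A walk not crossing a set stays on one side. -/
lemma walk_side {H : SimpleGraph V} {a b : V} (w : H.Walk a b) (A : Finset V)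
    (h : ∀ e ∈ w.edges, sep A e = 0) : ∀ v ∈ w.support, (v ∈ A ↔ a ∈ A) := by
  induction w with
  | nil => intro v hv; simp at hv; rw [hv]
  | @cons a b c hab w ih =>
    intro v hv
    rw [SimpleGraph.Walk.support_cons, List.mem_cons] at hv
    rcases hv with rfl | hv
    · rfl
    · rw [ih (fun e he => h e (by simp [he])) v hv]
      have := h s(a, b) (by simp)
      rw [sep_mk] at this
      by_cases h1 : a ∈ A ↔ b ∈ A
      · exact h1.symm
      · rw [if_neg h1] at this; omega

lemma walk_edges_side {H : SimpleGraph V} {a b : V} (w : H.Walk a b) (A : Finset V)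
    (h : ∀ e ∈ w.edges, sep A e = 0) : ∀ e ∈ w.edges, ∀ v ∈ e, (v ∈ A ↔ a ∈ A) := by
  intro e he v hv
  induction e with | _ x y =>
  rw [Sym2.mem_iff] at hv
  rcases hv with rfl | rfl
  · exact walk_side w A h _ (w.fst_mem_support_of_mem_edges he)
  · exact walk_side w A h _ (w.snd_mem_support_of_mem_edges he)

end Flow

section Star

variable {V ι : Type} [Fintype V] [DecidableEq V] [Fintype ι] [DecidableEq ι]

open Classical in
/-- Routing through a single well linked vertex. -/
theorem star_routing (u : Sym2 V → ℕ) (s t : ι → V) (r : V) (z : ι → ℝ) (hz : ∀ d, 0 ≤ z d)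
    (hz1 : ∀ d, z d ≤ 1) (ε : ℝ) (hε : 0 < ε) (hε1 : ε ≤ 1)
    (hL : ∀ A, r ∉ A → ε * wload s t z A ≤ cut u A)
    (hw : ∀ d, 0 < z d → ∃ w, IsRoute (s d) (t d) w ∧ ∀ e, w e ≤ u e) :
    ∃ (I : Finset ι) (f : ι → Sym2 V → ℕ), (∀ d ∈ I, 0 < z d ∧ IsRoute (s d) (t d) (f d)) ∧
      (∀ e, ∑ d ∈ I, f d e ≤ u e) ∧ ε * ∑ d, z d ≤ 128 * #I := by
  set X := ∑ d, z d with hX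
  have hX0 : 0 ≤ X := sum_nonneg fun d _ => hz d
  by_cases hXp : X = 0
  · exact ⟨∅, fun _ _ => 0, by simp, by simp, by simp [hXp]⟩
  by_cases hM : ε * X < 64
  · obtain ⟨d, hd⟩ : ∃ d, 0 < z d := by
      by_contra hcon
      push Not at hcon
      exact hXp (sum_eq_zero fun d _ => le_antisymm (hcon d) (hz d))
    obtain ⟨w, h1, h2⟩ := hw d hd
    refine ⟨{d}, fun _ => w, ?_, ?_, ?_⟩
    · intro d' hd'; rw [mem_singleton] at hd'; subst hd'; exact ⟨hd, h1⟩
    · intro e; simpa using h2 e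
    · rw [card_singleton]; push_cast; linarith
  push Not at hM
  obtain ⟨M0, hM0⟩ : ∃ M0 : ℕ, M0 = ⌊ε * X / 64⌋₊ := ⟨_, rfl⟩
  have hM1 : (M0 : ℝ) ≤ ε * X / 64 := hM0 ▸ Nat.floor_le (by positivity)
  have hM2 : ε * X / 64 < M0 + 1 := hM0 ▸ Nat.lt_floor_add_one _
  have hM3 : 1 ≤ M0 := hM0 ▸ Nat.le_floor (by push_cast; linarith)
  have hM3' : (1 : ℝ) ≤ M0 := by exact_mod_cast hM3
  rcases extendable_or_local u s t (fun A => r ∉ A) (fun A B hAB hB hA => hB (hAB hA)) (4 * M0 + 2)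
    (fun A B hA hB _ => by simp only [mem_union, not_or]; exact ⟨hA, hB⟩) (by simp) z hz hz1 ε hε
        hε1
    hL hw M0 hM1 le_rfl with ⟨I, f, h1, h2, h3⟩ | h
  · exact ⟨I, f, h2, h3, by linarith⟩
  · obtain ⟨I, h1, h2, h3, -⟩ := greedy_balanced (∅ : Finset Unit) (fun _ _ => False) z hz
        (fun _ => 0)
      (by simp) (Linkable u s t (fun A => r ∉ A)) (fun A _ => by simp [load]) (X / 2)
      (by positivity) M0 (fun I h1 h2 => by
        refine (h I h1 h2).trans (le_of_eq ?_)
        refine sum_congr ?_ fun _ _ => rfl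
        congr!) M0 le_rfl (fun _ => 0) (fun _ => le_rfl)
    obtain ⟨φ, ψ, p, q, g, g', -, -, -, h4, h5, h6⟩ := exists_links (κ := Option (ι × Bool)) u s t I
      ((I ×ˢ univ).image some) (fun _ => {r}) (fun A => by
        by_cases hr : r ∈ A
        · have : ((I ×ˢ (univ : Finset Bool)).image some).filter (fun _ => ({r} ∩ A).Nonempty) =
              (I ×ˢ (univ : Finset Bool)).image some := by
            refine filter_true_of_mem fun _ _ => ⟨r, ?_⟩
            simp [hr]
          rw [this, card_image_of_injective _ (Option.some_injective _), card_product]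
          have := load_le s t I A
          simp only [Finset.card_univ, Fintype.card_bool]
          omega
        · exact (h1 A hr).trans (by omega))
    refine ⟨I, fun d e => g d e + g' d e, fun d hd => ⟨h3 d hd, ?_⟩, h6, ?_⟩
    · have e1 : p d = r := by simpa using (h4 d hd).2.1
      have e2 : q d = r := by simpa using (h5 d hd).2.1
      have h7 := (h4 d hd).2.2
      have h8 := (h5 d hd).2.2
      rw [e1] at h7
      rw [e2] at h8
      exact h7.trans h8.symm
    · rw [h2]; linarith

end Star

section Reach

variable {V D : Type} [Fintype V] [DecidableEq V] [Fintype D] [DecidableEq D]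

/-- The edge set of a set of darts. -/
def edg (θ : Equiv.Perm D) (vt : D → V) (K : Finset D) : Finset (Sym2 V) :=
  K.image fun d => s(vt d, vt (θ d))

variable {σ θ : Equiv.Perm D} {vt : D → V}

lemma mem_edg {K : Finset D} {e : Sym2 V} : e ∈ edg θ vt K ↔ ∃ d ∈ K, s(vt d, vt (θ d)) = e := by
  simp [edg]

lemma edg_mono {K K' : Finset D} (h : K ⊆ K') : edg θ vt K ⊆ edg θ vt K' := image_subset_image h

lemma exists_dart (hinv : ∀ d, θ (θ d) = d) {K : Finset D} (hKθ : ∀ d ∈ K, θ d ∈ K) {a b : V}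
    (h : s(a, b) ∈ edg θ vt K) : ∃ d ∈ K, vt d = a ∧ vt (θ d) = b := by
  obtain ⟨d, hd, he⟩ := mem_edg.1 h
  rw [Sym2.eq_iff] at he
  rcases he with he | he
  · exact ⟨d, hd, he⟩
  · exact ⟨θ d, hKθ d hd, he.2, by rw [hinv]; exact he.1⟩

/-- Darts with both ends in a vertex set. -/
def within (θ : Equiv.Perm D) (vt : D → V) (K : Finset D) (S : Finset V) : Finset D :=
  K.filter fun d => vt d ∈ S ∧ vt (θ d) ∈ S

lemma within_subset (K : Finset D) (S : Finset V) : within θ vt K S ⊆ K := filter_subset _ _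

lemma within_closed (hinv : ∀ d, θ (θ d) = d) {K : Finset D} (hKθ : ∀ d ∈ K, θ d ∈ K)
    (S : Finset V) :
    ∀ d ∈ within θ vt K S, θ d ∈ within θ vt K S := by
  intro d hd
  obtain ⟨h1, h2, h3⟩ := mem_filter.1 hd
  exact mem_filter.2 ⟨hKθ d h1, h3, by rwa [hinv]⟩

lemma mem_edg_within {K : Finset D} {S : Finset V} {e : Sym2 V} :
    e ∈ edg θ vt (within θ vt K S) ↔ e ∈ edg θ vt K ∧ ∀ v ∈ e, v ∈ S := by
  constructor
  · intro h
    obtain ⟨d, hd, rfl⟩ := mem_edg.1 h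
    obtain ⟨h1, h2, h3⟩ := mem_filter.1 hd
    refine ⟨mem_edg.2 ⟨d, h1, rfl⟩, fun v hv => ?_⟩
    rw [Sym2.mem_iff] at hv
    rcases hv with rfl | rfl
    · exact h2
    · exact h3
  · rintro ⟨h1, h2⟩
    obtain ⟨d, hd, rfl⟩ := mem_edg.1 h1
    exact mem_edg.2 ⟨d, mem_filter.2 ⟨hd, h2 _ (by simp), h2 _ (by simp)⟩, rfl⟩

lemma disjoint_edg_within {K : Finset D} {S S' : Finset V} (h : Disjoint S S') :
    Disjoint (edg θ vt (within θ vt K S)) (edg θ vt (within θ vt K S')) := by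
  rw [disjoint_left]
  intro e h1 h2
  rw [mem_edg_within] at h1 h2
  induction e with | _ a b =>
  exact disjoint_left.1 h (h1.2 a (by simp)) (h2.2 a (by simp))

open Classical in
/-- Vertices reachable from `r` outside `S`. -/
noncomputable def reach (θ : Equiv.Perm D) (vt : D → V) (K : Finset D) (S : Finset V) (r : V) :
    Finset V := univ.filter fun v => Relation.ReflTransGen (LiveStep θ vt K S) r v

lemma mem_reach {K : Finset D} {S : Finset V} {r v : V} :
    v ∈ reach θ vt K S r ↔ Relation.ReflTransGen (LiveStep θ vt K S) r v := by
  simp [reach]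

lemma self_mem_reach {K : Finset D} {S : Finset V} {r : V} : r ∈ reach θ vt K S r :=
  mem_reach.2 .refl

lemma reach_step {K : Finset D} {S : Finset V} {r : V} {d : D} (hd : d ∈ K)
    (h : vt d ∈ reach θ vt K S r) (h' : vt (θ d) ∉ S) : vt (θ d) ∈ reach θ vt K S r := by
  rw [mem_reach] at h ⊢
  exact h.tail ⟨h', d, hd, rfl, rfl⟩

lemma reach_anti {K : Finset D} {S S' : Finset V} {r : V} (h : S ⊆ S') :
    reach θ vt K S' r ⊆ reach θ vt K S r := by
  intro v hv
  rw [mem_reach] at hv ⊢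
  have hle : LiveStep θ vt K S' ≤ LiveStep θ vt K S :=
    fun a b ⟨h1, h2⟩ => ⟨fun h3 => h1 (h h3), h2⟩
  exact Relation.ReflTransGen.mono hle _ _ hv

lemma reach_avoid {K : Finset D} {S : Finset V} {r : V} (hr : r ∉ S) {v : V}
    (h : v ∈ reach θ vt K S r) : v ∉ S := by
  rw [mem_reach] at h
  cases h with
  | refl => exact hr
  | tail _ h => exact h.1

lemma reach_induct {K : Finset D} {S : Finset V} {r : V} (T : Finset V) (hr : r ∈ T)
    (h : ∀ d ∈ K, vt d ∈ T → vt (θ d) ∉ S → vt (θ d) ∈ T) : reach θ vt K S r ⊆ T := by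
  intro v hv
  rw [mem_reach] at hv
  induction hv with
  | refl => exact hr
  | tail _ h' ih =>
    obtain ⟨h1, d, hd, rfl, rfl⟩ := h'
    exact h d hd ih h1

/-- Fill the part of the complement of `A` that is not reachable from `r`. -/
noncomputable def fill (θ : Equiv.Perm D) (vt : D → V) (K : Finset D) (A : Finset V) (r : V) :
    Finset V := reach θ vt K ∅ r \ reach θ vt K A r

/-- The outside of `S` is connected to `r` near `S`. -/
def Cocon (θ : Equiv.Perm D) (vt : D → V) (K : Finset D) (r : V) (S : Finset V) : Prop :=
  S ⊆ reach θ vt K ∅ r ∧ r ∉ S ∧ ∀ d ∈ K, vt d ∉ S → vt (θ d) ∈ S → vt d ∈ reach θ vt K S r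

variable {K : Finset D}

lemma subset_fill {A : Finset V} {r : V} (hA : A ⊆ reach θ vt K ∅ r) (hr : r ∉ A) :
    A ⊆ fill θ vt K A r := fun _ hv =>
  mem_sdiff.2 ⟨hA hv, fun h => reach_avoid hr h hv⟩

lemma fill_sep (hinv : ∀ d, θ (θ d) = d) (hKθ : ∀ d ∈ K, θ d ∈ K) {A : Finset V} {r : V}
    (hr : r ∉ A) {e : Sym2 V} (he : e ∈ edg θ vt K)
    (h : sep (fill θ vt K A r) e = 1) : sep A e = 1 := by
  have key : ∀ a b, s(a, b) ∈ edg θ vt K → a ∈ fill θ vt K A r → b ∉ fill θ vt K A r →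
      a ∈ A ∧ b ∉ A := by
    intro a b hab ha hb
    obtain ⟨d, hd, rfl, rfl⟩ := exists_dart hinv hKθ hab
    obtain ⟨h1, h2⟩ := mem_sdiff.1 ha
    have h3 := reach_step hd h1 (notMem_empty _)
    have h4 : vt (θ d) ∈ reach θ vt K A r := by
      by_contra h5
      exact hb (mem_sdiff.2 ⟨h3, h5⟩)
    have h5 : vt d ∈ A := by
      by_contra h5
      apply h2
      have := reach_step (hKθ d hd) h4 (by rwa [hinv])
      rwa [hinv] at this
    exact ⟨h5, reach_avoid hr h4⟩
  induction e with | _ a b =>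
  rw [sep_mk] at h ⊢
  have h' : ¬(a ∈ fill θ vt K A r ↔ b ∈ fill θ vt K A r) := by
    intro h1; rw [if_pos h1] at h; omega
  rw [if_neg]
  by_cases h1 : a ∈ fill θ vt K A r
  · have := key a b he h1 (by tauto)
    tauto
  · have := key b a (by rwa [Sym2.eq_swap]) (by tauto) h1
    tauto

lemma fill_cocon (hinv : ∀ d, θ (θ d) = d) (hKθ : ∀ d ∈ K, θ d ∈ K) {A : Finset V} {r : V} :
    Cocon θ vt K r (fill θ vt K A r) := by
  have havoid : ∀ v ∈ reach θ vt K A r, v ∉ fill θ vt K A r := fun v h1 h2 => (mem_sdiff.1 h2).2 h1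
  refine ⟨sdiff_subset, havoid r self_mem_reach, fun d hd h1 h2 => ?_⟩
  have h3 : vt d ∈ reach θ vt K ∅ r := by
    have := reach_step (hKθ d hd) (mem_sdiff.1 h2).1 (notMem_empty _)
    rwa [hinv] at this
  have h4 : vt d ∈ reach θ vt K A r := by
    by_contra h4
    exact h1 (mem_sdiff.2 ⟨h3, h4⟩)
  have : reach θ vt K A r ⊆ reach θ vt K A r ∩ reach θ vt K (fill θ vt K A r) r := by
    refine reach_induct _ (mem_inter.2 ⟨self_mem_reach, self_mem_reach⟩) fun d hd h h' => ?_
    obtain ⟨h5, h6⟩ := mem_inter.1 h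
    have h7 := reach_step hd h5 h'
    exact mem_inter.2 ⟨h7, reach_step hd h6 (havoid _ h7)⟩
  exact (mem_inter.1 (this h4)).2

lemma Cocon.compl_subset (hinv : ∀ d, θ (θ d) = d) (hKθ : ∀ d ∈ K, θ d ∈ K) {S : Finset V} {r : V}
    (h : Cocon θ vt K r S) : reach θ vt K ∅ r ⊆ S ∪ reach θ vt K S r := by
  refine reach_induct _ (mem_union_right _ self_mem_reach) fun d hd h1 _ => ?_
  by_cases h2 : vt (θ d) ∈ S
  · exact mem_union_left _ h2
  · refine mem_union_right _ ?_
    rcases mem_union.1 h1 with h3 | h3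
    · exact h.2.2 _ (hKθ d hd) h2 (by rwa [hinv])
    · exact reach_step hd h3 h2

lemma Cocon.fill_subset (hinv : ∀ d, θ (θ d) = d) (hKθ : ∀ d ∈ K, θ d ∈ K) {S A : Finset V} {r : V}
    (h : Cocon θ vt K r S) (hA : A ⊆ S) : fill θ vt K A r ⊆ S := by
  intro v hv
  obtain ⟨h1, h2⟩ := mem_sdiff.1 hv
  exact (mem_union.1 (h.compl_subset hinv hKθ h1)).resolve_right fun h3 => h2 (reach_anti hA h3)

lemma Cocon.exists_cross (h : Cocon θ vt K r S) (hS : S.Nonempty) :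
    ∃ d ∈ K, vt d ∉ S ∧ vt (θ d) ∈ S := by
  by_contra hcon
  push Not at hcon
  obtain ⟨v, hv⟩ := hS
  have := reach_induct (Sᶜ) (by simpa using h.2.1) (fun d hd h1 _ => by
    simpa using hcon d hd (by simpa using h1)) (h.1 hv)
  simp at this
  exact this hv

end Reach

section Disc

variable {V ι μ D : Type} [Fintype V] [DecidableEq V] [Fintype ι] [DecidableEq ι] [Fintype μ]
  [Fintype D] [DecidableEq D] {σ θ : Equiv.Perm D} {vt : D → V} {K : Finset D}
  {s t : ι → V} {dm : μ → ι} {wk : ∀ i, (⊤ : SimpleGraph V).Walk (s (dm i)) (t (dm i))}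
  {y : μ → ℝ}

lemma ind_inter (v : V) (A B : Finset V) : ind v (A ∩ B) = ind v A * ind v B := by
  simp only [ind, mem_inter]
  by_cases h1 : v ∈ A <;> by_cases h2 : v ∈ B <;> simp [h1, h2]

/-- The walk stays on the side of `S` given by its first vertex, and this side is `A`. -/
def Stays (wk : ∀ i, (⊤ : SimpleGraph V).Walk (s (dm i)) (t (dm i))) (S A : Finset V) (i : μ) :
    Prop :=
  s (dm i) ∈ A ∧ ∀ e ∈ (wk i).edges, sep S e = 0

lemma Stays.mem {S : Finset V} {i : μ} (h : Stays wk S S i) :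
    t (dm i) ∈ S ∧ ∀ e ∈ (wk i).edges, ∀ v ∈ e, v ∈ S :=
  ⟨(walk_side _ S h.2 _ (wk i).end_mem_support).2 h.1, fun e he v hv =>
    (walk_edges_side _ S h.2 e he v hv).2 h.1⟩

lemma Stays.compl_mem {S : Finset V} {i : μ} (h : Stays wk S Sᶜ i) :
    t (dm i) ∈ Sᶜ ∧ ∀ e ∈ (wk i).edges, ∀ v ∈ e, v ∈ Sᶜ := by
  have h1 := Finset.mem_compl.1 h.1
  simp only [Finset.mem_compl]
  exact ⟨fun h2 => h1 ((walk_side _ S h.2 _ (wk i).end_mem_support).1 h2), fun e he v hv h2 =>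
    h1 ((walk_edges_side _ S h.2 e he v hv).1 h2)⟩

/-- Number of crossings of the `i`-th walk with `S`. -/
def crossings (wk : ∀ i, (⊤ : SimpleGraph V).Walk (s (dm i)) (t (dm i))) (S : Finset V) (i : μ) :
    ℕ :=
  ∑ e, (wk i).edges.count e * sep S e

lemma crossings_pos {S : Finset V} {i : μ} (h : ¬ ∀ e ∈ (wk i).edges, sep S e = 0) :
    1 ≤ crossings wk S i := by
  push Not at h
  obtain ⟨e, he, h1⟩ := h
  have h2 : 1 ≤ (wk i).edges.count e * sep S e :=
    Nat.mul_pos (List.count_pos_iff.2 he) (by omega)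
  exact h2.trans (single_le_sum (f := fun e => (wk i).edges.count e * sep S e) (fun _ _ => by omega)
    (mem_univ e))

open Classical in
lemma ends_le {S : Finset V} {i : μ} :
    ind (s (dm i)) S + ind (t (dm i)) S ≤
        2 * (if Stays wk S S i then 1 else 0) + crossings wk S i := by
  have h1 := ind_le_one (s (dm i)) S
  have h2 := ind_le_one (t (dm i)) S
  by_cases h : Stays wk S S i
  · rw [if_pos h]; omega
  rw [if_neg h]
  obtain ⟨h3, h4⟩ := sep_le_walk (wk i) S
  rw [sep_mk] at h3 h4
  change _ ≤ crossings wk S i at h3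
  change crossings wk S i % 2 = _ at h4
  by_cases h5 : s (dm i) ∈ S <;> by_cases h6 : t (dm i) ∈ S
  · have h7 := crossings_pos (wk := wk) (S := S) (i := i) (fun h8 => h ⟨h5, h8⟩)
    simp [h5, h6] at h4
    omega
  all_goals simp [ind, h5, h6] at h3 ⊢; try omega

open Classical in
/-- Bounds on the flow touching a violating set. -/
lemma IsFlow.touch {E : Finset (Sym2 V)} (h : IsFlow dm wk E y) (S : Finset V) :
    wload s t (zof dm y) S ≤ 2 * (∑ i, if Stays wk S S i then y i else 0) + cut (ue E) S ∧
    ∑ i, y i ≤ (∑ i, if Stays wk S Sᶜ i then y i else 0) + wload s t (zof dm y) S +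
      cut (ue E) S := by
  have hc := h.cross_le S
  rw [wload_zof]
  constructor
  · refine le_trans ?_ (add_le_add_right hc _)
    rw [mul_sum, ← sum_add_distrib]
    refine sum_le_sum fun i _ => ?_
    have h1 := ends_le (wk := wk) (S := S) (i := i)
    have h2 : ((ind (s (dm i)) S : ℝ) + ind (t (dm i)) S) ≤
        2 * (if Stays wk S S i then 1 else 0) + (crossings wk S i : ℝ) := by exact_mod_cast h1
    have h3 := mul_le_mul_of_nonneg_left h2 (h.nonneg i)
    refine h3.trans (le_of_eq ?_)
    by_cases h4 : Stays wk S S i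
    · simp only [if_pos h4, crossings]; push_cast; ring
    · simp only [if_neg h4, crossings]; push_cast; ring
  · rw [add_assoc]
    refine le_trans ?_ (add_le_add_right (add_le_add_right hc _) _)
    rw [← sum_add_distrib, ← sum_add_distrib]
    refine sum_le_sum fun i _ => ?_
    have hy := h.nonneg i
    by_cases h1 : Stays wk S Sᶜ i
    · rw [if_pos h1]
      have : 0 ≤ y i * ((ind (s (dm i)) S : ℝ) + ind (t (dm i)) S) := by positivity
      have : 0 ≤ y i * ((∑ e, (wk i).edges.count e * sep S e : ℕ) : ℝ) := by positivity
      linarith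
    · rw [if_neg h1, zero_add, ← mul_add]
      refine le_mul_of_one_le_right hy ?_
      have h3 : 1 ≤ ind (s (dm i)) S + ind (t (dm i)) S + crossings wk S i := by
        by_cases h4 : s (dm i) ∈ S
        · have : ind (s (dm i)) S = 1 := if_pos h4
          omega
        · have := crossings_pos (wk := wk) (S := S) (i := i) fun h5 => h1
              ⟨Finset.mem_compl.2 h4, h5⟩
          omega
      exact_mod_cast h3

lemma wload_nonneg (z : ι → ℝ) (hz : ∀ d, 0 ≤ z d) (A : Finset V) : 0 ≤ wload s t z A :=
  sum_nonneg fun d _ => mul_nonneg (hz d) (by positivity)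

lemma wload_mono_set (z : ι → ℝ) (hz : ∀ d, 0 ≤ z d) {A B : Finset V} (h : A ⊆ B) :
    wload s t z A ≤ wload s t z B :=
  sum_le_sum fun d _ => mul_le_mul_of_nonneg_left
    (by exact_mod_cast add_le_add (ind_mono _ h) (ind_mono _ h)) (hz d)

/-- Loads of a flow confined to `S`. -/
lemma wload_inter {y' : μ → ℝ} (hy : ∀ i, y' i ≠ 0 → Stays wk S S i) (A : Finset V) :
    wload s t (zof dm y') A = wload s t (zof dm y') (A ∩ S) := by
  rw [wload_zof, wload_zof]
  refine sum_congr rfl fun i _ => ?_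
  by_cases h : y' i = 0
  · rw [h, zero_mul, zero_mul]
  · have h1 := hy i h
    have h2 : ind (s (dm i)) S = 1 := if_pos h1.1
    have h3 : ind (t (dm i)) S = 1 := if_pos h1.mem.1
    rw [ind_inter, ind_inter, h2, h3, mul_one, mul_one]

lemma wload_mono_z {z z' : ι → ℝ} (h : ∀ d, z d ≤ z' d) (A : Finset V) :
    wload s t z A ≤ wload s t z' A :=
  sum_le_sum fun d _ => mul_le_mul_of_nonneg_right (h d) (by positivity)

end Disc

section Disc

variable {V ι μ D : Type} [Fintype V] [DecidableEq V] [Fintype ι] [DecidableEq ι] [Fintype μ]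
  [Fintype D] [DecidableEq D] {σ θ : Equiv.Perm D} {vt : D → V} {K : Finset D}
  {s t : ι → V} {dm : μ → ι} {wk : ∀ i, (⊤ : SimpleGraph V).Walk (s (dm i)) (t (dm i))}
  {y : μ → ℝ}

open Classical in
/-- The part of a flow that stays inside `S`. -/
lemma IsFlow.stays (hy : IsFlow dm wk (edg θ vt K) y) (S : Finset V) :
    IsFlow dm wk (edg θ vt (within θ vt K S)) (fun i => if Stays wk S S i then y i else 0) :=
  hy.filter _ fun i h1 h2 e he => mem_edg_within.2 ⟨hy.inside i h1 e he, h2.mem.2 e he⟩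

open Classical in
lemma zof_filter_pos {y : μ → ℝ} {P : μ → Prop} {d : ι}
    (h : 0 < zof dm (fun i => if P i then y i else 0) d) : ∃ i, P i ∧ y i ≠ 0 ∧ dm i = d := by
  obtain ⟨i, h1, h2⟩ := IsFlow.exists_of_zof_pos h
  by_cases hP : P i
  · rw [if_pos hP] at h1; exact ⟨i, hP, h1, h2⟩
  · rw [if_neg hP] at h1; exact absurd rfl h1

open Classical in
lemma cross_le_cut (hE : Emb σ θ vt) (S : Finset V) :
    #{d ∈ K | vt d ∉ S ∧ vt (θ d) ∈ S} ≤ cut (ue (edg θ vt K)) S := by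
  rw [cut_ue_eq]
  refine card_le_card_of_injOn (fun d => s(vt d, vt (θ d))) ?_ ?_
  · intro d hd
    obtain ⟨h1, h2, h3⟩ := mem_filter.1 (mem_coe.1 hd)
    refine mem_coe.2 (mem_filter.2 ⟨mem_edg.2 ⟨d, h1, rfl⟩, ?_⟩)
    simp [h2, h3]
  · intro d hd d' hd' h
    obtain ⟨h1, h2, h3⟩ := mem_filter.1 (mem_coe.1 hd)
    obtain ⟨h1', h2', h3'⟩ := mem_filter.1 (mem_coe.1 hd')
    rcases hE.simple d d' h with h4 | h4
    · exact h4
    · rw [h4] at h2; exact absurd h3' h2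

open Classical in
lemma component_case (hE : Emb σ θ vt) (hKθ : ∀ d ∈ K, θ d ∈ K)
    (hy : IsFlow dm wk (edg θ vt K) y) (r : V)
    (hnv : ∀ A, r ∉ A → A ⊆ reach θ vt K ∅ r → 1 / 2 * wload s t (zof dm y) A ≤ cut
        (ue (edg θ vt K)) A) :
    ∃ I, Route3 s t (edg θ vt (within θ vt K (reach θ vt K ∅ r))) I ∧
      (∀ d ∈ I, ∃ i, y i ≠ 0 ∧ dm i = d) ∧
      ∑ i, (if Stays wk (reach θ vt K ∅ r) (reach θ vt K ∅ r) i then y i else 0) ≤ 2 ^ 72 * #I := by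
  set W := reach θ vt K ∅ r with hW
  have hyS := hy.stays W
  set y' : μ → ℝ := fun i => if Stays wk W W i then y i else 0 with hy'
  obtain ⟨I, f, h1, h2, h3⟩ := star_routing (ue (edg θ vt (within θ vt K W))) s t r (zof dm y')
    hyS.zof_nonneg hyS.dem (1 / 2) (by norm_num) (by norm_num) (fun A hA => by
      have e1 := wload_inter (wk := wk) (S := W) (y' := y') (fun i hi => by
        by_contra h; exact hi (if_neg h)) A
      rw [e1]
      have h1 := wload_mono_z (s := s) (t := t) (hy.zof_filter_le (Stays wk W W)) (A ∩ W)
      have h2 := hnv (A ∩ W) (fun h => hA (mem_inter.1 h).1) inter_subset_right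
      have h3 : cut (ue (edg θ vt K)) (A ∩ W) ≤ cut (ue (edg θ vt (within θ vt K W))) A := by
        refine cut_ue_le fun e he hs => ?_
        have key : ∀ a b, s(a, b) ∈ edg θ vt K → a ∈ A ∩ W → b ∉ A ∩ W → b ∈ W ∧ b ∉ A := by
          intro a b hab ha hb
          obtain ⟨d, hd, rfl, rfl⟩ := exists_dart hE.inv hKθ hab
          have := reach_step hd (mem_inter.1 ha).2 (notMem_empty _)
          exact ⟨this, fun h => hb (mem_inter.2 ⟨h, this⟩)⟩
        induction e with | _ a b =>
        rw [sep_mk] at hs ⊢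
        have h' : ¬(a ∈ A ∩ W ↔ b ∈ A ∩ W) := by
          intro h1; rw [if_pos h1] at hs; omega
        have h5 : (a ∈ W ∧ b ∈ W) ∧ ¬(a ∈ A ↔ b ∈ A) := by
          by_cases h1 : a ∈ A ∩ W
          · have := key a b he h1 (by tauto)
            have := mem_inter.1 h1
            tauto
          · have := key b a (by rwa [Sym2.eq_swap]) (by tauto) h1
            have : b ∈ A ∩ W := by tauto
            have := mem_inter.1 this
            tauto
        refine ⟨mem_edg_within.2 ⟨he, fun v hv => ?_⟩, if_neg h5.2⟩
        rw [Sym2.mem_iff] at hv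
        rcases hv with rfl | rfl
        exacts [h5.1.1, h5.1.2]
      have h4 : ((cut (ue (edg θ vt K)) (A ∩ W) : ℕ) : ℝ) ≤
          cut (ue (edg θ vt (within θ vt K W))) A := by
        exact_mod_cast h3
      have : wload s t (zof dm y') (A ∩ W) ≤ wload s t (zof dm y) (A ∩ W) := h1
      linarith)
    (fun d hd => hyS.route_le hd)
  refine ⟨I, Route3.of_le_one (fun d hd => (h1 d hd).2) h2, fun d hd => ?_, ?_⟩
  · obtain ⟨i, -, h4⟩ := zof_filter_pos (h1 d hd).1
    exact ⟨i, h4⟩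
  · rw [sum_zof] at h3
    have : (0 : ℝ) ≤ #I := by positivity
    linarith

open Classical in
lemma violating_case (hE : Emb σ θ vt) (hKθ : ∀ d ∈ K, θ d ∈ K) (hK : Planar σ θ K)
    (hy : IsFlow dm wk (edg θ vt K) y) (r : V) (S : Finset V) (hS : Cocon θ vt K r S)
    (hv : cut (ue (edg θ vt K)) S < 1 / 2 * wload s t (zof dm y) S)
    (hmin : ∀ S', Cocon θ vt K r S' →
      cut (ue (edg θ vt K)) S' < 1 / 2 * wload s t (zof dm y) S' → #S ≤ #S') :
    ∃ I, Route3 s t (edg θ vt (within θ vt K S)) I ∧ (∀ d ∈ I, ∃ i, y i ≠ 0 ∧ dm i = d) ∧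
      ∑ i, (if Stays wk S S i then y i else 0) ≤ 2 ^ 72 * #I := by
  have hyS := hy.stays S
  obtain ⟨ht, -⟩ := hy.touch S
  set y' : μ → ℝ := fun i => if Stays wk S S i then y i else 0 with hy'
  have hSne : S.Nonempty := by
    rw [nonempty_iff_ne_empty]
    rintro rfl
    have : wload s t (zof dm y) ∅ = 0 := by simp [wload, ind]
    rw [this] at hv
    have : (0 : ℝ) ≤ cut (ue (edg θ vt K)) ∅ := by positivity
    linarith
  obtain ⟨d0, hd0, hd1, hd2⟩ := hS.exists_cross hSne
  obtain ⟨R, hR1, hR2, hR3⟩ := exists_peel hE hKθ hK hS.2.1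
    (fun d h1 h2 h3 => mem_reach.1 (hS.2.2 d h1 h2 h3)) ⟨d0, hd0, hd1, hd2⟩
  have hN := cross_le_cut (K := K) hE S
  obtain ⟨I, f, h1, h2, h3⟩ := ring_routing R (edg θ vt (within θ vt K S)) hR1
    (ue (edg θ vt (within θ vt K S))) rfl s t (zof dm y') hyS.zof_nonneg hyS.dem (by
      rw [sum_zof]
      have : (R.length : ℝ) ≤ cut (ue (edg θ vt K)) S := by
        rw [hR2]
        refine le_trans (le_of_eq ?_) (Nat.cast_le.2 hN)
        congr!
      linarith) (fun d hd => hyS.route hd) hyS.demand_cut (fun A hA => by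
      have e1 := wload_inter (wk := wk) (S := S) (y' := y') (fun i hi => by
        by_contra h; exact hi (if_neg h)) A
      rw [e1]
      have h1 : wload s t (zof dm y') (A ∩ S) ≤ wload s t (zof dm y) (A ∩ S) :=
        wload_mono_z (s := s) (t := t) (hy.zof_filter_le (Stays wk S S)) (A ∩ S)
      have h2 : 1 / 2 * wload s t (zof dm y) (A ∩ S) ≤ cut (ue (edg θ vt K)) (A ∩ S) := by
        by_contra hcon
        push Not at hcon
        have hAr : r ∉ A ∩ S := fun h => hS.2.1 (mem_inter.1 h).2
        have hsub : A ∩ S ⊆ reach θ vt K ∅ r := inter_subset_right.trans hS.1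
        have h3 := hmin (fill θ vt K (A ∩ S) r) (fill_cocon hE.inv hKθ) (by
          have h4 := wload_mono_set (s := s) (t := t) _ hy.zof_nonneg (subset_fill hsub hAr)
          have h5 : cut (ue (edg θ vt K)) (fill θ vt K (A ∩ S) r) ≤ cut (ue (edg θ vt K)) (A ∩ S) :=
            cut_ue_le fun e he h => ⟨he, fill_sep hE.inv hKθ hAr he h⟩
          have h6 : ((cut (ue (edg θ vt K)) (fill θ vt K (A ∩ S) r) : ℕ) : ℝ) ≤
            cut (ue (edg θ vt K)) (A ∩ S) := by exact_mod_cast h5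
          linarith)
        have h4 := eq_of_subset_of_card_le (hS.fill_subset hE.inv hKθ inter_subset_right) h3
        have h5 : vt (θ d0) ∈ R := (hR3 _).2 ⟨hd2, θ d0, hKθ _ hd0, rfl, by rwa [hE.inv]⟩
        have h6 : vt (θ d0) ∈ reach θ vt K (A ∩ S) r :=
          reach_step hd0 (reach_anti inter_subset_right (hS.2.2 d0 hd0 hd1 hd2))
            fun h => hA _ h5 (mem_inter.1 h).1
        rw [← h4] at hd2
        exact (mem_sdiff.1 hd2).2 h6
      have h3 : cut (ue (edg θ vt K)) (A ∩ S) ≤ cut (ue (edg θ vt (within θ vt K S))) A := by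
        refine cut_ue_le fun e he hs => ?_
        have key : ∀ a b, s(a, b) ∈ edg θ vt K → a ∈ A ∩ S → b ∉ A ∩ S → b ∈ S ∧ b ∉ A := by
          intro a b hab ha hb
          obtain ⟨d, hd, rfl, rfl⟩ := exists_dart hE.inv hKθ hab
          have : vt (θ d) ∈ S := by
            by_contra h
            exact hA _ ((hR3 _).2 ⟨(mem_inter.1 ha).2, d, hd, rfl, h⟩) (mem_inter.1 ha).1
          exact ⟨this, fun h => hb (mem_inter.2 ⟨h, this⟩)⟩
        induction e with | _ a b =>
        rw [sep_mk] at hs ⊢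
        have h' : ¬(a ∈ A ∩ S ↔ b ∈ A ∩ S) := by
          intro h1; rw [if_pos h1] at hs; omega
        have h5 : (a ∈ S ∧ b ∈ S) ∧ ¬(a ∈ A ↔ b ∈ A) := by
          by_cases h1 : a ∈ A ∩ S
          · have := key a b he h1 (by tauto)
            have := mem_inter.1 h1
            tauto
          · have := key b a (by rwa [Sym2.eq_swap]) (by tauto) h1
            have : b ∈ A ∩ S := by tauto
            have := mem_inter.1 this
            tauto
        refine ⟨mem_edg_within.2 ⟨he, fun v hv => ?_⟩, if_neg h5.2⟩
        rw [Sym2.mem_iff] at hv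
        rcases hv with rfl | rfl
        exacts [h5.1.1, h5.1.2]
      have h4 : ((cut (ue (edg θ vt K)) (A ∩ S) : ℕ) : ℝ) ≤
          cut (ue (edg θ vt (within θ vt K S))) A := by
        exact_mod_cast h3
      linarith)
  refine ⟨I, ⟨f, fun d hd => (h1 d hd).2, h2⟩, fun d hd => ?_, ?_⟩
  · obtain ⟨i, -, h4⟩ := zof_filter_pos (h1 d hd).1
    exact ⟨i, h4⟩
  · rwa [sum_zof] at h3

open Classical in
lemma disc_step (hE : Emb σ θ vt) (hKθ : ∀ d ∈ K, θ d ∈ K) (hK : Planar σ θ K)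
    (hy : IsFlow dm wk (edg θ vt K) y) (i₀ : μ) (hi₀ : y i₀ ≠ 0) :
    ∃ (S : Finset V) (I : Finset ι), Route3 s t (edg θ vt (within θ vt K S)) I ∧
      (∀ d ∈ I, ∃ i, y i ≠ 0 ∧ dm i = d) ∧
      0 < ∑ i, (if Stays wk S S i then y i else 0) ∧
      ∑ i, (if Stays wk S S i then y i else 0) ≤ 2 ^ 72 * #I ∧
      ∑ i, y i ≤ ∑ i, (if Stays wk S Sᶜ i then y i else 0) +
        6 * ∑ i, (if Stays wk S S i then y i else 0) := by
  set r := s (dm i₀) with hr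
  by_cases hv : ∃ S, Cocon θ vt K r S ∧ cut (ue (edg θ vt K)) S < 1 / 2 * wload s t (zof dm y) S
  · obtain ⟨S, hS, hSmin⟩ := exists_min_image (univ.filter fun S => Cocon θ vt K r S ∧
      cut (ue (edg θ vt K)) S < 1 / 2 * wload s t (zof dm y) S) card (by
        obtain ⟨S, hS⟩ := hv; exact ⟨S, mem_filter.2 ⟨mem_univ _, hS⟩⟩)
    obtain ⟨-, hS1, hS2⟩ := mem_filter.1 hS
    obtain ⟨I, h1, h2, h3⟩ := violating_case (wk := wk) hE hKθ hK hy r S hS1 hS2 fun S' h1 h2 =>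
      hSmin S' (mem_filter.2 ⟨mem_univ _, h1, h2⟩)
    obtain ⟨h4, h5⟩ := hy.touch S
    have h6 : (0 : ℝ) ≤ cut (ue (edg θ vt K)) S := by positivity
    exact ⟨S, I, h1, h2, by linarith, h3, by linarith⟩
  · obtain ⟨I, h1, h2, h3⟩ := component_case (wk := wk) hE hKθ hy r fun A hA hAW => by
      by_contra hcon
      push Not at hcon
      refine hv ⟨_, fill_cocon hE.inv hKθ (A := A), ?_⟩
      have h4 := wload_mono_set (s := s) (t := t) _ hy.zof_nonneg (subset_fill hAW hA)
      have h5 : cut (ue (edg θ vt K)) (fill θ vt K A r) ≤ cut (ue (edg θ vt K)) A :=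
        cut_ue_le fun e he h => ⟨he, fill_sep hE.inv hKθ hA he h⟩
      have h6 : ((cut (ue (edg θ vt K)) (fill θ vt K A r) : ℕ) : ℝ) ≤
        cut (ue (edg θ vt K)) A := by exact_mod_cast h5
      linarith
    have h0 : ∀ e ∈ edg θ vt K, sep (reach θ vt K ∅ r) e = 0 := by
      intro e he
      induction e with | _ a b =>
      obtain ⟨d, hd, rfl, rfl⟩ := exists_dart hE.inv hKθ he
      rw [sep_mk, if_pos]
      refine ⟨fun h => reach_step hd h (notMem_empty _), fun h => ?_⟩
      have := reach_step (hKθ d hd) h (notMem_empty _)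
      rwa [hE.inv] at this
    refine ⟨_, I, h1, h2, ?_, h3, ?_⟩
    · have h4 : Stays wk (reach θ vt K ∅ r) (reach θ vt K ∅ r) i₀ :=
        ⟨self_mem_reach, fun e he => h0 e (hy.inside i₀ hi₀ e he)⟩
      have h5 : y i₀ ≤
          ∑ i, (if Stays wk (reach θ vt K ∅ r) (reach θ vt K ∅ r) i then y i else 0) := by
        refine le_trans (le_of_eq (if_pos h4).symm) (single_le_sum
          (f := fun i => if Stays wk (reach θ vt K ∅ r) (reach θ vt K ∅ r) i then y i else 0)
          (fun i _ => ?_) (mem_univ i₀))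
        by_cases h : Stays wk (reach θ vt K ∅ r) (reach θ vt K ∅ r) i
        · simp only [if_pos h]; exact hy.nonneg i
        · simp only [if_neg h]; exact le_rfl
      exact lt_of_lt_of_le (lt_of_le_of_ne (hy.nonneg _) hi₀.symm) h5
    · rw [mul_sum, ← sum_add_distrib]
      refine sum_le_sum fun i _ => ?_
      have hyi := hy.nonneg i
      by_cases hi : y i = 0
      · simp [hi]
      have h7 : ∀ e ∈ (wk i).edges, sep (reach θ vt K ∅ r) e = 0 :=
        fun e he => h0 e (hy.inside i hi e he)
      by_cases h8 : s (dm i) ∈ reach θ vt K ∅ r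
      · rw [if_neg (fun h => Finset.mem_compl.1 h.1 h8), if_pos ⟨h8, h7⟩]; linarith
      · rw [if_pos ⟨Finset.mem_compl.2 h8, h7⟩, if_neg (fun h => h8 h.1)]; linarith

open Classical in
/-- Constant-factor routing for planar pieces. -/
theorem planar_routing (hE : Emb σ θ vt) (N : ℕ) : ∀ (K : Finset D) (y : μ → ℝ),
    (∀ d ∈ K, θ d ∈ K) → Planar σ θ K → IsFlow dm wk (edg θ vt K) y → #{i | y i ≠ 0} ≤ N →
    ∃ I : Finset ι, (∀ d ∈ I, ∃ i, y i ≠ 0 ∧ dm i = d) ∧ Route3 s t (edg θ vt K) I ∧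
      ∑ i, y i ≤ 2 ^ 75 * #I := by
  induction N with
  | zero =>
    intro K y _ _ hy hN
    have h0 : ∀ i, y i = 0 := by
      intro i
      by_contra h
      have : i ∈ ({i | y i ≠ 0} : Finset μ) := mem_filter.2 ⟨mem_univ _, h⟩
      have := card_pos.2 ⟨i, this⟩
      omega
    exact ⟨∅, by simp, ⟨fun _ _ => 0, by simp, by simp⟩, by simp [h0]⟩
  | succ N ih =>
    intro K y hKθ hK hy hN
    by_cases h0 : ∀ i, y i = 0
    · exact ⟨∅, by simp, ⟨fun _ _ => 0, by simp, by simp⟩, by simp [h0]⟩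
    push Not at h0
    obtain ⟨i₀, hi₀⟩ := h0
    obtain ⟨S, I, h1, h2, h3, h4, h5⟩ := disc_step hE hKθ hK hy i₀ hi₀
    have hy2 : IsFlow dm wk (edg θ vt (within θ vt K Sᶜ))
        (fun i => if Stays wk S Sᶜ i ∧ dm i ∉ I then y i else 0) :=
      hy.filter _ fun i h6 h7 e he => mem_edg_within.2 ⟨hy.inside i h6 e he, h7.1.compl_mem.2 e he⟩
    obtain ⟨I', h6, h7, h8⟩ := ih _ _ (within_closed hE.inv hKθ Sᶜ)
      (hK.mono (within_subset _ _)) hy2 (by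
        have hlt : #{i | (if Stays wk S Sᶜ i ∧ dm i ∉ I then y i else 0) ≠ 0} < #{i | y i ≠ 0} := by
          refine card_lt_card ?_
          rw [ssubset_iff_of_subset]
          · obtain ⟨i, -, hi⟩ := exists_ne_zero_of_sum_ne_zero h3.ne'
            by_cases hi2 : Stays wk S S i
            · rw [if_pos hi2] at hi
              refine ⟨i, mem_filter.2 ⟨mem_univ _, hi⟩, fun h => (mem_filter.1 h).2 (if_neg ?_)⟩
              exact fun h => Finset.mem_compl.1 h.1.1 hi2.1
            · rw [if_neg hi2] at hi; exact absurd rfl hi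
          · intro i hi
            refine mem_filter.2 ⟨mem_univ _, fun h => (mem_filter.1 hi).2 ?_⟩
            rw [h]; exact ite_self _
        omega)
    have h9 : ∀ d ∈ I', ∃ i, (Stays wk S Sᶜ i ∧ dm i ∉ I) ∧ y i ≠ 0 ∧ dm i = d := by
      intro d hd
      obtain ⟨i, hi, hid⟩ := h6 d hd
      by_cases hi2 : Stays wk S Sᶜ i ∧ dm i ∉ I
      · rw [if_pos hi2] at hi; exact ⟨i, hi2, hi, hid⟩
      · rw [if_neg hi2] at hi; exact absurd rfl hi
    have hdisj : Disjoint I I' := by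
      rw [disjoint_right]
      intro d hd
      obtain ⟨i, hi, -, rfl⟩ := h9 d hd
      exact hi.2
    refine ⟨I ∪ I', fun d hd => ?_, h1.union h7 (edg_mono (within_subset _ _))
      (edg_mono (within_subset _ _)) (disjoint_edg_within disjoint_compl_right) hdisj, ?_⟩
    · rcases mem_union.1 hd with h | h
      · exact h2 d h
      · obtain ⟨i, -, hi⟩ := h9 d h
        exact ⟨i, hi⟩
    · have h10 : ∑ i, (if Stays wk S Sᶜ i then y i else 0) ≤
          ∑ i, (if Stays wk S Sᶜ i ∧ dm i ∉ I then y i else 0) + ∑ d ∈ I, zof dm y d := by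
        have e : ∑ d ∈ I, zof dm y d = ∑ i, if dm i ∈ I then y i else 0 := by
          have := sum_zof_mul (dm := dm) y (fun d => if d ∈ I then 1 else 0)
          simpa using this
        rw [e, ← sum_add_distrib]
        refine sum_le_sum fun i _ => ?_
        have := hy.nonneg i
        by_cases h11 : Stays wk S Sᶜ i <;> by_cases h12 : dm i ∈ I <;> simp [h11, h12, this]
      have h11 : ∑ d ∈ I, zof dm y d ≤ #I := by
        refine (sum_le_sum fun d _ => hy.dem d).trans ?_
        simp
      rw [card_union_of_disjoint hdisj]
      push_cast
      have : (0 : ℝ) ≤ #I := by positivity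
      nlinarith

end Disc

section Orth

variable {D : Type} [Fintype D] [DecidableEq D] {σ θ : Equiv.Perm D} {K : Finset D}

lemma bd_add (σ : Equiv.Perm D) (c c' : D → ZMod 2) (d : D) :
    bd σ (fun e => c e + c' e) d = bd σ c d + bd σ c' d := by
  unfold bd; ring

/-- The boundary map as a linear map. -/
def bdL (σ : Equiv.Perm D) : (D → ZMod 2) →ₗ[ZMod 2] (D → ZMod 2) where
  toFun c := bd σ c
  map_add' c c' := by ext d; exact bd_add σ c c' d
  map_smul' a c := by ext d; simp [bd, mul_add]

/-- Symmetric functions supported on `K`. -/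
def symSub (θ : Equiv.Perm D) (K : Finset D) : Submodule (ZMod 2) (D → ZMod 2) where
  carrier := {b | (∀ d, b (θ d) = b d) ∧ ∀ d ∉ K, b d = 0}
  add_mem' := fun {a b} ha hb => ⟨fun d => by simp [ha.1 d, hb.1 d],
    fun d hd => by simp [ha.2 d hd, hb.2 d hd]⟩
  zero_mem' := ⟨fun _ => rfl, fun _ _ => rfl⟩
  smul_mem' := fun a b hb => ⟨fun d => by simp [hb.1 d], fun d hd => by simp [hb.2 d hd]⟩

/-- A functional vanishing on all cycles is a cut. -/
lemma exists_cut_of_orth (hinv : ∀ d, θ (θ d) = d) (hKθ : ∀ d ∈ K, θ d ∈ K) (φ : D → ZMod 2)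
    (h : ∀ c, IsZc σ θ K c → ∑ d, φ d * bd σ c d = 0) :
    ∃ w : D → ZMod 2, (∀ d, w (σ d) = w d) ∧ ∀ d ∈ K, φ d + φ (θ d) = w d + w (θ d) := by
  set A := LinearMap.range (bdL σ)
  set B := symSub θ K
  let Φ : Module.Dual (ZMod 2) (D → ZMod 2) :=
    { toFun := fun b => ∑ d, φ d * b d
      map_add' := fun b b' => by simp [mul_add, sum_add_distrib]
      map_smul' := fun a b => by simp [mul_sum, mul_left_comm] }
  have hΦ : Φ ∈ (A ⊓ B).dualAnnihilator := by
    rw [Submodule.mem_dualAnnihilator]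
    rintro b ⟨⟨c, rfl⟩, hb1, hb2⟩
    exact h c ⟨hb1, hb2⟩
  rw [Subspace.dualAnnihilator_inf_eq, Submodule.mem_sup] at hΦ
  obtain ⟨Φ₁, h1, Φ₂, h2, h12⟩ := hΦ
  rw [Submodule.mem_dualAnnihilator] at h1 h2
  have hφ : ∀ d, φ d = Φ₁ (Pi.single d 1) + Φ₂ (Pi.single d 1) := by
    intro d
    rw [← LinearMap.add_apply, h12]
    simp [Φ, Pi.single_apply]
  have z2 : ∀ a b : ZMod 2, a + b = 0 → a = b := by decide
  refine ⟨fun d => Φ₁ (Pi.single d 1), fun d => ?_, fun d hd => ?_⟩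
  · have := h1 _ ⟨Pi.single d 1, rfl⟩
    have e : bdL σ (Pi.single d 1) = Pi.single d 1 + Pi.single (σ d) 1 := by
      ext e
      simp only [bdL, LinearMap.coe_mk, AddHom.coe_mk, bd, Pi.add_apply, Pi.single_apply,
        Equiv.symm_apply_eq]
    rw [e, map_add] at this
    exact (z2 _ _ this).symm
  · have := h2 (Pi.single d 1 + Pi.single (θ d) 1) ⟨fun e => ?_, fun e he => ?_⟩
    · rw [map_add] at this
      rw [hφ d, hφ (θ d)]
      have := z2 _ _ this
      rw [this]
      show _ = Φ₁ (Pi.single d 1) + Φ₁ (Pi.single (θ d) 1)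
      generalize Φ₁ (Pi.single d 1) = a, Φ₁ (Pi.single (θ d) 1) = b, Φ₂ (Pi.single (θ d) 1) = c
      revert a b c; decide
    · have e1 : θ e = d ↔ e = θ d := ⟨fun h => by rw [← h, hinv], fun h => by rw [h, hinv]⟩
      have e2 : θ e = θ d ↔ e = d := θ.injective.eq_iff
      simp only [Pi.add_apply, Pi.single_apply, e1, e2]
      rw [add_comm]
    · have e1 : e ≠ d := fun h => he (h ▸ hd)
      have e2 : e ≠ θ d := fun h => he (h ▸ hKθ d hd)
      simp [e1, e2]

lemma exists_orientation (θ : Equiv.Perm D) (hne : ∀ d, θ d ≠ d) :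
    (∀ d, θ (θ d) = d) → ∃ O : Finset D, ∀ d, d ∈ O ↔ θ d ∉ O := by
  intro hinv
  let e := Fintype.equivFin D
  refine ⟨univ.filter fun d => e d < e (θ d), fun d => ?_⟩
  have : e d ≠ e (θ d) := fun h => hne d (e.injective h).symm
  simp only [mem_filter, mem_univ, true_and, hinv, not_lt]
  exact ⟨le_of_lt, fun h => lt_of_le_of_ne h this⟩

lemma sum_orientation {O : Finset D} (hO : ∀ d, d ∈ O ↔ θ d ∉ O) (hinv : ∀ d, θ (θ d) = d)
    (F : D → ZMod 2) : ∑ d, F d = ∑ d ∈ O, (F d + F (θ d)) := by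
  rw [sum_add_distrib, ← sum_add_sum_compl O F]
  congr 1
  refine (sum_bij' (fun d _ => θ d) (fun d _ => θ d) ?_ ?_ ?_ ?_ ?_)
  · intro d hd
    rw [mem_compl, hO, not_not] at hd; exact hd
  · intro d hd
    rw [mem_compl]; exact (hO d).1 hd
  · intro d _; exact hinv d
  · intro d _; exact hinv d
  · intro d _; simp only [hinv]

/-- The change of `g` along the face next to a dart. -/
def psi (σ θ : Equiv.Perm D) (g : D → ZMod 2) (d : D) : ZMod 2 := g (σ.symm d) + g (θ d)

lemma psi_symm (hinv : ∀ d, θ (θ d) = d) {g : D → ZMod 2} (hg : IsZc σ θ K g) (d : D) :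
    psi σ θ g (θ d) = psi σ θ g d := by
  have := hg.1 d
  unfold bd at this
  unfold psi
  rw [hinv]
  generalize g (θ d) = a, g (σ.symm (θ d)) = b, g d = x, g (σ.symm d) = y at *
  revert a b x y; decide

lemma IsFc.isZc (hinv : ∀ d, θ (θ d) = d) (hKθ : ∀ d ∈ K, θ d ∈ K) {l : D → ZMod 2}
    (h : IsFc σ θ K l) : IsZc σ θ K l := by
  refine ⟨fun d => ?_, h.1⟩
  by_cases hd : d ∈ K
  · have h1 := h.2 d hd
    have h2 := h.2 (θ d) (hKθ d hd)
    unfold bd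
    rw [h1, h2, hinv, add_comm]
  · rw [h.1 d hd, h.1]
    intro h'
    exact hd (hinv d ▸ hKθ _ h')

lemma psi_orth_face {O : Finset D} (hO : ∀ d, d ∈ O ↔ θ d ∉ O) (hinv : ∀ d, θ (θ d) = d)
    (hKθ : ∀ d ∈ K, θ d ∈ K) {g l : D → ZMod 2} (hg : IsZc σ θ K g) (hl : IsFc σ θ K l) :
    ∑ d ∈ O, psi σ θ g d * bd σ l d = 0 := by
  have h1 : ∑ d ∈ O, psi σ θ g d * bd σ l d =
      ∑ d, if d ∈ K then g (σ.symm d) * l (σ.symm d) + g (θ d) * l (θ d) else 0 := by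
    rw [sum_orientation hO hinv]
    refine sum_congr rfl fun d _ => ?_
    by_cases hd : d ∈ K
    · rw [if_pos hd, if_pos (hKθ d hd)]
      have e1 := hl.2 d hd
      have e2 := hl.2 (θ d) (hKθ d hd)
      have e3 := psi_symm hinv hg d
      rw [hinv] at e2
      unfold psi bd at *
      rw [hinv] at e3 ⊢
      rw [e1, e2]
      linear_combination (-(l d)) * e3
    · rw [if_neg hd, if_neg (fun h' => hd (hinv d ▸ hKθ _ h')), hl.1 d hd]; simp
  rw [h1]
  have h2 : ∀ d, (if d ∈ K then g (σ.symm d) * l (σ.symm d) + g (θ d) * l (θ d) else 0) =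
      g (σ.symm d) * l (σ.symm d) + (if d ∈ K then g (θ d) * l (θ d) else g d * l d) := by
    intro d
    by_cases hd : d ∈ K
    · rw [if_pos hd, if_pos hd]
    · rw [if_neg hd, if_neg hd]
      have e1 := hg.2 d hd
      have e2 := hl.1 d hd
      unfold bd at e1 e2
      generalize g d = a, g (σ.symm d) = b, l d = x, l (σ.symm d) = y at *
      revert a b x y; decide
  have h3 : ∑ d, (if d ∈ K then g (θ d) * l (θ d) else g d * l d) = ∑ d, g d * l d := by
    refine sum_bij' (fun d _ => if d ∈ K then θ d else d) (fun d _ => if d ∈ K then θ d else d)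
      ?_ ?_ ?_ ?_ ?_
    · intro d _; exact mem_univ _
    · intro d _; exact mem_univ _
    · intro d _
      by_cases hd : d ∈ K
      · simp only [if_pos hd, if_pos (hKθ d hd), hinv]
      · simp only [if_neg hd]
    · intro d _
      by_cases hd : d ∈ K
      · simp only [if_pos hd, if_pos (hKθ d hd), hinv]
      · simp only [if_neg hd]
    · intro d _
      by_cases hd : d ∈ K
      · simp only [if_pos hd]
      · simp only [if_neg hd]
  rw [sum_congr rfl (fun d _ => h2 d), sum_add_distrib, h3,
    Equiv.sum_comp σ.symm (fun d => g d * l d)]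
  exact CharTwo.add_self_eq_zero _

/-- Nondegeneracy of the intersection form. -/
lemma bounds_of_psi_orth {O : Finset D} (hO : ∀ d, d ∈ O ↔ θ d ∉ O) (hinv : ∀ d, θ (θ d) = d)
    (hKθ : ∀ d ∈ K, θ d ∈ K) {g : D → ZMod 2} (hg : IsZc σ θ K g)
    (h : ∀ c, IsZc σ θ K c → ∑ d ∈ O, psi σ θ g d * bd σ c d = 0) :
    ∃ l, IsFc σ θ K l ∧ ∀ d, bd σ l d = bd σ g d := by
  obtain ⟨w, h1, h2⟩ := exists_cut_of_orth hinv hKθ (fun d => if d ∈ O then psi σ θ g d else 0)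
    (fun c hc => by
      refine Eq.trans ?_ (h c hc)
      rw [← sum_subset (subset_univ O)]
      · exact sum_congr rfl fun d hd => by rw [if_pos hd]
      · intro d _ hd; rw [if_neg hd, zero_mul])
  have h3 : ∀ d, w (σ.symm d) = w d := fun d => by
    have := h1 (σ.symm d); rw [Equiv.apply_symm_apply] at this; exact this.symm
  have h4 : ∀ d, bd σ (fun e => g e + w e) d = bd σ g d := by
    intro d
    rw [bd_add]
    unfold bd
    rw [h3, CharTwo.add_self_eq_zero, add_zero]
  refine ⟨fun e => g e + w e, ⟨fun d hd => (h4 d).trans (hg.2 d hd), fun d hd => ?_⟩, h4⟩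
  have h5 := h2 d hd
  have h6 := psi_symm hinv hg d
  have h7 : psi σ θ g d = w d + w (θ d) := by
    rw [← h5]
    by_cases hd2 : d ∈ O
    · rw [if_pos hd2, if_neg ((hO d).1 hd2), add_zero]
    · have : θ d ∈ O := by by_contra h8; exact hd2 ((hO d).2 h8)
      rw [if_neg hd2, if_pos this, zero_add, h6]
  unfold psi at h7
  dsimp only
  rw [h3]
  clear h5 h2 h6
  generalize g (σ.symm d) = a, g (θ d) = b, w d = x, w (θ d) = y at *
  revert a b x y; decide

end Orth

section Dual

variable {D : Type} [Fintype D] [DecidableEq D] {σ θ : Equiv.Perm D} {K : Finset D}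

/-- Consecutive corners of the same face of the subgraph `K`. -/
def faceRel (σ θ : Equiv.Perm D) (K : Finset D) (x y : D) : Prop :=
  (∃ d ∈ K, x = σ.symm d ∧ y = θ d) ∨ ∃ d ∉ K, x = d ∧ y = σ.symm d

/-- Faces of the subgraph `K`. -/
def Face (σ θ : Equiv.Perm D) (K : Finset D) : Type := Quot (faceRel σ θ K)

/-- The face containing a given corner. -/
def fc (σ θ : Equiv.Perm D) (K : Finset D) (d : D) : Face σ θ K := Quot.mk _ d

/-- The face on the other side of the edge of `d`. -/
def fl (σ θ : Equiv.Perm D) (K : Finset D) (d : D) : Face σ θ K := Quot.mk _ (σ.symm d)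

lemma fl_rev {d : D} (hd : d ∈ K) : fc σ θ K (θ d) = fl σ θ K d :=
  (Quot.sound (r := faceRel σ θ K) (Or.inl ⟨d, hd, rfl, rfl⟩)).symm

lemma fl_of_notMem {d : D} (hd : d ∉ K) : fl σ θ K d = fc σ θ K d :=
  (Quot.sound (r := faceRel σ θ K) (Or.inr ⟨d, hd, rfl, rfl⟩)).symm

lemma isFc_lift (ω : Face σ θ K → ZMod 2) : IsFc σ θ K (fun d => ω (fc σ θ K d)) := by
  refine ⟨fun d hd => ?_, fun d hd => ?_⟩
  · change ω (fc σ θ K d) + ω (fl σ θ K d) = 0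
    rw [fl_of_notMem hd]; exact CharTwo.add_self_eq_zero _
  · change ω (fl σ θ K d) = ω (fc σ θ K (θ d))
    rw [fl_rev hd]

lemma bd_lift (ω : Face σ θ K → ZMod 2) (d : D) :
    bd σ (fun d => ω (fc σ θ K d)) d = ω (fc σ θ K d) + ω (fl σ θ K d) := rfl

lemma IsFc.exists_lift {l : D → ZMod 2} (h : IsFc σ θ K l) :
    ∃ ω : Face σ θ K → ZMod 2, ∀ d, l d = ω (fc σ θ K d) := by
  refine ⟨Quot.lift l ?_, fun _ => rfl⟩
  rintro x y (⟨d, hd, rfl, rfl⟩ | ⟨d, hd, rfl, rfl⟩)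
  · exact h.2 d hd
  · have := h.1 x hd
    unfold bd at this
    generalize l x = a, l (σ.symm x) = b at *
    revert a b; decide

/-- Walks in the dual graph crossing the darts of a list, all in `E`. -/
def DW (σ θ : Equiv.Perm D) (K E : Finset D) : Face σ θ K → List D → Face σ θ K → Prop
  | a, [], b => a = b
  | a, d :: l, b => d ∈ E ∧ fl σ θ K d = a ∧ DW σ θ K E (fc σ θ K d) l b

/-- Intersection parity of a dual walk with a cycle. -/
def wt (σ : Equiv.Perm D) (c : D → ZMod 2) (l : List D) : ZMod 2 := (l.map (bd σ c)).sum

lemma wt_nil (c : D → ZMod 2) : wt σ c [] = 0 := rfl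

lemma wt_cons (c : D → ZMod 2) (d : D) (l : List D) :
    wt σ c (d :: l) = bd σ c d + wt σ c l := by simp [wt]

lemma wt_append (c : D → ZMod 2) (l l' : List D) :
    wt σ c (l ++ l') = wt σ c l + wt σ c l' := by simp [wt]

variable {E : Finset D}

lemma dw_append {l l' : List D} : ∀ {a b : Face σ θ K},
    DW σ θ K E a (l ++ l') b ↔ ∃ m, DW σ θ K E a l m ∧ DW σ θ K E m l' b := by
  induction l with
  | nil => intro a b; simp [DW]
  | cons d l ih =>
    intro a b
    simp only [List.cons_append, DW, ih]
    constructor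
    · rintro ⟨h1, h2, m, h3, h4⟩; exact ⟨m, ⟨h1, h2, h3⟩, h4⟩
    · rintro ⟨m, ⟨h1, h2, h3⟩, h4⟩; exact ⟨h1, h2, m, h3, h4⟩

lemma DW.append {l l' : List D} {a b c : Face σ θ K} (h : DW σ θ K E a l b)
    (h' : DW σ θ K E b l' c) : DW σ θ K E a (l ++ l') c := dw_append.2 ⟨b, h, h'⟩

lemma DW.mono {E' : Finset D} (hE : E ⊆ E') {l : List D} : ∀ {a b : Face σ θ K},
    DW σ θ K E a l b → DW σ θ K E' a l b := by
  induction l with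
  | nil => intro a b h; exact h
  | cons d l ih => intro a b h; exact ⟨hE h.1, h.2.1, ih h.2.2⟩

lemma DW.mem {l : List D} : ∀ {a b : Face σ θ K}, DW σ θ K E a l b → ∀ d ∈ l, d ∈ E := by
  induction l with
  | nil => intro a b _ d hd; simp at hd
  | cons e l ih =>
    intro a b h d hd
    rcases List.mem_cons.1 hd with rfl | hd
    · exact h.1
    · exact ih h.2.2 d hd

lemma fl_eq_rev (hinv : ∀ d, θ (θ d) = d) (hKθ : ∀ d ∈ K, θ d ∈ K) {d : D} (hd : d ∈ K) :
    fl σ θ K (θ d) = fc σ θ K d := by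
  rw [← fl_rev (hKθ d hd), hinv]

lemma DW.rev (hinv : ∀ d, θ (θ d) = d) (hKθ : ∀ d ∈ K, θ d ∈ K) (hEθ : ∀ d ∈ E, θ d ∈ E)
    (hEK : E ⊆ K) {l : List D} : ∀ {a b : Face σ θ K},
    DW σ θ K E a l b → DW σ θ K E b (l.reverse.map θ) a := by
  induction l with
  | nil => intro a b h; exact h.symm
  | cons d l ih =>
    rintro a b ⟨h1, h2, h3⟩
    rw [List.reverse_cons, List.map_append]
    refine (ih h3).append ⟨hEθ d h1, fl_eq_rev hinv hKθ (hEK h1), ?_⟩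
    change fc σ θ K (θ d) = a
    rw [fl_rev (hEK h1), h2]

lemma wt_rev {c : D → ZMod 2} (hc : IsZc σ θ K c) (l : List D) :
    wt σ c (l.reverse.map θ) = wt σ c l := by
  unfold wt
  rw [List.map_map, List.map_reverse, List.sum_reverse]
  congr 1
  exact List.map_congr_left fun d _ => hc.1 d

lemma wt_congr {c c' : D → ZMod 2} {l : List D} (h : ∀ d ∈ l, bd σ c d = bd σ c' d) :
    wt σ c l = wt σ c' l := by
  unfold wt
  rw [List.map_congr_left h]

lemma wt_lift (ω : Face σ θ K → ZMod 2) {l : List D} : ∀ {a b : Face σ θ K},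
    DW σ θ K E a l b → wt σ (fun d => ω (fc σ θ K d)) l = ω a + ω b := by
  induction l with
  | nil =>
    intro a b h
    have h : a = b := h
    subst h
    exact (CharTwo.add_self_eq_zero _).symm
  | cons d l ih =>
    rintro a b ⟨h1, h2, h3⟩
    rw [wt_cons, ih h3, bd_lift, h2]
    generalize ω (fc σ θ K d) = x, ω a = y, ω b = z
    revert x y z; decide

lemma IsFc.wt_closed {l : D → ZMod 2} (h : IsFc σ θ K l) {p : List D} {a : Face σ θ K}
    (hp : DW σ θ K E a p a) : wt σ l p = 0 := by
  obtain ⟨ω, hω⟩ := h.exists_lift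
  obtain rfl : l = fun d => ω (fc σ θ K d) := funext hω
  rw [wt_lift ω hp]; exact CharTwo.add_self_eq_zero _

/-- A cycle crossing every closed dual walk in `E` evenly bounds a set of faces, as far as `E` is
concerned. -/
lemma exists_potential (hinv : ∀ d, θ (θ d) = d) (hKθ : ∀ d ∈ K, θ d ∈ K)
    (hEθ : ∀ d ∈ E, θ d ∈ E) (hEK : E ⊆ K) {c : D → ZMod 2} (hc : IsZc σ θ K c)
    (h : ∀ a p, DW σ θ K E a p a → wt σ c p = 0) :
    ∃ l, IsFc σ θ K l ∧ ∀ d ∈ E, bd σ l d = bd σ c d := by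
  let S : Setoid (Face σ θ K) :=
    { r := fun a b => ∃ p, DW σ θ K E a p b
      iseqv := ⟨fun a => ⟨[], rfl⟩, fun ⟨p, hp⟩ => ⟨_, hp.rev hinv hKθ hEθ hEK⟩,
        fun ⟨p, hp⟩ ⟨q, hq⟩ => ⟨_, hp.append hq⟩⟩ }
  let rep : Face σ θ K → Face σ θ K := fun a => (Quotient.mk S a).out
  have hrep : ∀ a, ∃ p, DW σ θ K E (rep a) p a := fun a => Quotient.mk_out (s := S) a
  choose p hp using hrep
  refine ⟨_, isFc_lift (fun a => wt σ c (p a)), fun d hd => ?_⟩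
  have h1 : rep (fl σ θ K d) = rep (fc σ θ K d) := by
    have : Quotient.mk S (fl σ θ K d) = Quotient.mk S (fc σ θ K d) :=
      Quotient.sound (s := S) ⟨[d], hd, rfl, rfl⟩
    simp only [rep, this]
  have h2 := h _ _ (((hp (fl σ θ K d)).append (b := fl σ θ K d) (l' := [d])
    (c := fc σ θ K d) ⟨hd, rfl, rfl⟩).append
      (h1 ▸ (hp (fc σ θ K d)).rev hinv hKθ hEθ hEK))
  rw [wt_append, wt_append, wt_rev hc, wt_cons, wt_nil] at h2
  rw [bd_lift (fun a => wt σ c (p a))]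
  generalize wt σ c (p (fc σ θ K d)) = x, wt σ c (p (fl σ θ K d)) = y, bd σ c d = z at *
  revert x y z; decide

/-- A closed dual walk that crosses some cycle an odd number of times. -/
def Ess (σ θ : Equiv.Perm D) (K E : Finset D) (p : List D) : Prop :=
  (∃ a, DW σ θ K E a p a) ∧ ∃ c, IsZc σ θ K c ∧ wt σ c p ≠ 0

lemma Ess.mono {E' : Finset D} (hE : E ⊆ E') {p : List D} (h : Ess σ θ K E p) :
    Ess σ θ K E' p := ⟨h.1.imp fun _ ha => ha.mono hE, h.2⟩

lemma exists_ess (hinv : ∀ d, θ (θ d) = d) (hKθ : ∀ d ∈ K, θ d ∈ K) (h : ¬ Planar σ θ K) :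
    ∃ p, Ess σ θ K K p := by
  by_contra hno
  push Not at hno
  refine h fun c hc => ?_
  obtain ⟨l, hl, hlc⟩ := exists_potential hinv hKθ hKθ subset_rfl hc (fun a p hp => by
    by_contra h0
    exact hno p ⟨⟨a, hp⟩, c, hc, h0⟩)
  refine ⟨l, hl, fun d => ?_⟩
  by_cases hd : d ∈ K
  · exact hlc d hd
  · rw [hl.1 d hd, hc.2 d hd]

/-- A dual edge set that is a cocycle pairing nontrivially with some cycle contains a short
essential walk. -/
lemma exists_ess_of_cocycle {O : Finset D} (hO : ∀ d, d ∈ O ↔ θ d ∉ O)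
    (hinv : ∀ d, θ (θ d) = d) (hKθ : ∀ d ∈ K, θ d ∈ K)
    (hEθ : ∀ d ∈ E, θ d ∈ E) (hEK : E ⊆ K) (φ : D → ZMod 2) (hφ : ∀ d ∉ E, φ d = 0)
    (hl : ∀ l, IsFc σ θ K l → ∑ d ∈ O, φ d * bd σ l d = 0)
    {c : D → ZMod 2} (hc : IsZc σ θ K c) (hne : ∑ d ∈ O, φ d * bd σ c d ≠ 0) :
    ∃ p, Ess σ θ K E p ∧ 2 * p.length ≤ #E := by
  classical
  have hex : ∃ m, ∃ p, (∃ a, DW σ θ K E a p a) ∧ wt σ c p ≠ 0 ∧ p.length = m := by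
    by_contra hno
    push Not at hno
    obtain ⟨l, h1, h2⟩ := exists_potential hinv hKθ hEθ hEK hc (fun a p hp => by
      by_contra h0
      exact hno _ p ⟨a, hp⟩ h0 rfl)
    refine hne ((sum_congr rfl fun d _ => ?_).trans (hl l h1))
    by_cases hd : d ∈ E
    · rw [h2 d hd]
    · rw [hφ d hd, zero_mul, zero_mul]
  obtain ⟨p, ⟨a, hp⟩, hw, hlen⟩ := Nat.find_spec hex
  have hmin : ∀ q b, DW σ θ K E b q b → q.length < p.length → wt σ c q = 0 := by
    intro q b hq hlt
    by_contra h0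
    exact Nat.find_min hex (hlen ▸ hlt) ⟨q, ⟨b, hq⟩, h0, rfl⟩
  refine ⟨p, ⟨⟨a, hp⟩, c, hc, hw⟩, ?_⟩
  have hpw : p.Pairwise (fun d e => e ≠ d ∧ e ≠ θ d) := by
    rw [List.pairwise_iff_forall_sublist]
    intro e e' hs
    obtain ⟨r₁, r₂, rfl, h1, h2⟩ := List.cons_sublist_iff.1 hs
    obtain ⟨A, B, rfl⟩ := List.append_of_mem h1
    obtain ⟨B', C, rfl⟩ := List.append_of_mem (List.singleton_sublist.1 h2)
    obtain ⟨b, h3, h4⟩ := dw_append.1 hp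
    obtain ⟨b1, h5, h6, h7, h8⟩ := dw_append.1 h3
    obtain ⟨b2, h9, h10, h11, h12⟩ := dw_append.1 h4
    subst h7
    subst h11
    rw [wt_append, wt_append, wt_append, wt_cons, wt_cons] at hw
    have h13 : DW σ θ K E (fc σ θ K e) (B ++ B') (fl σ θ K e') := h8.append h9
    refine ⟨?_, ?_⟩
    · rintro rfl
      have k1 := hmin (e' :: (B ++ B')) (fl σ θ K e') ⟨h6, rfl, h13⟩ (by simp; omega)
      have k2 := hmin (A ++ e' :: C) a (h5.append ⟨h6, rfl, h12⟩) (by simp; omega)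
      rw [wt_cons, wt_append] at k1
      rw [wt_append, wt_cons] at k2
      apply hw
      linear_combination k1 + k2
    · rintro rfl
      rw [fl_eq_rev hinv hKθ (hEK h6)] at h13
      have k1 := hmin (B ++ B') (fc σ θ K e) h13 (by simp; omega)
      have h14 : fc σ θ K (θ e) = fl σ θ K e := fl_rev (hEK h6)
      rw [h14] at h12
      have k2 := hmin (A ++ C) a (h5.append h12) (by simp; omega)
      rw [wt_append] at k1 k2
      apply hw
      rw [hc.1 e]
      linear_combination k1 + k2 + CharTwo.add_self_eq_zero (bd σ c e)
  have hnd : p.Nodup := hpw.imp fun h => h.1.symm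
  have hdis : Disjoint p.toFinset (p.toFinset.image θ) := by
    rw [disjoint_left]
    intro d hd hd'
    rw [List.mem_toFinset] at hd
    obtain ⟨e, he, rfl⟩ := mem_image.1 hd'
    rw [List.mem_toFinset] at he
    by_cases heq : θ e = e
    · obtain ⟨A, B, rfl⟩ := List.append_of_mem he
      have := (hO e)
      rw [heq] at this
      tauto
    · have : ∀ x ∈ p, ∀ y ∈ p, x ≠ y → (y ≠ x ∧ y ≠ θ x) := by
        intro x hx y hy hxy
        have : Std.Symm (fun d e => e ≠ d ∧ e ≠ θ d) :=
          ⟨fun x y h => ⟨h.1.symm, fun h' => h.2 (by rw [h', hinv])⟩⟩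
        exact hpw.forall hx hy hxy
      exact (this e he (θ e) hd (Ne.symm heq)).2 rfl
  have hsub : p.toFinset ∪ p.toFinset.image θ ⊆ E := by
    intro d hd
    rcases mem_union.1 hd with h | h
    · exact hp.mem d (List.mem_toFinset.1 h)
    · obtain ⟨e, he, rfl⟩ := mem_image.1 h
      exact hEθ e (hp.mem e (List.mem_toFinset.1 he))
  have := card_le_card hsub
  rw [card_union_of_disjoint hdis, card_image_of_injective _ θ.injective,
    List.toFinset_card_of_nodup hnd] at this
  omega

end Dual

section Circle

variable {V D : Type} [Fintype V] [DecidableEq V] [Fintype D] [DecidableEq D]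
  {σ θ : Equiv.Perm D} {vt : D → V} {K : Finset D}

open Classical in
/-- Indicator of a ball in the dual graph. -/
noncomputable def ball (σ θ : Equiv.Perm D) (K : Finset D) (a : Face σ θ K) (j : ℕ) :
    Face σ θ K → ZMod 2 :=
  fun b => if ∃ q, DW σ θ K K a q b ∧ q.length ≤ j then 1 else 0

lemma ball_eq_one {a b : Face σ θ K} {j : ℕ} :
    ball σ θ K a j b = 1 ↔ ∃ q, DW σ θ K K a q b ∧ q.length ≤ j := by
  unfold ball
  by_cases h : ∃ q, DW σ θ K K a q b ∧ q.length ≤ j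
  · rw [if_pos h]; simp [h]
  · rw [if_neg h]; simp [h]

lemma zmod_two_cases (a : ZMod 2) : a = 0 ∨ a = 1 := by revert a; decide

/-- The corner function of a ball. -/
noncomputable def ballFn (σ θ : Equiv.Perm D) (K : Finset D) (a : Face σ θ K) (j : ℕ) (d : D) :
    ZMod 2 := ball σ θ K a j (fc σ θ K d)

/-- Darts on the boundary of a ball. -/
noncomputable def rim (σ θ : Equiv.Perm D) (K : Finset D) (a : Face σ θ K) (j : ℕ) : Finset D :=
  univ.filter fun d => bd σ (ballFn σ θ K a j) d = 1

lemma isFc_ballFn (a : Face σ θ K) (j : ℕ) : IsFc σ θ K (ballFn σ θ K a j) := isFc_lift _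

lemma bd_ballFn (a : Face σ θ K) (j : ℕ) (d : D) : bd σ (ballFn σ θ K a j) d =
    ball σ θ K a j (fc σ θ K d) + ball σ θ K a j (fl σ θ K d) := rfl

lemma mem_rim {a : Face σ θ K} {j : ℕ} {d : D} :
    d ∈ rim σ θ K a j ↔ bd σ (ballFn σ θ K a j) d = 1 := by simp [rim]

lemma rim_subset (a : Face σ θ K) (j : ℕ) : rim σ θ K a j ⊆ K := by
  intro d hd
  by_contra h
  rw [mem_rim, (isFc_ballFn a j).1 d h] at hd
  exact absurd hd (by decide)

lemma rim_closed (hinv : ∀ d, θ (θ d) = d) (hKθ : ∀ d ∈ K, θ d ∈ K) (a : Face σ θ K) (j : ℕ) :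
    ∀ d ∈ rim σ θ K a j, θ d ∈ rim σ θ K a j := by
  intro d hd
  rw [mem_rim] at hd ⊢
  rw [((isFc_ballFn a j).isZc hinv hKθ).1, hd]

lemma ball_step (hinv : ∀ d, θ (θ d) = d) (hKθ : ∀ d ∈ K, θ d ∈ K) {a : Face σ θ K} {j : ℕ} {d : D}
    (hd : d ∈ rim σ θ K a j) :
    ball σ θ K a (j + 1) (fc σ θ K d) = 1 ∧ ball σ θ K a (j + 1) (fl σ θ K d) = 1 := by
  have hK := rim_subset a j hd
  rw [mem_rim, bd_ballFn] at hd
  have : ball σ θ K a j (fc σ θ K d) = 1 ∨ ball σ θ K a j (fl σ θ K d) = 1 := by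
    generalize ball σ θ K a j (fc σ θ K d) = x, ball σ θ K a j (fl σ θ K d) = y at *
    revert x y; decide
  simp only [ball_eq_one] at this ⊢
  rcases this with ⟨q, h1, h2⟩ | ⟨q, h1, h2⟩
  · refine ⟨⟨q, h1, by omega⟩, q ++ [θ d], h1.append ⟨hKθ d hK, fl_eq_rev hinv hKθ hK, ?_⟩,
      by simp; omega⟩
    exact fl_rev hK
  · exact ⟨⟨q ++ [d], h1.append ⟨hK, rfl, rfl⟩, by simp; omega⟩, q, h1, by omega⟩

lemma ball_mono {a b : Face σ θ K} {j j' : ℕ} (h : j ≤ j') (hb : ball σ θ K a j b = 1) :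
    ball σ θ K a j' b = 1 := by
  rw [ball_eq_one] at hb ⊢
  obtain ⟨q, h1, h2⟩ := hb
  exact ⟨q, h1, h2.trans h⟩

lemma rim_disjoint (hinv : ∀ d, θ (θ d) = d) (hKθ : ∀ d ∈ K, θ d ∈ K) (a : Face σ θ K) {j j' : ℕ}
    (h : j < j') : Disjoint (rim σ θ K a j) (rim σ θ K a j') := by
  rw [disjoint_left]
  intro d hd hd'
  obtain ⟨h1, h2⟩ := ball_step hinv hKθ hd
  rw [mem_rim, bd_ballFn, ball_mono h h1, ball_mono h h2] at hd'
  exact absurd hd' (by decide)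

/-- The component of the rim of a ball containing a given dart. -/
noncomputable def circ (σ θ : Equiv.Perm D) (vt : D → V) (K : Finset D) (a : Face σ θ K) (j : ℕ)
    (e : D) : Finset V := reach θ vt (rim σ θ K a j) ∅ (vt e)

lemma circ_route {E : Finset D} {r v : V} (h : v ∈ reach θ vt E ∅ r) :
    IsRoute r v (ue (edg θ vt E)) := by
  classical
  have : reach θ vt E ∅ r ⊆ univ.filter fun v => ∃ n : ℕ,
      IsRoute r v (fun e => n * ue (edg θ vt E) e) := by
    refine reach_induct _ ?_ ?_
    · simp only [mem_filter, mem_univ, true_and]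
      exact ⟨0, IsRoute.refl _ _⟩
    · intro d hd h1 _
      simp only [mem_filter, mem_univ, true_and] at h1 ⊢
      obtain ⟨n, hn⟩ := h1
      refine ⟨n + 1, ?_⟩
      have h2 : IsRoute (vt d) (vt (θ d)) (ue (edg θ vt E)) := by
        refine IsRoute.edge fun _ => ?_
        unfold ue
        rw [if_pos (mem_edg.2 ⟨d, hd, rfl⟩)]
      exact (hn.trans h2).mono (fun e => le_of_eq (by ring))
  obtain ⟨n, hn⟩ := (mem_filter.1 (this h)).2
  refine hn.min_one.mono fun e => ?_
  unfold ue
  by_cases h : e ∈ edg θ vt E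
  · simp [h]
  · simp [h]

lemma circ_routes {a : Face σ θ K} {j : ℕ} {e : D} {v w : V}
    (hv : v ∈ circ σ θ vt K a j e) (hw : w ∈ circ σ θ vt K a j e) :
    IsRoute v w (ue (edg θ vt (rim σ θ K a j))) := by
  have := (circ_route hv).symm.trans (circ_route hw)
  refine this.min_one.mono fun x => ?_
  unfold ue
  by_cases h : x ∈ edg θ vt (rim σ θ K a j)
  · simp [h]
  · simp [h]

/-- A component of the rim of a small ball bounds. -/
lemma circ_bounds {O : Finset D} (hO : ∀ d, d ∈ O ↔ θ d ∉ O) (hE : Emb σ θ vt)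
    (hKθ : ∀ d ∈ K, θ d ∈ K) (a : Face σ θ K) (j : ℕ) (e : D)
    (hmin : ∀ q, Ess σ θ K K q → 2 * j + 1 < q.length) :
    ∃ l, IsFc σ θ K l ∧ ∀ d, bd σ l d =
      if vt d ∈ circ σ θ vt K a j e then bd σ (ballFn σ θ K a j) d else 0 := by
  classical
  have hinv := hE.inv
  set Y := circ σ θ vt K a j e with hY
  set b := ballFn σ θ K a j with hb
  have hbF : IsFc σ θ K b := isFc_ballFn a j
  have hbZ := hbF.isZc hinv hKθ
  have hYrim : ∀ d ∈ rim σ θ K a j, (vt d ∈ Y ↔ vt (θ d) ∈ Y) := by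
    intro d hd
    refine ⟨fun h => reach_step hd h (notMem_empty _), fun h => ?_⟩
    have := reach_step (rim_closed hinv hKθ a j d hd) h (notMem_empty _)
    rwa [hinv] at this
  set g : D → ZMod 2 := fun d => if vt d ∈ Y then b d else 0 with hg
  have htl : ∀ d, vt (σ.symm d) = vt d := fun d => by
    have := hE.tail (σ.symm d)
    rw [Equiv.apply_symm_apply] at this
    exact this.symm
  have hbg : ∀ d, bd σ g d = if vt d ∈ Y then bd σ b d else 0 := by
    intro d
    simp only [bd, hg, htl]
    by_cases h : vt d ∈ Y
    · simp only [if_pos h]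
    · simp only [if_neg h, add_zero]
  have hgZ : IsZc σ θ K g := by
    refine ⟨fun d => ?_, fun d hd => ?_⟩
    · rw [hbg, hbg, hbZ.1]
      rcases zmod_two_cases (bd σ b d) with h | h
      · simp [h]
      · have := hYrim d (mem_rim.2 h)
        simp [this]
    · rw [hbg, hbF.1 d hd]; simp
  obtain ⟨l, h1, h2⟩ := bounds_of_psi_orth hO hinv hKθ hgZ (fun c hc => by
    have hch : ∀ F, ∃ q, ball σ θ K a j F = 1 → DW σ θ K K a q F ∧ q.length ≤ j := by
      intro F
      by_cases h : ball σ θ K a j F = 1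
      · obtain ⟨q, hq⟩ := ball_eq_one.1 h
        exact ⟨q, fun _ => hq⟩
      · exact ⟨[], fun h' => absurd h' h⟩
    choose q hq using hch
    set ω := fun d => wt σ c (q (fc σ θ K d)) with hω
    have hωF : IsFc σ θ K ω := isFc_lift (fun F => wt σ c (q F))
    refine Eq.trans (sum_congr rfl fun d _ => ?_) (psi_orth_face hO hinv hKθ hgZ hωF)
    by_cases hd : d ∈ K
    · by_cases hps : psi σ θ g d = 0
      · rw [hps, zero_mul, zero_mul]
      · congr 1
        have e1 : b (σ.symm d) = b (θ d) := hbF.2 d hd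
        have e2 : psi σ θ g d = (if vt d ∈ Y then b (σ.symm d) else 0) +
          (if vt (θ d) ∈ Y then b (σ.symm d) else 0) := by
          simp only [psi, hg, htl, e1]
        rw [e2] at hps
        have hne : ¬ (vt d ∈ Y ↔ vt (θ d) ∈ Y) := by
          intro h
          apply hps
          simp only [h]
          exact CharTwo.add_self_eq_zero _
        have hb0 : bd σ b d = 0 := by
          rcases zmod_two_cases (bd σ b d) with h | h
          · exact h
          · exact absurd (hYrim d (mem_rim.2 h)) hne
        have hL : b (σ.symm d) = 1 := by
          rcases zmod_two_cases (b (σ.symm d)) with h | h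
          · exact absurd (by simp [h]) hps
          · exact h
        have hR : b d = 1 := by
          unfold bd at hb0
          rw [hL] at hb0
          generalize b d = x at *
          revert x; decide
        obtain ⟨p1, p2⟩ := hq (fl σ θ K d) hL
        obtain ⟨p3, p4⟩ := hq (fc σ θ K d) hR
        have hcl := ((p1.append (l' := [d]) (c := fc σ θ K d) ⟨hd, rfl, rfl⟩).append
          (p3.rev hinv hKθ hKθ subset_rfl))
        have hw : wt σ c (q (fl σ θ K d) ++ [d] ++ (q (fc σ θ K d)).reverse.map θ) = 0 := by
          by_contra h0
          have := hmin _ ⟨⟨_, hcl⟩, c, hc, h0⟩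
          simp at this
          omega
        rw [wt_append, wt_append, wt_rev hc, wt_cons, wt_nil] at hw
        have e3 : bd σ ω d = wt σ c (q (fc σ θ K d)) + wt σ c (q (fl σ θ K d)) := rfl
        rw [e3]
        generalize wt σ c (q (fc σ θ K d)) = x, wt σ c (q (fl σ θ K d)) = y, bd σ c d = z at *
        clear hps hb0 e3
        revert x y z; decide
    · rw [hc.2 d hd, hωF.1 d hd])
  exact ⟨l, h1, fun d => (h2 d).trans (hbg d)⟩

end Circle

section Systole

variable {V D : Type} [Fintype V] [DecidableEq V] [Fintype D] [DecidableEq D]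
  {σ θ : Equiv.Perm D} {vt : D → V} {K : Finset D}

/-- A shortest essential closed dual walk, as a sequence of darts and faces. -/
structure Systole (σ θ : Equiv.Perm D) (K : Finset D) (a : ℕ → D) (f : ℕ → Face σ θ K)
    (ℓ : ℕ) : Prop where
  mem : ∀ i < ℓ, a i ∈ K
  left : ∀ i < ℓ, fl σ θ K (a i) = f i
  right : ∀ i < ℓ, fc σ θ K (a i) = f (i + 1)
  closed : f 0 = f ℓ
  ess : ∃ c, IsZc σ θ K c ∧ ∑ i ∈ range ℓ, bd σ c (a i) ≠ 0
  min : ∀ q, Ess σ θ K K q → ℓ ≤ q.length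

lemma DW.exists_seq {E : Finset D} (x : D) {p : List D} : ∀ {u v : Face σ θ K}, DW σ θ K E u p v →
    ∃ (a : ℕ → D) (f : ℕ → Face σ θ K), f 0 = u ∧ f p.length = v ∧
      (∀ i < p.length, a i ∈ E ∧ fl σ θ K (a i) = f i ∧ fc σ θ K (a i) = f (i + 1)) ∧
      ∀ c, wt σ c p = ∑ i ∈ range p.length, bd σ c (a i) := by
  induction p with
  | nil => intro u v h; exact ⟨fun _ => x, fun _ => u, rfl, h, by simp, by simp [wt]⟩
  | cons d p ih =>
    rintro u v ⟨h1, h2, h3⟩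
    obtain ⟨a, f, h4, h5, h6, h7⟩ := ih h3
    refine ⟨fun i => Nat.casesOn i d a, fun i => Nat.casesOn i u f, rfl, h5, ?_, fun c => ?_⟩
    · rintro (_ | i) hi
      · exact ⟨h1, h2, h4.symm⟩
      · exact h6 i (by simpa using hi)
    · rw [wt_cons, List.length_cons, sum_range_succ', h7, add_comm]; rfl

lemma exists_systole (hinv : ∀ d, θ (θ d) = d) (hKθ : ∀ d ∈ K, θ d ∈ K) (h : ¬ Planar σ θ K) :
    ∃ a f ℓ, Systole σ θ K a f ℓ := by
  classical
  have hex : ∃ m p, Ess σ θ K K p ∧ p.length = m := by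
    obtain ⟨p, hp⟩ := exists_ess hinv hKθ h
    exact ⟨_, p, hp, rfl⟩
  obtain ⟨p, ⟨⟨u, hu⟩, c, hc, hw⟩, hlen⟩ := Nat.find_spec hex
  have hx : ∃ x, x ∈ p := by
    cases p with
    | nil => exact absurd (wt_nil c) hw
    | cons d p => exact ⟨d, by simp⟩
  obtain ⟨x, -⟩ := hx
  obtain ⟨a, f, h4, h5, h6, h7⟩ := hu.exists_seq x
  refine ⟨a, f, p.length, fun i hi => (h6 i hi).1, fun i hi => (h6 i hi).2.1,
    fun i hi => (h6 i hi).2.2, h4.trans h5.symm, ⟨c, hc, h7 c ▸ hw⟩, fun q hq => ?_⟩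
  rw [hlen]
  exact Nat.find_min' hex ⟨q, hq, rfl⟩

/-- Consecutive darts of a sequence. -/
def seg (a : ℕ → D) (i n : ℕ) : List D := (List.range' i n).map a

lemma length_seg (a : ℕ → D) (i n : ℕ) : (seg a i n).length = n := by simp [seg]

lemma wt_seg (c : D → ZMod 2) (a : ℕ → D) (n : ℕ) : ∀ i,
    wt σ c (seg a i n) = ∑ x ∈ range n, bd σ c (a (i + x)) := by
  induction n with
  | zero => intro i; simp [seg, wt]
  | succ n ih =>
    intro i
    have : seg a i (n + 1) = a i :: seg a (i + 1) n := by simp [seg, List.range'_succ]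
    rw [this, wt_cons, ih, sum_range_succ', add_comm]
    congr 1
    refine sum_congr rfl fun x _ => ?_
    congr 2; omega

variable {a : ℕ → D} {f : ℕ → Face σ θ K} {ℓ : ℕ}

lemma Systole.seg (h : Systole σ θ K a f ℓ) (n : ℕ) : ∀ i, i + n ≤ ℓ →
    DW σ θ K K (f i) (seg a i n) (f (i + n)) := by
  induction n with
  | zero => intro i _; rfl
  | succ n ih =>
    intro i hi
    have e : MEDP.seg a i (n + 1) = a i :: MEDP.seg a (i + 1) n := by
      simp [MEDP.seg, List.range'_succ]
    rw [e]
    refine ⟨h.mem i (by omega), h.left i (by omega), ?_⟩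
    rw [h.right i (by omega)]
    have := ih (i + 1) (by omega)
    rwa [show i + 1 + n = i + (n + 1) by omega] at this

lemma Systole.isometry (hinv : ∀ d, θ (θ d) = d) (hKθ : ∀ d ∈ K, θ d ∈ K)
    (h : Systole σ θ K a f ℓ) {i n : ℕ} (hin : i + n ≤ ℓ) {q : List D}
    (hq : DW σ θ K K (f i) q (f (i + n))) : n ≤ q.length ∨ ℓ ≤ q.length + n := by
  obtain ⟨c, hc, hw⟩ := h.ess
  have h1 := (h.seg n i hin).append (hq.rev hinv hKθ hKθ subset_rfl)
  have h2 : DW σ θ K K (f (i + n)) (MEDP.seg a (i + n) (ℓ - (i + n))) (f 0) := by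
    have := h.seg (ℓ - (i + n)) (i + n) (by omega)
    rwa [show i + n + (ℓ - (i + n)) = ℓ by omega, ← h.closed] at this
  have h3 : DW σ θ K K (f 0) (MEDP.seg a 0 i) (f i) := by
    have := h.seg i 0 (by omega)
    rwa [zero_add] at this
  have h4 := (hq.append h2).append h3
  by_cases k1 : wt σ c (MEDP.seg a i n ++ q.reverse.map θ) = 0
  · by_cases k2 : wt σ c (q ++ MEDP.seg a (i + n) (ℓ - (i + n)) ++ MEDP.seg a 0 i) = 0
    · exfalso
      rw [wt_append, wt_rev hc, wt_seg] at k1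
      rw [wt_append, wt_append, wt_seg, wt_seg] at k2
      apply hw
      simp only [zero_add] at k2
      have e : ∑ x ∈ range ℓ, bd σ c (a x) = ∑ x ∈ range i, bd σ c (a x) +
          ∑ x ∈ range n, bd σ c (a (i + x)) +
          ∑ x ∈ range (ℓ - (i + n)), bd σ c (a (i + n + x)) := by
        rw [← sum_range_add, ← sum_range_add, show i + n + (ℓ - (i + n)) = ℓ by omega]
      rw [e]
      linear_combination k1 + k2 - CharTwo.add_self_eq_zero (wt σ c q)
    · left
      have := h.min _ ⟨⟨_, h4⟩, c, hc, k2⟩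
      simp only [List.length_append, length_seg] at this
      omega
  · right
    have := h.min _ ⟨⟨_, h1⟩, c, hc, k1⟩
    simp only [List.length_append, length_seg, List.length_map, List.length_reverse] at this
    omega

lemma Systole.ball_iff (hinv : ∀ d, θ (θ d) = d) (hKθ : ∀ d ∈ K, θ d ∈ K)
    (h : Systole σ θ K a f ℓ) {p j i : ℕ} (hp : j < p) (hj : p + j < ℓ) (hi : i ≤ ℓ) :
    ball σ θ K (f p) j (f i) = 1 ↔ p ≤ i + j ∧ i ≤ p + j := by
  rw [ball_eq_one]
  rcases le_total p i with hpi | hpi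
  · obtain ⟨n, rfl⟩ := Nat.exists_eq_add_of_le hpi
    constructor
    · rintro ⟨q, h1, h2⟩
      rcases h.isometry hinv hKθ hi h1 with h3 | h3 <;> omega
    · rintro ⟨-, h2⟩
      exact ⟨_, h.seg n p hi, by rw [length_seg]; omega⟩
  · obtain ⟨n, rfl⟩ := Nat.exists_eq_add_of_le hpi
    constructor
    · rintro ⟨q, h1, h2⟩
      have h4 := h1.rev hinv hKθ hKθ subset_rfl
      rcases h.isometry hinv hKθ (by omega) h4 with h3 | h3 <;>
        rw [List.length_map, List.length_reverse] at h3 <;> omega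
    · rintro ⟨h1, -⟩
      refine ⟨_, (h.seg n i (by omega)).rev hinv hKθ hKθ subset_rfl, ?_⟩
      rw [List.length_map, List.length_reverse, length_seg]
      omega

lemma Systole.bd_ball (hinv : ∀ d, θ (θ d) = d) (hKθ : ∀ d ∈ K, θ d ∈ K)
    (h : Systole σ θ K a f ℓ) {p j i : ℕ} (hp : j < p) (hj : p + j < ℓ) (hi : i < ℓ) :
    bd σ (ballFn σ θ K (f p) j) (a i) = if i = p + j ∨ i + 1 + j = p then 1 else 0 := by
  have e : ∀ i ≤ ℓ, ball σ θ K (f p) j (f i) = if p ≤ i + j ∧ i ≤ p + j then 1 else 0 := by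
    intro i hi
    by_cases h1 : p ≤ i + j ∧ i ≤ p + j
    · rw [if_pos h1]; exact (h.ball_iff hinv hKθ hp hj hi).2 h1
    · rw [if_neg h1]
      rcases zmod_two_cases (ball σ θ K (f p) j (f i)) with h2 | h2
      · exact h2
      · exact absurd ((h.ball_iff hinv hKθ hp hj hi).1 h2) h1
  rw [bd_ballFn, h.left i hi, h.right i hi, e _ (by omega), e _ (by omega)]
  by_cases h1 : i = p + j ∨ i + 1 + j = p
  · rw [if_pos h1]
    rcases h1 with h1 | h1
    · rw [if_neg (by omega), if_pos (by omega), zero_add]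
    · rw [if_pos (by omega), if_neg (by omega), add_zero]
  · rw [if_neg h1]
    by_cases h2 : p ≤ i + 1 + j ∧ i + 1 ≤ p + j
    · rw [if_pos h2, if_pos (by omega)]; rfl
    · rw [if_neg h2, if_neg (by omega)]; rfl

lemma Systole.sum_lift (h : Systole σ θ K a f ℓ) {l : D → ZMod 2} (hl : IsFc σ θ K l) :
    ∃ ω : Face σ θ K → ZMod 2, (∀ d, l d = ω (fc σ θ K d)) ∧
      ∀ n i, i + n ≤ ℓ → ∑ x ∈ range n, bd σ l (a (i + x)) = ω (f i) + ω (f (i + n)) := by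
  obtain ⟨ω, hω⟩ := hl.exists_lift
  obtain rfl : l = fun d => ω (fc σ θ K d) := funext hω
  refine ⟨ω, hω, fun n i hi => ?_⟩
  rw [← wt_seg, wt_lift ω (h.seg n i hi)]

/-- The circle of radius `j` around the `p`-th face of the systole. -/
noncomputable def Systole.circle (_ : Systole σ θ K a f ℓ) (vt : D → V) (p j : ℕ) : Finset V :=
  circ σ θ vt K (f p) j (a (p + j))

lemma Systole.circle_bounds {O : Finset D} (hO : ∀ d, d ∈ O ↔ θ d ∉ O) (hE : Emb σ θ vt)
    (hKθ : ∀ d ∈ K, θ d ∈ K) (h : Systole σ θ K a f ℓ) {p j : ℕ} (hp : j < p) (hj : p + j < ℓ) :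
    ∃ l, IsFc σ θ K l ∧ (∀ d, vt d ∉ h.circle vt p j → bd σ l d = 0) ∧
      ∀ i < ℓ, bd σ l (a i) = if i = p + j ∨ i + 1 + j = p then 1 else 0 := by
  have hinv := hE.inv
  obtain ⟨l, h1, h2⟩ := circ_bounds hO hE hKθ (f p) j (a (p + j)) (fun q hq => by
    have := h.min q hq
    omega)
  refine ⟨l, h1, fun d hd => (h2 d).trans (if_neg hd), ?_⟩
  have h3 : ∀ i < ℓ, ¬ (i = p + j ∨ i + 1 + j = p) → bd σ l (a i) = 0 := by
    intro i hi hne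
    rw [h2, h.bd_ball hinv hKθ hp hj hi, if_neg hne]
    simp
  have h4 : bd σ l (a (p + j)) = 1 := by
    have hm : vt (a (p + j)) ∈ circ σ θ vt K (f p) j (a (p + j)) := self_mem_reach
    rw [h2, if_pos hm, h.bd_ball hinv hKθ hp hj (by omega), if_pos (Or.inl rfl)]
  obtain ⟨k, rfl⟩ : ∃ k, p = k + 1 + j := ⟨p - 1 - j, by omega⟩
  obtain ⟨ω, -, h5⟩ := h.sum_lift h1
  have h6 := h5 ℓ 0 (by omega)
  rw [zero_add, ← h.closed, CharTwo.add_self_eq_zero] at h6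
  simp only [zero_add] at h6
  have h7 : ∑ x ∈ ({k, k + 1 + j + j} : Finset ℕ), bd σ l (a x) = 0 := by
    refine Eq.trans (sum_subset ?_ ?_) h6
    · intro x hx
      simp only [mem_insert, mem_singleton] at hx
      rw [mem_range]; omega
    · intro x hx hx'
      simp only [mem_insert, mem_singleton, not_or] at hx'
      exact h3 x (mem_range.1 hx) (by omega)
  rw [sum_pair (by omega), h4] at h7
  have h8 : bd σ l (a k) = 1 := by
    generalize bd σ l (a k) = x at *
    clear h4 h3
    revert x; decide
  intro i hi
  by_cases hc : i = k + 1 + j + j ∨ i + 1 + j = k + 1 + j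
  · rw [if_pos hc]
    rcases hc with rfl | hc
    · exact h4
    · obtain rfl : i = k := by omega
      exact h8
  · rw [if_neg hc]; exact h3 i hi hc

lemma Systole.circle_mem {O : Finset D} (hO : ∀ d, d ∈ O ↔ θ d ∉ O) (hE : Emb σ θ vt)
    (hKθ : ∀ d ∈ K, θ d ∈ K) (h : Systole σ θ K a f ℓ) {p j i : ℕ} (hp : j < p) (hj : p + j < ℓ)
    (hi : i < ℓ) (hij : i = p + j ∨ i + 1 + j = p) :
    vt (a i) ∈ h.circle vt p j ∧ vt (θ (a i)) ∈ h.circle vt p j := by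
  obtain ⟨l, h1, h2, h3⟩ := h.circle_bounds hO hE hKθ hp hj
  have h4 : bd σ l (a i) = 1 := by rw [h3 i hi, if_pos hij]
  have h5 := (h1.isZc hE.inv hKθ).1 (a i)
  constructor
  · by_contra hc
    rw [h2 _ hc] at h4
    exact absurd h4 (by decide)
  · by_contra hc
    rw [h2 _ hc, h4] at h5
    exact absurd h5 (by decide)

/-- Circles that interleave along the systole meet. -/
lemma Systole.circles_meet {O : Finset D} (hO : ∀ d, d ∈ O ↔ θ d ∉ O) (hE : Emb σ θ vt)
    (hKθ : ∀ d ∈ K, θ d ∈ K) (h : Systole σ θ K a f ℓ) {p q i j : ℕ} (hp : i < p) (hq : j < q)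
    (hpl : p + i < ℓ) (hql : q + j < ℓ) (h1 : p + j < q + i) (h2 : q ≤ p + i + j)
    (h3 : p + i < q + j) : ∃ v, v ∈ h.circle vt p i ∧ v ∈ h.circle vt q j := by
  classical
  by_contra hno
  push Not at hno
  have hinv := hE.inv
  obtain ⟨l, k1, k2, k3⟩ := h.circle_bounds hO hE hKθ hp hpl
  have hcor : ∀ d d', vt d ∈ h.circle vt q j → vt d = vt d' → l d = l d' := by
    intro d d' hd hdd
    obtain ⟨n, rfl⟩ := hE.cyc d d' hdd
    clear hdd
    induction n with
    | zero => rfl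
    | succ n ih =>
      have hv : ∀ n, vt ((σ ^ n) d) = vt d := by
        intro n
        induction n with
        | zero => rfl
        | succ n ih => rw [pow_succ', Equiv.Perm.mul_apply, hE.tail, ih]
      have := k2 ((σ ^ (n + 1)) d) (fun h' => hno _ h' (by rw [hv]; exact hd))
      rw [ih, pow_succ', Equiv.Perm.mul_apply]
      rw [pow_succ', Equiv.Perm.mul_apply] at this
      unfold bd at this
      rw [Equiv.symm_apply_apply] at this
      generalize l (σ ((σ ^ n) d)) = x, l ((σ ^ n) d) = y at *
      clear ih
      revert x y; decide
  have hsub : h.circle vt q j ⊆ (h.circle vt q j).filter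
      fun v => ∀ d, vt d = v → l d = l (a (q + j)) := by
    refine reach_induct _ ?_ ?_
    · exact mem_filter.2 ⟨self_mem_reach, fun d hd => hcor _ _ (hd ▸ self_mem_reach) hd⟩
    · intro d hd hT _
      obtain ⟨m1, m2⟩ := mem_filter.1 hT
      have m3 : vt (θ d) ∈ h.circle vt q j := reach_step hd m1 (notMem_empty _)
      refine mem_filter.2 ⟨m3, fun d' hd' => ?_⟩
      have e1 := hcor d' (θ d) (hd' ▸ m3) hd'
      have e2 := k1.2 d (rim_subset _ _ hd)
      have e3 : vt (σ.symm d) = vt d := by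
        have := hE.tail (σ.symm d)
        rw [Equiv.apply_symm_apply] at this
        exact this.symm
      rw [e1, ← e2, m2 _ e3]
  obtain ⟨k, rfl⟩ : ∃ k, q = k + 1 + j := ⟨q - 1 - j, by omega⟩
  have hk := (h.circle_mem hO hE hKθ hq hql (i := k) (by omega) (Or.inr rfl)).1
  have hkl := (mem_filter.1 (hsub hk)).2 (a k) rfl
  obtain ⟨ω, w1, w2⟩ := h.sum_lift k1
  rw [w1, w1, h.right _ (by omega), h.right _ (by omega)] at hkl
  have h5 := w2 (2 * j + 1) (k + 1) (by omega)
  rw [show k + 1 + (2 * j + 1) = k + 1 + j + j + 1 by omega, hkl, CharTwo.add_self_eq_zero,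
    sum_eq_single (p + i - (k + 1))] at h5
  · rw [show k + 1 + (p + i - (k + 1)) = p + i by omega, k3 _ hpl, if_pos (Or.inl rfl)] at h5
    exact absurd h5 (by decide)
  · intro x hx hne
    rw [mem_range] at hx
    rw [k3 _ (by omega), if_neg (by omega)]
  · intro hx
    rw [mem_range] at hx
    omega

end Systole

section Flat

variable {V D : Type} [Fintype V] [DecidableEq V] [Fintype D] [DecidableEq D]
  {σ θ : Equiv.Perm D} {vt : D → V} {K : Finset D}

/-- Every cycle of `K'` bounds in the embedding of `K`. -/
def Flat (σ θ : Equiv.Perm D) (K K' : Finset D) : Prop :=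
  ∀ c, IsZc σ θ K' c → ∃ l, IsFc σ θ K l ∧ ∀ d, bd σ l d = bd σ c d

lemma card_crossing_le (hE : Emb σ θ vt) (K : Finset D) (T : Finset V) :
    #(K.filter fun d => vt d ∈ T ∧ vt (θ d) ∉ T) ≤ cut (ue (edg θ vt K)) T := by
  have hinj : Set.InjOn (fun d => s(vt d, vt (θ d)))
      (K.filter fun d => vt d ∈ T ∧ vt (θ d) ∉ T : Finset D) := by
    intro d hd d' hd' he
    rw [mem_coe, mem_filter] at hd hd'
    rcases hE.simple d d' he with h | h
    · exact h
    · exfalso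
      apply hd'.2.2
      rw [← h]; exact hd.2.1
  rw [← card_image_of_injOn hinj, card_eq_sum_ones]
  refine le_trans (sum_le_sum fun e he => ?_) (sum_le_sum_of_subset (subset_univ _))
  obtain ⟨d, hd, rfl⟩ := mem_image.1 he
  obtain ⟨h1, h2, h3⟩ := mem_filter.1 hd
  have e1 : ue (edg θ vt K) s(vt d, vt (θ d)) = 1 := if_pos (mem_edg.2 ⟨d, h1, rfl⟩)
  have e2 : sep T s(vt d, vt (θ d)) = 1 := by
    rw [sep_mk]; simp [h2, h3]
  simp only [e1, e2, mul_one, le_refl]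

lemma sum_inv_mul_bd (σ : Equiv.Perm D) {y : D → ZMod 2} (hy : ∀ d, y (σ d) = y d)
    (c : D → ZMod 2) : ∑ d, y d * bd σ c d = 0 := by
  have h : ∀ d, y d * bd σ c d = y d * c d + y (σ.symm d) * c (σ.symm d) := by
    intro d
    have := hy (σ.symm d)
    rw [Equiv.apply_symm_apply] at this
    unfold bd
    rw [← this]; ring
  rw [sum_congr rfl fun d _ => h d, sum_add_distrib,
    Equiv.sum_comp σ.symm (fun d => y d * c d)]
  exact CharTwo.add_self_eq_zero _

/-- A flat vertex set absorbs few edges of the systole. -/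
lemma Systole.card_inside_le {O : Finset D} (hO : ∀ d, d ∈ O ↔ θ d ∉ O) (hE : Emb σ θ vt)
    (hKθ : ∀ d ∈ K, θ d ∈ K) {a : ℕ → D} {f : ℕ → Face σ θ K} {ℓ : ℕ}
    (h : Systole σ θ K a f ℓ) (T : Finset V) (hT : Flat σ θ K (within θ vt K T)) :
    #((range ℓ).filter fun i => vt (a i) ∈ T ∧ vt (θ (a i)) ∈ T) ≤
      cut (ue (edg θ vt K)) T := by
  classical
  have hinv := hE.inv
  set φ : D → ZMod 2 := fun d => ∑ i ∈ range ℓ, if a i = d then 1 else 0 with hφ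
  have hφs : ∀ F : D → ZMod 2, ∑ d, φ d * F d = ∑ i ∈ range ℓ, F (a i) := by
    intro F
    simp only [hφ, sum_mul]
    rw [sum_comm]
    refine sum_congr rfl fun i _ => ?_
    simp
  have hφ0 : ∀ d, φ d ≠ 0 → ∃ i < ℓ, a i = d := by
    intro d hd
    obtain ⟨i, hi, h1⟩ := exists_ne_zero_of_sum_ne_zero hd
    refine ⟨i, mem_range.1 hi, ?_⟩
    by_contra h2
    exact h1 (if_neg h2)
  have hclosed : ∀ l, IsFc σ θ K l → ∑ i ∈ range ℓ, bd σ l (a i) = 0 := by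
    intro l hl
    obtain ⟨ω, -, h1⟩ := h.sum_lift hl
    have := h1 ℓ 0 (by omega)
    simp only [zero_add] at this
    rw [this, ← h.closed, CharTwo.add_self_eq_zero]
  obtain ⟨w, hw1, hw2⟩ := exists_cut_of_orth hinv (within_closed (vt := vt) hinv hKθ T) φ
    (fun c hc => by
      rw [hφs]
      obtain ⟨l, h1, h2⟩ := hT c hc
      rw [← hclosed l h1]
      exact sum_congr rfl fun i _ => (h2 _).symm)
  set y : D → ZMod 2 := fun d => if vt d ∈ T then w d else 0 with hy
  have hyσ : ∀ d, y (σ d) = y d := by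
    intro d; simp only [hy, hE.tail, hw1]
  set ψ : D → ZMod 2 := fun d => if d ∈ K then φ d + φ (θ d) + y d + y (θ d) else 0 with hψ
  have hKθ' : ∀ d, θ d ∈ K ↔ d ∈ K := fun d => ⟨fun h => by have := hKθ _ h; rwa [hinv] at this,
    hKθ d⟩
  have hψθ : ∀ d, ψ (θ d) = ψ d := by
    intro d
    simp only [hψ, hKθ', hinv]
    congr 1; ring
  have hpair : ∀ c, IsZc σ θ K c → ∑ d ∈ O, ψ d * bd σ c d = ∑ i ∈ range ℓ, bd σ c (a i) := by
    intro c hc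
    rw [← hφs, ← add_zero (∑ d, φ d * bd σ c d), ← sum_inv_mul_bd σ hyσ c, ← sum_add_distrib,
      sum_orientation hO hinv]
    refine sum_congr rfl fun d _ => ?_
    rw [hc.1 d]
    by_cases hd : d ∈ K
    · simp only [hψ, if_pos hd]; ring
    · rw [hc.2 d hd]; ring
  set E := K.filter fun d => ψ d ≠ 0 with hEd
  obtain ⟨c, hc, hne⟩ := h.ess
  obtain ⟨p, hp, hlen⟩ := exists_ess_of_cocycle (E := E) hO hinv hKθ
    (fun d hd => by
      obtain ⟨h1, h2⟩ := mem_filter.1 hd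
      exact mem_filter.2 ⟨hKθ d h1, by rwa [hψθ]⟩)
    (filter_subset _ _) ψ
    (fun d hd => by
      by_cases hK : d ∈ K
      · by_contra h0
        exact hd (mem_filter.2 ⟨hK, h0⟩)
      · simp only [hψ, if_neg hK])
    (fun l hl => by rw [hpair l (hl.isZc hinv hKθ), hclosed l hl])
    hc (by rwa [hpair c hc])
  have h1 := h.min p (hp.mono (filter_subset _ _))
  set B := (range ℓ).filter fun i => ¬ (vt (a i) ∈ T ∧ vt (θ (a i)) ∈ T) with hB
  set C := K.filter fun d => vt d ∈ T ∧ vt (θ d) ∉ T with hC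
  have hsub : E ⊆ (B.image a ∪ B.image (fun i => θ (a i))) ∪ (C ∪ C.image θ) := by
    intro d hd
    obtain ⟨hdK, hd0⟩ := mem_filter.1 hd
    simp only [mem_union]
    by_cases m1 : vt d ∈ T
    · by_cases m2 : vt (θ d) ∈ T
      · exfalso
        apply hd0
        have := hw2 d (mem_filter.2 ⟨hdK, m1, m2⟩)
        simp only [hψ, if_pos hdK, hy, if_pos m1, if_pos m2]
        rw [add_assoc (φ d + φ (θ d)), this]
        exact CharTwo.add_self_eq_zero _
      · exact Or.inr (Or.inl (mem_filter.2 ⟨hdK, m1, m2⟩))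
    · by_cases m2 : vt (θ d) ∈ T
      · refine Or.inr (Or.inr (mem_image.2 ⟨θ d, mem_filter.2 ⟨hKθ d hdK, m2, ?_⟩, hinv d⟩))
        rwa [hinv]
      · simp only [hψ, if_pos hdK, hy, if_neg m1, if_neg m2, add_zero] at hd0
        left
        by_cases h0 : φ d = 0
        · rw [h0, zero_add] at hd0
          obtain ⟨i, hi, hid⟩ := hφ0 _ hd0
          refine Or.inr (mem_image.2 ⟨i, mem_filter.2 ⟨mem_range.2 hi, fun h => ?_⟩, ?_⟩)
          · rw [hid] at h; exact m2 h.1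
          · rw [hid, hinv]
        · obtain ⟨i, hi, hid⟩ := hφ0 _ h0
          refine Or.inl (mem_image.2 ⟨i, mem_filter.2 ⟨mem_range.2 hi, fun h => ?_⟩, hid⟩)
          rw [hid] at h; exact m1 h.1
  have h2 := (card_le_card hsub).trans ((card_union_le _ _).trans
    (add_le_add (card_union_le _ _) (card_union_le _ _)))
  have h3 : #(B.image a) ≤ #B := card_image_le
  have h4 : #(B.image (fun i => θ (a i))) ≤ #B := card_image_le
  have h5 : #(C.image θ) ≤ #C := card_image_le
  have h6 : #C ≤ _ := card_crossing_le hE K T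
  have h7 : #((range ℓ).filter fun i => vt (a i) ∈ T ∧ vt (θ (a i)) ∈ T) + #B = ℓ := by
    have := card_filter_add_card_filter_not (s := range ℓ)
      (fun i => vt (a i) ∈ T ∧ vt (θ (a i)) ∈ T)
    rw [card_range] at this
    rw [← this, hB]
    congr!
  omega

end Flat

section Homology

variable {V D : Type} [Fintype V] [DecidableEq V] [Fintype D] [DecidableEq D]
  {σ θ : Equiv.Perm D} {vt : D → V} {K : Finset D}

/-- Cycles of the subgraph `K`. -/
def Zb (σ θ : Equiv.Perm D) (K : Finset D) : Submodule (ZMod 2) (D → ZMod 2) :=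
  LinearMap.range (bdL σ) ⊓ symSub θ K

lemma mem_Zb {b : D → ZMod 2} : b ∈ Zb σ θ K ↔ ∃ c, IsZc σ θ K c ∧ bd σ c = b := by
  constructor
  · rintro ⟨⟨c, rfl⟩, h1, h2⟩
    exact ⟨c, ⟨h1, h2⟩, rfl⟩
  · rintro ⟨c, ⟨h1, h2⟩, rfl⟩
    exact ⟨⟨c, rfl⟩, h1, h2⟩

/-- Functions constant along the faces of `K`. -/
def fcSub (σ θ : Equiv.Perm D) (K : Finset D) : Submodule (ZMod 2) (D → ZMod 2) where
  carrier := {c | IsFc σ θ K c}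
  add_mem' := fun {a b} ha hb => ⟨fun d hd => by
      have := bd_add σ a b d
      rw [ha.1 d hd, hb.1 d hd, add_zero] at this
      exact this,
    fun d hd => by simp [ha.2 d hd, hb.2 d hd]⟩
  zero_mem' := ⟨fun _ _ => by simp [bd], fun _ _ => rfl⟩
  smul_mem' := fun x a ha => ⟨fun d hd => by
      have := ha.1 d hd
      unfold bd at this ⊢
      simp only [Pi.smul_apply, ← smul_add, this, smul_zero],
    fun d hd => by simp [ha.2 d hd]⟩

/-- Boundaries of sets of faces of `K`. -/
def Fb (σ θ : Equiv.Perm D) (K : Finset D) : Submodule (ZMod 2) (D → ZMod 2) :=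
  (fcSub σ θ K).map (bdL σ)

lemma mem_Fb {b : D → ZMod 2} : b ∈ Fb σ θ K ↔ ∃ l, IsFc σ θ K l ∧ bd σ l = b := by
  constructor
  · rintro ⟨l, hl, rfl⟩; exact ⟨l, hl, rfl⟩
  · rintro ⟨l, hl, rfl⟩; exact ⟨l, hl, rfl⟩

/-- Rank of the homology of the embedding restricted to `K`. -/
noncomputable def hom (σ θ : Equiv.Perm D) (K : Finset D) : ℕ :=
  Module.finrank (ZMod 2) (Zb σ θ K) - Module.finrank (ZMod 2) (Fb σ θ K)

lemma Fb_le_Zb (hinv : ∀ d, θ (θ d) = d) (hKθ : ∀ d ∈ K, θ d ∈ K) : Fb σ θ K ≤ Zb σ θ K := by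
  intro b hb
  obtain ⟨l, hl, rfl⟩ := mem_Fb.1 hb
  exact mem_Zb.2 ⟨l, hl.isZc hinv hKθ, rfl⟩

lemma Zb_mono {K' : Finset D} (h : K' ⊆ K) : Zb σ θ K' ≤ Zb σ θ K := by
  intro b hb
  obtain ⟨c, hc, rfl⟩ := mem_Zb.1 hb
  exact mem_Zb.2 ⟨c, hc.mono h, rfl⟩

lemma planar_of_hom (hinv : ∀ d, θ (θ d) = d) (hKθ : ∀ d ∈ K, θ d ∈ K) (h : hom σ θ K = 0) :
    Planar σ θ K := by
  have h1 := Fb_le_Zb (σ := σ) hinv hKθ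
  have h2 : Fb σ θ K = Zb σ θ K :=
    Submodule.eq_of_le_of_finrank_le h1 (Nat.sub_eq_zero_iff_le.1 h)
  intro c hc
  have h3 : bd σ c ∈ Fb σ θ K := h2 ▸ mem_Zb.2 ⟨c, hc, rfl⟩
  obtain ⟨l, hl, he⟩ := mem_Fb.1 h3
  exact ⟨l, hl, fun d => congrFun he d⟩

lemma Zb_inf_Fb_le {K' : Finset D} (h : K' ⊆ K) : Zb σ θ K' ⊓ Fb σ θ K ≤ Fb σ θ K' := by
  rintro b ⟨hb1, hb2⟩
  obtain ⟨l, hl, rfl⟩ := mem_Fb.1 hb2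
  exact mem_Fb.2 ⟨l, ⟨hb1.2.2, fun d hd => hl.2 d (h hd)⟩, rfl⟩

lemma hom_add_le {K' : Finset D} (h : K' ⊆ K) : hom σ θ K' + Module.finrank (ZMod 2) (Fb σ θ K) ≤
      Module.finrank (ZMod 2) ↑(Zb σ θ K' ⊔ Fb σ θ K) := by
  have h1 := Submodule.finrank_sup_add_finrank_inf_eq (Zb σ θ K') (Fb σ θ K)
  have h2 := Submodule.finrank_mono (Zb_inf_Fb_le (σ := σ) (θ := θ) h)
  unfold hom
  have h3 := Submodule.finrank_mono (show Fb σ θ K ≤ Zb σ θ K' ⊔ Fb σ θ K from le_sup_right)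
  omega

lemma hom_lt {K' : Finset D} (hinv : ∀ d, θ (θ d) = d) (hKθ : ∀ d ∈ K, θ d ∈ K)
    (h : K' ⊆ K) {b : D → ZMod 2} (hb : b ∈ Zb σ θ K) (hb' : b ∉ Zb σ θ K' ⊔ Fb σ θ K) :
    hom σ θ K' < hom σ θ K := by
  have h1 := hom_add_le h (σ := σ) (θ := θ)
  have h2 := Submodule.finrank_lt_finrank_of_lt
    (lt_of_le_of_ne (sup_le (Zb_mono (σ := σ) (θ := θ) h) (Fb_le_Zb hinv hKθ))
      (fun he => hb' (he ▸ hb)))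
  unfold hom at h1 ⊢
  omega

/-- Deleting the edges of an essential closed dual walk reduces the homology. -/
lemma hom_delete_lt (hinv : ∀ d, θ (θ d) = d) (hKθ : ∀ d ∈ K, θ d ∈ K) {K' : Finset D}
    (h : K' ⊆ K) {p : List D} (hp : Ess σ θ K K p) (hpK : ∀ d ∈ p, d ∉ K') :
    hom σ θ K' < hom σ θ K := by
  obtain ⟨⟨a, ha⟩, c, hc, hw⟩ := hp
  refine hom_lt hinv hKθ h (mem_Zb.2 ⟨c, hc, rfl⟩) fun hmem => hw ?_
  obtain ⟨b1, hb1, b2, hb2, he⟩ := Submodule.mem_sup.1 hmem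
  obtain ⟨l, hl, rfl⟩ := mem_Fb.1 hb2
  have : wt σ c p = wt σ l p := wt_congr fun d hd => by
    rw [← he, Pi.add_apply, hb1.2.2 d (hpK d hd), zero_add]
  rw [this, hl.wt_closed ha]

lemma isFc_restrict (hE : Emb σ θ vt) {K : Finset D} {l : D → ZMod 2} (hl : IsFc σ θ K l)
    (A : Finset V) (h : ∀ d ∉ within θ vt K A, vt d ∈ A → bd σ l d = 0) :
    IsFc σ θ (within θ vt K A) (fun d => if vt d ∈ A then l d else 0) ∧
      ∀ d, bd σ (fun d => if vt d ∈ A then l d else 0) d = if vt d ∈ A then bd σ l d else 0 := by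
  have htl : ∀ d, vt (σ.symm d) = vt d := fun d => by
    have := hE.tail (σ.symm d)
    rw [Equiv.apply_symm_apply] at this
    exact this.symm
  have hb : ∀ d, bd σ (fun d => if vt d ∈ A then l d else 0) d =
      if vt d ∈ A then bd σ l d else 0 := by
    intro d
    simp only [bd, htl]
    by_cases h : vt d ∈ A
    · simp only [if_pos h]
    · simp only [if_neg h, add_zero]
  refine ⟨⟨fun d hd => ?_, fun d hd => ?_⟩, hb⟩
  · rw [hb]
    by_cases hA : vt d ∈ A
    · rw [if_pos hA, h d hd hA]
    · rw [if_neg hA]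
  · obtain ⟨h1, h2, h3⟩ := mem_filter.1 hd
    simp only [htl, if_pos h2, if_pos h3]
    exact hl.2 d h1

lemma hom_split (hE : Emb σ θ vt) (hKθ : ∀ d ∈ K, θ d ∈ K) (A : Finset V) :
    hom σ θ (within θ vt K A) + hom σ θ (within θ vt K Aᶜ) ≤ hom σ θ K := by
  have hinv := hE.inv
  set K₁ := within θ vt K A
  set K₂ := within θ vt K Aᶜ
  have hd1 : ∀ d ∈ K₁, vt d ∈ A := fun d hd => (mem_filter.1 hd).2.1
  have hd2 : ∀ d ∈ K₂, vt d ∉ A := fun d hd => Finset.mem_compl.1 (mem_filter.1 hd).2.1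
  have i0 : Zb σ θ K₁ ⊓ Zb σ θ K₂ = ⊥ := by
    rw [eq_bot_iff]
    rintro b ⟨hb1, hb2⟩
    rw [Submodule.mem_bot]
    ext d
    by_cases hd : d ∈ K₁
    · exact hb2.2.2 d fun h => hd2 d h (hd1 d hd)
    · exact hb1.2.2 d hd
  have i1 : (Zb σ θ K₁ ⊔ Zb σ θ K₂) ⊓ Fb σ θ K ≤ Fb σ θ K₁ ⊔ Fb σ θ K₂ := by
    rintro b ⟨hb1, hb2⟩
    obtain ⟨b1, h1, b2, h2, rfl⟩ := Submodule.mem_sup.1 hb1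
    obtain ⟨l, hl, he⟩ := mem_Fb.1 hb2
    have he' : ∀ d, bd σ l d = b1 d + b2 d := fun d => congrFun he d
    refine Submodule.add_mem_sup (mem_Fb.2 ?_) (mem_Fb.2 ?_)
    · obtain ⟨k1, k2⟩ := isFc_restrict hE hl A fun d hd hA => by
        rw [he', h1.2.2 d hd, h2.2.2 d (fun h => hd2 d h hA), add_zero]
      refine ⟨_, k1, funext fun d => ?_⟩
      rw [k2]
      by_cases hA : vt d ∈ A
      · rw [if_pos hA, he', h2.2.2 d (fun h => hd2 d h hA), add_zero]
      · rw [if_neg hA, h1.2.2 d (fun h => hA (hd1 d h))]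
    · obtain ⟨k1, k2⟩ := isFc_restrict hE hl Aᶜ fun d hd hA => by
        rw [he', h2.2.2 d hd, h1.2.2 d (fun h => Finset.mem_compl.1 hA (hd1 d h)), add_zero]
      refine ⟨_, k1, funext fun d => ?_⟩
      rw [k2]
      by_cases hA : vt d ∈ Aᶜ
      · rw [if_pos hA, he', h1.2.2 d (fun h => Finset.mem_compl.1 hA (hd1 d h)), zero_add]
      · rw [if_neg hA, h2.2.2 d (fun h => hA (Finset.mem_compl.2 (hd2 d h)))]
  have j0 := Submodule.finrank_sup_add_finrank_inf_eq (Zb σ θ K₁) (Zb σ θ K₂)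
  rw [i0, finrank_bot] at j0
  have j1 := Submodule.finrank_sup_add_finrank_inf_eq (Zb σ θ K₁ ⊔ Zb σ θ K₂) (Fb σ θ K)
  have j2 := Submodule.finrank_mono i1
  have j3 := Submodule.finrank_add_le_finrank_add_finrank (Fb σ θ K₁) (Fb σ θ K₂)
  have z1 : Zb σ θ K₁ ≤ Zb σ θ K := Zb_mono (within_subset K A)
  have z2 : Zb σ θ K₂ ≤ Zb σ θ K := Zb_mono (within_subset K Aᶜ)
  have z3 : Fb σ θ K₁ ≤ Zb σ θ K₁ := Fb_le_Zb hinv (within_closed hinv hKθ A)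
  have z4 : Fb σ θ K₂ ≤ Zb σ θ K₂ := Fb_le_Zb hinv (within_closed hinv hKθ Aᶜ)
  have j4 := Submodule.finrank_mono (sup_le (sup_le z1 z2) (Fb_le_Zb hinv hKθ))
  have j5 := Submodule.finrank_mono z3
  have j6 := Submodule.finrank_mono z4
  unfold hom
  omega

lemma hom_lt_of_not_flat {O : Finset D} (hO : ∀ d, d ∈ O ↔ θ d ∉ O) (hE : Emb σ θ vt)
    (hKθ : ∀ d ∈ K, θ d ∈ K) (A : Finset V) (h : ¬ Flat σ θ K (within θ vt K Aᶜ)) :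
    hom σ θ (within θ vt K A) < hom σ θ K := by
  have hinv := hE.inv
  by_contra hlt
  have hall : ∀ b ∈ Zb σ θ K, b ∈ Zb σ θ (within θ vt K A) ⊔ Fb σ θ K := by
    intro b hb
    by_contra hb'
    exact hlt (hom_lt hinv hKθ (within_subset K A) hb hb')
  refine h fun c hc => ?_
  have htl : ∀ d, vt (σ.symm d) = vt d := fun d => by
    have := hE.tail (σ.symm d)
    rw [Equiv.apply_symm_apply] at this
    exact this.symm
  set g : D → ZMod 2 := fun d => if vt d ∈ A then 0 else c d with hg
  have hbg : ∀ d, bd σ g d = bd σ c d := by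
    intro d
    by_cases hA : vt d ∈ A
    · rw [hc.2 d fun h => Finset.mem_compl.1 (mem_filter.1 h).2.1 hA]
      simp only [bd, hg, htl, if_pos hA, add_zero]
    · simp only [bd, hg, htl, if_neg hA]
  have hgZ : IsZc σ θ K g := by
    refine ⟨fun d => ?_, fun d hd => ?_⟩
    · rw [hbg, hbg, hc.1]
    · rw [hbg, hc.2 d fun h => hd (within_subset K Aᶜ h)]
  obtain ⟨l, h1, h2⟩ := bounds_of_psi_orth hO hinv hKθ hgZ (fun e he => by
    obtain ⟨b1, hb1, b2, hb2, hs⟩ := Submodule.mem_sup.1 (hall _ (mem_Zb.2 ⟨e, he, rfl⟩))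
    obtain ⟨l, hl, rfl⟩ := mem_Fb.1 hb2
    refine Eq.trans (sum_congr rfl fun d _ => ?_) (psi_orth_face hO hinv hKθ hgZ hl)
    rw [← hs, Pi.add_apply, mul_add, add_eq_right]
    by_cases hd : d ∈ within θ vt K A
    · obtain ⟨-, m1, m2⟩ := mem_filter.1 hd
      simp only [psi, hg, htl, if_pos m1, if_pos m2, add_zero, zero_mul]
    · rw [hb1.2.2 d hd, mul_zero])
  exact ⟨l, h1, fun d => (h2 d).trans (hbg d)⟩

end Homology

section Grid

variable {V ι : Type} [Fintype V] [DecidableEq V] [Fintype ι] [DecidableEq ι]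

/-- Two families of `n` edge-disjoint connected subgraphs, meeting pairwise. -/
structure Grid (n : ℕ) (u : Sym2 V → ℕ) (P Q : Fin n → Finset V) (pi qi : Fin n → Sym2 V → ℕ) :
    Prop where
  routeP : ∀ i, ∀ v ∈ P i, ∀ w ∈ P i, IsRoute v w (pi i)
  routeQ : ∀ i, ∀ v ∈ Q i, ∀ w ∈ Q i, IsRoute v w (qi i)
  capP : ∀ e, ∑ i, pi i e ≤ u e
  capQ : ∀ e, ∑ i, qi i e ≤ u e
  meet : ∀ i j, ∃ v, v ∈ P i ∧ v ∈ Q j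

lemma card_le_cut {κ : Type} [Fintype κ] {u : Sym2 V → ℕ} {P : κ → Finset V} {pi : κ → Sym2 V → ℕ}
    (hr : ∀ i, ∀ v ∈ P i, ∀ w ∈ P i, IsRoute v w (pi i)) (hc : ∀ e, ∑ i, pi i e ≤ u e)
    (A : Finset V) (S : Finset κ) (h : ∀ i ∈ S, ∃ v ∈ P i, ∃ w ∈ P i, v ∈ A ∧ w ∉ A) :
    #S ≤ cut u A := by
  have h1 : ∀ i ∈ S, 1 ≤ cut (pi i) A := by
    intro i hi
    obtain ⟨v, hv, w, hw, h1, h2⟩ := h i hi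
    have := (hr i v hv w hw).sep_le A
    rw [sep_mk, if_neg (by tauto)] at this
    exact this
  calc #S = ∑ i ∈ S, 1 := by simp
    _ ≤ ∑ i ∈ S, cut (pi i) A := sum_le_sum h1
    _ ≤ ∑ i, cut (pi i) A := sum_le_sum_of_subset (subset_univ _)
    _ ≤ cut u A := by
      unfold cut
      rw [sum_comm]
      refine sum_le_sum fun e _ => ?_
      rw [← sum_mul]
      exact Nat.mul_le_mul_right _ (hc e)

variable {n : ℕ} {u : Sym2 V → ℕ} {P Q : Fin n → Finset V} {pi qi : Fin n → Sym2 V → ℕ}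

/-- Sets containing no row of the grid. -/
def Loose (P : Fin n → Finset V) (A : Finset V) : Prop := ∀ i, ¬ P i ⊆ A

lemma Loose.anti {A B : Finset V} (h : A ⊆ B) (hB : Loose P B) : Loose P A :=
  fun i hi => hB i (hi.trans h)

lemma Grid.card_meet_le (h : Grid n u P Q pi qi) {A : Finset V} (hA : Loose P A) :
    #{i | (P i ∩ A).Nonempty} ≤ cut u A := by
  refine card_le_cut h.routeP h.capP A _ fun i hi => ?_
  obtain ⟨v, hv⟩ := (mem_filter.1 hi).2
  obtain ⟨w, hw, hw'⟩ := not_subset.1 (hA i)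
  exact ⟨v, (mem_inter.1 hv).1, w, hw, (mem_inter.1 hv).2, hw'⟩

lemma Grid.le_cut (h : Grid n u P Q pi qi) {A : Finset V} (i j : Fin n) (hi : P i ⊆ A)
    (hj : ¬ (P j ∩ A).Nonempty) : n ≤ cut u A := by
  have := card_le_cut h.routeQ h.capQ A univ fun m _ => by
    obtain ⟨v, hv, hv'⟩ := h.meet i m
    obtain ⟨w, hw, hw'⟩ := h.meet j m
    exact ⟨v, hv', w, hw', hi hv, fun hwA => hj ⟨w, mem_inter.2 ⟨hw, hwA⟩⟩⟩
  simpa using this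

lemma Grid.loose_union (h : Grid n u P Q pi qi) {A B : Finset V} (hA : Loose P A) (hB : Loose P B)
    (hc : cut u A + cut u B < n) : Loose P (A ∪ B) := by
  intro i hi
  have h1 := h.card_meet_le hA
  have h2 := h.card_meet_le hB
  obtain ⟨j, -, hj⟩ := exists_mem_notMem_of_card_lt_card
    (s := univ.filter (fun i => (P i ∩ A).Nonempty) ∪ univ.filter fun i => (P i ∩ B).Nonempty)
    (t := univ) (by
      have := card_union_le (univ.filter fun i => (P i ∩ A).Nonempty)
        (univ.filter fun i => (P i ∩ B).Nonempty)
      rw [Finset.card_univ, Fintype.card_fin]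
      omega)
  have h3 := h.le_cut i j hi fun hne => by
    obtain ⟨v, hv⟩ := hne
    obtain ⟨h4, h5⟩ := mem_inter.1 hv
    refine hj (mem_union.2 ?_)
    rcases mem_union.1 h5 with h5 | h5
    · exact Or.inl (mem_filter.2 ⟨mem_univ _, v, mem_inter.2 ⟨h4, h5⟩⟩)
    · exact Or.inr (mem_filter.2 ⟨mem_univ _, v, mem_inter.2 ⟨h4, h5⟩⟩)
  have := cut_union_le u A B
  omega

lemma Grid.loose_empty (h : Grid n u P Q pi qi) : Loose P ∅ := by
  intro i hi
  obtain ⟨v, hv, -⟩ := h.meet i i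
  exact notMem_empty _ (hi hv)

lemma sum_comp_le {κ : Type} [Fintype κ] [DecidableEq κ] {I : Finset ι} {φ : ι → κ} (F : κ → ℕ)
    (h : ∀ d ∈ I, ∀ d' ∈ I, φ d = φ d' → d = d') : ∑ d ∈ I, F (φ d) ≤ ∑ i, F i := by
  rw [← sum_image (f := F) (g := φ) (fun d hd d' hd' => h d hd d' hd')]
  exact sum_le_sum_of_subset (subset_univ _)

lemma sum_comp_add_le {κ : Type} [Fintype κ] [DecidableEq κ] {I : Finset ι} {φ ψ : ι → κ}
    (F : κ → ℕ) (h : ∀ d ∈ I, ∀ d' ∈ I, φ d = φ d' → d = d')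
    (h' : ∀ d ∈ I, ∀ d' ∈ I, ψ d = ψ d' → d = d') (hd : ∀ d ∈ I, ∀ d' ∈ I, φ d ≠ ψ d') :
    ∑ d ∈ I, (F (φ d) + F (ψ d)) ≤ ∑ i, F i := by
  rw [sum_add_distrib, ← sum_image (f := F) (g := φ) (fun d hd d' hd' => h d hd d' hd'),
    ← sum_image (f := F) (g := ψ) (fun d hd d' hd' => h' d hd d' hd'), ← sum_union]
  · exact sum_le_sum_of_subset (subset_univ _)
  · rw [disjoint_left]
    intro i hi hi'
    obtain ⟨d, h1, rfl⟩ := mem_image.1 hi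
    obtain ⟨d', h2, h3⟩ := mem_image.1 hi'
    exact hd d h1 d' h2 h3.symm

open Classical in
/-- Routing through a grid. -/
lemma grid_routing (h : Grid n u P Q pi qi) (s t : ι → V) (z : ι → ℝ) (hz : ∀ d, 0 ≤ z d)
    (hz1 : ∀ d, z d ≤ 1) (hX : 32 * ∑ d, z d ≤ n)
    (hL : ∀ A, Loose P A → 1 / 2 * wload s t z A ≤ cut u A)
    (hw : ∀ d, 0 < z d → ∃ w, IsRoute (s d) (t d) w ∧ ∀ e, w e ≤ u e) :
    ∃ (I : Finset ι) (f : ι → Sym2 V → ℕ), (∀ d ∈ I, 0 < z d ∧ IsRoute (s d) (t d) (f d)) ∧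
      (∀ e, ∑ d ∈ I, f d e ≤ 3 * u e) ∧ ∑ d, z d ≤ 256 * #I := by
  set X := ∑ d, z d with hXdef
  have hX0 : 0 ≤ X := sum_nonneg fun d _ => hz d
  by_cases hXp : X = 0
  · exact ⟨∅, fun _ _ => 0, by simp, by simp, by simp [hXp]⟩
  by_cases hM : X < 128
  · obtain ⟨d, hd⟩ : ∃ d, 0 < z d := by
      by_contra hcon
      push Not at hcon
      exact hXp (sum_eq_zero fun d _ => le_antisymm (hcon d) (hz d))
    obtain ⟨w, h1, h2⟩ := hw d hd
    refine ⟨{d}, fun _ => w, ?_, ?_, ?_⟩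
    · intro d' hd'; rw [mem_singleton] at hd'; subst hd'; exact ⟨hd, h1⟩
    · intro e
      have := h2 e
      simp only [sum_singleton]; omega
    · rw [card_singleton]; push_cast; linarith
  push Not at hM
  obtain ⟨M0, hM0⟩ : ∃ M0 : ℕ, M0 = ⌊X / 128⌋₊ := ⟨_, rfl⟩
  have hM1 : (M0 : ℝ) ≤ X / 128 := hM0 ▸ Nat.floor_le (by positivity)
  have hM2 : X / 128 < M0 + 1 := hM0 ▸ Nat.lt_floor_add_one _
  have hM3 : 1 ≤ M0 := hM0 ▸ Nat.le_floor (by push_cast; linarith)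
  have hM3' : (1 : ℝ) ≤ M0 := by exact_mod_cast hM3
  have hMn : 4 * M0 + 3 ≤ n := by
    have : ((4 * M0 + 3 : ℕ) : ℝ) ≤ n := by push_cast; linarith
    exact_mod_cast this
  rcases extendable_or_local u s t (Loose P) (fun A B hAB hB => hB.anti hAB) (n - 1)
    (fun A B hA hB hc => h.loose_union hA hB (by omega)) h.loose_empty z hz hz1 (1 / 2)
    (by norm_num) (by norm_num) hL hw M0 (by linarith) (by omega) with ⟨I, f, h1, h2, h3⟩ | hext
  · exact ⟨I, f, h2, fun e => (h3 e).trans (by omega), by linarith⟩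
  · obtain ⟨I, h1, h2, h3, -⟩ := greedy_balanced (∅ : Finset Unit) (fun _ _ => False) z hz
        (fun _ => 0)
      (by simp) (Linkable u s t (Loose P)) (fun A _ => by simp [load]) (X / 2)
      (by positivity) M0 (fun I h1 h2 => by
        refine (hext I h1 h2).trans (le_of_eq ?_)
        refine sum_congr ?_ fun _ _ => rfl
        congr!) M0 le_rfl (fun _ => 0) (fun _ => le_rfl)
    have : Nonempty (Fin n) := ⟨⟨0, by omega⟩⟩
    obtain ⟨φ, ψ, p, q, g, g', k1, k2, k3, h4, h5, h6⟩ := exists_links u s t I univ P (fun A => by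
      have h7 := load_le s t I A
      by_cases hA : Loose P A
      · exact (h1 A hA).trans (by omega)
      · obtain ⟨i, hi⟩ : ∃ i, P i ⊆ A := by
          by_contra hcon; push Not at hcon; exact hA hcon
        by_cases hall : ∀ j, (P j ∩ A).Nonempty
        · rw [filter_true_of_mem fun j _ => hall j, Finset.card_univ, Fintype.card_fin]
          omega
        · push Not at hall
          obtain ⟨j, hj⟩ := hall
          have := h.le_cut i j hi (by rw [hj]; simp)
          omega)
    choose v hv hv' using h.meet
    refine ⟨I, fun d e => g d e + (pi (φ d) e + qi (φ d) e) + pi (ψ d) e + g' d e,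
      fun d hd => ⟨h3 d hd, ?_⟩, fun e => ?_, ?_⟩
    · obtain ⟨-, a1, a2⟩ := h4 d hd
      obtain ⟨-, b1, b2⟩ := h5 d hd
      have c1 := h.routeP (φ d) _ a1 _ (hv (φ d) (φ d))
      have c2 := h.routeQ (φ d) _ (hv' (φ d) (φ d)) _ (hv' (ψ d) (φ d))
      have c3 := h.routeP (ψ d) _ (hv (ψ d) (φ d)) _ b1
      exact ((a2.trans (c1.trans c2)).trans c3).trans b2.symm
    · have d1 := h6 e
      have d2 := sum_comp_add_le (fun i => pi i e) k1 k2 k3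
      have d3 := sum_comp_le (fun i => qi i e) k1
      have d4 := h.capP e
      have d5 := h.capQ e
      have d6 : ∑ d ∈ I, (g d e + (pi (φ d) e + qi (φ d) e) + pi (ψ d) e + g' d e) =
          ∑ d ∈ I, (g d e + g' d e) + ∑ d ∈ I, (pi (φ d) e + pi (ψ d) e) + ∑ d ∈ I, qi (φ d) e := by
        rw [← sum_add_distrib, ← sum_add_distrib]
        exact sum_congr rfl fun _ _ => by ring
      rw [d6]
      omega
    · rw [h2]; linarith

end Grid

section Hub

variable {V ι μ D : Type} [Fintype V] [DecidableEq V] [Fintype ι] [DecidableEq ι] [Fintype μ]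
  [Fintype D] [DecidableEq D] {σ θ : Equiv.Perm D} {vt : D → V} {K : Finset D}
  {s t : ι → V} {dm : μ → ι} {wk : ∀ i, (⊤ : SimpleGraph V).Walk (s (dm i)) (t (dm i))}
  {y : μ → ℝ}

lemma sum_ue_le (hE : Emb σ θ vt) {κ : Type} [Fintype κ] (R : κ → Finset D)
    (hK : ∀ i, R i ⊆ K) (hθ : ∀ i, ∀ d ∈ R i, θ d ∈ R i)
    (hd : ∀ i j, i ≠ j → Disjoint (R i) (R j)) (e : Sym2 V) :
    ∑ i, ue (edg θ vt (R i)) e ≤ ue (edg θ vt K) e := by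
  classical
  by_cases h : ∃ i, e ∈ edg θ vt (R i)
  · obtain ⟨i, hi⟩ := h
    rw [sum_eq_single i]
    · exact ue_mono (edg_mono (hK i)) e
    · intro j _ hj
      refine if_neg fun he => ?_
      obtain ⟨d, h1, h2⟩ := mem_edg.1 hi
      obtain ⟨d', h3, h4⟩ := mem_edg.1 he
      rcases hE.simple d d' (h2.trans h4.symm) with h5 | h5
      · exact disjoint_left.1 (hd i j hj.symm) h1 (h5 ▸ h3)
      · exact disjoint_left.1 (hd i j hj.symm) h1 (h5 ▸ hθ j d' h3)
    · intro h; exact absurd (mem_univ _) h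
  · push Not at h
    exact (sum_eq_zero fun i _ => if_neg (h i)).le.trans (Nat.zero_le _)

lemma rims_disjoint (hinv : ∀ d, θ (θ d) = d) (hKθ : ∀ d ∈ K, θ d ∈ K) (a : Face σ θ K) {i j : ℕ}
    (h : i ≠ j) : Disjoint (rim σ θ K a i) (rim σ θ K a j) := by
  rcases lt_or_gt_of_ne h with h | h
  · exact rim_disjoint hinv hKθ a h
  · exact (rim_disjoint hinv hKθ a h).symm

lemma Systole.grid {O : Finset D} (hO : ∀ d, d ∈ O ↔ θ d ∉ O) (hE : Emb σ θ vt)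
    (hKθ : ∀ d ∈ K, θ d ∈ K) {a : ℕ → D} {f : ℕ → Face σ θ K} {ℓ : ℕ} (h : Systole σ θ K a f ℓ)
    (n : ℕ) (hn : 10 * n ≤ ℓ) : Grid n (ue (edg θ vt K))
      (fun i => h.circle vt (5 * n) (n + i)) (fun i => h.circle vt (4 * n) (n + i))
      (fun i => ue (edg θ vt (rim σ θ K (f (5 * n)) (n + i))))
      (fun i => ue (edg θ vt (rim σ θ K (f (4 * n)) (n + i)))) where
  routeP i v hv w hw := circ_routes hv hw
  routeQ i v hv w hw := circ_routes hv hw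
  capP := sum_ue_le hE _ (fun i => rim_subset _ _) (fun i => rim_closed hE.inv hKθ _ _)
    fun i j hij => rims_disjoint hE.inv hKθ _ (by
      have := Fin.val_ne_of_ne hij
      omega)
  capQ := sum_ue_le hE _ (fun i => rim_subset _ _) (fun i => rim_closed hE.inv hKθ _ _)
    fun i j hij => rims_disjoint hE.inv hKθ _ (by
      have := Fin.val_ne_of_ne hij
      omega)
  meet i j := by
    have hi := i.2
    have hj := j.2
    obtain ⟨v, h1, h2⟩ := h.circles_meet hO hE hKθ (p := 4 * n) (i := n + j) (q := 5 * n)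
      (j := n + i) (by omega) (by omega) (by omega) (by omega) (by omega) (by omega) (by omega)
    exact ⟨v, h2, h1⟩

/-- Loose sets with small cuts have complements that are not flat. -/
lemma Systole.not_flat {O : Finset D} (hO : ∀ d, d ∈ O ↔ θ d ∉ O) (hE : Emb σ θ vt)
    (hKθ : ∀ d ∈ K, θ d ∈ K) {a : ℕ → D} {f : ℕ → Face σ θ K} {ℓ : ℕ} (h : Systole σ θ K a f ℓ)
    (n : ℕ) (hn : 10 * n ≤ ℓ) {Z : Finset V}
    (hZ : Loose (fun i : Fin n => h.circle vt (5 * n) (n + i)) Z)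
    (hc : 2 * cut (ue (edg θ vt K)) Z < n) : ¬ Flat σ θ K (within θ vt K Zᶜ) := by
  intro hT
  have h1 := h.card_inside_le hO hE hKθ Zᶜ hT
  rw [cut_compl] at h1
  have h2 := (h.grid hO hE hKθ n hn).card_meet_le hZ
  have h3 : #(univ.filter fun i : Fin n => ¬ (h.circle vt (5 * n) (n + i) ∩ Z).Nonempty) ≤
      #((range ℓ).filter fun i => vt (a i) ∈ Zᶜ ∧ vt (θ (a i)) ∈ Zᶜ) := by
    refine card_le_card_of_injOn (fun i : Fin n => 6 * n + i) ?_ ?_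
    · intro i hi
      have hi' := (mem_filter.1 (mem_coe.1 hi)).2
      have hin := i.2
      obtain ⟨m1, m2⟩ := h.circle_mem hO hE hKθ (p := 5 * n) (j := n + i) (i := 6 * n + i)
        (by omega) (by omega) (by omega) (Or.inl (by omega))
      refine mem_coe.2 (mem_filter.2 ⟨mem_range.2 (by dsimp only; omega), ?_, ?_⟩)
      · exact Finset.mem_compl.2 fun hm => hi' ⟨_, mem_inter.2 ⟨m1, hm⟩⟩
      · exact Finset.mem_compl.2 fun hm => hi' ⟨_, mem_inter.2 ⟨m2, hm⟩⟩
    · intro i _ j _ hij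
      exact Fin.ext (by simpa using hij)
  have h4 := card_filter_add_card_filter_not (s := (univ : Finset (Fin n)))
    (fun i => (h.circle vt (5 * n) (n + i) ∩ Z).Nonempty)
  rw [Finset.card_univ, Fintype.card_fin] at h4
  omega

open Classical in
lemma wload_union_ge (hy : ∀ i, 0 ≤ y i) (A Z : Finset V) :
    wload s t (zof dm y) Z +
      wload s t (zof dm fun i => if Stays wk Z Zᶜ i then y i else 0) A ≤
      wload s t (zof dm y) (A ∪ Z) := by
  rw [wload_zof, wload_zof, wload_zof, ← sum_add_distrib]
  refine sum_le_sum fun i _ => ?_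
  by_cases h : Stays wk Z Zᶜ i
  · rw [if_pos h, ← mul_add]
    refine mul_le_mul_of_nonneg_left ?_ (hy i)
    have h1 : ind (s (dm i)) Z = 0 := if_neg (Finset.mem_compl.1 h.1)
    have h2 : ind (t (dm i)) Z = 0 := if_neg (Finset.mem_compl.1 h.compl_mem.1)
    rw [h1, h2, Nat.cast_zero, zero_add, zero_add]
    exact_mod_cast add_le_add (ind_mono _ subset_union_left) (ind_mono _ subset_union_left)
  · rw [if_neg h, zero_mul, add_zero]
    refine mul_le_mul_of_nonneg_left ?_ (hy i)
    exact_mod_cast add_le_add (ind_mono _ subset_union_right) (ind_mono _ subset_union_right)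

lemma wload_le (z : ι → ℝ) (hz : ∀ d, 0 ≤ z d) (A : Finset V) :
    wload s t z A ≤ 2 * ∑ d, z d := by
  rw [mul_sum]
  refine sum_le_sum fun d _ => ?_
  have h1 : ((ind (s d) A + ind (t d) A : ℕ) : ℝ) ≤ 2 := by
    exact_mod_cast add_le_add (ind_le_one (s d) A) (ind_le_one (t d) A)
  push_cast at h1
  have := mul_le_mul_of_nonneg_left h1 (hz d)
  linarith

open Classical in
/-- Routing through the circles around two faces of a long systole. -/
theorem hub_routing {O : Finset D} (hO : ∀ d, d ∈ O ↔ θ d ∉ O) (hE : Emb σ θ vt)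
    (hKθ : ∀ d ∈ K, θ d ∈ K) {a : ℕ → D} {f : ℕ → Face σ θ K} {ℓ : ℕ} (h : Systole σ θ K a f ℓ)
    (n : ℕ) (hn0 : 0 < n) (hn : 10 * n ≤ ℓ)
    (hneck : ∀ A, cut (ue (edg θ vt K)) A < n →
      Flat σ θ K (within θ vt K Aᶜ) ∨ Planar σ θ (within θ vt K A))
    (hy : IsFlow dm wk (edg θ vt K) y) (hX : 64 * ∑ i, y i ≤ n) :
    ∃ I : Finset ι, (∀ d ∈ I, ∃ i, y i ≠ 0 ∧ dm i = d) ∧ Route3 s t (edg θ vt K) I ∧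
      ∑ i, y i ≤ 2 ^ 79 * #I := by
  have hG := h.grid hO hE hKθ n hn
  set u := ue (edg θ vt K) with hu
  set P : Fin n → Finset V := fun i => h.circle vt (5 * n) (n + i) with hP
  have hn0' : (0 : ℝ) < n := by exact_mod_cast hn0
  obtain ⟨Z, hZ, hZmax⟩ := exists_max_image (univ.filter fun A => Loose P A ∧
    cut u A ≤ 1 / 2 * wload s t (zof dm y) A) card ⟨∅, mem_filter.2 ⟨mem_univ _, hG.loose_empty, by
      rw [cut_empty]
      have := wload_nonneg (s := s) (t := t) _ hy.zof_nonneg ∅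
      push_cast
      linarith⟩⟩
  obtain ⟨-, hZL, hZc⟩ := mem_filter.1 hZ
  have hw1 := wload_le (s := s) (t := t) _ hy.zof_nonneg Z
  rw [sum_zof] at hw1
  have hcn : ((64 * cut u Z : ℕ) : ℝ) ≤ n := by push_cast; linarith
  have hcn' : 64 * cut u Z ≤ n := by exact_mod_cast hcn
  have hpl : Planar σ θ (within θ vt K Z) :=
    (hneck Z (by omega)).resolve_left (h.not_flat hO hE hKθ n hn hZL
        (by change 2 * cut u Z < n; omega))
  have hy2 : IsFlow dm wk (edg θ vt K) (fun i => if Stays wk Z Zᶜ i then y i else 0) :=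
    hy.filter _ fun i h1 _ => hy.inside i h1
  obtain ⟨ht1, ht2⟩ := hy.touch Z
  by_cases hcase : ∑ i, (if Stays wk Z Zᶜ i then y i else 0) < 1 / 2 * ∑ i, y i
  · obtain ⟨I, h1, h2, h3⟩ := planar_routing hE _ _ _ (within_closed hE.inv hKθ Z) hpl
      (hy.stays Z) le_rfl
    refine ⟨I, fun d hd => ?_, h2.mono (edg_mono (within_subset _ _)), ?_⟩
    · obtain ⟨i, h4, h5⟩ := h1 d hd
      exact ⟨i, fun h6 => h4 (by rw [h6]; exact ite_self _), h5⟩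
    · linarith
  · push Not at hcase
    have hle : ∀ i, (if Stays wk Z Zᶜ i then y i else 0) ≤ y i := fun i => by
      by_cases h1 : Stays wk Z Zᶜ i
      · rw [if_pos h1]
      · rw [if_neg h1]; exact hy.nonneg i
    have hsum := sum_le_sum fun i (_ : i ∈ (univ : Finset μ)) => hle i
    obtain ⟨I, F, h1, h2, h3⟩ := grid_routing hG s t _ hy2.zof_nonneg hy2.dem (by
        rw [sum_zof]; linarith [hy2.nonneg, sum_nonneg fun i (_ : i ∈ univ) => hy.nonneg i])
            (fun A hA => by
        have h4 := wload_le (s := s) (t := t) _ hy2.zof_nonneg A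
        rw [sum_zof] at h4
        by_contra hlt
        push Not at hlt
        have h5 : ((cut u A + cut u Z : ℕ) : ℝ) < n := by push_cast; linarith
        have h6 : cut u A + cut u Z < n := by exact_mod_cast h5
        have h7 := hG.loose_union hA hZL h6
        have h8 := wload_union_ge (wk := wk) hy.nonneg A Z
        have h9 : (cut u (A ∪ Z) : ℝ) ≤ cut u A + cut u Z := by
          exact_mod_cast cut_union_le u A Z
        have h10 := hZmax (A ∪ Z) (mem_filter.2 ⟨mem_univ _, h7, by linarith⟩)
        have h11 := eq_of_subset_of_card_le (subset_union_right (s₁ := A)) h10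
        rw [← h11] at h8
        have : (0 : ℝ) ≤ cut u A := by positivity
        linarith)
      (fun d hd => hy2.route_le hd)
    refine ⟨I, fun d hd => ?_, ⟨F, fun d hd => (h1 d hd).2, h2⟩, ?_⟩
    · obtain ⟨i, -, h4⟩ := zof_filter_pos (h1 d hd).1
      exact ⟨i, h4⟩
    · rw [sum_zof] at h3
      have : (0 : ℝ) ≤ #I := by positivity
      linarith

end Hub

section Genus

variable {V ι μ D : Type} [Fintype V] [DecidableEq V] [Fintype ι] [DecidableEq ι] [Fintype μ]
  [Fintype D] [DecidableEq D] {σ θ : Equiv.Perm D} {vt : D → V} {K : Finset D}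
  {s t : ι → V} {dm : μ → ι} {wk : ∀ i, (⊤ : SimpleGraph V).Walk (s (dm i)) (t (dm i))}
  {y : μ → ℝ}

lemma Systole.ess_seg {a : ℕ → D} {f : ℕ → Face σ θ K} {ℓ : ℕ} (h : Systole σ θ K a f ℓ) :
    Ess σ θ K K (MEDP.seg a 0 ℓ) := by
  refine ⟨⟨f 0, ?_⟩, ?_⟩
  · have := h.seg ℓ 0 (by omega)
    rw [zero_add, ← h.closed] at this
    exact this
  · obtain ⟨c, hc, hne⟩ := h.ess
    refine ⟨c, hc, ?_⟩
    rw [wt_seg]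
    simpa using hne

lemma IsFlow.scale {E : Finset (Sym2 V)} (hy : IsFlow dm wk E y) {c : ℝ} (hc : 0 ≤ c)
    (hc1 : c ≤ 1) : IsFlow dm wk E (fun i => c * y i) where
  nonneg i := mul_nonneg hc (hy.nonneg i)
  inside i hi := hy.inside i (right_ne_zero_of_mul hi)
  cap e := by
    refine le_trans (sum_le_sum fun i _ => mul_le_mul_of_nonneg_right ?_ (by positivity)) (hy.cap e)
    exact mul_le_of_le_one_left (hy.nonneg i) hc1
  dem d := le_trans (sum_le_sum fun i _ => mul_le_of_le_one_left (hy.nonneg i) hc1) (hy.dem d)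

open Classical in
/-- Deleting a set of edges destroys little flow. -/
lemma IsFlow.delete {E : Finset (Sym2 V)} (hy : IsFlow dm wk E y) (F : Finset (Sym2 V)) :
    ∑ i, y i ≤ ∑ i, (if ∀ e ∈ (wk i).edges, e ∉ F then y i else 0) + #F := by
  have h1 : ∑ e ∈ F, ∑ i, y i * ((wk i).edges.count e : ℝ) ≤ #F := by
    refine (sum_le_sum fun e _ => hy.cap e).trans ?_
    simp
  refine le_trans ?_ (add_le_add_right h1 _)
  rw [sum_comm, ← sum_add_distrib]
  refine sum_le_sum fun i _ => ?_
  have hnn : ∀ e ∈ F, 0 ≤ y i * ((wk i).edges.count e : ℝ) :=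
    fun e _ => mul_nonneg (hy.nonneg i) (by positivity)
  by_cases h : ∀ e ∈ (wk i).edges, e ∉ F
  · rw [if_pos h]
    linarith [sum_nonneg hnn]
  · rw [if_neg h, zero_add]
    push Not at h
    obtain ⟨e, he, heF⟩ := h
    refine le_trans ?_ (single_le_sum hnn heF)
    refine le_mul_of_one_le_right (hy.nonneg i) ?_
    exact_mod_cast List.count_pos_iff.2 he

open Classical in
lemma IsFlow.split (hy : IsFlow dm wk (edg θ vt K) y) (A : Finset V) :
    ∑ i, y i ≤ ∑ i, (if Stays wk A A i then y i else 0) +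
      ∑ i, (if Stays wk A Aᶜ i then y i else 0) + cut (ue (edg θ vt K)) A := by
  have h := hy.delete ((edg θ vt K).filter fun e => sep A e = 1)
  rw [cut_ue_eq]
  refine h.trans (add_le_add_left ?_ _)
  rw [← sum_add_distrib]
  refine sum_le_sum fun i _ => ?_
  have h1 : 0 ≤ if Stays wk A A i then y i else 0 := by
    by_cases h : Stays wk A A i
    · rw [if_pos h]; exact hy.nonneg i
    · rw [if_neg h]
  have h2 : 0 ≤ if Stays wk A Aᶜ i then y i else 0 := by
    by_cases h : Stays wk A Aᶜ i
    · rw [if_pos h]; exact hy.nonneg i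
    · rw [if_neg h]
  by_cases h3 : ∀ e ∈ (wk i).edges, e ∉ (edg θ vt K).filter fun e => sep A e = 1
  swap
  · rw [if_neg h3]; linarith
  rw [if_pos h3]
  by_cases hi : y i = 0
  · rw [hi] at h1 h2 ⊢; simp
  have h4 : ∀ e ∈ (wk i).edges, sep A e = 0 := fun e he => by
    have := sep_le_one A e
    have h5 : sep A e ≠ 1 := fun h6 => h3 e he (mem_filter.2 ⟨hy.inside i hi e he, h6⟩)
    omega
  by_cases h5 : s (dm i) ∈ A
  · rw [if_pos (show Stays wk A A i from ⟨h5, h4⟩)]; linarith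
  · rw [if_pos (show Stays wk A Aᶜ i from ⟨Finset.mem_compl.2 h5, h4⟩)]; linarith

open Classical in
lemma IsFlow.exclude {E : Finset (Sym2 V)} (hy : IsFlow dm wk E y) (P : μ → Prop) (I : Finset ι) :
    ∑ i, (if P i then y i else 0) ≤ ∑ i, (if P i ∧ dm i ∉ I then y i else 0) + #I := by
  have e : ∑ d ∈ I, zof dm y d = ∑ i, if dm i ∈ I then y i else 0 := by
    have := sum_zof_mul (dm := dm) y (fun d => if d ∈ I then 1 else 0)
    simpa using this
  have h1 : ∑ d ∈ I, zof dm y d ≤ #I := by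
    refine (sum_le_sum fun d _ => hy.dem d).trans ?_
    simp
  refine le_trans ?_ (add_le_add_right h1 _)
  rw [e, ← sum_add_distrib]
  refine sum_le_sum fun i _ => ?_
  have := hy.nonneg i
  by_cases h11 : P i <;> by_cases h12 : dm i ∈ I <;> simp [h11, h12, this]

open Classical in
/-- Deleting the edges of a short essential dual walk. -/
lemma IsFlow.cut_open (hE : Emb σ θ vt) (hKθ : ∀ d ∈ K, θ d ∈ K)
    (hy : IsFlow dm wk (edg θ vt K) y) {p : List D} (hp : Ess σ θ K K p) :
    ∃ K' : Finset D, K' ⊆ K ∧ (∀ d ∈ K', θ d ∈ K') ∧ hom σ θ K' < hom σ θ K ∧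
      ∃ Q : μ → Prop, IsFlow dm wk (edg θ vt K') (fun i => if Q i then y i else 0) ∧
        ∑ i, y i ≤ ∑ i, (if Q i then y i else 0) + p.length := by
  set F : Finset (Sym2 V) := p.toFinset.image fun d => s(vt d, vt (θ d)) with hF
  set K' : Finset D := K.filter fun d => s(vt d, vt (θ d)) ∉ F with hK'
  have hsym : ∀ d, s(vt (θ d), vt (θ (θ d))) = s(vt d, vt (θ d)) := fun d => by
    rw [hE.inv, Sym2.eq_swap]
  have hKθ' : ∀ d ∈ K', θ d ∈ K' := by
    intro d hd
    obtain ⟨h1, h2⟩ := mem_filter.1 hd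
    exact mem_filter.2 ⟨hKθ d h1, by rw [hsym]; exact h2⟩
  obtain ⟨Q, hQ⟩ : ∃ Q : μ → Prop, ∀ i, Q i ↔ ∀ e ∈ (wk i).edges, e ∉ F :=
    ⟨_, fun _ => Iff.rfl⟩
  refine ⟨K', filter_subset _ _, hKθ', hom_delete_lt hE.inv hKθ (filter_subset _ _) hp
    (fun d hd h => (mem_filter.1 h).2 (mem_image.2 ⟨d, List.mem_toFinset.2 hd, rfl⟩)),
    Q, ?_, ?_⟩
  · refine hy.filter Q fun i h1 h2 e he => ?_
    obtain ⟨d, hd, rfl⟩ := mem_edg.1 (hy.inside i h1 e he)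
    exact mem_edg.2 ⟨d, mem_filter.2 ⟨hd, (hQ i).1 h2 _ he⟩, rfl⟩
  · have h1 := hy.delete F
    simp only [← hQ] at h1
    have h2 : #F ≤ p.length := card_image_le.trans p.toFinset_card_le
    have h3 : (#F : ℝ) ≤ p.length := by exact_mod_cast h2
    linarith

lemma exists_of_filter {P : μ → Prop} [DecidablePred P] {I : Finset ι}
    (h : ∀ d ∈ I, ∃ i, (if P i then y i else 0) ≠ 0 ∧ dm i = d) :
    ∀ d ∈ I, ∃ i, P i ∧ y i ≠ 0 ∧ dm i = d := by
  intro d hd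
  obtain ⟨i, h1, h2⟩ := h d hd
  by_cases hP : P i
  · rw [if_pos hP] at h1; exact ⟨i, hP, h1, h2⟩
  · rw [if_neg hP] at h1; exact absurd rfl h1

open Classical in
/-- Routing in an embedded graph with bounded homology. -/
theorem homology_routing {O : Finset D} (hO : ∀ d, d ∈ O ↔ θ d ∉ O) (hE : Emb σ θ vt)
    (n : ℕ) (hn : 0 < n) (H : ℕ) : ∀ (K : Finset D) (y : μ → ℝ), (∀ d ∈ K, θ d ∈ K) →
    hom σ θ K = H → IsFlow dm wk (edg θ vt K) y →
    ∃ I : Finset ι, (∀ d ∈ I, ∃ i, y i ≠ 0 ∧ dm i = d) ∧ Route3 s t (edg θ vt K) I ∧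
      ((n : ℝ) ≤ 2 ^ 86 * #I ∨ ∑ i, y i ≤ 2 ^ 86 * #I + ((12 * H - 2 : ℕ) : ℝ) * n) := by
  induction H using Nat.strong_induction_on with
  | _ H ih =>
  intro K y hKθ hH hy
  have hn' : (0 : ℝ) < n := by exact_mod_cast hn
  have ihm : ∀ (H' : ℕ), H' < H → ((12 * H' - 2 : ℕ) : ℝ) + 10 ≤ ((12 * H - 2 : ℕ) : ℝ) := by
    intro H' h
    exact_mod_cast (by omega : 12 * H' - 2 + 10 ≤ 12 * H - 2)
  by_cases hpl : Planar σ θ K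
  · obtain ⟨I, h1, h2, h3⟩ := planar_routing hE _ K y hKθ hpl hy le_rfl
    refine ⟨I, h1, h2, Or.inr ?_⟩
    have : (0 : ℝ) ≤ #I := by positivity
    have : (0 : ℝ) ≤ ((12 * H - 2 : ℕ) : ℝ) * n := by positivity
    linarith
  obtain ⟨a, f, ℓ, hsys⟩ := exists_systole hE.inv hKθ hpl
  by_cases hℓ : ℓ < 10 * n
  · obtain ⟨K', hK', hKθ', hlt, Q, hyQ, hle⟩ := hy.cut_open hE hKθ hsys.ess_seg
    rw [length_seg] at hle
    obtain ⟨I, h1, h2, h3⟩ := ih _ (hH ▸ hlt) K' _ hKθ' rfl hyQ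
    refine ⟨I, fun d hd => ?_, h2.mono (edg_mono hK'), h3.imp id fun h3 => ?_⟩
    · obtain ⟨i, -, h4⟩ := exists_of_filter h1 d hd
      exact ⟨i, h4⟩
    · have h4 := ihm _ (hH ▸ hlt)
      have h5 : (ℓ : ℝ) ≤ 10 * n := by exact_mod_cast hℓ.le
      nlinarith
  push Not at hℓ
  by_cases hneck : ∀ A, cut (ue (edg θ vt K)) A < n →
      Flat σ θ K (within θ vt K Aᶜ) ∨ Planar σ θ (within θ vt K A)
  · by_cases hX : 64 * ∑ i, y i ≤ n
    · obtain ⟨I, h1, h2, h3⟩ := hub_routing hO hE hKθ hsys n hn hℓ hneck hy hX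
      refine ⟨I, h1, h2, Or.inr ?_⟩
      have : (0 : ℝ) ≤ #I := by positivity
      have : (0 : ℝ) ≤ ((12 * H - 2 : ℕ) : ℝ) * n := by positivity
      linarith
    · push Not at hX
      have hX0 : 0 < ∑ i, y i := by linarith
      set c : ℝ := n / (64 * ∑ i, y i) with hc
      have hc0 : 0 ≤ c := by positivity
      have hc1 : c ≤ 1 := by
        rw [hc, div_le_one (by positivity)]; exact hX.le
      have hcX : 64 * ∑ i, c * y i = n := by
        rw [← mul_sum, hc]; field_simp
      obtain ⟨I, h1, h2, h3⟩ := hub_routing hO hE hKθ hsys n hn hℓ hneck (hy.scale hc0 hc1) hcX.le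
      refine ⟨I, fun d hd => ?_, h2, Or.inl ?_⟩
      · obtain ⟨i, h4, h5⟩ := h1 d hd
        exact ⟨i, right_ne_zero_of_mul h4, h5⟩
      · have : (0 : ℝ) ≤ #I := by positivity
        linarith
  push Not at hneck
  obtain ⟨A, hA, hflat, hnp⟩ := hneck
  have hAr : (cut (ue (edg θ vt K)) A : ℝ) ≤ n := by exact_mod_cast hA.le
  have hc1 := within_closed (vt := vt) hE.inv hKθ A
  have hc2 := within_closed (vt := vt) hE.inv hKθ Aᶜ
  have hs := hom_split hE hKθ A
  have hlt := hom_lt_of_not_flat hO hE hKθ A hflat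
  have hpos : hom σ θ (within θ vt K A) ≠ 0 := fun h0 => hnp (planar_of_hom hE.inv hc1 h0)
  rw [hH] at hs hlt
  obtain ⟨I₁, h1, h2, h3⟩ := ih _ hlt _ _ hc1 rfl (hy.stays A)
  have h1' := exists_of_filter h1
  have hsub1 := edg_mono (θ := θ) (vt := vt) (within_subset (θ := θ) (vt := vt) K A)
  have hsub2 := edg_mono (θ := θ) (vt := vt) (within_subset (θ := θ) (vt := vt) K Aᶜ)
  rcases le_or_gt (n : ℝ) (2 ^ 86 * #I₁) with hbig | hbig
  · exact ⟨I₁, fun d hd => (h1' d hd).imp fun i h => h.2, h2.mono hsub1, Or.inl hbig⟩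
  have h3' := h3.resolve_left (not_le.2 hbig)
  have hy2 : IsFlow dm wk (edg θ vt (within θ vt K Aᶜ))
      (fun i => if Stays wk A Aᶜ i ∧ dm i ∉ I₁ then y i else 0) :=
    hy.filter _ fun i h6 h7 e he => mem_edg_within.2 ⟨hy.inside i h6 e he, h7.1.compl_mem.2 e he⟩
  obtain ⟨I₂, k1, k2, k3⟩ := ih (hom σ θ (within θ vt K Aᶜ)) (by omega) _ _ hc2 rfl hy2
  have k1' := exists_of_filter k1
  have hdisj : Disjoint I₁ I₂ := by
    rw [disjoint_right]
    intro d hd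
    obtain ⟨i, hi, -, rfl⟩ := k1' d hd
    exact hi.2
  refine ⟨I₁ ∪ I₂, fun d hd => ?_, h2.union k2 hsub1 hsub2
    (disjoint_edg_within disjoint_compl_right) hdisj, ?_⟩
  · rcases mem_union.1 hd with h | h
    · exact (h1' d h).imp fun i h => h.2
    · exact (k1' d h).imp fun i h => h.2
  rw [card_union_of_disjoint hdisj]
  have hI1 : (0 : ℝ) ≤ #I₁ := by positivity
  have hI2 : (0 : ℝ) ≤ #I₂ := by positivity
  push_cast
  rcases k3 with k3 | k3
  · left; linarith
  right
  have e1 := hy.split A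
  have e2 := hy.exclude (Stays wk A Aᶜ) I₁
  have e3 : ((12 * hom σ θ (within θ vt K A) - 2 : ℕ) : ℝ) +
      ((12 * hom σ θ (within θ vt K Aᶜ) - 2 : ℕ) : ℝ) + 2 ≤ ((12 * H - 2 : ℕ) : ℝ) := by
    exact_mod_cast (by omega : 12 * hom σ θ (within θ vt K A) - 2 +
      (12 * hom σ θ (within θ vt K Aᶜ) - 2) + 2 ≤ 12 * H - 2)
  have e4 := mul_le_mul_of_nonneg_right e3 hn'.le
  have e5 : (#I₁ : ℝ) ≤ n := by linarith
  linarith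

end Genus

section Euler

open Module

lemma finrank_map_add_finrank_inf_ker {W W' : Type} [AddCommGroup W] [AddCommGroup W']
    [Module (ZMod 2) W] [Module (ZMod 2) W'] [FiniteDimensional (ZMod 2) W]
    (f : W →ₗ[ZMod 2] W') (S : Submodule (ZMod 2) W) :
    finrank (ZMod 2) (S.map f) + finrank (ZMod 2) ↥(S ⊓ LinearMap.ker f) =
      finrank (ZMod 2) S := by
  rw [← LinearMap.finrank_range_add_finrank_ker (f.domRestrict S), LinearMap.range_domRestrict,
    LinearMap.ker_domRestrict, ← Submodule.map_comap_subtype,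
    LinearEquiv.finrank_eq (Submodule.equivMapOfInjective S.subtype S.injective_subtype _).symm]

variable {V D : Type} [Fintype V] [Fintype D] [DecidableEq D]
  {σ θ : Equiv.Perm D} {vt : D → V}

/-- Functions constant along the orbits of a permutation. -/
def invSub (f : Equiv.Perm D) : Submodule (ZMod 2) (D → ZMod 2) where
  carrier := {w | ∀ d, w (f d) = w d}
  add_mem' := fun ha hb d => by simp [ha d, hb d]
  zero_mem' := fun _ => rfl
  smul_mem' := fun x a ha d => by simp [ha d]

lemma finrank_invSub (f : Equiv.Perm D) : finrank (ZMod 2) (invSub f) = numOrbits f := by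
  classical
  have : Fintype (Quotient (permOrbitSetoid f)) := Fintype.ofFinite _
  have hR : LinearMap.range (LinearMap.funLeft (ZMod 2) (ZMod 2)
      (Quotient.mk (permOrbitSetoid f))) = invSub f := by
    ext w
    constructor
    · rintro ⟨u, rfl⟩ d
      exact congrArg u (Quotient.sound (s := permOrbitSetoid f)
        (show f.SameCycle (f d) d from (Equiv.Perm.sameCycle_apply_left).2 (.refl _ _)))
    · intro hw
      refine ⟨Quotient.lift w ?_, rfl⟩
      intro a b h
      obtain ⟨n, rfl⟩ := (show f.SameCycle a b from h).exists_nat_pow_eq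
      clear h
      induction n with
      | zero => rfl
      | succ n ih => rw [ih, pow_succ', Equiv.Perm.mul_apply, hw]
  rw [← hR, LinearMap.finrank_range_of_inj (LinearMap.funLeft_injective_of_surjective _ _ _
    Quotient.mk_surjective), finrank_fintype_fun_eq_card, numOrbits, Nat.card_eq_fintype_card]

lemma finrank_fcSub_univ (hinv : ∀ d, θ (θ d) = d) :
    finrank (ZMod 2) (fcSub σ θ univ) = numOrbits (σ * θ) := by
  rw [← finrank_invSub]
  have hmap : (fcSub σ θ univ).map (LinearMap.funLeft (ZMod 2) (ZMod 2) θ) = invSub (σ * θ) := by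
    ext w
    constructor
    · rintro ⟨c, hc, rfl⟩ d
      have := hc.2 (σ (θ d)) (mem_univ _)
      rw [Equiv.symm_apply_apply] at this
      exact this.symm
    · intro hw
      refine ⟨w ∘ θ, ⟨fun d hd => absurd (mem_univ d) hd, fun d _ => ?_⟩, ?_⟩
      · have := hw (θ (σ.symm d))
        simp only [Equiv.Perm.mul_apply, hinv, Equiv.apply_symm_apply] at this
        simpa only [Function.comp, hinv] using this.symm
      · ext d
        exact congrArg w (hinv d)
  rw [← hmap]
  exact LinearEquiv.finrank_eq (Submodule.equivMapOfInjective _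
    (LinearMap.funLeft_injective_of_surjective _ _ _ θ.surjective) _)

/-- Functions constant along the components of the embedded graph. -/
def compSub (σ θ : Equiv.Perm D) : Submodule (ZMod 2) (D → ZMod 2) := invSub σ ⊓ invSub θ

lemma finrank_Fb_univ (hinv : ∀ d, θ (θ d) = d) :
    finrank (ZMod 2) (Fb σ θ univ) + finrank (ZMod 2) (compSub σ θ) = numOrbits (σ * θ) := by
  rw [← finrank_fcSub_univ hinv, ← finrank_map_add_finrank_inf_ker (bdL σ) (fcSub σ θ univ), Fb]
  suffices h : compSub σ θ = fcSub σ θ univ ⊓ LinearMap.ker (bdL σ) by rw [h]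
  have z2 : ∀ a b : ZMod 2, a + b = 0 ↔ a = b := by decide
  have hker : ∀ w, w ∈ LinearMap.ker (bdL σ) ↔ ∀ d, w d = w (σ.symm d) := fun w => by
    rw [LinearMap.mem_ker, funext_iff]
    exact forall_congr' fun d => z2 _ _
  ext w
  rw [Submodule.mem_inf, hker]
  constructor
  · rintro ⟨h1, h2⟩
    have h3 : ∀ d, w d = w (σ.symm d) := fun d => by
      have := h1 (σ.symm d)
      rwa [Equiv.apply_symm_apply] at this
    exact ⟨⟨fun d hd => absurd (mem_univ d) hd, fun d _ => by rw [← h3, h2]⟩, h3⟩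
  · rintro ⟨h1, h2⟩
    refine ⟨fun d => by rw [h2 (σ d), Equiv.symm_apply_apply], fun d => ?_⟩
    rw [← h1.2 d (mem_univ d), ← h2]

lemma finrank_Zb_add_le {O : Finset D} (hO : ∀ d, d ∈ O ↔ θ d ∉ O) (hinv : ∀ d, θ (θ d) = d) :
    finrank (ZMod 2) (Zb σ θ univ) + finrank (ZMod 2) (invSub σ) ≤
      #O + finrank (ZMod 2) (compSub σ θ) := by
  have z2 : ∀ a b : ZMod 2, a + b = 0 ↔ a = b := by decide
  let δ : (D → ZMod 2) →ₗ[ZMod 2] (O → ZMod 2) :=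
    { toFun := fun w d => w d + w (θ d)
      map_add' := fun a b => by ext d; simp only [Pi.add_apply]; ring
      map_smul' := fun a b => by ext d; simp [mul_add] }
  have hker : invSub σ ⊓ LinearMap.ker δ = compSub σ θ := by
    ext w
    rw [Submodule.mem_inf, compSub, Submodule.mem_inf, LinearMap.mem_ker, funext_iff]
    refine and_congr_right fun _ => ⟨fun h d => ?_, fun h d => (z2 _ _).2 (h d).symm⟩
    by_cases hd : d ∈ O
    · exact ((z2 _ _).1 (h ⟨d, hd⟩)).symm
    · have hd' : θ d ∈ O := by rw [hO, hinv]; exact hd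
      have := (z2 _ _).1 (h ⟨θ d, hd'⟩)
      rwa [hinv] at this
  have h1 := finrank_map_add_finrank_inf_ker δ (invSub σ)
  rw [hker] at h1
  let T : (D → ZMod 2) →ₗ[ZMod 2] Dual (ZMod 2) (O → ZMod 2) :=
    { toFun := fun b =>
        { toFun := fun u => ∑ d : O, u d * b d
          map_add' := fun u v => by simp [add_mul, sum_add_distrib]
          map_smul' := fun x u => by simp [mul_sum, mul_assoc] }
      map_add' := fun b b' => LinearMap.ext fun u => by
        change ∑ d : O, u d * (b d + b' d) = ∑ d : O, u d * b d + ∑ d : O, u d * b' d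
        rw [← sum_add_distrib]
        exact sum_congr rfl fun _ _ => mul_add _ _ _
      map_smul' := fun x b => by ext u; simp [mul_left_comm, mul_sum] }
  have hT : (Zb σ θ univ).map T ≤ ((invSub σ).map δ).dualAnnihilator := by
    rintro _ ⟨b, hb, rfl⟩
    rw [Submodule.mem_dualAnnihilator]
    rintro _ ⟨w, hw, rfl⟩
    obtain ⟨⟨c, rfl⟩, hb1, -⟩ := hb
    change ∑ d : O, (w d + w (θ d)) * bd σ c d = 0
    rw [sum_coe_sort O (fun d => (w d + w (θ d)) * bd σ c d), ← sum_inv_mul_bd σ (fun d => hw d) c,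
      sum_orientation hO hinv]
    refine sum_congr rfl fun d _ => ?_
    rw [show bd σ c (θ d) = bd σ c d from hb1 d]
    ring
  have hTker : Zb σ θ univ ⊓ LinearMap.ker T = ⊥ := by
    rw [eq_bot_iff]
    rintro b ⟨⟨-, hb1, -⟩, hb⟩
    have h0 : ∀ d (hd : d ∈ O), b d = 0 := fun d hd => by
      have := LinearMap.congr_fun (LinearMap.mem_ker.1 hb) (Pi.single ⟨d, hd⟩ 1)
      simpa [T, Pi.single_apply] using this
    refine (Submodule.mem_bot _).2 (funext fun d => ?_)
    by_cases hd : d ∈ O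
    · exact h0 d hd
    · rw [← hb1 d]
      exact h0 _ (by rw [hO, hinv]; exact hd)
  have h2 := finrank_map_add_finrank_inf_ker T (Zb σ θ univ)
  rw [hTker, finrank_bot, add_zero] at h2
  have h3 := Submodule.finrank_mono hT
  have h4 := Subspace.finrank_add_finrank_dualAnnihilator_eq ((invSub σ).map δ)
  rw [finrank_fintype_fun_eq_card, Fintype.card_coe] at h4
  omega

lemma hom_univ_le {O : Finset D} (hO : ∀ d, d ∈ O ↔ θ d ∉ O) (hinv : ∀ d, θ (θ d) = d) :
    hom σ θ univ + finrank (ZMod 2) (invSub σ) + numOrbits (σ * θ) ≤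
      #O + 2 * finrank (ZMod 2) (compSub σ θ) := by
  have h1 := finrank_Zb_add_le (σ := σ) hO hinv
  have h2 := finrank_Fb_univ (σ := σ) hinv
  have h3 := Submodule.finrank_mono (Fb_le_Zb (σ := σ) (K := univ) hinv fun d _ => mem_univ (θ d))
  unfold hom
  omega

/-- Counting components, with `C` the type of components and `π` the component map. -/
lemma card_add_finrank_compSub_le (hE : Emb σ θ vt) {C : Type} [Fintype C] (π : V → C)
    (hπ : ∀ f : V → ZMod 2, (∀ d, f (vt (θ d)) = f (vt d)) → ∃ u : C → ZMod 2, u ∘ π = f) :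
    Fintype.card V + finrank (ZMod 2) (compSub σ θ) ≤
      Fintype.card C + finrank (ZMod 2) (invSub σ) ∧
    finrank (ZMod 2) (invSub σ) ≤ Fintype.card V := by
  classical
  let τ : (V → ZMod 2) →ₗ[ZMod 2] (D → ZMod 2) := LinearMap.funLeft (ZMod 2) (ZMod 2) vt
  have hrange : LinearMap.range τ = invSub σ := by
    ext w
    constructor
    · rintro ⟨f, rfl⟩ d
      exact congrArg f (hE.tail d)
    · intro hw
      have key : ∀ d d', vt d = vt d' → w d' = w d := by
        intro d d' h
        obtain ⟨n, rfl⟩ := hE.cyc d d' h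
        clear h
        induction n with
        | zero => rfl
        | succ n ih => rw [pow_succ', Equiv.Perm.mul_apply, hw, ih]
      refine ⟨fun v => if h : ∃ d, vt d = v then w h.choose else 0, funext fun d => ?_⟩
      have h : ∃ d', vt d' = vt d := ⟨d, rfl⟩
      change (if h : ∃ d', vt d' = vt d then w h.choose else 0) = w d
      rw [dif_pos h]
      exact key _ _ h.choose_spec.symm
  set L : Submodule (ZMod 2) (V → ZMod 2) := (compSub σ θ).comap τ with hL
  have h1 := LinearMap.finrank_range_add_finrank_ker τ
  rw [hrange, finrank_fintype_fun_eq_card] at h1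
  have h2 := finrank_map_add_finrank_inf_ker τ L
  rw [hL, Submodule.map_comap_eq, hrange, ← hL,
    inf_eq_right.2 (show compSub σ θ ≤ invSub σ from inf_le_left),
    inf_eq_right.2 (LinearMap.ker_le_comap τ)] at h2
  have h3 : L ≤ LinearMap.range (LinearMap.funLeft (ZMod 2) (ZMod 2) π) := fun f hf =>
    hπ f fun d => hf.2 d
  have h4 := (Submodule.finrank_mono h3).trans (LinearMap.finrank_range_le _)
  rw [finrank_fintype_fun_eq_card] at h4
  omega

end Euler

section Final

variable {V : Type} [Fintype V] [DecidableEq V] {G : SimpleGraph V}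

lemma RotationSystem.emb [Fintype G.Dart] (rs : RotationSystem G) :
    Emb rs.rot (dartRev G) (fun d => d.fst) where
  inv d := d.symm_symm
  tail := rs.tail_fixed
  cyc d d' h := (rs.vertex_cycle d d' h).exists_nat_pow_eq
  noloop d := d.adj.ne
  simple d d' h := SimpleGraph.dart_edge_eq_iff d d' |>.1 h

open Classical in
lemma hom_le_of_genusLE {g : ℕ} (h : genusLE G g) :
    ∃ (σ : Equiv.Perm G.Dart) (O : Finset G.Dart), (∀ d, d ∈ O ↔ dartRev G d ∉ O) ∧
      Emb σ (dartRev G) (fun d => d.fst) ∧ hom σ (dartRev G) univ ≤ 2 * g := by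
  obtain ⟨rs, hrs⟩ := h
  have hE := RotationSystem.emb rs
  obtain ⟨O, hO⟩ := exists_orientation (dartRev G) (fun d => d.symm_ne) hE.inv
  refine ⟨rs.rot, O, hO, hE, ?_⟩
  have h1 := hom_univ_le (σ := rs.rot) hO hE.inv
  have h2 := card_add_finrank_compSub_le hE (C := G.ConnectedComponent)
    G.connectedComponentMk fun f hf => by
      refine ⟨SimpleGraph.ConnectedComponent.lift f fun v w p h => ?_, rfl⟩
      clear h
      induction p with
      | nil => rfl
      | cons hadj _ ih => rw [← ih]; exact (hf ⟨(_, _), hadj⟩).symm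
  have h3 : #O = G.edgeSet.ncard := by
    have e1 := G.dart_card_eq_twice_card_edges
    have e2 : #Oᶜ = #O := by
      rw [← card_map (dartRev G).toEmbedding (s := O)]
      congr 1
      ext d
      rw [Finset.mem_compl, mem_map_equiv, hO,
        (Equiv.symm_apply_eq _).2 (hE.inv d).symm, not_not]
    have e3 := card_compl_add_card O
    rw [Set.ncard_eq_toFinset_card']
    change #O = #G.edgeFinset
    omega
  rw [Nat.card_eq_fintype_card, Nat.card_eq_fintype_card] at hrs
  have h4 : rs.numFaces = numOrbits (rs.rot * dartRev G) := rfl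
  omega

lemma ecount_eq (l : List (Sym2 V)) (e : Sym2 V) : ecount l e = l.count e := by
  unfold ecount
  congr!

open Classical in
lemma hasIntegralRouting_of_route3 {n : ℕ} {s t : Fin n → V} {I : Finset (Fin n)} {N : ℝ}
    (h : Route3 s t G.edgeFinset I) (hN : N ≤ #I) : HasIntegralRouting G s t 3 N := by
  obtain ⟨f, h1, h2⟩ := h
  have key : ∀ d ∈ I, ∃ w : G.Walk (s d) (t d), ∀ e, w.edges.count e ≤ f d e := by
    intro d hd
    obtain ⟨w, hw⟩ := h1 d hd
    have hin : ∀ e ∈ w.edges, e ∈ G.edgeSet := by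
      intro e he
      by_contra hne
      have h3 : f d e ≤ 3 * ue G.edgeFinset e :=
        (single_le_sum (f := fun d => f d e) (fun _ _ => Nat.zero_le _) hd).trans (h2 e)
      rw [ue, if_neg (by rwa [SimpleGraph.mem_edgeFinset])] at h3
      have h4 := hw e
      have h5 := List.count_pos_iff.2 he
      omega
    exact ⟨w.transfer G hin, fun e => by rw [SimpleGraph.Walk.edges_transfer]; exact hw e⟩
  choose Q hQ using key
  refine ⟨I, Q, hN, fun e => ?_⟩
  calc ∑ d ∈ I.attach, ecount (Q d.1 d.2).edges e ≤ ∑ d ∈ I.attach, f d.1 e :=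
        sum_le_sum fun d _ => by rw [ecount_eq]; exact hQ d.1 d.2 e
    _ = ∑ d ∈ I, f d e := sum_attach I fun d => f d e
    _ ≤ 3 * ue G.edgeFinset e := h2 e
    _ ≤ 3 := by
      have : ue G.edgeFinset e ≤ 1 := by
        unfold ue
        by_cases he : e ∈ G.edgeFinset
        · rw [if_pos he]
        · rw [if_neg he]; omega
      omega

open Classical in
/-- A constant fraction of the flow divided by the genus can be routed. -/
theorem genus_routing {g : ℕ} (hg : 0 < g) (hG : genusLE G g) {n : ℕ} {s t : Fin n → V}
    (x : FracSol G s t) :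
    ∃ I : Finset (Fin n), Route3 s t G.edgeFinset I ∧ x.value ≤ 2 ^ 93 * g * #I := by
  have hg' : (1 : ℝ) ≤ g := by exact_mod_cast hg
  have hR0 : Route3 s t G.edgeFinset ∅ := ⟨fun _ _ => 0, by simp, by simp⟩
  by_cases h0 : ∀ i, x.xval i = 0
  · exact ⟨∅, hR0, by simp [FracSol.value, h0]⟩
  push Not at h0
  obtain ⟨i₀, -⟩ := h0
  obtain ⟨wk, hwk⟩ : ∃ wk : ∀ i, (⊤ : SimpleGraph V).Walk (s (x.dem i)) (t (x.dem i)),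
      ∀ i, (wk i).edges = (x.fpath i).edges :=
    ⟨fun i => (x.fpath i).mapLe le_top, fun i => SimpleGraph.Walk.edges_mapLe_eq_edges ..⟩
  by_cases hX : x.value < 48 * g
  · refine ⟨{x.dem i₀}, ⟨fun _ e => min ((wk i₀).edges.count e) 1, fun d hd => ?_, fun e => ?_⟩, ?_⟩
    · obtain rfl := mem_singleton.1 hd
      exact IsRoute.min_one ⟨wk i₀, fun _ => le_rfl⟩
    · rw [sum_singleton]
      dsimp only
      by_cases he : e ∈ G.edgeFinset
      · rw [ue, if_pos he]; omega
      · rw [List.count_eq_zero_of_not_mem]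
        · simp
        · intro h
          rw [hwk] at h
          exact he (SimpleGraph.mem_edgeFinset.2 (SimpleGraph.Walk.edges_subset_edgeSet _ h))
    · rw [card_singleton]
      push_cast
      linarith
  push Not at hX
  obtain ⟨σ, O, hO, hE, hH⟩ := hom_le_of_genusLE hG
  have hedg : edg (dartRev G) (fun d : G.Dart => d.fst) univ = G.edgeFinset := by
    ext e
    rw [mem_edg, SimpleGraph.mem_edgeFinset]
    constructor
    · rintro ⟨d, -, rfl⟩; exact d.adj
    · induction e with
      | _ a b => exact fun h => ⟨⟨(a, b), h⟩, mem_univ _, rfl⟩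
  have hflow : IsFlow x.dem wk (edg (dartRev G) (fun d : G.Dart => d.fst) univ) x.xval := by
    refine ⟨x.nonneg, fun i _ e he => ?_, fun e => ?_, fun d => ?_⟩
    · rw [hedg, SimpleGraph.mem_edgeFinset]
      rw [hwk] at he
      exact SimpleGraph.Walk.edges_subset_edgeSet _ he
    · refine le_trans (le_of_eq (sum_congr rfl fun i _ => ?_)) (x.capacity e)
      rw [ecount_eq, hwk, mul_comm]
    · rw [sum_filter]
      exact x.perDemand d
  obtain ⟨N, hN⟩ : ∃ N : ℕ, N = ⌊x.value / (48 * g)⌋₊ := ⟨_, rfl⟩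
  have hq : 1 ≤ x.value / (48 * g) := by rw [le_div_iff₀ (by positivity)]; linarith
  have hN0 : 0 < N := hN ▸ Nat.floor_pos.2 hq
  have hN1 : (1 : ℝ) ≤ N := by exact_mod_cast hN0
  have hN2 : (N : ℝ) * (48 * g) ≤ x.value := by
    rw [← le_div_iff₀ (by positivity)]
    exact hN ▸ Nat.floor_le (by positivity)
  have hN3 : x.value ≤ (N + 1) * (48 * g) := by
    rw [← div_le_iff₀ (by positivity)]
    exact hN ▸ (Nat.lt_floor_add_one _).le
  obtain ⟨I, -, h2, h3⟩ := homology_routing hO hE N hN0 _ univ x.xval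
    (fun d _ => mem_univ _) rfl hflow
  rw [hedg] at h2
  refine ⟨I, h2, ?_⟩
  rcases h3 with h3 | h3
  · calc x.value ≤ (N + 1) * (48 * g) := hN3
      _ ≤ (2 * N) * (48 * g) := by gcongr; linarith
      _ ≤ (2 * (2 ^ 86 * #I)) * (48 * g) := by gcongr
      _ = (96 * 2 ^ 86) * (g * #I) := by ring
      _ ≤ 2 ^ 93 * (g * #I) := by gcongr; norm_num
      _ = 2 ^ 93 * g * #I := by ring
  · have h4 : ((12 * hom σ (dartRev G) univ - 2 : ℕ) : ℝ) ≤ 24 * g := by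
      exact_mod_cast (by omega : 12 * hom σ (dartRev G) univ - 2 ≤ 24 * g)
    have h5 : ((12 * hom σ (dartRev G) univ - 2 : ℕ) : ℝ) * N ≤ 24 * g * N := by gcongr
    have h6 : x.value ≤ 2 ^ 87 * #I := by
      change x.value ≤ _ at h3
      linarith
    have h7 : (#I : ℝ) ≤ g * #I := le_mul_of_one_le_left (by positivity) hg'
    have h8 : (0 : ℝ) ≤ #I := by positivity
    linarith

end Final

end MEDP

/-- **MEDP in bounded-genus graphs.** There is a constant `c > 0` such that for every
graph `G` of (orientable) genus `g > 0` and every MEDP instance on `G`: if `x` is a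
feasible fractional solution to the flow LP, then at least `c·val(x)/(g·log²(g+1))`
demand pairs can be routed integrally with congestion `3`. -/
theorem medp_bounded_genus :
    ∃ c : ℝ, 0 < c ∧
      ∀ (V : Type) [Fintype V] [DecidableEq V] (G : SimpleGraph V)
        (g : ℕ), 0 < g → genusLE G g →
        ∀ (n : ℕ) (s t : Fin n → V) (x : FracSol G s t),
          HasIntegralRouting G s t 3
            (c * x.value / ((g : ℝ) * Real.log ((g : ℝ) + 1) ^ 2)) := by
  classical
  refine ⟨1 / 2 ^ 95, by positivity, fun V _ _ G g hg hG n s t x => ?_⟩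
  obtain ⟨I, h1, h2⟩ := MEDP.genus_routing hg hG x
  refine MEDP.hasIntegralRouting_of_route3 h1 ?_
  have hg' : (1 : ℝ) ≤ g := by exact_mod_cast hg
  have hl : (1 : ℝ) / 2 ≤ Real.log ((g : ℝ) + 1) :=
    (by linarith [Real.log_two_gt_d9] : (1 : ℝ) / 2 ≤ Real.log 2).trans
      (Real.log_le_log (by norm_num) (by linarith))
  have hl2 : (1 : ℝ) / 4 ≤ Real.log ((g : ℝ) + 1) ^ 2 := by nlinarith
  rw [div_le_iff₀ (by positivity)]
  calc 1 / 2 ^ 95 * x.value ≤ 1 / 2 ^ 95 * (2 ^ 93 * g * (#I : ℝ)) := by gcongr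
    _ = (#I : ℝ) * (g * (1 / 4)) := by ring
    _ ≤ (#I : ℝ) * (g * Real.log ((g : ℝ) + 1) ^ 2) := by gcongr
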